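/- Let W be a finite Weyl group of rank l. An element w ∈ W is rationally smooth if and only if its Poincaré polynomial factors as P_w(q) = ∏_{i=1}^{l} [m_i+1]_q for some collection of non-negative integers m_1,…,m_l, where [m]_q = 1 + q + q^2 + … + q^{m-1}. -/

import Mathlib

noncomputable section
namespace Paper
open Polynomial

variable {B W : Type*} [Group W] {M : CoxeterMatrix B} (cs : CoxeterSystem M W)

/-- The crystallographic condition: together with finiteness, this characterizes
the Coxeter systems of finite Weyl groups. -/
def IsWeylMatrix (M : CoxeterMatrix B) : Prop :=
  ∀ i j : B, i ≠ j → M i j ∈ ({2, 3, 4, 6} : Set ℕ)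

/-- Bruhat order on `W`. -/
def bruhatLE (u w : W) : Prop :=
  Relation.ReflTransGen
    (fun x y => cs.length x < cs.length y ∧ ∃ t, cs.IsReflection t ∧ y = t * x) u w

/-- The Poincaré polynomial of `w`: the length generating function of the Bruhat
interval `[e,w]`. -/
def poin (w : W) : Polynomial ℤ :=
  ∑ᶠ x ∈ {x : W | bruhatLE cs x w}, X ^ cs.length x

/-- `w` is rationally smooth iff its Poincaré polynomial is palindromic. -/
def RatSmooth (w : W) : Prop :=
  ∀ i ≤ cs.length w, (poin cs w).coeff i = (poin cs w).coeff (cs.length w - i)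

/-- The `q`-integer `[m]_q = 1 + q + ⋯ + q^(m-1)`. -/
def qint (m : ℕ) : Polynomial ℤ := ∑ j ∈ Finset.range m, X ^ j

/-- The support of `w`: the simple reflections appearing in some reduced word for `w`. -/
def supp (w : W) : Set B :=
  {i | ∃ ω : List B, cs.IsReduced ω ∧ cs.wordProd ω = w ∧ i ∈ ω}

/-- `i` is a leaf of the Dynkin diagram of `W_{S(w)}`. -/
def IsLeaf (w : W) (i : B) : Prop :=
  i ∈ supp cs w ∧ {j | j ∈ supp cs w ∧ j ≠ i ∧ M i j ≠ 2}.Subsingleton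

/-- The standard parabolic subgroup `W_J`. -/
def WJc (J : Set B) : Subgroup W := Subgroup.closure (cs.simple '' J)

/-- `v ∈ ᴶW`: `v` is a minimal length right coset representative. -/
def MinRight (J : Set B) (v : W) : Prop :=
  ∀ i ∈ J, cs.length v < cs.length (cs.simple i * v)

/-- `v ∈ Wᴶ`: `v` is a minimal length left coset representative. -/
def MinLeft (J : Set B) (v : W) : Prop :=
  ∀ i ∈ J, cs.length v < cs.length (v * cs.simple i)

/-- The Poincaré polynomial `ᴶP_v`, summing over `[e,v] ∩ ᴶW`. -/
def poinRight (J : Set B) (v : W) : Polynomial ℤ :=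
  ∑ᶠ x ∈ {x : W | bruhatLE cs x v ∧ MinRight cs J x}, X ^ cs.length x

/-- The Poincaré polynomial `P_v^J`, summing over `[e,v] ∩ Wᴶ`. -/
def poinLeft (J : Set B) (v : W) : Polynomial ℤ :=
  ∑ᶠ x ∈ {x : W | bruhatLE cs x v ∧ MinLeft cs J x}, X ^ cs.length x

/-- `[e,v] ∩ ᴶW` is a chain in Bruhat order. -/
def ChainRight (J : Set B) (v : W) : Prop :=
  ∀ x y : W, (bruhatLE cs x v ∧ MinRight cs J x) → (bruhatLE cs y v ∧ MinRight cs J y) →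
    bruhatLE cs x y ∨ bruhatLE cs y x

/-- `[e,v] ∩ Wᴶ` is a chain in Bruhat order. -/
def ChainLeft (J : Set B) (v : W) : Prop :=
  ∀ x y : W, (bruhatLE cs x v ∧ MinLeft cs J x) → (bruhatLE cs y v ∧ MinLeft cs J y) →
    bruhatLE cs x y ∨ bruhatLE cs y x

/-- `w = u * v` is a left Billey–Postnikov decomposition with respect to `J`. -/
def LeftBP (J : Set B) (u v w : W) : Prop :=
  w = u * v ∧ u ∈ WJc cs J ∧ MinRight cs J v ∧
    poin cs w = poin cs u * poinRight cs J v

/-- `w = v * u` is a right Billey–Postnikov decomposition with respect to `J`. -/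
def RightBP (J : Set B) (u v w : W) : Prop :=
  w = v * u ∧ u ∈ WJc cs J ∧ MinLeft cs J v ∧
    poin cs w = poin cs u * poinLeft cs J v

/-- A (nontrivial) left chain BP decomposition. -/
def LeftChainBP (J : Set B) (u v w : W) : Prop :=
  LeftBP cs J u v w ∧ v ≠ 1 ∧ ChainRight cs J v

/-- A (nontrivial) right chain BP decomposition. -/
def RightChainBP (J : Set B) (u v w : W) : Prop :=
  RightBP cs J u v w ∧ v ≠ 1 ∧ ChainLeft cs J v

/-- `x` is the longest (maximal) element of the set `K`. -/
def IsLongestIn (K : Set W) (x : W) : Prop :=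
  x ∈ K ∧ ∀ y ∈ K, cs.length y ≤ cs.length x

/-- Directed distance in the Bruhat graph. -/
def bgDist (u w : W) : ℕ :=
  sInf {m | ∃ c : ℕ → W, c 0 = u ∧ c m = w ∧
    ∀ i < m, cs.length (c i) < cs.length (c (i + 1)) ∧
      ∃ t, cs.IsReflection t ∧ c (i + 1) = t * c i}

/-- Absolute (reflection) length. -/
def absLen (x : W) : ℕ :=
  sInf {m | ∃ g : Fin m → W, (∀ i, cs.IsReflection (g i)) ∧ x = (List.ofFn g).prod}

/-- The HLSS condition. -/
def HLSS (w : W) : Prop :=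
  ∀ u, bruhatLE cs u w → bgDist cs u w = absLen cs (u * w⁻¹)

/-- The Coxeter matrix of type `Dₙ` (chain `1 - 2 - ⋯ - (n-1)` with extra node `0`
attached to node `2`). -/
def Dmat (i j : ℕ) : ℕ :=
  if i = j then 1
  else if (i = 0 ∧ j = 2) ∨ (j = 0 ∧ i = 2) ∨ (1 ≤ i ∧ 1 ≤ j ∧ (i + 1 = j ∨ j + 1 = i))
    then 3 else 2

/-- The Coxeter matrix of type `Eₙ` in the labelling of the paper (shifted by one:
index `i` is the paper's node `i+1`): chain `1 - 2 - ⋯ - (n-1)` with node `0` attached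
to node `3`. -/
def Emat (i j : ℕ) : ℕ :=
  if i = j then 1
  else if (i = 0 ∧ j = 3) ∨ (j = 0 ∧ i = 3) ∨ (1 ≤ i ∧ 1 ≤ j ∧ (i + 1 = j ∨ j + 1 = i))
    then 3 else 2

/-- The Coxeter matrix of type `F₄`. -/
def Fmat (i j : ℕ) : ℕ :=
  if i = j then 1
  else if (i = 0 ∧ j = 1) ∨ (i = 1 ∧ j = 0) ∨ (i = 2 ∧ j = 3) ∨ (i = 3 ∧ j = 2) then 3
  else if (i = 1 ∧ j = 2) ∨ (i = 2 ∧ j = 1) then 4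
  else 2

end Paper
end

noncomputable section
namespace Paper
open CoxeterSystem

set_option linter.unusedSectionVars false
set_option linter.unusedSimpArgs false

variable {B W : Type*} [Group W] {M : CoxeterMatrix B} {cs : CoxeterSystem M W}

/-- A crystallographic Cartan matrix for the Coxeter system `cs`; `A i j` is the pairing
of the simple root `α_j` with the simple coroot `α_i^∨`. -/
structure Cartan (cs : CoxeterSystem M W) where
  A : B → B → ℤ
  diag : ∀ i, A i i = 2
  off : ∀ i j, i ≠ j →
    (M i j = 2 ∧ A i j = 0 ∧ A j i = 0) ∨ (M i j = 3 ∧ A i j = -1 ∧ A j i = -1) ∨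
    (M i j = 4 ∧ A i j = -1 ∧ A j i = -2) ∨ (M i j = 4 ∧ A i j = -2 ∧ A j i = -1) ∨
    (M i j = 6 ∧ A i j = -1 ∧ A j i = -3) ∨ (M i j = 6 ∧ A i j = -3 ∧ A j i = -1)

namespace Cartan

variable [Fintype B] [DecidableEq B] (C : Cartan cs)

/-- The simple root `α_i`. -/
def al (i : B) : B → ℤ := Pi.single i 1

/-- The simple coroot `α_i^∨`. -/
def pair (i : B) : (B → ℤ) →ₗ[ℤ] ℤ := ∑ j, C.A i j • LinearMap.proj j

theorem pair_apply (i : B) (v : B → ℤ) : C.pair i v = ∑ j, C.A i j * v j := by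
  simp [pair]

@[simp] theorem pair_al (i j : B) : C.pair i (al j) = C.A i j := by
  simp [pair_apply, al, Pi.single_apply]

/-- The simple reflection in the geometric representation. -/
def srefl (i : B) : Module.End ℤ (B → ℤ) :=
  LinearMap.id - (C.pair i).smulRight (al i)

theorem srefl_apply (i : B) (v : B → ℤ) : C.srefl i v = v - C.pair i v • al i := rfl

theorem srefl_comb (i j : B) (v : B → ℤ) (x y : ℤ) :
    C.srefl i (v + x • al i + y • al j) =
      v + (-x - C.A i j * y - C.pair i v) • al i + y • al j := by
  simp only [srefl_apply, map_add, map_smul, pair_al, C.diag, smul_eq_mul]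
  module

theorem srefl_comb' (i j : B) (v : B → ℤ) (x y : ℤ) :
    C.srefl j (v + x • al i + y • al j) =
      v + x • al i + (-y - C.A j i * x - C.pair j v) • al j := by
  simp only [srefl_apply, map_add, map_smul, pair_al, C.diag, smul_eq_mul]
  module

theorem srefl_mul_self (i : B) : C.srefl i * C.srefl i = 1 := by
  refine LinearMap.ext fun v => ?_
  have := C.srefl_comb i i v 0 0
  simp only [zero_smul, add_zero] at this
  simp only [Module.End.mul_apply, Module.End.one_apply]
  rw [this]
  simp only [srefl_apply, map_add, map_smul, pair_al, C.diag, smul_eq_mul]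
  module

theorem srefl_liftable : M.IsLiftable C.srefl := by
  intro i j
  by_cases hij : i = j
  · subst hij; simp [C.srefl_mul_self]
  refine LinearMap.ext fun v => ?_
  have key : ∀ x y, (C.srefl i * C.srefl j) (v + x • al i + y • al j) =
      v + (-x - C.A i j * (-y - C.A j i * x - C.pair j v) - C.pair i v) • al i
        + (-y - C.A j i * x - C.pair j v) • al j := by
    intro x y
    rw [Module.End.mul_apply, srefl_comb', srefl_comb]
  have h0 : v = v + (0:ℤ) • al i + (0:ℤ) • al j := by simp
  rw [Module.End.one_apply]
  rcases C.off i j hij with h | h | h | h | h | h <;> obtain ⟨hm, h1, h2⟩ := h <;>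
    rw [hm] <;> rw [h1, h2] at key <;> conv_lhs => rw [h0]
  all_goals
    simp only [pow_succ, pow_zero, Module.End.mul_apply, Module.End.one_apply]
    simp only [← Module.End.mul_apply (C.srefl i) (C.srefl j), key]
    module

/-- The geometric representation. -/
def rep : W →* Module.End ℤ (B → ℤ) := cs.lift ⟨C.srefl, C.srefl_liftable⟩

/-- The action of `W` on the root lattice. -/
def act (w : W) (v : B → ℤ) : B → ℤ := C.rep w v

theorem act_simple (i : B) (v : B → ℤ) : C.act (cs.simple i) v = v - C.pair i v • al i := by
  rw [act, rep, cs.lift_apply_simple]; rfl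

@[simp] theorem act_one (v : B → ℤ) : C.act 1 v = v := by simp [act]

theorem act_mul (x y : W) (v : B → ℤ) : C.act (x * y) v = C.act x (C.act y v) := by
  simp [act]

@[simp] theorem act_inv_act (x : W) (v : B → ℤ) : C.act x⁻¹ (C.act x v) = v := by
  rw [← act_mul]; simp

@[simp] theorem act_act_inv (x : W) (v : B → ℤ) : C.act x (C.act x⁻¹ v) = v := by
  rw [← act_mul]; simp

theorem act_add (x : W) (u v : B → ℤ) : C.act x (u + v) = C.act x u + C.act x v := by simp [act]
theorem act_sub (x : W) (u v : B → ℤ) : C.act x (u - v) = C.act x u - C.act x v := by simp [act]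
@[simp] theorem act_neg (x : W) (v : B → ℤ) : C.act x (-v) = -C.act x v := by simp [act]
@[simp] theorem act_zero (x : W) : C.act x 0 = 0 := by simp [act]
theorem act_smul (x : W) (c : ℤ) (v : B → ℤ) : C.act x (c • v) = c • C.act x v :=
  map_smul _ _ _
theorem act_sum {ι : Type*} (s : Finset ι) (x : W) (f : ι → B → ℤ) :
    C.act x (∑ i ∈ s, f i) = ∑ i ∈ s, C.act x (f i) := by simp [act]

theorem act_injective (x : W) : Function.Injective (C.act x) := fun u v h => by
  rw [← C.act_inv_act x u, h, act_inv_act]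

@[simp] theorem act_simple_al_self (i : B) : C.act (cs.simple i) (al i) = -al i := by
  rw [act_simple, pair_al, C.diag]; module

theorem act_simple_comb (i j : B) (x y : ℤ) :
    C.act (cs.simple i) (x • al i + y • al j) = (-x - C.A i j * y) • al i + y • al j := by
  simp only [act_simple, map_add, map_smul, pair_al, C.diag, smul_eq_mul]
  module

theorem act_simple_comb' (i j : B) (x y : ℤ) :
    C.act (cs.simple j) (x • al i + y • al j) = x • al i + (-y - C.A j i * x) • al j := by
  simp only [act_simple, map_add, map_smul, pair_al, C.diag, smul_eq_mul]
  module

theorem M_cases (C : Cartan cs) (i j : B) (hij : i ≠ j) : 2 ≤ M i j ∧ M i j ≤ 6 := by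
  rcases C.off i j hij with h | h | h | h | h | h <;> omega

theorem dihedral_pos (i j : B) (hij : i ≠ j) (k : ℕ) (hk : k < M i j) :
    ∃ a b : ℤ, 0 ≤ a ∧ 0 ≤ b ∧
      C.act (cs.wordProd (alternatingWord i j k)) (al i) = a • al i + b • al j := by
  suffices h : ∃ a b : ℤ, 0 ≤ a ∧ 0 ≤ b ∧
      C.act (cs.wordProd (alternatingWord i j k)) ((1:ℤ) • al i + (0:ℤ) • al j) =
        a • al i + b • al j by
    simpa using h
  have h6 := (C.M_cases i j hij).2
  have hk6 : k < 6 := by omega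
  rcases C.off i j hij with h | h | h | h | h | h <;> obtain ⟨hm, h1, h2⟩ := h <;>
    rw [hm] at hk <;> interval_cases k <;>
    simp only [alternatingWord, List.concat_eq_append, List.nil_append, List.cons_append,
      wordProd, List.map_cons, List.map_nil, List.prod_cons, List.prod_nil, act_mul, act_one,
      act_simple_comb, act_simple_comb', h1, h2] <;>
    refine ⟨_, _, ?_, ?_, rfl⟩ <;> norm_num

end Cartan

theorem isReduced_append_left {a b : List B} (h : cs.IsReduced (a ++ b)) : cs.IsReduced a := by
  have := h.take a.length; simpa using this

theorem alternating_of_isReduced (i j : B) (ω : List B) (h : cs.IsReduced ω)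
    (hl : ∀ k ∈ ω, k = i ∨ k = j) :
    ∃ k, ω = alternatingWord i j k ∨ ω = alternatingWord j i k := by
  induction ω using List.reverseRecOn with
  | nil => exact ⟨0, Or.inl rfl⟩
  | append_singleton ω c ih =>
    have key : ∀ a b : B, ∀ k, ω = alternatingWord a b k → (c = a ∨ c = b) →
        ∃ k, ω ++ [c] = alternatingWord a b k ∨ ω ++ [c] = alternatingWord b a k := by
      intro a b k hk hc
      rcases hc with rfl | rfl
      · exact ⟨k + 1, Or.inr (by rw [alternatingWord_succ, hk, List.concat_eq_append])⟩
      · cases k with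
        | zero => exact ⟨1, Or.inl (by simp [hk, alternatingWord])⟩
        | succ k =>
          exfalso
          rw [alternatingWord_succ, List.concat_eq_append] at hk
          have h1 := h.eq
          have h2 := cs.length_wordProd_le (alternatingWord c a k)
          rw [hk] at h1
          simp [wordProd_append, wordProd_cons] at h1
          simp at h2
          omega
    obtain ⟨k, hk | hk⟩ := ih (isReduced_append_left h) (fun k hk => hl k (by simp [hk]))
    · exact key i j k hk (hl c (by simp))
    · obtain ⟨k', h'⟩ := key j i k hk (hl c (by simp)).symm
      exact ⟨k', h'.symm⟩

theorem length_mul_simple_lt_of_alternating (v w : W) (i j : B) (k : ℕ)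
    (hw : w = v * cs.wordProd (alternatingWord j i (k + 1)))
    (hl : cs.length w = cs.length v + (k + 1)) : cs.length (w * cs.simple i) < cs.length w := by
  rw [alternatingWord_succ, wordProd_concat] at hw
  have : w * cs.simple i = v * cs.wordProd (alternatingWord i j k) := by
    rw [hw]; simp [mul_assoc]
  rw [this]
  have h1 := cs.length_mul_le v (cs.wordProd (alternatingWord i j k))
  have h2 := cs.length_wordProd_le (alternatingWord i j k)
  rw [length_alternatingWord] at h2
  omega

namespace Cartan

variable [Fintype B] [DecidableEq B] (C : Cartan cs)

theorem al_nonneg (i : B) : (0 : B → ℤ) ≤ al i := by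
  intro k; by_cases h : k = i
  · subst h; simp [al]
  · simp [al, h]

theorem act_al_nonneg (w : W) (i : B) (h : cs.length w < cs.length (w * cs.simple i)) :
    0 ≤ C.act w (al i) := by
  induction hn : cs.length w using Nat.strong_induction_on generalizing w i with
  | _ n ih =>
  subst hn
  by_cases hw1 : w = 1
  · subst hw1; simpa using al_nonneg i
  obtain ⟨j, hj⟩ := cs.exists_rightDescent_of_ne_one hw1
  have hj' := cs.isRightDescent_iff.1 hj
  have hij : i ≠ j := by rintro rfl; unfold IsRightDescent at hj; omega
  let P : ℕ → Prop := fun n => ∃ v ω, cs.length v = n ∧ w = v * cs.wordProd ω ∧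
    cs.length w = n + ω.length ∧ ∀ k ∈ ω, k = i ∨ k = j
  have hP : P (cs.length (w * cs.simple j)) :=
    ⟨w * cs.simple j, [j], rfl, by simp [wordProd_cons], by simp [hj'], by simp⟩
  classical
  obtain ⟨v, ω, hv, hw, hl, hω⟩ := Nat.find_spec ⟨_, hP⟩
  have hmin := fun m => Nat.find_min' (H := ⟨_, hP⟩) (m := m)
  rw [← hv] at hl hmin
  have hlt : cs.length v < cs.length w := by
    have := hmin _ hP; omega
  have hred : cs.IsReduced ω := by
    have h1 := cs.length_mul_le v (cs.wordProd ω)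
    rw [← hw] at h1
    have h2 := cs.length_wordProd_le ω
    unfold CoxeterSystem.IsReduced; omega
  have hpos : ∀ a, a = i ∨ a = j → 0 ≤ C.act v (al a) := by
    intro a ha
    refine ih _ hlt v a ?_ rfl
    by_contra hcon
    have h3 : cs.length (v * cs.simple a) + 1 = cs.length v := by
      rcases cs.length_mul_simple v a with h | h <;> omega
    have := hmin (cs.length (v * cs.simple a)) ⟨v * cs.simple a, a :: ω, rfl, by
      simp [wordProd_cons, hw, mul_assoc], by simp; omega, by
        intro k hk; rcases List.mem_cons.1 hk with rfl | hk
        · exact ha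
        · exact hω k hk⟩
    omega
  have hωk : ∃ k, k < M i j ∧ ω = alternatingWord i j k := by
    obtain ⟨k, hk⟩ := alternating_of_isReduced i j ω hred hω
    have hk0 : k ≠ 0 := by
      rintro rfl
      have : ω = [] := by rcases hk with h | h <;> simpa [alternatingWord] using h
      subst this; simp at hl; omega
    obtain ⟨k, rfl⟩ := Nat.exists_eq_succ_of_ne_zero hk0
    rcases hk with hk | hk
    · have hlen : ω.length = k + 1 := by rw [hk, length_alternatingWord]
      refine ⟨k + 1, ?_, hk⟩
      have hM := C.M_cases i j hij
      by_contra hcon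
      rcases Nat.lt_or_ge (M i j) (k + 1) with h1 | h1
      · exact cs.not_isReduced_alternatingWord i j (by omega) h1 (hk ▸ hred)
      · have h2 : M i j = k + 1 := by omega
        have h3 := cs.wordProd_braidWord_eq i j
        rw [braidWord, braidWord, M.symmetric j i, h2] at h3
        rw [hk, h3] at hw
        have := length_mul_simple_lt_of_alternating v w i j k hw (by omega)
        omega
    · rw [hk] at hw
      have hlen : ω.length = k + 1 := by rw [hk, length_alternatingWord]
      have := length_mul_simple_lt_of_alternating v w i j k hw (by omega)
      omega
  obtain ⟨k, hk, rfl⟩ := hωk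
  obtain ⟨a, b, ha, hb, hab⟩ := C.dihedral_pos i j hij k hk
  rw [hw, act_mul, hab, act_add, act_smul, act_smul]
  exact add_nonneg (smul_nonneg ha (hpos i (Or.inl rfl))) (smul_nonneg hb (hpos j (Or.inr rfl)))

theorem act_al_nonpos (w : W) (i : B) (h : cs.length (w * cs.simple i) < cs.length w) :
    C.act w (al i) ≤ 0 := by
  have := C.act_al_nonneg (w * cs.simple i) i (by simpa using h)
  rw [act_mul, act_simple_al_self, act_neg] at this
  exact neg_nonneg.1 this

theorem al_ne_zero (i : B) : (al i : B → ℤ) ≠ 0 := by simp [al]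

theorem act_ne_zero (w : W) {v : B → ℤ} (h : v ≠ 0) : C.act w v ≠ 0 := fun h0 =>
  h (C.act_injective w (by simpa using h0))

/-- The roots. -/
def IsRoot (v : B → ℤ) : Prop := ∃ w i, v = C.act w (al i)

variable {C}

theorem isRoot_al (i : B) : C.IsRoot (al i) := ⟨1, i, by simp⟩

theorem IsRoot.act {v : B → ℤ} (h : C.IsRoot v) (x : W) : C.IsRoot (C.act x v) := by
  obtain ⟨w, i, rfl⟩ := h; exact ⟨x * w, i, by rw [act_mul]⟩

theorem IsRoot.neg {v : B → ℤ} (h : C.IsRoot v) : C.IsRoot (-v) := by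
  obtain ⟨w, i, rfl⟩ := h; exact ⟨w * cs.simple i, i, by simp [act_mul]⟩

theorem IsRoot.ne_zero {v : B → ℤ} (h : C.IsRoot v) : v ≠ 0 := by
  obtain ⟨w, i, rfl⟩ := h; exact C.act_ne_zero w (al_ne_zero i)

theorem IsRoot.nonneg_or_nonpos {v : B → ℤ} (h : C.IsRoot v) : 0 ≤ v ∨ v ≤ 0 := by
  obtain ⟨w, i, rfl⟩ := h
  rcases lt_or_gt_of_ne (cs.length_mul_simple_ne w i) with h | h
  · exact Or.inr (C.act_al_nonpos w i h)
  · exact Or.inl (C.act_al_nonneg w i h)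

theorem IsRoot.not_nonneg_iff {v : B → ℤ} (h : C.IsRoot v) : ¬ 0 ≤ v ↔ v ≤ 0 := by
  constructor
  · intro h1; exact h.nonneg_or_nonpos.resolve_left h1
  · intro h1 h2; exact h.ne_zero (le_antisymm h1 h2)

theorem IsRoot.not_nonpos_iff {v : B → ℤ} (h : C.IsRoot v) : ¬ v ≤ 0 ↔ 0 ≤ v := by
  rw [← h.not_nonneg_iff, not_not]

variable (C)

theorem act_al_nonneg_iff (w : W) (i : B) :
    0 ≤ C.act w (al i) ↔ cs.length w < cs.length (w * cs.simple i) := by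
  refine ⟨fun h => ?_, C.act_al_nonneg w i⟩
  by_contra hc
  have hr : C.IsRoot (C.act w (al i)) := ⟨w, i, rfl⟩
  have := C.act_al_nonpos w i (lt_of_le_of_ne (not_lt.1 hc) (cs.length_mul_simple_ne w i))
  exact hr.not_nonneg_iff.2 this h

theorem act_al_nonpos_iff (w : W) (i : B) :
    C.act w (al i) ≤ 0 ↔ cs.length (w * cs.simple i) < cs.length w := by
  have hr : C.IsRoot (C.act w (al i)) := ⟨w, i, rfl⟩
  rw [← hr.not_nonneg_iff, act_al_nonneg_iff, not_lt]
  exact ⟨fun h => lt_of_le_of_ne h (cs.length_mul_simple_ne w i), le_of_lt⟩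

theorem eq_one_of_act (w : W) (h : ∀ v, C.act w v = v) : w = 1 := by
  by_contra hw
  obtain ⟨j, hj⟩ := cs.exists_rightDescent_of_ne_one hw
  have := C.act_al_nonpos w j hj
  rw [h] at this
  exact al_ne_zero j (le_antisymm this (al_nonneg j))

/-! ### The invariant form -/

variable [Finite W]

/-- A `W`-invariant positive definite form on the root lattice. -/
def form (u v : B → ℤ) : ℤ := ∑ᶠ w : W, C.act w u ⬝ᵥ C.act w v

theorem form_comm (u v : B → ℤ) : C.form u v = C.form v u := by
  simp only [form, dotProduct_comm]

theorem form_add (u v w : B → ℤ) : C.form u (v + w) = C.form u v + C.form u w := by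
  have := Fintype.ofFinite W
  simp [form, finsum_eq_sum_of_fintype, act_add, Finset.sum_add_distrib]

theorem form_smul (u v : B → ℤ) (c : ℤ) : C.form u (c • v) = c * C.form u v := by
  have := Fintype.ofFinite W
  simp only [form, finsum_eq_sum_of_fintype, act_smul, dotProduct_smul, smul_dotProduct,
    smul_eq_mul, Finset.mul_sum]

theorem form_sub (u v w : B → ℤ) : C.form u (v - w) = C.form u v - C.form u w := by
  have := Fintype.ofFinite W
  simp [form, finsum_eq_sum_of_fintype, act_sub, Finset.sum_sub_distrib]

theorem form_neg (u v : B → ℤ) : C.form u (-v) = -C.form u v := by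
  have := C.form_smul u v (-1); simpa using this

theorem form_sum {ι : Type*} (s : Finset ι) (u : B → ℤ) (f : ι → B → ℤ) :
    C.form u (∑ i ∈ s, f i) = ∑ i ∈ s, C.form u (f i) := by
  classical
  induction s using Finset.induction_on with
  | empty => simpa using C.form_smul u 0 0
  | insert a s ha ih => rw [Finset.sum_insert ha, form_add, ih, Finset.sum_insert ha]

theorem form_act (x : W) (u v : B → ℤ) : C.form (C.act x u) (C.act x v) = C.form u v := by
  have := Fintype.ofFinite W
  simp only [form, finsum_eq_sum_of_fintype, ← act_mul]
  exact Fintype.sum_equiv (Equiv.mulRight x) _ _ (fun w => rfl)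

theorem form_self_pos {v : B → ℤ} (h : v ≠ 0) : 0 < C.form v v := by
  have := Fintype.ofFinite W
  simp only [form, finsum_eq_sum_of_fintype]
  apply Finset.sum_pos
  · intro w _
    have h1 := C.act_ne_zero w h
    have h2 : 0 ≤ C.act w v ⬝ᵥ C.act w v := Finset.sum_nonneg fun i _ => mul_self_nonneg _
    exact lt_of_le_of_ne h2 (fun h3 => h1 (dotProduct_self_eq_zero.1 h3.symm))
  · exact ⟨1, Finset.mem_univ _⟩

theorem form_al (i : B) (v : B → ℤ) :
    C.pair i v * C.form (al i) (al i) = 2 * C.form (al i) v := by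
  have h := C.form_act (cs.simple i) (al i) v
  rw [act_simple_al_self, act_simple, form_sub, form_smul, form_comm _ (-al i) v,
    form_comm _ (-al i) (al i), form_neg, form_neg, form_comm _ v] at h
  linarith

end Cartan

namespace Cartan

variable [Fintype B] [DecidableEq B] {C : Cartan cs}

theorem IsRoot.primitive {v u : B → ℤ} (h : C.IsRoot v) {c : ℤ} (hv : v = c • u) :
    c = 1 ∨ c = -1 := by
  obtain ⟨w, i, rfl⟩ := h
  have h1 : al i = c • C.act w⁻¹ u := by rw [← act_smul, ← hv, act_inv_act]
  have h2 := congrFun h1 i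
  simp only [al, Pi.single_eq_same, Pi.smul_apply, smul_eq_mul] at h2
  exact Int.eq_one_or_neg_one_of_mul_eq_one h2.symm

theorem IsRoot.act_simple_nonneg {v : B → ℤ} (h : C.IsRoot v) (h0 : 0 ≤ v) {i : B}
    (hi : v ≠ al i) : 0 ≤ C.act (cs.simple i) v := by
  have : ∃ k, k ≠ i ∧ v k ≠ 0 := by
    by_contra! hc
    have hv : v = v i • al i := by
      ext k; by_cases hk : k = i
      · subst hk; simp [al]
      · simp [al, hk, hc k hk]
    rcases h.primitive hv with h1 | h1
    · rw [h1, one_smul] at hv; exact hi hv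
    · have := h0 i; rw [h1] at this; simp at this
  obtain ⟨k, hk, hvk⟩ := this
  rw [← (h.act _).not_nonpos_iff]
  intro h1
  have h2 := h1 k
  rw [act_simple] at h2
  simp only [al, Pi.sub_apply, Pi.smul_apply, Pi.single_eq_of_ne hk, smul_eq_mul, mul_zero,
    sub_zero, Pi.zero_apply] at h2
  exact hvk (le_antisymm h2 (h0 k))

variable (C)

theorem act_conj (x : W) (i : B) (v : B → ℤ) :
    C.act (x * cs.simple i * x⁻¹) v = v - C.pair i (C.act x⁻¹ v) • C.act x (al i) := by
  rw [act_mul, act_mul, act_simple, act_sub, act_smul, act_act_inv]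

/-- The coroot functional attached to `x α_i`. -/
def coro (x : W) (i : B) : (B → ℤ) →ₗ[ℤ] ℤ := C.pair i ∘ₗ C.rep x⁻¹

theorem exists_rt_aux (t : W) (ht : cs.IsReflection t) :
    ∃ p : (B → ℤ) × ((B → ℤ) →ₗ[ℤ] ℤ), C.IsRoot p.1 ∧ 0 ≤ p.1 ∧
      (∀ v, C.act t v = v - p.2 v • p.1) ∧ p.2 p.1 = 2 ∧
      ∃ w i, t = w * cs.simple i * w⁻¹ ∧ (p.1 = C.act w (al i) ∨ p.1 = -C.act w (al i)) := by
  obtain ⟨w, i, rfl⟩ := ht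
  have hr : C.IsRoot (C.act w (al i)) := ⟨w, i, rfl⟩
  have h2 : C.coro w i (C.act w (al i)) = 2 := by
    change C.pair i (C.act w⁻¹ _) = 2
    rw [act_inv_act, pair_al, C.diag]
  rcases hr.nonneg_or_nonpos with h | h
  · exact ⟨(C.act w (al i), C.coro w i), hr, h, fun v => C.act_conj w i v, h2,
      w, i, rfl, Or.inl rfl⟩
  · refine ⟨(-C.act w (al i), -C.coro w i), hr.neg, neg_nonneg.2 h, fun v => ?_, ?_,
      w, i, rfl, Or.inr rfl⟩
    · rw [C.act_conj w i v]
      simp only [LinearMap.neg_apply, smul_neg, neg_smul, neg_neg]; rfl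
    · simpa using h2

open Classical in
/-- The positive root of a reflection. -/
def rt (t : W) : B → ℤ :=
  if ht : cs.IsReflection t then (C.exists_rt_aux t ht).choose.1 else 0

open Classical in
/-- The coroot of a reflection. -/
def cor (t : W) : (B → ℤ) →ₗ[ℤ] ℤ :=
  if ht : cs.IsReflection t then (C.exists_rt_aux t ht).choose.2 else 0

variable {t t' : W}

theorem rt_spec (ht : cs.IsReflection t) : C.IsRoot (C.rt t) ∧ 0 ≤ C.rt t ∧
      (∀ v, C.act t v = v - C.cor t v • C.rt t) ∧ C.cor t (C.rt t) = 2 ∧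
      ∃ w i, t = w * cs.simple i * w⁻¹ ∧
        (C.rt t = C.act w (al i) ∨ C.rt t = -C.act w (al i)) := by
  have := (C.exists_rt_aux t ht).choose_spec
  simpa only [rt, cor, dif_pos ht] using this

theorem isRoot_rt (ht : cs.IsReflection t) : C.IsRoot (C.rt t) := (C.rt_spec ht).1
theorem rt_nonneg (ht : cs.IsReflection t) : 0 ≤ C.rt t := (C.rt_spec ht).2.1
theorem act_refl (ht : cs.IsReflection t) (v : B → ℤ) :
    C.act t v = v - C.cor t v • C.rt t := (C.rt_spec ht).2.2.1 v
theorem cor_rt (ht : cs.IsReflection t) : C.cor t (C.rt t) = 2 := (C.rt_spec ht).2.2.2.1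
theorem act_rt (ht : cs.IsReflection t) : C.act t (C.rt t) = -C.rt t := by
  rw [act_refl C ht, cor_rt C ht]; module
theorem rt_ne_zero (ht : cs.IsReflection t) : C.rt t ≠ 0 := (C.isRoot_rt ht).ne_zero

theorem rt_eq (w : W) (i : B) (h : t = w * cs.simple i * w⁻¹) :
    C.rt t = C.act w (al i) ∨ C.rt t = -C.act w (al i) := by
  have ht : cs.IsReflection t := ⟨w, i, h⟩
  set u := C.act w (al i) with hu
  have hr : C.IsRoot u := ⟨w, i, rfl⟩
  have e1 : (2:ℤ) • u = C.cor t u • C.rt t := by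
    have h1 : C.act t u = -u := by rw [h, hu]; simp [act_mul]
    rw [act_refl C ht] at h1
    calc (2:ℤ) • u = u - -u := by module
      _ = _ := by rw [← h1]; module
  have e2 : (2:ℤ) • C.rt t = C.coro w i (C.rt t) • u := by
    have h1 := C.act_conj w i (C.rt t)
    rw [← h, act_rt C ht] at h1
    change _ = C.rt t - C.coro w i (C.rt t) • u at h1
    calc (2:ℤ) • C.rt t = C.rt t - -C.rt t := by module
      _ = _ := by rw [h1]; module
  set k := C.cor t u
  set k' := C.coro w i (C.rt t)
  have e3 : k * k' = 4 := by
    have : (k * k' - 4 : ℤ) • u = 0 := by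
      have h1 : (4:ℤ) • u = (k * k') • u := by
        calc (4:ℤ) • u = (2:ℤ) • ((2:ℤ) • u) := by module
          _ = k • ((2:ℤ) • C.rt t) := by rw [e1]; module
          _ = _ := by rw [e2]; module
      rw [sub_smul, h1, sub_self]
    rcases smul_eq_zero.1 this with h1 | h1
    · omega
    · exact absurd h1 hr.ne_zero
  have inj : ∀ a b : B → ℤ, (2:ℤ) • a = (2:ℤ) • b → a = b := fun a b hab =>
    smul_right_injective _ (by norm_num) hab
  have hk : k ∣ 4 := ⟨k', e3.symm⟩
  have hk4 : k ≤ 4 := Int.le_of_dvd (by norm_num) hk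
  have hk4' : -k ≤ 4 := Int.le_of_dvd (by norm_num) ((neg_dvd).2 hk)
  have hk5 : -4 ≤ k := by omega
  have notodd : ∀ c : ℤ, C.rt t = c • u → c = 2 ∨ c = -2 → False := by
    intro c hc h2; rcases (C.isRoot_rt ht).primitive hc with h | h <;> omega
  have notodd' : ∀ c : ℤ, u = c • C.rt t → c = 2 ∨ c = -2 → False := by
    intro c hc h2; rcases hr.primitive hc with h | h <;> omega
  interval_cases k
  · exact (notodd' (-2) (inj _ _ (by rw [e1]; module)) (by simp)).elim
  · omega
  · right; apply inj; rw [e2, show k' = -2 by omega]; module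
  · exact (notodd (-2) (inj _ _ (by rw [e2, show k' = -4 by omega]; module)) (by simp)).elim
  · omega
  · exact (notodd 2 (inj _ _ (by rw [e2, show k' = 4 by omega]; module)) (by simp)).elim
  · left; apply inj; rw [e2, show k' = 2 by omega]
  · omega
  · exact (notodd' 2 (inj _ _ (by rw [e1]; module)) (by simp)).elim

theorem rt_simple (i : B) : C.rt (cs.simple i) = al i := by
  have hs := cs.isReflection_simple i
  rcases C.rt_eq 1 i (t := cs.simple i) (by simp) with h | h
  · simpa using h
  · have := C.rt_nonneg hs
    rw [h] at this
    simp only [act_one, Left.nonneg_neg_iff] at this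
    exact absurd (le_antisymm this (al_nonneg i)) (al_ne_zero i)

theorem rt_conj (ht : cs.IsReflection t) (x : W) :
    C.rt (x * t * x⁻¹) = C.act x (C.rt t) ∨ C.rt (x * t * x⁻¹) = -C.act x (C.rt t) := by
  obtain ⟨-, -, -, -, w, i, hw, h⟩ := C.rt_spec ht
  have h2 := C.rt_eq (t := x * t * x⁻¹) (x * w) i (by rw [hw]; simp [mul_assoc])
  rw [act_mul] at h2
  rcases h with h | h <;> rw [h]
  · exact h2
  · rw [act_neg, neg_neg]; exact h2.symm

variable {C}

theorem IsRoot.exists_refl {v : B → ℤ} (h : C.IsRoot v) :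
    ∃ t, cs.IsReflection t ∧ (C.rt t = v ∨ C.rt t = -v) := by
  obtain ⟨w, i, rfl⟩ := h
  exact ⟨_, ⟨w, i, rfl⟩, C.rt_eq w i rfl⟩

theorem IsRoot.exists_refl_of_nonneg {v : B → ℤ} (h : C.IsRoot v) (h0 : 0 ≤ v) :
    ∃ t, cs.IsReflection t ∧ C.rt t = v := by
  obtain ⟨t, ht, h1 | h1⟩ := h.exists_refl
  · exact ⟨t, ht, h1⟩
  · have := C.rt_nonneg ht
    rw [h1] at this
    exact absurd (le_antisymm (neg_nonneg.1 this) h0) h.ne_zero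

variable (C) [Finite W]

theorem cor_form (ht : cs.IsReflection t) (v : B → ℤ) :
    C.cor t v * C.form (C.rt t) (C.rt t) = 2 * C.form (C.rt t) v := by
  have h := C.form_act t (C.rt t) v
  rw [act_rt C ht, act_refl C ht, form_sub, form_smul, form_comm _ (-C.rt t) v,
    form_comm _ (-C.rt t) (C.rt t), form_neg, form_neg, form_comm _ v] at h
  linarith

theorem refl_ext' (ht : cs.IsReflection t) (ht' : cs.IsReflection t') {c d : ℤ} (hc : c ≠ 0)
    (h : c • C.rt t = d • C.rt t') : t = t' := by
  have hd : d ≠ 0 := by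
    rintro rfl; simp only [zero_smul, smul_eq_zero] at h
    exact h.elim hc (C.rt_ne_zero ht)
  have key : ∀ (s : W), cs.IsReflection s → ∀ (c : ℤ) v,
      C.form (c • C.rt s) (c • C.rt s) • (v - C.act s v) =
      (2 * C.form (c • C.rt s) v) • (c • C.rt s) := by
    intro s hs c v
    rw [act_refl C hs, form_comm _ (c • _) v, form_smul, form_smul, form_comm _ (c • _), form_smul]
    have h1 := C.cor_form hs v
    rw [sub_sub_cancel, smul_smul, smul_smul, form_comm _ v]
    congr 1
    linear_combination (c * c) * h1
  have h1 : ∀ v, C.act t v = C.act t' v := by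
    intro v
    have h2 := key t ht c v
    rw [h, ← key t' ht' d v] at h2
    have h3 : C.form (d • C.rt t') (d • C.rt t') ≠ 0 :=
      (C.form_self_pos (smul_ne_zero hd (C.rt_ne_zero ht'))).ne'
    have h4 := smul_right_injective _ h3 h2
    exact sub_right_injective h4
  have h2 : t * t'⁻¹ = 1 := by
    apply C.eq_one_of_act
    intro v; rw [act_mul, h1, act_act_inv]
  exact mul_inv_eq_one.1 h2

theorem refl_ext (ht : cs.IsReflection t) (ht' : cs.IsReflection t')
    (h : C.rt t = C.rt t' ∨ C.rt t = -C.rt t') : t = t' := by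
  rcases h with h | h
  · exact C.refl_ext' ht ht' (c := 1) (d := 1) one_ne_zero (by rw [h])
  · exact C.refl_ext' ht ht' (c := 1) (d := -1) one_ne_zero (by rw [h]; simp)

theorem act_rt_nonneg (w : W) (ht : cs.IsReflection t) (h : cs.length w < cs.length (w * t)) :
    0 ≤ C.act w (C.rt t) := by
  induction hn : cs.length w generalizing w with
  | zero => rw [cs.length_eq_zero_iff] at hn; subst hn; simpa using C.rt_nonneg ht
  | succ n ih =>
    have hw1 : w ≠ 1 := by rintro rfl; simp at hn
    obtain ⟨j, hj⟩ := cs.exists_leftDescent_of_ne_one hw1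
    have hj' := cs.isLeftDescent_iff.1 hj
    have h1 := cs.length_simple_mul (w * t) j
    rw [← mul_assoc] at h1
    have h2 := ih (cs.simple j * w) (by omega) (by omega)
    by_contra hcon
    have hr := (C.isRoot_rt ht).act w
    have hv := hr.not_nonneg_iff.1 hcon
    by_cases he : -C.act w (C.rt t) = al j
    · have h3 : w * t * w⁻¹ = cs.simple j := by
        apply C.refl_ext (ht.conj w) (cs.isReflection_simple j)
        rw [rt_simple, ← he]
        simpa using (C.rt_conj ht w).symm
      have h4 : w * t = cs.simple j * w := by rw [← h3]; simp
      rw [h4] at h; omega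
    · have h3 := hr.neg.act_simple_nonneg (neg_nonneg.2 hv) he
      rw [act_neg, ← act_mul] at h3
      exact ((C.isRoot_rt ht).act _).not_nonpos_iff.2 h2 (neg_nonneg.1 h3)

theorem act_rt_nonneg_iff (w : W) (ht : cs.IsReflection t) :
    0 ≤ C.act w (C.rt t) ↔ cs.length w < cs.length (w * t) := by
  refine ⟨fun h => ?_, C.act_rt_nonneg w ht⟩
  by_contra hc
  have h1 := C.act_rt_nonneg (w * t) ht (by
    rw [mul_assoc, ht.mul_self, mul_one]
    exact lt_of_le_of_ne (not_lt.1 hc) (ht.length_mul_left_ne w))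
  rw [act_mul, act_rt C ht, act_neg] at h1
  exact ((C.isRoot_rt ht).act w).not_nonneg_iff.2 (neg_nonneg.1 h1) h

theorem length_refl_mul (ht : cs.IsReflection t) (x : W) :
    cs.length (x⁻¹ * t) = cs.length (t * x) := by
  rw [← cs.length_inv, mul_inv_rev, ht.inv, inv_inv]

theorem up_iff (ht : cs.IsReflection t) (x : W) :
    cs.length x < cs.length (t * x) ↔ 0 ≤ C.act x⁻¹ (C.rt t) := by
  rw [act_rt_nonneg_iff C _ ht, length_refl_mul ht, cs.length_inv]

theorem down_iff (ht : cs.IsReflection t) (x : W) :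
    cs.length (t * x) < cs.length x ↔ C.act x⁻¹ (C.rt t) ≤ 0 := by
  rw [← ((C.isRoot_rt ht).act _).not_nonneg_iff, ← up_iff C ht, not_lt]
  exact ⟨le_of_lt, fun h => lt_of_le_of_ne h (ht.length_mul_right_ne x)⟩

theorem act_simple_sign {v : B → ℤ} (hv : C.IsRoot v) {i : B} (h1 : v ≠ al i) (h2 : v ≠ -al i) :
    0 ≤ C.act (cs.simple i) v ↔ 0 ≤ v := by
  constructor
  · intro h
    by_contra hc
    have h3 := hv.neg.act_simple_nonneg (neg_nonneg.2 (hv.not_nonneg_iff.1 hc))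
      (i := i) (fun h => h2 (by rw [← h, neg_neg]))
    rw [act_neg] at h3
    exact (hv.act _).not_nonneg_iff.2 (neg_nonneg.1 h3) h
  · intro h; exact hv.act_simple_nonneg h h1

theorem up_mul_simple (C : Cartan cs) (ht : cs.IsReflection t) (x : W) (i : B)
    (hne : t ≠ x * cs.simple i * x⁻¹) :
    cs.length (x * cs.simple i) < cs.length (t * (x * cs.simple i)) ↔
      cs.length x < cs.length (t * x) := by
  rw [C.up_iff ht, C.up_iff ht, mul_inv_rev, cs.inv_simple, act_mul]
  have key : ∀ v, C.act x⁻¹ (C.rt t) = v → C.rt t = C.act x v := by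
    rintro v rfl; rw [act_act_inv]
  apply C.act_simple_sign ((C.isRoot_rt ht).act _)
  · intro h
    apply hne
    apply C.refl_ext ht ⟨x, i, rfl⟩
    have := C.rt_conj (cs.isReflection_simple i) x
    rw [rt_simple] at this
    rw [key _ h]
    rcases this with h | h <;> rw [h] <;> simp
  · intro h
    apply hne
    apply C.refl_ext ht ⟨x, i, rfl⟩
    have := C.rt_conj (cs.isReflection_simple i) x
    rw [rt_simple] at this
    rw [key _ h]
    rcases this with h | h <;> rw [h] <;> simp

end Cartan

open Classical in
/-- The finite set of reflections. -/
def refls (cs : CoxeterSystem M W) [Finite W] : Finset W :=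
  (Set.toFinite {t | cs.IsReflection t}).toFinset

theorem mem_refls [Finite W] {t : W} : t ∈ refls cs ↔ cs.IsReflection t := by
  simp [refls]

open Classical in
/-- Left inversions. -/
def dn (cs : CoxeterSystem M W) [Finite W] (x : W) : Finset W :=
  (refls cs).filter fun t => cs.length (t * x) < cs.length x

open Classical in
/-- Reflections that are not left inversions. -/
def up (cs : CoxeterSystem M W) [Finite W] (x : W) : Finset W :=
  (refls cs).filter fun t => cs.length x < cs.length (t * x)

theorem mem_dn [Finite W] {x t : W} :
    t ∈ dn cs x ↔ cs.IsReflection t ∧ cs.length (t * x) < cs.length x := by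
  simp [dn, mem_refls]

theorem mem_up [Finite W] {x t : W} :
    t ∈ up cs x ↔ cs.IsReflection t ∧ cs.length x < cs.length (t * x) := by
  simp [up, mem_refls]

theorem up_disjoint_dn [Finite W] (x : W) : Disjoint (up cs x) (dn cs x) := by
  rw [Finset.disjoint_left]; intro t h1 h2
  rw [mem_up] at h1; rw [mem_dn] at h2; omega

theorem card_up_add_card_dn [Finite W] (x : W) :
    (up cs x).card + (dn cs x).card = (refls cs).card := by
  classical
  rw [← Finset.card_union_of_disjoint (up_disjoint_dn x)]
  congr 1
  ext t
  simp only [Finset.mem_union, mem_up, mem_dn, mem_refls]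
  constructor
  · rintro (h | h) <;> exact h.1
  · intro h
    rcases lt_or_gt_of_ne (h.length_mul_right_ne t |> fun _ => h.length_mul_right_ne x) with h1 | h1
    · exact Or.inr ⟨h, h1⟩
    · exact Or.inl ⟨h, h1⟩

namespace Cartan
variable [Fintype B] [DecidableEq B] (C : Cartan cs) [Finite W] [DecidableEq W]

theorem conj_mul_mul_simple (x : W) (i : B) :
    x * cs.simple i * x⁻¹ * (x * cs.simple i) = x := by simp [mul_assoc]

theorem up_eq_insert (C : Cartan cs) (x : W) (i : B) (h : cs.length x < cs.length (x * cs.simple i)) :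
    up cs x = insert (x * cs.simple i * x⁻¹) (up cs (x * cs.simple i)) := by
  ext t
  rw [Finset.mem_insert, mem_up, mem_up]
  by_cases ht : t = x * cs.simple i * x⁻¹
  · subst ht
    simp only [true_or, iff_true]
    exact ⟨⟨x, i, rfl⟩, by simpa using h⟩
  · simp only [ht, false_or]
    constructor
    · rintro ⟨h1, h2⟩; exact ⟨h1, (C.up_mul_simple h1 x i ht).2 h2⟩
    · rintro ⟨h1, h2⟩; exact ⟨h1, (C.up_mul_simple h1 x i ht).1 h2⟩

theorem notMem_up (x : W) (i : B) (h : cs.length x < cs.length (x * cs.simple i)) :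
    x * cs.simple i * x⁻¹ ∉ up cs (x * cs.simple i) := by
  rw [mem_up]; rintro ⟨-, h1⟩
  rw [conj_mul_mul_simple] at h1; omega

theorem card_dn (C : Cartan cs) (x : W) : (dn cs x).card = cs.length x := by
  induction hn : cs.length x generalizing x with
  | zero =>
    rw [Finset.card_eq_zero, Finset.eq_empty_iff_forall_notMem]
    intro t ht; rw [mem_dn] at ht; omega
  | succ n ih =>
    have hw1 : x ≠ 1 := by rintro rfl; simp at hn
    obtain ⟨i, hi⟩ := cs.exists_rightDescent_of_ne_one hw1
    have hi' := cs.isRightDescent_iff.1 hi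
    have h0 : cs.length (x * cs.simple i) < cs.length (x * cs.simple i * cs.simple i) := by
      simp; omega
    have h1 := C.up_eq_insert _ i h0
    have h2 := notMem_up _ i h0
    simp only [simple_mul_simple_cancel_right] at h1 h2
    have h3 := congrArg Finset.card h1
    rw [Finset.card_insert_of_notMem h2] at h3
    have h4 := card_up_add_card_dn (cs := cs) (x * cs.simple i)
    have h5 := card_up_add_card_dn (cs := cs) x
    have h6 := ih (x * cs.simple i) (by omega)
    omega

theorem card_up (C : Cartan cs) (x : W) :
    (up cs x).card + cs.length x = (refls cs).card := by
  rw [← card_up_add_card_dn x, C.card_dn]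

theorem exists_ascent (C : Cartan cs) (x y : W) (h : cs.length x < cs.length y) :
    ∃ i, cs.length x < cs.length (x * cs.simple i) := by
  by_contra! hc
  have h1 : up cs x = ∅ := by
    rw [Finset.eq_empty_iff_forall_notMem]
    intro t ht
    rw [mem_up] at ht
    obtain ⟨ht, h2⟩ := ht
    rw [← length_refl_mul ht, ← cs.length_inv x, ← C.act_rt_nonneg_iff _ ht] at h2
    have h3 : C.rt t = C.act x (C.act x⁻¹ (C.rt t)) := by simp
    set v := C.act x⁻¹ (C.rt t)
    have h4 : v = ∑ i, v i • al i := by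
      ext k; simp [al, Pi.single_apply]
    rw [h4, act_sum] at h3
    have h5 : C.rt t ≤ 0 := by
      rw [h3]
      apply Finset.sum_nonpos
      intro i _
      rw [act_smul]
      exact smul_nonpos_of_nonneg_of_nonpos (h2 i) ((C.act_al_nonpos_iff x i).2
        (lt_of_le_of_ne (hc i) (cs.length_mul_simple_ne x i)))
    exact C.rt_ne_zero ht (le_antisymm h5 (C.rt_nonneg ht))
  have h2 := C.card_up x
  have h3 := C.card_up y
  rw [h1, Finset.card_empty] at h2
  omega

end Cartan

/-! ### Bruhat order -/

theorem bruhat_refl (x : W) : bruhatLE cs x x := Relation.ReflTransGen.refl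

theorem bruhat_trans {x y z : W} (h : bruhatLE cs x y) (h' : bruhatLE cs y z) :
    bruhatLE cs x z := Relation.ReflTransGen.trans h h'

theorem bruhat_of_refl {t x : W} (ht : cs.IsReflection t) (h : cs.length x < cs.length (t * x)) :
    bruhatLE cs x (t * x) := Relation.ReflTransGen.single ⟨h, t, ht, rfl⟩

theorem bruhat_of_refl' {t x : W} (ht : cs.IsReflection t) (h : cs.length (t * x) < cs.length x) :
    bruhatLE cs (t * x) x := Relation.ReflTransGen.single
      ⟨h, t, ht, by rw [← mul_assoc, ht.mul_self, one_mul]⟩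

theorem bruhat_length {x y : W} (h : bruhatLE cs x y) : cs.length x ≤ cs.length y := by
  induction h with
  | refl => rfl
  | tail _ h ih => exact ih.trans h.1.le

theorem bruhat_length_lt {x y : W} (h : bruhatLE cs x y) (hne : x ≠ y) :
    cs.length x < cs.length y := by
  rcases Relation.ReflTransGen.cases_tail h with h1 | ⟨c, h1, h2⟩
  · exact absurd h1.symm hne
  · exact lt_of_le_of_lt (bruhat_length h1) h2.1

theorem bruhat_antisymm {x y : W} (h : bruhatLE cs x y) (h' : bruhatLE cs y x) : x = y := by
  by_contra hne
  have := bruhat_length_lt h hne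
  have := bruhat_length h'
  omega

theorem bruhat_inv {x y : W} (h : bruhatLE cs x y) : bruhatLE cs x⁻¹ y⁻¹ := by
  induction h with
  | refl => exact bruhat_refl _
  | @tail b c _ h ih =>
    refine ih.tail ⟨by simpa using h.1, ?_⟩
    obtain ⟨t, ht, rfl⟩ := h.2
    refine ⟨b⁻¹ * t * b, by simpa using ht.conj b⁻¹, ?_⟩
    simp [ht.inv]

theorem bruhat_inv_iff {x y : W} : bruhatLE cs x⁻¹ y⁻¹ ↔ bruhatLE cs x y :=
  ⟨fun h => by simpa using bruhat_inv h, bruhat_inv⟩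

theorem bruhat_mul_simple {x : W} {i : B} (h : cs.length x < cs.length (x * cs.simple i)) :
    bruhatLE cs x (x * cs.simple i) := by
  have := bruhat_of_refl (cs := cs) (t := x * cs.simple i * x⁻¹) (x := x) ⟨x, i, rfl⟩
    (by simpa using h)
  simpa using this

theorem bruhat_mul_simple' {x : W} {i : B} (h : cs.length (x * cs.simple i) < cs.length x) :
    bruhatLE cs (x * cs.simple i) x := by
  have := bruhat_mul_simple (cs := cs) (x := x * cs.simple i) (i := i) (by simpa using h)
  simpa using this

theorem one_bruhat (w : W) : bruhatLE cs 1 w := by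
  induction hn : cs.length w generalizing w with
  | zero => rw [cs.length_eq_zero_iff] at hn; subst hn; exact bruhat_refl _
  | succ n ih =>
    have hw1 : w ≠ 1 := by rintro rfl; simp at hn
    obtain ⟨i, hi⟩ := cs.exists_rightDescent_of_ne_one hw1
    have hi' := cs.isRightDescent_iff.1 hi
    exact bruhat_trans (ih _ (by omega)) (bruhat_mul_simple' hi)

theorem bruhat_one_iff {x : W} : bruhatLE cs x 1 ↔ x = 1 :=
  ⟨fun h => bruhat_antisymm h (one_bruhat _), fun h => h ▸ bruhat_refl _⟩

namespace Cartan
variable [Fintype B] [DecidableEq B] (C : Cartan cs) [Finite W]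

theorem edge_mul_simple (C : Cartan cs) {x t : W} (ht : cs.IsReflection t)
    (h : cs.length x < cs.length (t * x)) (i : B) : x * cs.simple i = t * x ∨
    cs.length (x * cs.simple i) < cs.length (t * (x * cs.simple i)) := by
  by_cases he : t = x * cs.simple i * x⁻¹
  · left; rw [he]; simp
  · right; exact (C.up_mul_simple ht x i he).2 h

theorem bruhat_lift_max (C : Cartan cs) {x w : W} (h : bruhatLE cs x w) (i : B) :
    bruhatLE cs (x * cs.simple i) w ∨ bruhatLE cs (x * cs.simple i) (w * cs.simple i) := by
  induction h using Relation.ReflTransGen.head_induction_on with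
  | refl => exact Or.inr (bruhat_refl _)
  | @head a c h1 h2 ih =>
    obtain ⟨hl, t, ht, rfl⟩ := h1
    rcases C.edge_mul_simple ht hl i with h | h
    · left; rw [h]; exact h2
    · have h3 := bruhat_of_refl ht h
      rw [← mul_assoc] at h3
      exact ih.imp (bruhat_trans h3) (bruhat_trans h3)

theorem bruhat_lift_min (C : Cartan cs) {x w : W} (h : bruhatLE cs x w) (i : B) :
    bruhatLE cs (x * cs.simple i) (w * cs.simple i) ∨ bruhatLE cs x (w * cs.simple i) := by
  induction h with
  | refl => exact Or.inl (bruhat_refl _)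
  | @tail b c h1 h2 ih =>
    obtain ⟨hl, t, ht, rfl⟩ := h2
    rcases C.edge_mul_simple ht hl i with h | h
    · right; rw [← h, simple_mul_simple_cancel_right]; exact h1
    · have h3 := bruhat_of_refl ht h
      rw [← mul_assoc] at h3
      exact ih.imp (fun h4 => bruhat_trans h4 h3) (fun h4 => bruhat_trans h4 h3)

variable {x w : W} {i : B}

/-- If `w` has descent `i` then `[e,w]` is stable under right multiplication by `s_i`. -/
theorem bruhat_mul_simple_le (C : Cartan cs) (h : bruhatLE cs x w)
    (hw : cs.length (w * cs.simple i) < cs.length w) : bruhatLE cs (x * cs.simple i) w :=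
  (C.bruhat_lift_max h i).elim id fun h1 => bruhat_trans h1 (bruhat_mul_simple' hw)

theorem bruhat_mul_simple_le_iff (C : Cartan cs)
    (hw : cs.length (w * cs.simple i) < cs.length w) :
    bruhatLE cs (x * cs.simple i) w ↔ bruhatLE cs x w :=
  ⟨fun h => by simpa using C.bruhat_mul_simple_le h hw, fun h => C.bruhat_mul_simple_le h hw⟩

theorem bruhat_mul_simple_mul_simple (C : Cartan cs) (h : bruhatLE cs x w)
    (hx : cs.length (x * cs.simple i) < cs.length x) :
    bruhatLE cs (x * cs.simple i) (w * cs.simple i) :=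
  (C.bruhat_lift_min h i).elim id fun h1 => bruhat_trans (bruhat_mul_simple' hx) h1

theorem bruhat_le_mul_simple (C : Cartan cs) (h : bruhatLE cs x w)
    (hx : cs.length x < cs.length (x * cs.simple i)) :
    bruhatLE cs x (w * cs.simple i) :=
  (C.bruhat_lift_min h i).elim (fun h1 => bruhat_trans (bruhat_mul_simple hx) h1) id

theorem bruhat_mul_both (C : Cartan cs) (h : bruhatLE cs x w)
    (hw : cs.length w < cs.length (w * cs.simple i)) :
    bruhatLE cs (x * cs.simple i) (w * cs.simple i) :=
  (C.bruhat_lift_max h i).elim (fun h1 => bruhat_trans h1 (bruhat_mul_simple hw)) id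

theorem bruhat_wordProd (C : Cartan cs) (ω : List B) (x : W) (h : bruhatLE cs x (cs.wordProd ω)) :
    ∃ ω', ω'.Sublist ω ∧ x = cs.wordProd ω' := by
  induction ω using List.reverseRecOn generalizing x with
  | nil => rw [wordProd_nil, bruhat_one_iff] at h; exact ⟨[], List.Sublist.refl _, by simp [h]⟩
  | append_singleton ω i ih =>
    rw [wordProd_append, wordProd_singleton] at h
    rcases C.bruhat_lift_min h i with h1 | h1 <;>
      rw [simple_mul_simple_cancel_right] at h1
    · obtain ⟨ω', h2, h3⟩ := ih _ h1
      refine ⟨ω' ++ [i], h2.append (List.Sublist.refl _), ?_⟩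
      rw [wordProd_append, wordProd_singleton, ← h3, simple_mul_simple_cancel_right]
    · obtain ⟨ω', h2, h3⟩ := ih _ h1
      exact ⟨ω', h2.trans (List.sublist_append_left _ _), h3⟩

end Cartan

section lin
variable [Fintype B]

/-- The linear form attached to a vector of the root lattice. -/
def lin (v : B → ℤ) : MvPolynomial B ℚ := ∑ i, (v i : ℚ) • MvPolynomial.X i

theorem lin_add (u v : B → ℤ) : lin (u + v) = lin u + lin v := by
  simp [lin, add_smul, Finset.sum_add_distrib]

theorem lin_smul (c : ℤ) (v : B → ℤ) : lin (c • v) = (c : MvPolynomial B ℚ) * lin v := by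
  simp only [lin, Finset.mul_sum, Pi.smul_apply, smul_eq_mul, Int.cast_mul, mul_smul]
  refine Finset.sum_congr rfl fun i _ => ?_
  rw [MvPolynomial.smul_eq_C_mul _ (c : ℚ)]; simp

theorem lin_neg (v : B → ℤ) : lin (-v) = -lin v := by
  have := lin_smul (-1) v; simpa using this

theorem lin_sub (u v : B → ℤ) : lin (u - v) = lin u - lin v := by
  rw [sub_eq_add_neg, lin_add, lin_neg, sub_eq_add_neg]

theorem coeff_lin [DecidableEq B] (v : B → ℤ) (i : B) :
    (lin v).coeff (Finsupp.single i 1) = v i := by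
  simp only [lin, MvPolynomial.coeff_sum, MvPolynomial.coeff_smul, MvPolynomial.coeff_X,
    Finsupp.single_left_inj one_ne_zero]
  simp

theorem lin_ne_zero {v : B → ℤ} (h : v ≠ 0) : lin v ≠ 0 := by
  classical
  intro h0
  apply h; ext i
  have := coeff_lin v i
  rw [h0] at this; simpa using this.symm

theorem totalDegree_lin {v : B → ℤ} (h : v ≠ 0) : (lin v).totalDegree = 1 := by
  classical
  apply le_antisymm
  · apply MvPolynomial.totalDegree_finsetSum_le
    intro i _
    exact (MvPolynomial.totalDegree_smul_le _ _).trans (by simp)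
  · by_contra hc
    have h0 : (lin v).totalDegree = 0 := by omega
    apply h; ext i
    have h1 := coeff_lin v i
    rw [MvPolynomial.totalDegree_eq_zero_iff_eq_C.1 h0, MvPolynomial.coeff_C,
      if_neg (by simp [eq_comm])] at h1
    exact_mod_cast h1.symm

theorem prime_lin {v : B → ℤ} (h : v ≠ 0) : Prime (lin v) := by
  classical
  apply Irreducible.prime
  apply MvPolynomial.irreducible_of_totalDegree_eq_one (totalDegree_lin h)
  intro x hx
  rw [isUnit_iff_ne_zero]
  rintro rfl
  apply h; ext i
  have := hx (Finsupp.single i 1)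
  rw [coeff_lin, zero_dvd_iff] at this
  exact_mod_cast this

theorem lin_dvd_lin {u v : B → ℤ} (hu : u ≠ 0) (h : lin u ∣ lin v) :
    ∃ a b : ℤ, a ≠ 0 ∧ a • v = b • u := by
  classical
  obtain ⟨q, hq⟩ := h
  by_cases hv : v = 0
  · exact ⟨1, 0, one_ne_zero, by simp [hv]⟩
  have hq0 : q ≠ 0 := by rintro rfl; rw [mul_zero] at hq; exact lin_ne_zero hv hq
  have h1 := MvPolynomial.totalDegree_mul_of_isDomain (lin_ne_zero hu) hq0
  rw [← hq, totalDegree_lin hu, totalDegree_lin hv] at h1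
  have h2 := MvPolynomial.totalDegree_eq_zero_iff_eq_C.1 (show q.totalDegree = 0 by omega)
  set c := q.coeff 0
  refine ⟨c.den, c.num, by simp, ?_⟩
  ext i
  have h3 := coeff_lin v i
  rw [hq, h2, mul_comm, MvPolynomial.coeff_C_mul, coeff_lin] at h3
  simp only [Pi.smul_apply, smul_eq_mul]
  have h4 : (c.den : ℚ) * v i = c.num * u i := by
    rw [← h3, ← mul_assoc, mul_comm (c.den : ℚ), Rat.mul_den_eq_num]
  exact_mod_cast h4

theorem eval_lin (u : B → ℚ) (v : B → ℤ) : MvPolynomial.eval u (lin v) = ∑ i, v i * u i := by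
  simp [lin, MvPolynomial.smul_eval]

theorem eval_lin_pos {v : B → ℤ} (h : 0 ≤ v) (h0 : v ≠ 0) :
    0 < MvPolynomial.eval (fun _ => 1) (lin v) := by
  rw [eval_lin]
  obtain ⟨k, hk⟩ := Function.ne_iff.1 h0
  apply Finset.sum_pos'
  · intro i _; have := h i; simp only [Pi.zero_apply] at this; simpa using this
  · refine ⟨k, Finset.mem_univ _, ?_⟩
    have := h k
    simp only [Pi.zero_apply] at this hk
    simpa using lt_of_le_of_ne this (Ne.symm hk)

end lin

namespace Cartan
variable [Fintype B] [DecidableEq B] (C : Cartan cs) [Finite W]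

/-- The linear form of the root of a reflection. -/
def rl (t : W) : MvPolynomial B ℚ := lin (C.rt t)

variable {t t' : W}

theorem prime_rl (ht : cs.IsReflection t) : Prime (C.rl t) := prime_lin (C.rt_ne_zero ht)

theorem rl_not_dvd (ht : cs.IsReflection t) (ht' : cs.IsReflection t') (h : t ≠ t') :
    ¬ C.rl t ∣ C.rl t' := by
  intro hd
  obtain ⟨a, b, ha, hab⟩ := lin_dvd_lin (C.rt_ne_zero ht) hd
  exact h (C.refl_ext' ht' ht ha hab).symm

theorem prod_rl_dvd {s : Finset W} (hs : ∀ t ∈ s, cs.IsReflection t) {p : MvPolynomial B ℚ}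
    (h : ∀ t ∈ s, C.rl t ∣ p) : ∏ t ∈ s, C.rl t ∣ p := by
  apply Finset.prod_dvd_of_isRelPrime _ h
  intro t ht t' ht' hne
  exact (C.prime_rl (hs t ht)).irreducible.isRelPrime_iff_not_dvd.2
    (C.rl_not_dvd (hs t ht) (hs t' ht') hne)

theorem prod_rl_ne_zero {s : Finset W} (hs : ∀ t ∈ s, cs.IsReflection t) :
    ∏ t ∈ s, C.rl t ≠ 0 :=
  Finset.prod_ne_zero_iff.2 fun t ht => lin_ne_zero (C.rt_ne_zero (hs t ht))

theorem totalDegree_prod_rl {s : Finset W} (hs : ∀ t ∈ s, cs.IsReflection t) :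
    (∏ t ∈ s, C.rl t).totalDegree = s.card := by
  classical
  induction s using Finset.induction_on with
  | empty => simp
  | insert a s ha ih =>
    have h1 : ∀ t ∈ s, cs.IsReflection t := fun t ht => hs t (Finset.mem_insert_of_mem ht)
    have h2 := hs a (Finset.mem_insert_self _ _)
    rw [Finset.prod_insert ha, MvPolynomial.totalDegree_mul_of_isDomain
      (C.prime_rl h2).ne_zero (C.prod_rl_ne_zero h1), ih h1,
      Finset.card_insert_of_notMem ha, rl, totalDegree_lin (C.rt_ne_zero h2), add_comm]

/-- The Goresky–Kottwitz–MacPherson condition. -/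
def GKM (f : W → MvPolynomial B ℚ) : Prop :=
  ∀ t, cs.IsReflection t → ∀ x, C.rl t ∣ f x - f (t * x)

theorem rl_dvd_lin_sub (ht : cs.IsReflection t) (v : B → ℤ) :
    C.rl t ∣ lin v - lin (C.act t v) := by
  rw [C.act_refl ht, ← lin_sub, sub_sub_cancel, lin_smul]
  exact Dvd.intro_left _ rfl

theorem rl_conj_simple (x : W) (i : B) :
    C.rl (x * cs.simple i * x⁻¹) = lin (C.act x (al i)) ∨
    C.rl (x * cs.simple i * x⁻¹) = -lin (C.act x (al i)) := by
  rw [rl]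
  rcases C.rt_eq x i rfl with h | h <;> rw [h]
  · exact Or.inl rfl
  · exact Or.inr (lin_neg _)

/-- The degree bound satisfied by nonzero values forces a GKM function to vanish. -/
theorem GKM.eq_zero {f : W → MvPolynomial B ℚ} (hf : C.GKM f)
    (h : ∀ x, f x ≠ 0 → (f x).totalDegree + cs.length x < (refls cs).card) (x : W) : f x = 0 := by
  classical
  by_contra hx
  have := Fintype.ofFinite W
  obtain ⟨y, hy, hmax⟩ := Finset.exists_max_image (Finset.univ.filter fun x => f x ≠ 0) cs.length
    ⟨x, by simpa using hx⟩
  simp only [Finset.mem_filter, Finset.mem_univ, true_and] at hy hmax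
  have h1 : ∏ t ∈ up cs y, C.rl t ∣ f y := by
    apply C.prod_rl_dvd (fun t ht => (mem_up.1 ht).1)
    intro t ht
    rw [mem_up] at ht
    have h2 := hf t ht.1 y
    have h3 : f (t * y) = 0 := by
      by_contra hc
      have := hmax _ hc
      omega
    rwa [h3, sub_zero] at h2
  have h2 := MvPolynomial.totalDegree_le_of_dvd_of_isDomain h1 hy
  rw [C.totalDegree_prod_rl (fun t ht => (mem_up.1 ht).1)] at h2
  have h3 := C.card_up y
  have h4 := h y hy
  omega

theorem exists_D {f : W → MvPolynomial B ℚ} (hf : C.GKM f) (i : B) :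
    ∃ g : W → MvPolynomial B ℚ, C.GKM g ∧
      ∀ x, lin (C.act x (al i)) * g x = f x - f (x * cs.simple i) := by
  have h1 : ∀ x, lin (C.act x (al i)) ∣ f x - f (x * cs.simple i) := by
    intro x
    have h2 := hf (x * cs.simple i * x⁻¹) ⟨x, i, rfl⟩ x
    rw [inv_mul_cancel_right] at h2
    rcases C.rl_conj_simple x i with h | h <;> rw [h] at h2
    · exact h2
    · exact (neg_dvd).1 h2
  choose g hg using h1
  refine ⟨g, ?_, fun x => (hg x).symm⟩
  intro t ht x
  have hne : ∀ y, lin (C.act y (al i)) ≠ 0 := fun y =>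
    lin_ne_zero (C.act_ne_zero _ (al_ne_zero i))
  by_cases he : t = x * cs.simple i * x⁻¹
  · have h2 : t * x = x * cs.simple i := by rw [he]; simp
    have h3 : g (t * x) = g x := by
      apply mul_left_cancel₀ (hne x)
      rw [← hg x, h2]
      have h4 := hg (x * cs.simple i)
      rw [act_mul, act_simple_al_self, act_neg, lin_neg, simple_mul_simple_cancel_right] at h4
      linear_combination h4
    rw [h3, sub_self]; exact dvd_zero _
  · have h2 : C.rl t ∣ lin (C.act x (al i)) * (g x - g (t * x)) := by
      have h3 := C.rl_dvd_lin_sub ht (C.act x (al i))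
      rw [← act_mul] at h3
      have h4 := hf t ht x
      have h5 := hf t ht (x * cs.simple i)
      rw [← mul_assoc] at h5
      have h6 := dvd_sub (dvd_sub h4 h5) (Dvd.dvd.mul_right h3 (g (t * x)))
      convert h6 using 1
      have h7 := hg x
      have h8 := hg (t * x)
      linear_combination -h7 + h8
    rcases (C.prime_rl ht).dvd_or_dvd h2 with h3 | h3
    · exfalso
      have h4 : C.rl t ∣ C.rl (x * cs.simple i * x⁻¹) := by
        rcases C.rl_conj_simple x i with h | h <;> rw [h]
        · exact h3
        · exact (dvd_neg).2 h3
      exact C.rl_not_dvd ht ⟨x, i, rfl⟩ he h4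
    · exact h3

theorem length_le_card (C : Cartan cs) (w : W) : cs.length w ≤ (refls cs).card := by
  classical
  have := C.card_up w; omega

/-- The equivariant Schubert class attached to `w`. -/
structure IsSchub (w : W) (f : W → MvPolynomial B ℚ) : Prop where
  gkm : C.GKM f
  supp : ∀ x, f x ≠ 0 → bruhatLE cs x w
  deg : ∀ x, (f x).totalDegree + cs.length w ≤ (refls cs).card
  top : f w = ∏ t ∈ up cs w, C.rl t

variable {C}

theorem IsSchub.unique {w : W} {f g : W → MvPolynomial B ℚ} (hf : C.IsSchub w f)
    (hg : C.IsSchub w g) (x : W) : f x = g x := by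
  have h : C.GKM (fun x => f x - g x) := by
    intro t ht x
    have := dvd_sub (hf.gkm t ht x) (hg.gkm t ht x)
    convert this using 1; ring
  have h1 := GKM.eq_zero C h ?_ x
  · exact sub_eq_zero.1 h1
  intro x hx
  have hle : bruhatLE cs x w := by
    by_contra hc
    apply hx
    rw [not_imp_comm.1 (hf.supp x) hc, not_imp_comm.1 (hg.supp x) hc, sub_zero]
  have hne : x ≠ w := by
    rintro rfl; apply hx; simp only [hf.top, hg.top, sub_self]
  have h1 := bruhat_length_lt hle hne
  have h2 := MvPolynomial.totalDegree_sub (f x) (g x)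
  have h3 := hf.deg x
  have h4 := hg.deg x
  rcases le_max_iff.1 h2 with h5 | h5 <;> omega

theorem deg_D {f g : W → MvPolynomial B ℚ} {w : W} (hf : C.IsSchub w f) {i : B}
    (h : ∀ x, lin (C.act x (al i)) * g x = f x - f (x * cs.simple i)) (x : W) (hx : g x ≠ 0) :
    (g x).totalDegree + 1 + cs.length w ≤ (refls cs).card := by
  have hne : C.act x (al i) ≠ 0 := C.act_ne_zero _ (al_ne_zero i)
  have h1 := MvPolynomial.totalDegree_mul_of_isDomain (lin_ne_zero hne) hx
  rw [h, totalDegree_lin hne] at h1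
  have h2 := MvPolynomial.totalDegree_sub (f x) (f (x * cs.simple i))
  have h3 := hf.deg x
  have h4 := hf.deg (x * cs.simple i)
  rcases le_max_iff.1 h2 with h5 | h5 <;> omega

theorem IsSchub.up {f g : W → MvPolynomial B ℚ} {w : W} (hf : C.IsSchub w f) {i : B}
    (hg : C.GKM g) (h : ∀ x, lin (C.act x (al i)) * g x = f x - f (x * cs.simple i))
    (hw : cs.length w < cs.length (w * cs.simple i)) : C.IsSchub (w * cs.simple i) g := by
  classical
  have hl : cs.length (w * cs.simple i) = cs.length w + 1 := by
    rcases cs.length_mul_simple w i with h | h <;> omega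
  refine ⟨hg, fun x hx => ?_, fun x => ?_, ?_⟩
  · have h1 : f x ≠ 0 ∨ f (x * cs.simple i) ≠ 0 := by
      by_contra! hc
      have h2 := h x
      rw [hc.1, hc.2, sub_zero] at h2
      exact (mul_ne_zero (lin_ne_zero (C.act_ne_zero _ (al_ne_zero i))) hx) h2
    rcases h1 with h1 | h1
    · exact bruhat_trans (hf.supp x h1) (bruhat_mul_simple hw)
    · have h2 := C.bruhat_mul_both (hf.supp _ h1) hw
      rwa [simple_mul_simple_cancel_right] at h2
  · by_cases hx : g x = 0
    · rw [hx, MvPolynomial.totalDegree_zero, zero_add]; exact C.length_le_card _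
    · have := deg_D hf h x hx; omega
  · have h1 := h (w * cs.simple i)
    have h2 : f (w * cs.simple i) = 0 := by
      by_contra hc
      have := bruhat_length (hf.supp _ hc); omega
    have h3 : C.rl (w * cs.simple i * w⁻¹) = lin (C.act w (al i)) := by
      rw [rl]
      have hp := C.act_al_nonneg w i hw
      rcases C.rt_eq w i rfl with h4 | h4 <;> rw [h4]
      exfalso
      have h5 := C.rt_nonneg (t := w * cs.simple i * w⁻¹) ⟨w, i, rfl⟩
      rw [h4] at h5
      exact C.act_ne_zero w (al_ne_zero i) (le_antisymm (neg_nonneg.1 h5) hp)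
    rw [h2, simple_mul_simple_cancel_right, hf.top, C.up_eq_insert w i hw,
      Finset.prod_insert (notMem_up w i hw), h3, act_mul, act_simple_al_self, act_neg,
      lin_neg] at h1
    apply mul_left_cancel₀ (lin_ne_zero (C.act_ne_zero w (al_ne_zero i)))
    linear_combination -h1

variable (C)

theorem exists_schub (w : W) : ∃ f, C.IsSchub w f := by
  classical
  induction hn : cs.length w generalizing w with
  | zero =>
    rw [cs.length_eq_zero_iff] at hn; subst hn
    have hup : up cs (1 : W) = refls cs := by
      apply Finset.filter_true_of_mem
      intro t ht
      have := (mem_refls.1 ht).length_mul_right_ne 1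
      rw [mul_one, length_one] at *
      omega
    refine ⟨fun x => if x = 1 then ∏ t ∈ refls cs, C.rl t else 0, ?_, ?_, ?_, ?_⟩
    · intro t ht x
      have h1 : C.rl t ∣ ∏ t ∈ refls cs, C.rl t := Finset.dvd_prod_of_mem _ (mem_refls.2 ht)
      beta_reduce
      apply dvd_sub
      · split_ifs
        · exact h1
        · exact dvd_zero _
      · split_ifs
        · exact h1
        · exact dvd_zero _
    · intro x hx
      have : x = 1 := by by_contra hc; exact hx (if_neg hc)
      rw [this]; exact bruhat_refl _
    · intro x
      simp only [length_one, add_zero]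
      split_ifs
      · rw [C.totalDegree_prod_rl (fun t ht => mem_refls.1 ht)]
      · simp
    · simp [hup]
  | succ n ih =>
    have hw1 : w ≠ 1 := by rintro rfl; simp at hn
    obtain ⟨i, hi⟩ := cs.exists_rightDescent_of_ne_one hw1
    have hi' := cs.isRightDescent_iff.1 hi
    obtain ⟨f, hf⟩ := ih (w * cs.simple i) (by omega)
    obtain ⟨g, hg, h⟩ := C.exists_D hf.gkm i
    have := hf.up hg h (by simp; omega)
    rw [simple_mul_simple_cancel_right] at this
    exact ⟨g, this⟩

/-- The equivariant Schubert class. -/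
def schub (w : W) : W → MvPolynomial B ℚ := (C.exists_schub w).choose

theorem isSchub_schub (w : W) : C.IsSchub w (C.schub w) := (C.exists_schub w).choose_spec

theorem schub_up {w : W} {i : B} (hw : cs.length w < cs.length (w * cs.simple i)) (x : W) :
    C.schub w x = C.schub w (x * cs.simple i) +
      lin (C.act x (al i)) * C.schub (w * cs.simple i) x := by
  obtain ⟨g, hg, h⟩ := C.exists_D (C.isSchub_schub w).gkm i
  rw [(C.isSchub_schub _).unique ((C.isSchub_schub w).up hg h hw) x, h]; ring

theorem schub_down {w : W} {i : B} (hw : cs.length (w * cs.simple i) < cs.length w) (x : W) :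
    C.schub w x = C.schub w (x * cs.simple i) := by
  obtain ⟨g, hg, h⟩ := C.exists_D (C.isSchub_schub w).gkm i
  have hs := C.isSchub_schub w
  have h0 : g x = 0 := by
    apply GKM.eq_zero C hg
    intro y hy
    have h1 := deg_D hs h y hy
    have h2 : bruhatLE cs y w := by
      by_contra hc
      have h3 := h y
      have h4 : ¬ bruhatLE cs (y * cs.simple i) w := fun h5 =>
        hc (by
          have h6 := C.bruhat_mul_simple_le h5 hw
          rwa [simple_mul_simple_cancel_right] at h6)
      rw [not_imp_comm.1 (hs.supp _) hc, not_imp_comm.1 (hs.supp _) h4, sub_zero] at h3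
      exact mul_ne_zero (lin_ne_zero (C.act_ne_zero _ (al_ne_zero i))) hy h3
    have h3 := bruhat_length h2
    omega
  have h1 := h x
  rw [h0, mul_zero] at h1
  exact (sub_eq_zero.1 h1.symm)

theorem schub_pos {w x : W} (h : bruhatLE cs x w) :
    0 < MvPolynomial.eval (fun _ => 1) (C.schub w x) := by
  classical
  induction hn : (refls cs).card - cs.length x using Nat.strong_induction_on
    generalizing x w with
  | _ n ih =>
  induction hm : (refls cs).card - cs.length w using Nat.strong_induction_on
    generalizing w with
  | _ m ih' =>
  by_cases hxw : x = w
  · subst hxw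
    rw [(C.isSchub_schub x).top, map_prod]
    apply Finset.prod_pos
    intro t ht
    have ht := (mem_up.1 ht).1
    exact eval_lin_pos (C.rt_nonneg ht) (C.rt_ne_zero ht)
  have hl := bruhat_length_lt h hxw
  obtain ⟨i, hi⟩ := C.exists_ascent x w hl
  have hN := C.length_le_card (x * cs.simple i)
  rcases lt_or_gt_of_ne (cs.length_mul_simple_ne w i) with hw | hw
  · rw [C.schub_down hw]
    exact ih _ (by omega) (C.bruhat_mul_simple_le h hw) rfl
  · rw [C.schub_up hw, map_add, map_mul]
    have h1 : 0 ≤ MvPolynomial.eval (fun _ => 1) (C.schub w (x * cs.simple i)) := by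
      by_cases hc : bruhatLE cs (x * cs.simple i) w
      · exact (ih _ (by omega) hc rfl).le
      · rw [not_imp_comm.1 ((C.isSchub_schub w).supp _) hc, map_zero]
    have h2 := eval_lin_pos (C.act_al_nonneg x i hi) (C.act_ne_zero x (al_ne_zero i))
    have hN' := C.length_le_card (w * cs.simple i)
    have h3 := ih' _ (by omega) (bruhat_trans h (bruhat_mul_simple hw)) rfl
    have := mul_pos h2 h3
    linarith

theorem schub_ne_zero {w x : W} (h : bruhatLE cs x w) : C.schub w x ≠ 0 := fun h0 => by
  have := C.schub_pos h; rw [h0, map_zero] at this; exact lt_irrefl _ this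

end Cartan

open Classical in
/-- The reflections `t` with `t x ≤ w`. -/
def edg (cs : CoxeterSystem M W) [Finite W] (w x : W) : Finset W :=
  (refls cs).filter fun t => bruhatLE cs (t * x) w

theorem mem_edg [Finite W] {w x t : W} :
    t ∈ edg cs w x ↔ cs.IsReflection t ∧ bruhatLE cs (t * x) w := by
  simp [edg, mem_refls]

namespace Cartan
variable [Fintype B] [DecidableEq B] (C : Cartan cs) [Finite W] [DecidableEq W]

theorem prod_dvd_schub (w x : W) :
    ∏ t ∈ refls cs \ edg cs w x, C.rl t ∣ C.schub w x := by
  apply C.prod_rl_dvd (fun t ht => mem_refls.1 (Finset.mem_sdiff.1 ht).1)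
  intro t ht
  rw [Finset.mem_sdiff, mem_refls, mem_edg, not_and] at ht
  have h1 := (C.isSchub_schub w).gkm t ht.1 x
  rwa [not_imp_comm.1 ((C.isSchub_schub w).supp _) (ht.2 ht.1), sub_zero] at h1

theorem card_sdiff_edg (w x : W) :
    (refls cs \ edg cs w x).card + (edg cs w x).card = (refls cs).card :=
  Finset.card_sdiff_add_card_eq_card (by classical exact Finset.filter_subset _ _)

/-- **Deodhar's inequality.** -/
theorem deodhar (C : Cartan cs) {w x : W} (h : bruhatLE cs x w) :
    cs.length w ≤ (edg cs w x).card := by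
  have h1 := MvPolynomial.totalDegree_le_of_dvd_of_isDomain (C.prod_dvd_schub w x)
    (C.schub_ne_zero h)
  rw [C.totalDegree_prod_rl (fun t ht => mem_refls.1 (Finset.mem_sdiff.1 ht).1)] at h1
  have h2 := card_sdiff_edg (cs := cs) w x
  have h3 := (C.isSchub_schub w).deg x
  omega

/-- `w` is regular if every vertex of its Bruhat graph has degree `ℓ(w)`. -/
def _root_.Paper.Regular (cs : CoxeterSystem M W) (w : W) : Prop :=
  ∀ x, bruhatLE cs x w → (edg cs w x).card = cs.length w

theorem schub_of_regular {w x : W} (hr : Regular cs w) (h : bruhatLE cs x w) :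
    ∃ k : ℚ, k ≠ 0 ∧ C.schub w x = MvPolynomial.C k * ∏ t ∈ refls cs \ edg cs w x, C.rl t := by
  obtain ⟨q, hq⟩ := C.prod_dvd_schub w x
  have h0 := C.schub_ne_zero h
  have hs : ∀ t ∈ refls cs \ edg cs w x, cs.IsReflection t :=
    fun t ht => mem_refls.1 (Finset.mem_sdiff.1 ht).1
  have hq0 : q ≠ 0 := by rintro rfl; rw [mul_zero] at hq; exact h0 hq
  have h1 := MvPolynomial.totalDegree_mul_of_isDomain (C.prod_rl_ne_zero hs) hq0
  rw [← hq, C.totalDegree_prod_rl hs] at h1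
  have h2 := card_sdiff_edg (cs := cs) w x
  have h3 := (C.isSchub_schub w).deg x
  have h4 := hr x h
  have h5 := MvPolynomial.totalDegree_eq_zero_iff_eq_C.1 (show q.totalDegree = 0 by omega)
  refine ⟨q.coeff 0, fun h6 => hq0 (by rw [h5, h6, map_zero]), ?_⟩
  rw [← h5, hq, mul_comm]

end Cartan

open Classical in
/-- The Bruhat interval `[e, w]`. -/
def ivl (cs : CoxeterSystem M W) [Finite W] (w : W) : Finset W :=
  have := Fintype.ofFinite W
  Finset.univ.filter fun x => bruhatLE cs x w

theorem mem_ivl [Finite W] {w x : W} : x ∈ ivl cs w ↔ bruhatLE cs x w := by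
  simp [ivl]

theorem poin_eq [Finite W] (w : W) :
    poin cs w = ∑ x ∈ ivl cs w, Polynomial.X ^ cs.length x := by
  rw [poin]
  apply finsum_mem_eq_sum_of_inter_support_eq
  ext x; simp [mem_ivl]

theorem coeff_poin [Finite W] (w : W) (n : ℕ) :
    (poin cs w).coeff n = (((ivl cs w).filter fun x => cs.length x = n).card : ℤ) := by
  rw [poin_eq, Polynomial.finsetSum_coeff]
  simp [Polynomial.coeff_X_pow, Finset.sum_ite, eq_comm]

theorem qint_reflect (m : ℕ) : Polynomial.reflect m (qint (m + 1)) = qint (m + 1) := by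
  ext i
  rw [Polynomial.coeff_reflect]
  by_cases h : i ≤ m
  · rw [Polynomial.revAt_le h]
    simp only [qint, Polynomial.finsetSum_coeff, Polynomial.coeff_X_pow, Finset.sum_ite_eq,
      Finset.mem_range]
    rw [if_pos (by omega), if_pos (by omega)]
  · rw [Polynomial.revAt_eq_self_of_lt (by omega)]

theorem qint_natDegree_le (m : ℕ) : (qint (m + 1)).natDegree ≤ m := by
  apply Polynomial.natDegree_sum_le_of_forall_le
  intro i hi
  rw [Polynomial.natDegree_X_pow]
  exact Nat.lt_succ_iff.1 (Finset.mem_range.1 hi)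

theorem qint_coeff (m i : ℕ) : (qint m).coeff i = if i < m then 1 else 0 := by
  simp [qint, Polynomial.finsetSum_coeff, Polynomial.coeff_X_pow]

theorem qint_natDegree (m : ℕ) : (qint (m + 1)).natDegree = m := by
  apply Polynomial.natDegree_eq_of_le_of_coeff_ne_zero (qint_natDegree_le m)
  simp [qint_coeff]

theorem qint_monic (m : ℕ) : (qint (m + 1)).Monic := by
  rw [Polynomial.Monic, Polynomial.leadingCoeff, qint_natDegree, qint_coeff, if_pos (by omega)]

theorem prod_qint_reflect {ι : Type*} (s : Finset ι) (m : ι → ℕ) :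
    Polynomial.reflect (∑ i ∈ s, m i) (∏ i ∈ s, qint (m i + 1)) = ∏ i ∈ s, qint (m i + 1) := by
  classical
  induction s using Finset.induction_on with
  | empty => simp
  | insert a s ha ih =>
    rw [Finset.prod_insert ha, Finset.sum_insert ha, Polynomial.reflect_mul _ _
      (qint_natDegree_le _), ih, qint_reflect]
    refine (Polynomial.natDegree_prod_le _ _).trans (Finset.sum_le_sum fun i _ => ?_)
    exact qint_natDegree_le _

namespace Cartan
variable [Fintype B] [DecidableEq B] (C : Cartan cs) [Finite W]

theorem natDegree_poin (w : W) : (poin cs w).natDegree = cs.length w := by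
  apply Polynomial.natDegree_eq_of_le_of_coeff_ne_zero
  · rw [poin_eq]
    apply Polynomial.natDegree_sum_le_of_forall_le
    intro x hx
    rw [Polynomial.natDegree_X_pow]
    exact bruhat_length (mem_ivl.1 hx)
  · rw [coeff_poin]
    have : w ∈ (ivl cs w).filter fun x => cs.length x = cs.length w := by
      simp [mem_ivl, bruhat_refl]
    have := Finset.card_pos.2 ⟨_, this⟩
    omega

theorem ratSmooth_of_prod {w : W} {m : B → ℕ}
    (h : poin cs w = ∏ i, qint (m i + 1)) : RatSmooth cs w := by
  have hd : cs.length w = ∑ i, m i := by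
    rw [← natDegree_poin, h, Polynomial.natDegree_prod_of_monic _ _ fun i _ => qint_monic _]
    exact Finset.sum_congr rfl fun i _ => qint_natDegree _
  intro i hi
  have h1 := prod_qint_reflect Finset.univ m
  rw [← h, ← hd] at h1
  conv_lhs => rw [← h1]
  rw [Polynomial.coeff_reflect, Polynomial.revAt_le hi]

theorem dn_subset_edg {w x : W} (h : bruhatLE cs x w) : dn cs x ⊆ edg cs w x := by
  intro t ht
  rw [mem_dn] at ht
  exact mem_edg.2 ⟨ht.1, bruhat_trans (bruhat_of_refl' ht.1 ht.2) h⟩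

theorem sum_length_of_ratSmooth {w : W} (h : RatSmooth cs w) :
    2 * ∑ x ∈ ivl cs w, cs.length x = cs.length w * (ivl cs w).card := by
  set ℓ := cs.length w
  let a : ℕ → ℕ := fun n => ((ivl cs w).filter fun x => cs.length x = n).card
  have ha : ∀ i ≤ ℓ, a i = a (ℓ - i) := by
    intro i hi
    have := h i hi
    rw [coeff_poin, coeff_poin] at this
    exact_mod_cast this
  have hmem : ∀ x ∈ ivl cs w, cs.length x ∈ Finset.range (ℓ + 1) := fun x hx =>
    Finset.mem_range.2 (Nat.lt_succ_of_le (bruhat_length (mem_ivl.1 hx)))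
  have h1 : ∑ x ∈ ivl cs w, cs.length x = ∑ i ∈ Finset.range (ℓ + 1), a i * i := by
    rw [← Finset.sum_fiberwise_of_maps_to hmem]
    refine Finset.sum_congr rfl fun i _ => ?_
    rw [Finset.sum_congr rfl fun x hx => (Finset.mem_filter.1 hx).2, Finset.sum_const,
      smul_eq_mul]
  have h2 : (ivl cs w).card = ∑ i ∈ Finset.range (ℓ + 1), a i :=
    Finset.card_eq_sum_card_fiberwise hmem
  have h3 : ∑ i ∈ Finset.range (ℓ + 1), a i * i =
      ∑ i ∈ Finset.range (ℓ + 1), a i * (ℓ - i) := by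
    rw [← Finset.sum_range_reflect]
    refine Finset.sum_congr rfl fun i hi => ?_
    have hi := Finset.mem_range.1 hi
    rw [show ℓ + 1 - 1 - i = ℓ - i by omega, ← ha i (by omega)]
  rw [h1, h2, two_mul]
  conv_lhs => rw [h3]
  rw [← h3]
  nth_rewrite 2 [h3]
  rw [← Finset.sum_add_distrib, Finset.mul_sum]
  refine Finset.sum_congr rfl fun i hi => ?_
  have hi := Finset.mem_range.1 hi
  rw [← mul_add, mul_comm, show i + (ℓ - i) = ℓ by omega]

theorem sum_card_edg (C : Cartan cs) (w : W) :
    ∑ x ∈ ivl cs w, (edg cs w x).card = 2 * ∑ x ∈ ivl cs w, cs.length x := by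
  classical
  have h1 : ∀ x ∈ ivl cs w, (edg cs w x).card =
      (dn cs x).card + ((edg cs w x) ∩ up cs x).card := by
    intro x hx
    rw [← Finset.card_union_of_disjoint]
    · congr 1
      ext t
      have hs : t ∈ dn cs x → t ∈ edg cs w x := fun h => dn_subset_edg (mem_ivl.1 hx) h
      simp only [Finset.mem_union, Finset.mem_inter]
      constructor
      · intro h
        have ht := (mem_edg.1 h).1
        rcases lt_or_gt_of_ne (ht.length_mul_right_ne x) with h2 | h2
        · exact Or.inl (mem_dn.2 ⟨ht, h2⟩)
        · exact Or.inr ⟨h, mem_up.2 ⟨ht, h2⟩⟩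
      · rintro (h | h)
        · exact hs h
        · exact h.1
    · exact (up_disjoint_dn x).symm.mono_right Finset.inter_subset_right
  rw [Finset.sum_congr rfl h1, Finset.sum_add_distrib, two_mul]
  have h2 : ∑ x ∈ ivl cs w, (dn cs x).card = ∑ x ∈ ivl cs w, cs.length x :=
    Finset.sum_congr rfl fun x _ => C.card_dn x
  rw [h2]; congr 1
  rw [← h2, ← Finset.card_sigma, ← Finset.card_sigma]
  refine Finset.card_bij' (fun p _ => ⟨p.2 * p.1, p.2⟩) (fun p _ => ⟨p.2 * p.1, p.2⟩) ?_ ?_ ?_ ?_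
  · rintro ⟨x, t⟩ h
    simp only [Finset.mem_sigma, mem_ivl, Finset.mem_inter, mem_edg, mem_up, mem_dn] at h ⊢
    obtain ⟨h1, ⟨h2, h3⟩, -, h4⟩ := h
    refine ⟨h3, h2, ?_⟩
    rwa [← mul_assoc, h2.mul_self, one_mul]
  · rintro ⟨x, t⟩ h
    simp only [Finset.mem_sigma, mem_ivl, Finset.mem_inter, mem_edg, mem_up, mem_dn] at h ⊢
    obtain ⟨h1, h2, h3⟩ := h
    refine ⟨bruhat_trans (bruhat_of_refl' h2 h3) h1, ?_⟩
    rw [← mul_assoc, h2.mul_self, one_mul]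
    exact ⟨⟨h2, h1⟩, h2, h3⟩
  · rintro ⟨x, t⟩ h
    simp only [Finset.mem_sigma, mem_ivl, Finset.mem_inter, mem_edg] at h
    simp only [← mul_assoc, h.2.1.1.mul_self, one_mul]
  · rintro ⟨x, t⟩ h
    simp only [Finset.mem_sigma, mem_dn] at h
    simp only [← mul_assoc, h.2.1.mul_self, one_mul]

/-- The Carrell–Peterson criterion. -/
theorem regular_of_ratSmooth (C : Cartan cs) {w : W} (h : RatSmooth cs w) : Regular cs w := by
  have h1 := C.sum_card_edg w
  rw [sum_length_of_ratSmooth h] at h1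
  have h2 : ∑ x ∈ ivl cs w, cs.length w = ∑ x ∈ ivl cs w, (edg cs w x).card := by
    rw [h1, Finset.sum_const, smul_eq_mul, mul_comm]
  classical
  intro x hx
  exact ((Finset.sum_eq_sum_iff_of_le fun x hx => C.deodhar (mem_ivl.1 hx)).1 h2 x
    (mem_ivl.2 hx)).symm

end Cartan

section plane
variable [Fintype B]

/-- Scalar extension of a vector of the root lattice. -/
def vq (v : B → ℤ) : B → ℚ := fun i => v i

theorem mem_span_vq {a b v : B → ℤ} (h : vq v ∈ Submodule.span ℚ {vq a, vq b}) :
    ∃ c d e : ℤ, c ≠ 0 ∧ c • v = d • a + e • b := by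
  obtain ⟨x, y, h⟩ := Submodule.mem_span_pair.1 h
  refine ⟨x.den * y.den, x.num * y.den, y.num * x.den, by simp, ?_⟩
  ext i
  have h1 := congrFun h i
  simp only [Pi.add_apply, Pi.smul_apply, smul_eq_mul, vq] at h1 ⊢
  have hx := Rat.mul_den_eq_num x
  have hy := Rat.mul_den_eq_num y
  have : ((x.den * y.den * v i : ℤ) : ℚ) = ((x.num * y.den * a i + y.num * x.den * b i : ℤ)) := by
    push_cast
    rw [← h1, ← hx, ← hy]; ring
  exact_mod_cast this

theorem eval_lin_dual [DecidableEq B] (f : Module.Dual ℚ (B → ℚ)) (v : B → ℤ) :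
    ∑ i, (v i : ℚ) * f (Pi.single i 1) = f (vq v) := by
  have : vq v = ∑ i, (v i : ℚ) • (Pi.single i (1 : ℚ) : B → ℚ) := by
    ext j; simp [vq, Finset.sum_apply, Pi.single_apply]
  rw [this, map_sum]
  simp

theorem X_pow_mul_unique {a b : ℕ} {p q : Polynomial ℚ} (hp : p.eval 0 ≠ 0) (hq : q.eval 0 ≠ 0)
    (h : Polynomial.X ^ a * p = Polynomial.X ^ b * q) : a = b := by
  have key : ∀ {a b : ℕ} {p q : Polynomial ℚ}, p.eval 0 ≠ 0 →
      Polynomial.X ^ a * p = Polynomial.X ^ b * q → ¬ a < b := by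
    intro a b p q hp h hab
    obtain ⟨c, rfl⟩ := Nat.exists_eq_add_of_lt hab
    rw [show a + c + 1 = a + (c + 1) by ring, pow_add, mul_assoc] at h
    have := mul_left_cancel₀ (pow_ne_zero a Polynomial.X_ne_zero) h
    apply hp; rw [this]; simp
  have h1 := key hp h
  have h2 := key hq h.symm
  omega

end plane

namespace Cartan
variable [Fintype B] [DecidableEq B] (C : Cartan cs) [Finite W]

/-- The root of `r` lies in the plane spanned by the roots of `t` and `s`. -/
def Pl (t s r : W) : Prop :=
  cs.IsReflection r ∧ ∃ c d e : ℤ, c ≠ 0 ∧ c • C.rt r = d • C.rt t + e • C.rt s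

open Classical in
theorem plane_count {w x t s : W} (hw : Regular cs w) (hx : bruhatLE cs x w)
    (ht : cs.IsReflection t) (htx : bruhatLE cs (t * x) w) (hs : cs.IsReflection s) (hts : s ≠ t) :
    ((edg cs w x).filter (C.Pl t s)).card = ((edg cs w (t * x)).filter (C.Pl t s)).card := by
  -- two functionals separating the plane
  obtain ⟨f, hf1, hf2⟩ := Submodule.exists_le_ker_of_notMem
    (p := Submodule.span ℚ {vq (C.rt t)}) (v := vq (C.rt s)) (by
      intro h
      have : vq (C.rt s) ∈ Submodule.span ℚ {vq (C.rt t), vq (0 : B → ℤ)} :=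
        Submodule.span_mono (by simp) h
      obtain ⟨c, d, e, hc, h⟩ := mem_span_vq this
      rw [smul_zero, add_zero] at h
      exact hts (C.refl_ext' hs ht hc h))
  let P := Submodule.span ℚ {vq (C.rt t), vq (C.rt s)}
  obtain ⟨g, hg1, hg2⟩ := Module.Dual.exists_forall_mem_ne_zero_of_forall_exists
    (ι := {r : W // cs.IsReflection r ∧ ¬ C.Pl t s r}) P.dualAnnihilator
    (fun r => Module.Dual.eval ℚ _ (vq (C.rt r.1))) (by
      rintro ⟨r, hr, hr'⟩
      have : vq (C.rt r) ∉ P := fun h => hr' ⟨hr, mem_span_vq h⟩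
      obtain ⟨f, hf1, hf2⟩ := Submodule.exists_le_ker_of_notMem this
      exact ⟨f, (Submodule.mem_dualAnnihilator f).2 fun v hv => hf2 hv, hf1⟩)
  rw [Submodule.mem_dualAnnihilator] at hg1
  have hft : f (vq (C.rt t)) = 0 := hf2 (Submodule.mem_span_singleton_self _)
  have hgt : g (vq (C.rt t)) = 0 := hg1 _ (Submodule.subset_span (by simp))
  have hgs : g (vq (C.rt s)) = 0 := hg1 _ (Submodule.subset_span (by simp))
  let φ : MvPolynomial B ℚ →ₐ[ℚ] Polynomial ℚ := MvPolynomial.aeval fun i =>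
    Polynomial.C (g (Pi.single i 1)) + Polynomial.C (f (Pi.single i 1)) * Polynomial.X
  have hφ : ∀ v, φ (lin v) = Polynomial.C (g (vq v)) + Polynomial.C (f (vq v)) * Polynomial.X := by
    intro v
    rw [← eval_lin_dual, ← eval_lin_dual]
    simp only [lin, map_sum, map_smul, φ, MvPolynomial.aeval_X, Finset.sum_mul, map_mul,
      ← Finset.sum_add_distrib]
    refine Finset.sum_congr rfl fun i _ => ?_
    rw [Polynomial.smul_eq_C_mul]; ring
  have hlin : ∀ r, r ≠ t → C.Pl t s r → g (vq (C.rt r)) = 0 ∧ f (vq (C.rt r)) ≠ 0 := by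
    rintro r hrt ⟨hr, c, d, e, hc, h⟩
    have hv : (c : ℚ) • vq (C.rt r) = (d : ℚ) • vq (C.rt t) + (e : ℚ) • vq (C.rt s) := by
      ext i
      have := congrFun h i
      simp only [Pi.add_apply, Pi.smul_apply, smul_eq_mul, vq] at this ⊢
      exact_mod_cast this
    have h1 := congrArg g hv
    have h2 := congrArg f hv
    simp only [map_add, map_smul, hgt, hgs, hft, smul_eq_mul, mul_zero, add_zero, zero_add,
      mul_eq_zero, Int.cast_eq_zero, hc, false_or] at h1 h2
    refine ⟨h1, fun h0 => ?_⟩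
    rw [h0, mul_zero, eq_comm, mul_eq_zero, or_iff_left hf1, Int.cast_eq_zero] at h2
    rw [h2, zero_smul, add_zero] at h
    exact hrt (C.refl_ext' hr ht hc h)
  have key : ∀ y, bruhatLE cs y w → t ∈ edg cs w y → ∃ q : Polynomial ℚ, q.eval 0 ≠ 0 ∧
      φ (C.schub w y) = Polynomial.X ^ ((refls cs \ edg cs w y).filter (C.Pl t s)).card * q := by
    intro y hy hty
    obtain ⟨k, hk, hk'⟩ := C.schub_of_regular hw hy
    rw [hk', map_mul, map_prod, ← Finset.prod_filter_mul_prod_filter_not _ (C.Pl t s)]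
    have h1 : ∏ r ∈ (refls cs \ edg cs w y).filter (C.Pl t s), φ (C.rl r) =
        Polynomial.X ^ ((refls cs \ edg cs w y).filter (C.Pl t s)).card *
        ∏ r ∈ (refls cs \ edg cs w y).filter (C.Pl t s), Polynomial.C (f (vq (C.rt r))) := by
      rw [← Finset.prod_const, ← Finset.prod_mul_distrib]
      refine Finset.prod_congr rfl fun r hr => ?_
      simp only [Finset.mem_filter, Finset.mem_sdiff] at hr
      rw [rl, hφ, (hlin r (by rintro rfl; exact hr.1.2 hty) hr.2).1]
      rw [map_zero, zero_add, mul_comm]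
    rw [h1]
    refine ⟨Polynomial.C k * (∏ r ∈ (refls cs \ edg cs w y).filter (C.Pl t s),
      Polynomial.C (f (vq (C.rt r)))) *
      ∏ r ∈ (refls cs \ edg cs w y).filter (fun r => ¬ C.Pl t s r), φ (C.rl r), ?_, ?_⟩
    · simp only [Polynomial.eval_mul, Polynomial.eval_C, Polynomial.eval_prod]
      refine mul_ne_zero (mul_ne_zero hk ?_) ?_
      · refine Finset.prod_ne_zero_iff.2 fun r hr => ?_
        simp only [Finset.mem_filter, Finset.mem_sdiff] at hr
        exact (hlin r (by rintro rfl; exact hr.1.2 hty) hr.2).2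
      · refine Finset.prod_ne_zero_iff.2 fun r hr => ?_
        simp only [Finset.mem_filter, Finset.mem_sdiff, mem_refls] at hr
        rw [rl, hφ]
        simpa using hg2 ⟨r, hr.1.1, hr.2⟩
    · have : φ (MvPolynomial.C k) = Polynomial.C k := by
        simp [φ, MvPolynomial.aeval_C]
      rw [this]; ring
  obtain ⟨q1, hq1, h1⟩ := key x hx (mem_edg.2 ⟨ht, htx⟩)
  obtain ⟨q2, hq2, h2⟩ := key (t * x) htx
    (mem_edg.2 ⟨ht, by rwa [← mul_assoc, ht.mul_self, one_mul]⟩)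
  obtain ⟨d, hd⟩ := (C.isSchub_schub w).gkm t ht x
  have h3 := congrArg φ hd
  rw [map_sub, map_mul, rl, hφ, hft, hgt, map_zero, zero_mul, add_zero, zero_mul, h1, h2,
    sub_eq_zero] at h3
  have h4 := X_pow_mul_unique hq1 hq2 h3
  have h5 : ∀ y, ((refls cs \ edg cs w y).filter (C.Pl t s)).card +
      ((edg cs w y).filter (C.Pl t s)).card = ((refls cs).filter (C.Pl t s)).card := by
    intro y
    rw [← Finset.card_union_of_disjoint, ← Finset.filter_union, Finset.sdiff_union_of_subset]
    · intro r hr; exact mem_refls.2 (mem_edg.1 hr).1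
    · exact Finset.disjoint_filter_filter Finset.sdiff_disjoint
  have h6 := h5 x
  have h7 := h5 (t * x)
  omega

end Cartan

theorem mem_WJ {J : Set B} {w : W} :
    w ∈ WJc cs J ↔ ∃ ω : List B, (∀ i ∈ ω, i ∈ J) ∧ cs.wordProd ω = w := by
  constructor
  · intro h
    induction h using Subgroup.closure_induction with
    | mem x hx =>
      obtain ⟨i, hi, rfl⟩ := hx
      exact ⟨[i], by simpa using hi, by simp⟩
    | one => exact ⟨[], by simp, by simp⟩
    | mul x y _ _ hx hy =>
      obtain ⟨a, ha, rfl⟩ := hx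
      obtain ⟨b, hb, rfl⟩ := hy
      refine ⟨a ++ b, fun i hi => ?_, cs.wordProd_append a b⟩
      exact (List.mem_append.1 hi).elim (ha i) (hb i)
    | inv x _ hx =>
      obtain ⟨a, ha, rfl⟩ := hx
      exact ⟨a.reverse, by simpa using ha, cs.wordProd_reverse a⟩
  · rintro ⟨ω, h, rfl⟩
    induction ω with
    | nil => simp
    | cons i ω ih =>
      rw [wordProd_cons]
      refine Subgroup.mul_mem _ (Subgroup.subset_closure ⟨i, h i (by simp), rfl⟩) (ih ?_)
      exact fun j hj => h j (List.mem_cons_of_mem _ hj)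

theorem simple_mem_WJ {J : Set B} {i : B} (h : i ∈ J) : cs.simple i ∈ WJc cs J :=
  Subgroup.subset_closure ⟨i, h, rfl⟩

/-- The vector `v` is supported in `J`. -/
def InJ (J : Set B) (v : B → ℤ) : Prop := ∀ k, k ∉ J → v k = 0

section InJ
variable {J : Set B} {u v : B → ℤ}
theorem InJ.add (hu : InJ J u) (hv : InJ J v) : InJ J (u + v) := fun k hk => by
  simp [hu k hk, hv k hk]
theorem InJ.sub (hu : InJ J u) (hv : InJ J v) : InJ J (u - v) := fun k hk => by
  simp [hu k hk, hv k hk]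
theorem InJ.neg (hu : InJ J u) : InJ J (-u) := fun k hk => by simp [hu k hk]
theorem InJ.smul (hu : InJ J u) (c : ℤ) : InJ J (c • u) := fun k hk => by simp [hu k hk]
end InJ

namespace Cartan
variable [Fintype B] [DecidableEq B] (C : Cartan cs) [Finite W]
variable {J : Set B}

theorem inJ_al {i : B} (h : i ∈ J) : InJ J (al i) := fun k hk => by
  simp only [al, Pi.single_apply]; exact if_neg (by rintro rfl; exact hk h)

theorem bruhat_mem_WJ (C : Cartan cs) {x w : W} (h : bruhatLE cs x w) (hw : w ∈ WJc cs J) :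
    x ∈ WJc cs J := by
  obtain ⟨ω, hω, rfl⟩ := mem_WJ.1 hw
  obtain ⟨ω', hs, rfl⟩ := C.bruhat_wordProd ω x h
  exact mem_WJ.2 ⟨ω', fun i hi => hω i (hs.subset hi), rfl⟩

theorem inJ_act_sub {x : W} (hx : x ∈ WJc cs J) (v : B → ℤ) : InJ J (C.act x v - v) := by
  obtain ⟨ω, hω, rfl⟩ := mem_WJ.1 hx
  clear hx
  induction ω with
  | nil => intro k _; simp
  | cons i ω ih =>
    have h1 := ih fun j hj => hω j (List.mem_cons_of_mem _ hj)
    have hi : i ∈ J := hω i (by simp)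
    rw [wordProd_cons, act_mul, act_simple]
    have : C.act (cs.wordProd ω) v - C.pair i (C.act (cs.wordProd ω) v) • al i - v =
      (C.act (cs.wordProd ω) v - v) - C.pair i (C.act (cs.wordProd ω) v) • al i := by module
    rw [this]
    exact h1.sub ((inJ_al hi).smul _)

theorem inJ_act {x : W} (hx : x ∈ WJc cs J) {v : B → ℤ} (hv : InJ J v) : InJ J (C.act x v) := by
  have := (C.inJ_act_sub hx v).add hv
  rwa [sub_add_cancel] at this

theorem inJ_rt {t : W} (ht : cs.IsReflection t) (h : t ∈ WJc cs J) : InJ J (C.rt t) := by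
  have h1 := C.inJ_act_sub h (C.rt t)
  rw [act_rt C ht] at h1
  intro k hk
  have := h1 k hk
  simp only [Pi.sub_apply, Pi.neg_apply] at this
  omega

theorem exists_pair_pos {v : B → ℤ} (h : 0 ≤ v) (h0 : v ≠ 0) :
    ∃ i, 0 < v i ∧ 0 < C.pair i v := by
  by_contra! hc
  have h1 := C.form_self_pos h0
  have h2 : v = ∑ i, v i • al i := by
    ext j; simp [al, Finset.sum_apply, Pi.single_apply]
  have h3 : C.form v v ≤ 0 := by
    conv_lhs => arg 3; rw [h2]
    rw [form_sum]
    apply Finset.sum_nonpos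
    intro i _
    rw [form_smul, form_comm]
    rcases (show 0 ≤ v i from h i).eq_or_lt with h4 | h4
    · rw [← h4, zero_mul]
    · have h5 := C.form_al i v
      have h6 := C.form_self_pos (al_ne_zero i)
      have h7 := hc i h4
      have : C.form (al i) v ≤ 0 := by nlinarith
      nlinarith
  omega

/-- The height of a vector. -/
def _root_.Paper.hgt (v : B → ℤ) : ℤ := ∑ i, v i

theorem hgt_nonneg {v : B → ℤ} (h : 0 ≤ v) : 0 ≤ hgt v := Finset.sum_nonneg fun i _ => h i

theorem hgt_sub (u v : B → ℤ) : hgt (u - v) = hgt u - hgt v := by simp [hgt]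
theorem hgt_add (u v : B → ℤ) : hgt (u + v) = hgt u + hgt v := by
  simp [hgt, Finset.sum_add_distrib]
theorem hgt_smul (c : ℤ) (v : B → ℤ) : hgt (c • v) = c * hgt v := by
  simp [hgt, Finset.mul_sum]
theorem hgt_al (i : B) : hgt (al i) = 1 := by simp [hgt, al]

theorem hgt_pos {v : B → ℤ} (h : 0 ≤ v) (h0 : v ≠ 0) : 0 < hgt v := by
  obtain ⟨k, hk⟩ := Function.ne_iff.1 h0
  exact Finset.sum_pos' (fun i _ => h i)
    ⟨k, Finset.mem_univ _, lt_of_le_of_ne (h k) (Ne.symm hk)⟩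

/-- Induction on positive roots by simple reflections. -/
theorem root_induction (C : Cartan cs) {P : (B → ℤ) → Prop} (h1 : ∀ i, P (al i))
    (h2 : ∀ v i, C.IsRoot v → 0 ≤ v → 0 ≤ C.act (cs.simple i) v → 0 < C.pair i v → v ≠ al i →
      0 < v i → P (C.act (cs.simple i) v) → P v) {v : B → ℤ} (hv : C.IsRoot v) (h0 : 0 ≤ v) :
    P v := by
  induction hn : (hgt v).toNat using Nat.strong_induction_on generalizing v with
  | _ n ih =>
  obtain ⟨i, hi1, hi2⟩ := C.exists_pair_pos h0 hv.ne_zero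
  by_cases hvi : v = al i
  · rw [hvi]; exact h1 i
  have h3 := hv.act_simple_nonneg h0 hvi
  refine h2 v i hv h0 h3 hi2 hvi hi1 (ih _ ?_ (hv.act _) h3 rfl)
  have h4 := hgt_pos h3 (hv.act (cs.simple i)).ne_zero
  have h5 : hgt (C.act (cs.simple i) v) = hgt v - C.pair i v := by
    rw [act_simple, hgt_sub, hgt_smul, hgt_al, mul_one]
  omega

theorem exists_WJ_of_isRoot {v : B → ℤ} (hv : C.IsRoot v) (h0 : 0 ≤ v) (hJ : InJ J v) :
    ∃ x ∈ WJc cs J, ∃ i ∈ J, v = C.act x (al i) := by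
  revert hJ
  refine C.root_induction (P := fun v => InJ J v → ∃ x ∈ WJc cs J, ∃ i ∈ J, v = C.act x (al i)) ?_ ?_ hv h0
  · intro i hi
    refine ⟨1, Subgroup.one_mem _, i, ?_, by simp⟩
    by_contra hc
    have := hi i hc
    simp [al] at this
  · intro v i _ _ _ _ _ hvi ih hJ
    have hi : i ∈ J := by
      by_contra hc
      have := hJ i hc; omega
    have hs := simple_mem_WJ (cs := cs) hi
    obtain ⟨x, hx, j, hj, h⟩ := ih (C.inJ_act hs hJ)
    refine ⟨cs.simple i * x, Subgroup.mul_mem _ hs hx, j, hj, ?_⟩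
    rw [act_mul, ← h, ← act_mul, simple_mul_simple_self, act_one]

theorem exists_WJ_of_refl {t : W} (ht : cs.IsReflection t) (hJ : InJ J (C.rt t)) :
    ∃ x ∈ WJc cs J, ∃ i ∈ J, C.rt t = C.act x (al i) ∧ t = x * cs.simple i * x⁻¹ := by
  obtain ⟨x, hx, i, hi, h⟩ := C.exists_WJ_of_isRoot (C.isRoot_rt ht) (C.rt_nonneg ht) hJ
  refine ⟨x, hx, i, hi, h, ?_⟩
  apply C.refl_ext ht ⟨x, i, rfl⟩
  rcases C.rt_eq x i rfl with h1 | h1 <;> rw [h1, h]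
  · exact Or.inl rfl
  · rw [neg_neg]; exact Or.inr rfl

theorem mem_WJ_of_inJ {t : W} (ht : cs.IsReflection t) (hJ : InJ J (C.rt t)) :
    t ∈ WJc cs J := by
  obtain ⟨x, hx, i, hi, -, rfl⟩ := C.exists_WJ_of_refl ht hJ
  exact Subgroup.mul_mem _ (Subgroup.mul_mem _ hx (simple_mem_WJ hi)) (Subgroup.inv_mem _ hx)

theorem refl_mem_WJ_iff {t : W} (ht : cs.IsReflection t) :
    t ∈ WJc cs J ↔ InJ J (C.rt t) := ⟨C.inJ_rt ht, C.mem_WJ_of_inJ ht⟩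

theorem cor_mul_cor_lt {t s : W} (ht : cs.IsReflection t) (hs : cs.IsReflection s) (h : s ≠ t) :
    C.cor t (C.rt s) * C.cor s (C.rt t) < 4 := by
  have h1 := C.cor_form ht (C.rt s)
  have h2 := C.cor_form hs (C.rt t)
  set a := C.cor t (C.rt s)
  set b := C.cor s (C.rt t)
  have h3 := C.form_self_pos (v := (2 : ℤ) • C.rt s - a • C.rt t) (by
    intro h0
    exact h (C.refl_ext' hs ht two_ne_zero (sub_eq_zero.1 h0)))
  have h4 := C.form_self_pos (C.rt_ne_zero hs)
  rw [form_sub, form_smul, form_smul, form_comm, form_sub, form_smul, form_smul,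
    C.form_comm (_ - _) (C.rt t), form_sub, form_smul, form_smul,
    C.form_comm (C.rt s) (C.rt t)] at h3
  rw [C.form_comm (C.rt s) (C.rt t)] at h2
  have h5 : 0 < (4 - a * b) * C.form (C.rt s) (C.rt s) := by linear_combination h3 + a * h1 + a * h2
  have := (pos_iff_pos_of_mul_pos h5).2 h4
  omega

end Cartan

namespace Cartan
variable [Fintype B] [DecidableEq B] (C : Cartan cs) [Finite W]
variable {J : Set B}

/-- The Cartan matrix is symmetric on `J`. -/
def SL (J : Set B) : Prop := ∀ i ∈ J, ∀ j ∈ J, C.A i j = C.A j i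

/-- The form given by the Cartan matrix. -/
def bil (u v : B → ℤ) : ℤ := ∑ i, u i * C.pair i v

theorem bil_al (i : B) (v : B → ℤ) : C.bil (al i) v = C.pair i v := by
  simp [bil, al, Pi.single_apply]

theorem bil_add (u v v' : B → ℤ) : C.bil u (v + v') = C.bil u v + C.bil u v' := by
  simp [bil, mul_add, Finset.sum_add_distrib]
theorem bil_sub (u v v' : B → ℤ) : C.bil u (v - v') = C.bil u v - C.bil u v' := by
  simp [bil, mul_sub, Finset.sum_sub_distrib]
theorem bil_smul (u : B → ℤ) (c : ℤ) (v : B → ℤ) : C.bil u (c • v) = c * C.bil u v := by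
  simp only [bil, map_smul, smul_eq_mul, Finset.mul_sum]
  exact Finset.sum_congr rfl fun i _ => by ring

variable {C}

theorem bil_comm (h : C.SL J) {u v : B → ℤ} (hu : InJ J u) (hv : InJ J v) :
    C.bil u v = C.bil v u := by
  simp only [bil, pair_apply, Finset.mul_sum]
  rw [Finset.sum_comm]
  refine Finset.sum_congr rfl fun i _ => Finset.sum_congr rfl fun j _ => ?_
  by_cases hi : i ∈ J
  · by_cases hj : j ∈ J
    · rw [h i hi j hj]; ring
    · rw [hu j hj]; ring
  · rw [hv i hi]; ring

theorem bil_act_simple (h : C.SL J) {u v : B → ℤ} (hu : InJ J u) (hv : InJ J v) {i : B}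
    (hi : i ∈ J) : C.bil (C.act (cs.simple i) u) (C.act (cs.simple i) v) = C.bil u v := by
  have h1 : InJ J (C.act (cs.simple i) u) := C.inJ_act (simple_mem_WJ hi) hu
  rw [act_simple _ i v, bil_sub, bil_smul, bil_comm h h1 hv, bil_comm h h1 (inJ_al hi),
    act_simple, bil_sub, bil_sub, bil_smul, bil_smul, bil_al, bil_al, bil_comm h hv (inJ_al hi),
    bil_al, pair_al, C.diag, bil_comm h hv hu]
  ring

theorem bil_act (h : C.SL J) {u v : B → ℤ} (hu : InJ J u) (hv : InJ J v) {x : W}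
    (hx : x ∈ WJc cs J) : C.bil (C.act x u) (C.act x v) = C.bil u v := by
  obtain ⟨ω, hω, rfl⟩ := mem_WJ.1 hx
  clear hx
  induction ω with
  | nil => simp
  | cons i ω ih =>
    have hω' : ∀ j ∈ ω, j ∈ J := fun j hj => hω j (List.mem_cons_of_mem _ hj)
    have h1 : cs.wordProd ω ∈ WJc cs J := mem_WJ.2 ⟨ω, hω', rfl⟩
    rw [wordProd_cons, act_mul, act_mul,
      bil_act_simple h (C.inJ_act h1 hu) (C.inJ_act h1 hv) (hω i (by simp)), ih hω']

theorem cor_eq_bil (h : C.SL J) {t : W} (ht : cs.IsReflection t) (htJ : t ∈ WJc cs J)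
    {v : B → ℤ} (hv : InJ J v) : C.cor t v = C.bil (C.rt t) v := by
  obtain ⟨x, hx, i, hi, h1, h2⟩ := C.exists_WJ_of_refl ht (C.inJ_rt ht htJ)
  have h3 := C.act_refl ht v
  have h5 := C.act_conj x i v
  rw [← h2, ← h1, h3, sub_right_inj] at h5
  have h4 := smul_left_injective ℤ (C.rt_ne_zero ht) h5
  rw [h4, h1, ← C.bil_al, ← bil_act h (inJ_al hi) (C.inJ_act (Subgroup.inv_mem _ hx) hv) hx,
    act_act_inv]

variable {t s r : W}

theorem bil_rt_self (h : C.SL J) (ht : cs.IsReflection t) (htJ : t ∈ WJc cs J) :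
    C.bil (C.rt t) (C.rt t) = 2 := by
  rw [← cor_eq_bil h ht htJ (C.inJ_rt ht htJ), cor_rt C ht]

theorem bil_rt_rt (h : C.SL J) (ht : cs.IsReflection t) (htJ : t ∈ WJc cs J)
    (hs : cs.IsReflection s) (hsJ : s ∈ WJc cs J) (hne : s ≠ t) :
    C.bil (C.rt t) (C.rt s) = 0 ∨ C.bil (C.rt t) (C.rt s) = 1 ∨
      C.bil (C.rt t) (C.rt s) = -1 := by
  have h1 := C.cor_mul_cor_lt ht hs hne
  rw [cor_eq_bil h ht htJ (C.inJ_rt hs hsJ), cor_eq_bil h hs hsJ (C.inJ_rt ht htJ),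
    bil_comm h (C.inJ_rt hs hsJ) (C.inJ_rt ht htJ)] at h1
  have h2 : C.bil (C.rt t) (C.rt s) < 2 := by nlinarith
  have h3 : -2 < C.bil (C.rt t) (C.rt s) := by nlinarith
  omega

theorem rt_conj_refl (C : Cartan cs) (ht : cs.IsReflection t) (hs : cs.IsReflection s) :
    C.rt (t * s * t) = C.act t (C.rt s) ∨ C.rt (t * s * t) = -C.act t (C.rt s) := by
  have := C.rt_conj hs t
  rwa [ht.inv] at this

theorem isReflection_conj_refl (ht : cs.IsReflection t) (hs : cs.IsReflection s) :
    cs.IsReflection (t * s * t) := by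
  have := hs.conj t; rwa [ht.inv] at this

/-- In the simply laced case, the planes through a root are the orbits of its reflection. -/
theorem Pl.eq (h : C.SL J) (ht : cs.IsReflection t) (htJ : t ∈ WJc cs J)
    (hs : cs.IsReflection s) (hsJ : s ∈ WJc cs J) (hst : s ≠ t) (hrJ : r ∈ WJc cs J)
    (hp : C.Pl t s r) : r = t ∨ r = s ∨ r = t * s * t := by
  obtain ⟨hr, c, d, e, hc, hp⟩ := hp
  by_contra! hne
  have htst := isReflection_conj_refl ht hs
  have htstJ : t * s * t ∈ WJc cs J := Subgroup.mul_mem _ (Subgroup.mul_mem _ htJ hsJ) htJ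
  have it := C.inJ_rt ht htJ
  have is := C.inJ_rt hs hsJ
  have ir := C.inJ_rt hr hrJ
  have e1 := congrArg (C.bil (C.rt t)) hp
  have e2 := congrArg (C.bil (C.rt s)) hp
  have e3 := congrArg (C.bil (C.rt r)) hp
  have h4 := bil_rt_rt h hr hrJ htst htstJ hne.2.2.symm
  have h5 : C.bil (C.rt r) (C.act t (C.rt s)) = 0 ∨ C.bil (C.rt r) (C.act t (C.rt s)) = 1 ∨
      C.bil (C.rt r) (C.act t (C.rt s)) = -1 := by
    rcases rt_conj_refl C ht hs with h6 | h6
    · rwa [h6] at h4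
    · rw [h6, show -C.act t (C.rt s) = (-1 : ℤ) • C.act t (C.rt s) by simp, bil_smul] at h4
      omega
  rw [act_refl C ht, cor_eq_bil h ht htJ is, bil_sub, bil_smul, bil_comm h ir is,
    bil_comm h ir it] at h5
  rw [bil_smul, bil_add, bil_smul, bil_smul] at e1 e2 e3
  rw [bil_comm h is it, bil_rt_self h hs hsJ] at e2
  rw [bil_rt_self h hr hrJ, bil_comm h ir is, bil_comm h ir it] at e3
  rw [bil_rt_self h ht htJ] at e1
  have h1 := bil_rt_rt h ht htJ hs hsJ hst
  have h2 := bil_rt_rt h ht htJ hr hrJ hne.1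
  have h3 := bil_rt_rt h hs hsJ hr hrJ hne.2.1
  rcases h1 with h1 | h1 | h1 <;> rcases h2 with h2 | h2 | h2 <;> rcases h3 with h3 | h3 | h3 <;>
    simp only [h1, h2, h3] at e1 e2 e3 h5 <;> omega

open Classical in
/-- The signed root of an edge `t` at the vertex `x`. -/
def lab (C : Cartan cs) (x t : W) : B → ℤ :=
  if 0 ≤ C.act x⁻¹ (C.rt t) then C.rt t else -C.rt t

theorem lab_up {x : W} (ht : cs.IsReflection t) (h : cs.length x < cs.length (t * x)) :
    C.lab x t = C.rt t := if_pos ((C.up_iff ht x).1 h)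

theorem lab_down {x : W} (ht : cs.IsReflection t) (h : cs.length (t * x) < cs.length x) :
    C.lab x t = -C.rt t := if_neg fun h1 => by
  have := (C.up_iff ht x).2 h1; omega

theorem act_lab_nonneg (x : W) (ht : cs.IsReflection t) : 0 ≤ C.act x⁻¹ (C.lab x t) := by
  rw [lab]
  split_ifs with h
  · exact h
  · rw [act_neg, neg_nonneg]
    exact (((C.isRoot_rt ht).act _).not_nonneg_iff).1 h

theorem eq_lab {x : W} {v : B → ℤ} (ht : cs.IsReflection t)
    (hv : C.rt t = v ∨ C.rt t = -v) (h : 0 ≤ C.act x⁻¹ v) : v = C.lab x t := by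
  rcases hv with hv | hv
  · rw [lab, hv, if_pos h]
  · rw [lab, hv, if_neg, neg_neg]
    rw [act_neg, neg_nonneg]
    intro h1
    have h2 := C.act_ne_zero x⁻¹ (neg_ne_zero.1 (hv ▸ C.rt_ne_zero ht))
    exact h2 (le_antisymm h1 h)

theorem lab_eq_or (x t : W) : C.lab x t = C.rt t ∨ C.lab x t = -C.rt t := by
  rw [lab]; split_ifs
  · exact Or.inl rfl
  · exact Or.inr rfl

theorem lab_conj {x : W} (ht : cs.IsReflection t) (hs : cs.IsReflection s) :
    C.lab (t * x) (t * s * t) = C.act t (C.lab x s) := by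
  symm
  apply eq_lab (isReflection_conj_refl ht hs)
  · rcases C.lab_eq_or x s with h | h <;> rw [h]
    · exact rt_conj_refl C ht hs
    · rw [act_neg, neg_neg]; exact (rt_conj_refl C ht hs).symm
  · rw [mul_inv_rev, ht.inv, ← act_mul, mul_assoc, ht.mul_self, mul_one]
    exact act_lab_nonneg x hs

open Classical in
theorem connection_of_SL (h : C.SL J) {K : Type*} [CommMonoid K] {w x : W} (hw : Regular cs w)
    (hwJ : w ∈ WJc cs J)
    (hx : bruhatLE cs x w) (ht : t ∈ edg cs w x) (g : (B → ℤ) → K)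
    (hg : ∀ (v : B → ℤ) (c : ℤ), g (v + c • C.rt t) = g v) :
    ∏ r ∈ (edg cs w x).erase t, g (C.lab x r) =
      ∏ r ∈ (edg cs w (t * x)).erase t, g (C.lab (t * x) r) := by
  obtain ⟨htr, htx⟩ := mem_edg.1 ht
  have tt : t * t = 1 := htr.mul_self
  have hxJ := C.bruhat_mem_WJ hx hwJ
  have mem1 : ∀ y, bruhatLE cs y w → ∀ r ∈ edg cs w y, r ∈ WJc cs J := by
    intro y hy r hr
    have := Subgroup.mul_mem _ (C.bruhat_mem_WJ (mem_edg.1 hr).2 hwJ)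
      (Subgroup.inv_mem _ (C.bruhat_mem_WJ hy hwJ))
    simpa using this
  have htJ := mem1 x hx t ht
  have cc : ∀ r, t * (t * r * t) * t = r := fun r => by
    rw [show t * (t * r * t) * t = (t * t) * r * (t * t) by group, tt, one_mul, mul_one]
  have hgt : ∀ v, g (C.act t v) = g v := fun v => by
    rw [act_refl C htr, sub_eq_add_neg, ← neg_smul, hg]
  set E := (edg cs w x).erase t with hE
  set E' := (edg cs w (t * x)).erase t with hE'
  set S := E'.image fun r => t * r * t with hS
  have inj : ∀ r r', t * r * t = t * r' * t → r = r' := fun r r' h => by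
    rw [← cc r, h, cc]
  have memS : ∀ r, r ∈ S ↔ t * r * t ∈ E' := by
    intro r
    rw [hS, Finset.mem_image]
    constructor
    · rintro ⟨r', h1, rfl⟩; rwa [cc]
    · intro h1; exact ⟨_, h1, cc r⟩
  have hR : ∏ r ∈ E', g (C.lab (t * x) r) = ∏ r ∈ S, g (C.lab x r) := by
    rw [hS, Finset.prod_image (fun a _ b _ => inj a b)]
    refine Finset.prod_congr rfl fun r hr => ?_
    have hr := (mem_edg.1 (Finset.mem_of_mem_erase hr)).1
    have h1 := lab_conj (C := C) (x := x) htr (isReflection_conj_refl htr hr)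
    rw [cc] at h1
    rw [h1, hgt]
  rw [hR]
  have htne : ∀ r, r ≠ t → t * r * t ≠ t := fun r hr h1 => hr (inj _ _ (by
    rw [h1, tt, one_mul]))
  -- counting in the plane of `t` and `r`
  have count : ∀ r, cs.IsReflection r → r ∈ WJc cs J → r ≠ t → t * r * t ≠ r →
      ((if r ∈ E then 1 else 0) + if t * r * t ∈ E then 1 else 0 : ℕ) =
      (if r ∈ E' then 1 else 0) + if t * r * t ∈ E' then 1 else 0 := by
    intro r hr hrJ hrt hne
    have hc := C.plane_count hw hx htr htx hr hrt
    have key : ∀ y, bruhatLE cs y w → t ∈ edg cs w y → ((edg cs w y).filter (C.Pl t r)).card =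
        (((if r ∈ (edg cs w y).erase t then 1 else 0) +
          if t * r * t ∈ (edg cs w y).erase t then 1 else 0 : ℕ)) + 1 := by
      intro y hy hty
      have : (edg cs w y).filter (C.Pl t r) =
          insert t ((({r, t * r * t} : Finset W)).filter fun s => s ∈ (edg cs w y).erase t) := by
        ext s
        simp only [Finset.mem_filter, Finset.mem_insert, Finset.mem_singleton, Finset.mem_erase]
        constructor
        · rintro ⟨h1, h2⟩
          have := Pl.eq h htr htJ hr hrJ hrt (mem1 y hy s h1) h2
          tauto
        · rintro (rfl | ⟨h1, h2, h3⟩)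
          · exact ⟨hty, htr, 1, 1, 0, one_ne_zero, by simp⟩
          · refine ⟨h3, ?_⟩
            rcases h1 with rfl | rfl
            · exact ⟨hr, 1, 0, 1, one_ne_zero, by simp⟩
            · refine ⟨isReflection_conj_refl htr hr, ?_⟩
              rcases rt_conj_refl C htr hr with h4 | h4 <;> rw [h4, act_refl C htr]
              · exact ⟨1, -C.cor t (C.rt r), 1, one_ne_zero, by module⟩
              · exact ⟨1, C.cor t (C.rt r), -1, one_ne_zero, by module⟩
      rw [this, Finset.card_insert_of_notMem (by simp), Finset.card_filter,
        Finset.sum_pair hne.symm]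
    rw [key x hx ht, key (t * x) htx (mem_edg.2 ⟨htr, by rwa [← mul_assoc, tt, one_mul]⟩)] at hc
    exact Nat.add_right_cancel hc
  -- the equality of labels for a swapped pair
  have swap : ∀ r, cs.IsReflection r → r ∈ E → r ∈ E' → t * r * t ∉ E → t * r * t ∉ E' →
      r ≠ t → r ∈ WJc cs J → g (C.lab x r) = g (C.lab x (t * r * t)) := by
    intro r hr h1 h2 h3 h4 hrt hrJ
    have hr' := isReflection_conj_refl htr hr
    have n1 : ∀ y, bruhatLE cs y w → t * r * t ∉ (edg cs w y).erase t →
        C.lab y (t * r * t) = C.rt (t * r * t) := by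
      intro y hy h
      apply lab_up hr'
      rcases lt_or_gt_of_ne (hr'.length_mul_right_ne y) with h5 | h5
      · exfalso
        apply h
        exact Finset.mem_erase.2 ⟨htne r hrt, dn_subset_edg hy (mem_dn.2 ⟨hr', h5⟩)⟩
      · exact h5
    have e1 := n1 x hx h3
    have e2 := n1 (t * x) htx h4
    rw [lab_conj htr hr] at e2
    rw [e1, ← e2, hgt]
  have hEr : ∀ r ∈ E, cs.IsReflection r ∧ r ∈ WJc cs J ∧ r ≠ t := fun r hr =>
    ⟨(mem_edg.1 (Finset.mem_of_mem_erase hr)).1, mem1 x hx r (Finset.mem_of_mem_erase hr),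
      Finset.ne_of_mem_erase hr⟩
  have hEr' : ∀ r ∈ E', cs.IsReflection r ∧ r ∈ WJc cs J ∧ r ≠ t := fun r hr =>
    ⟨(mem_edg.1 (Finset.mem_of_mem_erase hr)).1, mem1 _ htx r (Finset.mem_of_mem_erase hr),
      Finset.ne_of_mem_erase hr⟩
  have dir1 : ∀ r ∈ E \ S, r ∈ E' ∧ t * r * t ∉ E ∧ t * r * t ∉ E' := by
    intro r hr
    rw [Finset.mem_sdiff, memS] at hr
    obtain ⟨h1, h2, h3⟩ := hEr r hr.1
    have hne : t * r * t ≠ r := by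
      intro hc
      rw [hc] at hr
      -- `r` commutes with `t`: use the plane count with a single point
      have hc1 := C.plane_count hw hx htr htx h1 h3
      have key : ∀ y, bruhatLE cs y w → t ∈ edg cs w y → ((edg cs w y).filter (C.Pl t r)).card =
          (if r ∈ (edg cs w y).erase t then 1 else 0) + 1 := by
        intro y hy hty
        have : (edg cs w y).filter (C.Pl t r) =
            insert t ((({r} : Finset W)).filter fun s => s ∈ (edg cs w y).erase t) := by
          ext s
          simp only [Finset.mem_filter, Finset.mem_insert, Finset.mem_singleton, Finset.mem_erase]
          constructor
          · rintro ⟨h4, h5⟩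
            have := Pl.eq h htr htJ h1 h2 h3 (mem1 y hy s h4) h5
            rw [hc] at this
            tauto
          · rintro (rfl | ⟨h4, h5, h6⟩)
            · exact ⟨hty, htr, 1, 1, 0, one_ne_zero, by simp⟩
            · refine ⟨h6, ?_⟩
              subst h4
              exact ⟨h1, 1, 0, 1, one_ne_zero, by simp⟩
        rw [this, Finset.card_insert_of_notMem (by simp), Finset.card_filter,
          Finset.sum_singleton]
      rw [key x hx ht, key (t * x) htx (mem_edg.2 ⟨htr, by rwa [← mul_assoc, tt, one_mul]⟩)] at hc1
      have := Nat.add_right_cancel hc1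
      rw [if_pos hr.1, if_neg hr.2] at this
      omega
    have hcount := count r h1 h2 h3 hne
    rw [if_pos hr.1, if_neg hr.2] at hcount
    refine ⟨?_, ?_, hr.2⟩
    · by_contra hc; rw [if_neg hc] at hcount; omega
    · intro hc; rw [if_pos hc] at hcount; split_ifs at hcount <;> omega
  have hcard : (E \ S).card = (S \ E).card := by
    have h1 : E.card = S.card := by
      rw [hS, Finset.card_image_of_injective _ (fun a b => inj a b), hE, hE',
        Finset.card_erase_of_mem ht, Finset.card_erase_of_mem (mem_edg.2 ⟨htr, by
          rwa [← mul_assoc, tt, one_mul]⟩), hw x hx, hw _ htx]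
    have h2 := Finset.card_sdiff_add_card_inter E S
    have h3 := Finset.card_sdiff_add_card_inter S E
    rw [Finset.inter_comm] at h3
    omega
  have himg : (E \ S).image (fun r => t * r * t) = S \ E := by
    apply Finset.eq_of_subset_of_card_le
    · intro q hq
      obtain ⟨r, hr, rfl⟩ := Finset.mem_image.1 hq
      have := dir1 r hr
      rw [Finset.mem_sdiff, memS, cc]
      exact ⟨this.1, this.2.1⟩
    · rw [Finset.card_image_of_injective _ (fun a b => inj a b), hcard]
  rw [← Finset.prod_inter_mul_prod_sdiff E S, ← Finset.prod_inter_mul_prod_sdiff S E,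
    Finset.inter_comm S E, ← himg, Finset.prod_image (fun a _ b _ => inj a b)]
  congr 1
  refine Finset.prod_congr rfl fun r hr => ?_
  have h1 := dir1 r hr
  have h2 := Finset.mem_sdiff.1 hr
  obtain ⟨h3, h4, h5⟩ := hEr r h2.1
  exact swap r h3 h2.1 h1.1 h1.2.1 h1.2.2 h5 h4

open Classical in
theorem connection {K : Type*} [CommMonoid K] {w x : W}
    (h : C.SL J ∨ ∀ y ∈ WJc cs J, bruhatLE cs y w) (hw : Regular cs w)
    (hwJ : w ∈ WJc cs J)
    (hx : bruhatLE cs x w) (ht : t ∈ edg cs w x) (g : (B → ℤ) → K)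
    (hg : ∀ (v : B → ℤ) (c : ℤ), g (v + c • C.rt t) = g v) :
    ∏ r ∈ (edg cs w x).erase t, g (C.lab x r) =
      ∏ r ∈ (edg cs w (t * x)).erase t, g (C.lab (t * x) r) := by
  rcases h with h | h
  · exact C.connection_of_SL h hw hwJ hx ht g hg
  obtain ⟨htr, htx⟩ := mem_edg.1 ht
  have tt : t * t = 1 := htr.mul_self
  have mem : ∀ y, bruhatLE cs y w → ∀ r, r ∈ edg cs w y ↔ cs.IsReflection r ∧ r ∈ WJc cs J := by
    intro y hy r
    have hyJ := C.bruhat_mem_WJ hy hwJ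
    rw [mem_edg]
    refine and_congr_right fun _ => ⟨fun hr => ?_, fun hr => h _ (Subgroup.mul_mem _ hr hyJ)⟩
    simpa using Subgroup.mul_mem _ (C.bruhat_mem_WJ hr hwJ) (Subgroup.inv_mem _ hyJ)
  have htJ := ((mem x hx t).1 ht).2
  have cc : ∀ r, t * (t * r * t) * t = r := fun r => by
    rw [show t * (t * r * t) * t = (t * t) * r * (t * t) by group, tt, one_mul, mul_one]
  have hgt : ∀ v, g (C.act t v) = g v := fun v => by
    rw [act_refl C htr, sub_eq_add_neg, ← neg_smul, hg]
  have hmaps : ∀ y z, bruhatLE cs y w → bruhatLE cs z w → ∀ r ∈ (edg cs w y).erase t,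
      t * r * t ∈ (edg cs w z).erase t := by
    intro y z hy hz r hr
    rw [Finset.mem_erase, mem _ hy] at hr
    rw [Finset.mem_erase, mem _ hz]
    refine ⟨fun h1 => hr.1 ?_, isReflection_conj_refl htr hr.2.1,
      Subgroup.mul_mem _ (Subgroup.mul_mem _ htJ hr.2.2) htJ⟩
    rw [← cc r, h1, tt, one_mul]
  refine Finset.prod_nbij' (fun r => t * r * t) (fun r => t * r * t) (hmaps _ _ hx htx)
    (hmaps _ _ htx hx) (fun r _ => cc r) (fun r _ => cc r) fun r hr => ?_
  rw [lab_conj htr (mem_edg.1 (Finset.mem_of_mem_erase hr)).1, hgt]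

end Cartan

open Polynomial in
theorem prod_dvd_of_eval_eq_zero {ι : Type*} {R : Finset ι} {n h : ι → ℕ} {q : ℕ} (hq : 2 ≤ q)
    (hn : ∀ i ∈ R, 0 < n i) (hne : ∀ i ∈ R, ∀ j ∈ R, i ≠ j → h i * n j ≠ h j * n i)
    {G : ℂ[X]} (hG : ∀ i ∈ R, ∀ z : ℂ, z ^ n i = (q : ℂ) ^ h i → G.eval z = 0) :
    ∏ i ∈ R, (X ^ n i - C ((q : ℂ) ^ h i)) ∣ G := by
  have hq0 : (q : ℂ) ≠ 0 := by exact_mod_cast (by omega : q ≠ 0)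
  by_cases hG0 : G = 0
  · rw [hG0]; exact dvd_zero _
  apply Finset.prod_dvd_of_coprime
  · intro i hi j hj hij
    rw [Function.onFun, Polynomial.isCoprime_iff_aeval_ne_zero_of_isAlgClosed ℂ ℂ]
    intro z
    by_contra hc
    push Not at hc
    have h1 : z ^ n i = (q : ℂ) ^ h i := by simpa [sub_eq_zero] using hc.1
    have h2 : z ^ n j = (q : ℂ) ^ h j := by simpa [sub_eq_zero] using hc.2
    have h3 : (q : ℂ) ^ (h i * n j) = (q : ℂ) ^ (h j * n i) := by
      rw [pow_mul, ← h1, pow_mul, ← h2, ← pow_mul, ← pow_mul, mul_comm]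
    have h4 : q ^ (h i * n j) = q ^ (h j * n i) := by exact_mod_cast h3
    exact hne i hi j hj hij (Nat.pow_right_injective hq h4)
  · intro i hi
    have hm : (X ^ n i - C ((q : ℂ) ^ h i)).Monic := monic_X_pow_sub_C _ (hn i hi).ne'
    have hs : (X ^ n i - C ((q : ℂ) ^ h i)).Separable :=
      separable_X_pow_sub_C _ (by exact_mod_cast (hn i hi).ne') (pow_ne_zero _ hq0)
    refine Splits.dvd_of_roots_le_roots (IsAlgClosed.splits _) hm.ne_zero ?_
    rw [Multiset.le_iff_subset (nodup_roots hs)]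
    intro z hz
    rw [mem_roots hm.ne_zero] at hz
    rw [mem_roots hG0]
    exact hG i hi z (by simpa [sub_eq_zero] using hz)

open Polynomial in
/-- A finite set of nonzero integer vectors is avoided by the kernel of a positive weight. -/
theorem exists_weight [Fintype B] (S : Finset (B → ℤ)) (hS : ∀ v ∈ S, v ≠ 0) :
    ∃ n : B → ℕ, (∀ i, 0 < n i) ∧ ∀ v ∈ S, ∑ i, v i * n i ≠ 0 := by
  set e := Fintype.equivFin B
  set p : (B → ℤ) → ℤ[X] := fun v => ∑ i, C (v i) * X ^ (e i : ℕ) with hp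
  have hp0 : ∀ v ∈ S, p v ≠ 0 := by
    intro v hv h
    apply hS v hv
    funext i
    have h1 := congrArg (fun f => f.coeff (e i : ℕ)) h
    simp only [hp, finsetSum_coeff, coeff_C_mul, coeff_X_pow, coeff_zero] at h1
    rw [Finset.sum_eq_single i] at h1
    · simpa using h1
    · intro j _ hj
      rw [if_neg, mul_zero]
      intro h2; exact hj (e.injective (Fin.ext h2.symm))
    · simp
  have hP : ∏ v ∈ S, p v ≠ 0 := Finset.prod_ne_zero_iff.2 hp0
  obtain ⟨N, hN⟩ : ∃ N : ℕ, (∏ v ∈ S, p v).eval ((N + 1 : ℕ) : ℤ) ≠ 0 := by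
    by_contra! hc
    apply hP
    apply Polynomial.eq_of_infinite_eval_eq
    refine (Set.infinite_range_of_injective (f := fun N : ℕ => ((N + 1 : ℕ) : ℤ)) ?_).mono ?_
    · intro a b h; simpa using h
    · rintro _ ⟨N, rfl⟩; simpa using hc N
  refine ⟨fun i => (N + 1) ^ (e i : ℕ), fun i => by positivity, fun v hv => ?_⟩
  rw [eval_prod, Finset.prod_ne_zero_iff] at hN
  have := hN v hv
  simpa [hp, eval_finsetSum] using this

namespace Cartan
variable [Fintype B] [DecidableEq B] (C : Cartan cs) [Finite W] {J : Set B} {t : W}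

/-- Height of the positive root of a reflection. -/
def ht (t : W) : ℕ := (hgt (C.rt t)).toNat

theorem ht_cast (ht : cs.IsReflection t) : (C.ht t : ℤ) = hgt (C.rt t) :=
  Int.toNat_of_nonneg (hgt_nonneg (C.rt_nonneg ht))

theorem ht_pos (ht : cs.IsReflection t) : 0 < C.ht t := by
  have := hgt_pos (C.rt_nonneg ht) (C.rt_ne_zero ht)
  have := C.ht_cast ht
  omega

theorem ht_simple (i : B) : C.ht (cs.simple i) = 1 := by
  have := C.ht_cast (cs.isReflection_simple i)
  rw [rt_simple, hgt_al] at this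
  exact_mod_cast this

theorem exists_generic_weight (C : Cartan cs) : ∃ n : B → ℕ, ∃ m : W → ℕ,
    (∀ t, cs.IsReflection t → (m t : ℤ) = ∑ i, C.rt t i * n i) ∧
    (∀ t, cs.IsReflection t → 0 < m t) ∧
    ∀ t, cs.IsReflection t → ∀ s, cs.IsReflection s → t ≠ s →
      C.ht t * m s ≠ C.ht s * m t := by
  classical
  obtain ⟨n, hn, h⟩ := exists_weight
    (((refls cs ×ˢ refls cs).filter fun p => p.1 ≠ p.2).image
      fun p => (C.ht p.1 : ℤ) • C.rt p.2 - (C.ht p.2 : ℤ) • C.rt p.1) (by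
    intro v hv
    simp only [Finset.mem_image, Finset.mem_filter, Finset.mem_product, mem_refls] at hv
    obtain ⟨⟨t, s⟩, ⟨⟨h1, h2⟩, h3⟩, rfl⟩ := hv
    intro h4
    have := C.ht_pos h2
    exact h3 (C.refl_ext' h1 h2 (c := C.ht s) (d := C.ht t) (by exact_mod_cast this.ne')
      (sub_eq_zero.1 h4).symm))
  have hnn : ∀ t, cs.IsReflection t → ((∑ i, C.rt t i * n i).toNat : ℤ) = ∑ i, C.rt t i * n i :=
    fun t ht => Int.toNat_of_nonneg (Finset.sum_nonneg fun i _ =>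
      mul_nonneg (C.rt_nonneg ht i) (by positivity))
  refine ⟨n, fun t => (∑ i, C.rt t i * n i).toNat, hnn, ?_, ?_⟩
  · intro t ht
    obtain ⟨k, hk⟩ := Function.ne_iff.1 (C.rt_ne_zero ht)
    have : 0 < ∑ i, C.rt t i * n i := Finset.sum_pos' (fun i _ =>
      mul_nonneg (C.rt_nonneg ht i) (by positivity)) ⟨k, Finset.mem_univ _,
        mul_pos (lt_of_le_of_ne (C.rt_nonneg ht k) (Ne.symm hk)) (by exact_mod_cast hn k)⟩
    simpa using this
  · intro t ht s hs hts hc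
    apply h _ (Finset.mem_image.2 ⟨(t, s), by simp [mem_refls, ht, hs, hts], rfl⟩)
    have hc' : (C.ht t : ℤ) * ((∑ i, C.rt s i * n i).toNat : ℤ) =
      C.ht s * ((∑ i, C.rt t i * n i).toNat : ℤ) := by exact_mod_cast hc
    rw [hnn s hs, hnn t ht] at hc'
    simp only [Pi.sub_apply, Pi.smul_apply, smul_eq_mul, sub_mul, Finset.sum_sub_distrib, mul_assoc,
      ← Finset.mul_sum]
    rw [hc', sub_self]

open Classical in
theorem card_up_edg (C : Cartan cs) {w x : W} (hw : Regular cs w) (hx : bruhatLE cs x w) :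
    ((edg cs w x).filter fun t => ¬ cs.length (t * x) < cs.length x).card =
      cs.length w - cs.length x := by
  have h1 := Finset.card_filter_add_card_filter_not (s := edg cs w x)
    (fun t => cs.length (t * x) < cs.length x)
  have h2 : (edg cs w x).filter (fun t => cs.length (t * x) < cs.length x) = dn cs x := by
    ext t
    rw [Finset.mem_filter, mem_dn]
    constructor
    · rintro ⟨h, h'⟩; exact ⟨(mem_edg.1 h).1, h'⟩
    · intro h; exact ⟨dn_subset_edg hx (mem_dn.2 h), h.2⟩
  rw [h2, C.card_dn, hw x hx] at h1
  omega

end Cartan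

namespace Cartan
variable [Fintype B] [DecidableEq B] (C : Cartan cs) [Finite W] {J : Set B} {t : W}

open Polynomial

/-- The denominators of the localization sum. -/
def den (m : W → ℕ) (q : ℕ) (t : W) : ℂ[X] := X ^ m t - Polynomial.C ((q : ℂ) ^ C.ht t)

open Classical in
/-- The numerators of the localization sum. -/
def num (m : W → ℕ) (q : ℕ) (x t : W) : ℂ[X] :=
  if cs.length (t * x) < cs.length x then
    Polynomial.C (q : ℂ) * X ^ m t - Polynomial.C ((q : ℂ) ^ C.ht t)
  else X ^ m t - Polynomial.C ((q : ℂ) ^ (C.ht t + 1))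

open Classical in
/-- The localization sum, cleared of denominators. -/
def loc (R : Finset W) (w : W) (m : W → ℕ) (q : ℕ) : ℂ[X] :=
  ∑ x ∈ ivl cs w, (∏ t ∈ edg cs w x, C.num m q x t) * ∏ t ∈ R \ edg cs w x, C.den m q t

/-- The ratio of numerator and denominator as a function of the label. -/
def quo (n : B → ℕ) (q : ℕ) (z : ℂ) (v : B → ℤ) : ℂ :=
  (1 - q * ((q : ℂ) ^ hgt v * z ^ (-∑ i, v i * n i))) /
    (1 - (q : ℂ) ^ hgt v * z ^ (-∑ i, v i * n i))

theorem quo_add_smul {n : B → ℕ} {q : ℕ} (hq : 2 ≤ q) {z : ℂ} (hz : z ≠ 0) {u : B → ℤ}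
    (hu : z ^ (∑ i, u i * n i : ℤ) = (q : ℂ) ^ hgt u) (v : B → ℤ) (c : ℤ) :
    quo n q z (v + c • u) = quo n q z v := by
  have hq0 : (q : ℂ) ≠ 0 := by exact_mod_cast (by omega : q ≠ 0)
  have h1 : (q : ℂ) ^ hgt (v + c • u) * z ^ (-∑ i, (v + c • u) i * n i) =
      (q : ℂ) ^ hgt v * z ^ (-∑ i, v i * n i) := by
    have h2 : ∑ i, (v + c • u) i * n i = ∑ i, v i * n i + c * ∑ i, u i * n i := by
      simp only [Pi.add_apply, Pi.smul_apply, smul_eq_mul, add_mul, Finset.sum_add_distrib,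
        Finset.mul_sum, mul_assoc]
    rw [h2, hgt_add, hgt_smul, neg_add, zpow_add₀ hq0, zpow_add₀ hz, zpow_neg z (c * _),
      mul_comm c, mul_comm c, zpow_mul, zpow_mul, hu]
    have : ((q : ℂ) ^ hgt u) ^ c ≠ 0 := zpow_ne_zero _ (zpow_ne_zero _ hq0)
    field_simp
  simp only [quo, h1]

theorem num_eval {n : B → ℕ} {m : W → ℕ}
    (hm : ∀ t, cs.IsReflection t → (m t : ℤ) = ∑ i, C.rt t i * n i)
    {q : ℕ} (hq : 2 ≤ q) {z : ℂ} (hz : z ≠ 0) {x t : W} (ht : cs.IsReflection t)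
    (h0 : (C.den m q t).eval z ≠ 0) :
    (C.num m q x t).eval z = (C.den m q t).eval z * quo n q z (C.lab x t) := by
  have hq0 : (q : ℂ) ≠ 0 := by exact_mod_cast (by omega : q ≠ 0)
  have hmz : z ^ (∑ i, C.rt t i * n i : ℤ) = z ^ m t := by rw [← hm t ht, zpow_natCast]
  have hhz : (q : ℂ) ^ hgt (C.rt t) = (q : ℂ) ^ C.ht t := by rw [← C.ht_cast ht, zpow_natCast]
  have hzm : z ^ m t ≠ 0 := pow_ne_zero _ hz
  have hqm : (q : ℂ) ^ C.ht t ≠ 0 := pow_ne_zero _ hq0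
  have h0' : z ^ m t - (q : ℂ) ^ C.ht t ≠ 0 := by simpa [den] using h0
  by_cases hd : cs.length (t * x) < cs.length x
  · rw [lab_down ht hd, num, if_pos hd]
    have e1 : (q : ℂ) ^ hgt (-C.rt t) * z ^ (-∑ i, (-C.rt t) i * n i : ℤ) =
        ((q : ℂ) ^ C.ht t)⁻¹ * z ^ m t := by
      have : hgt (-C.rt t) = -hgt (C.rt t) := by simp [hgt]
      rw [this, zpow_neg, hhz]
      simp only [Pi.neg_apply, neg_mul, Finset.sum_neg_distrib, neg_neg, hmz]
    rw [quo, e1]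
    have h2 : 1 - ((q : ℂ) ^ C.ht t)⁻¹ * z ^ m t ≠ 0 := by
      intro hc; apply h0'
      field_simp at hc
      linear_combination -hc
    simp only [den, eval_sub, eval_mul, eval_pow, eval_X, eval_C]
    field_simp
    have h3 : (q : ℂ) ^ C.ht t - z ^ m t ≠ 0 := by rw [← neg_sub]; exact neg_ne_zero.2 h0'
    field_simp
    ring
  · have hu : cs.length x < cs.length (t * x) :=
      lt_of_le_of_ne (not_lt.1 hd) (ht.length_mul_right_ne x).symm
    rw [lab_up ht hu, num, if_neg hd]
    rw [quo, zpow_neg, hmz, hhz]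
    have h2 : 1 - (q : ℂ) ^ C.ht t * (z ^ m t)⁻¹ ≠ 0 := by
      intro hc; apply h0'
      field_simp at hc
      linear_combination hc
    simp only [den, eval_sub, eval_mul, eval_pow, eval_X, eval_C]
    field_simp
    ring

theorem num_eval_root {m : W → ℕ} {q : ℕ} {z : ℂ} {x t : W}  (ht : cs.IsReflection t)
    (hz : z ^ m t = (q : ℂ) ^ C.ht t) :
    (C.num m q x t).eval z = -(C.num m q (t * x) t).eval z := by
  rcases lt_or_gt_of_ne (ht.length_mul_right_ne x) with h | h
  · have h' : ¬ cs.length (t * (t * x)) < cs.length (t * x) := by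
      rw [← mul_assoc, ht.mul_self, one_mul]; omega
    rw [num, num, if_pos h, if_neg h']
    simp only [eval_sub, eval_mul, eval_pow, eval_X, eval_C, hz]
    ring
  · have h' : cs.length (t * (t * x)) < cs.length (t * x) := by
      rwa [← mul_assoc, ht.mul_self, one_mul]
    rw [num, num, if_neg (by omega), if_pos h']
    simp only [eval_sub, eval_mul, eval_pow, eval_X, eval_C, hz]
    ring

open Classical in
theorem loc_eval_root {w : W} (h : C.SL J ∨ ∀ y ∈ WJc cs J, bruhatLE cs y w)
    (hw : Regular cs w) (hwJ : w ∈ WJc cs J)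
    {R : Finset W} (hR : ∀ t, t ∈ R ↔ cs.IsReflection t ∧ t ∈ WJc cs J)
    {n : B → ℕ} {m : W → ℕ}
    (hm : ∀ t, cs.IsReflection t → (m t : ℤ) = ∑ i, C.rt t i * n i)
    (hm0 : ∀ t, cs.IsReflection t → 0 < m t)
    (hne : ∀ t, cs.IsReflection t → ∀ s, cs.IsReflection s → t ≠ s → C.ht t * m s ≠ C.ht s * m t)
    {q : ℕ} (hq : 2 ≤ q) {z : ℂ} {s : W} (hs : s ∈ R) (hz : z ^ m s = (q : ℂ) ^ C.ht s) :
    (C.loc R w m q).eval z = 0 := by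
  have hq0 : (q : ℂ) ≠ 0 := by exact_mod_cast (by omega : q ≠ 0)
  have hsr := ((hR s).1 hs).1
  have hz0 : z ≠ 0 := by
    rintro rfl
    rw [zero_pow (hm0 s hsr).ne'] at hz
    exact pow_ne_zero _ hq0 hz.symm
  have hden : ∀ t, cs.IsReflection t → t ≠ s → (C.den m q t).eval z ≠ 0 := by
    intro t ht hts hc
    have h1 : z ^ m t = (q : ℂ) ^ C.ht t := by simpa [den, sub_eq_zero] using hc
    have h3 : (q : ℂ) ^ (C.ht t * m s) = (q : ℂ) ^ (C.ht s * m t) := by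
      rw [pow_mul, ← h1, pow_mul, ← hz, ← pow_mul, ← pow_mul, mul_comm]
    have h4 : q ^ (C.ht t * m s) = q ^ (C.ht s * m t) := by exact_mod_cast h3
    exact hne t ht s hsr hts (Nat.pow_right_injective hq h4)
  have hdens : (C.den m q s).eval z = 0 := by simp [den, hz]
  have hER : ∀ x ∈ ivl cs w, edg cs w x ⊆ R := by
    intro x hx t ht
    rw [mem_ivl] at hx
    refine (hR t).2 ⟨(mem_edg.1 ht).1, ?_⟩
    have := Subgroup.mul_mem _ (C.bruhat_mem_WJ (mem_edg.1 ht).2 hwJ)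
      (Subgroup.inv_mem _ (C.bruhat_mem_WJ hx hwJ))
    rwa [mul_inv_cancel_right] at this
  have hquo : ∀ (v : B → ℤ) (c : ℤ), quo n q z (v + c • C.rt s) = quo n q z v := by
    intro v c
    apply quo_add_smul hq hz0
    rw [← hm s hsr, zpow_natCast, hz, ← zpow_natCast, C.ht_cast hsr]
  rw [loc, eval_finsetSum]
  -- terms with `s` among the edges
  have key : ∀ x ∈ ivl cs w, s ∈ edg cs w x →
      ((∏ t ∈ edg cs w x, C.num m q x t) * ∏ t ∈ R \ edg cs w x, C.den m q t).eval z =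
      (C.num m q x s).eval z * (∏ t ∈ (edg cs w x).erase s, quo n q z (C.lab x t)) *
        ∏ t ∈ R.erase s, (C.den m q t).eval z := by
    intro x hx hsx
    rw [eval_mul, eval_prod, eval_prod, ← Finset.mul_prod_erase _ _ hsx, mul_assoc, mul_assoc]
    congr 1
    rw [Finset.prod_congr (g := fun t => (C.den m q t).eval z * quo n q z (C.lab x t)) rfl,
      Finset.prod_mul_distrib]
    · have hsub : (edg cs w x).erase s ⊆ R.erase s := Finset.erase_subset_erase _ (hER x hx)
      rw [← Finset.prod_sdiff hsub]
      have : R.erase s \ (edg cs w x).erase s = R \ edg cs w x := by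
        ext t; simp only [Finset.mem_sdiff, Finset.mem_erase]
        constructor
        · rintro ⟨⟨h1, h2⟩, h3⟩; exact ⟨h2, fun h4 => h3 ⟨h1, h4⟩⟩
        · rintro ⟨h1, h2⟩
          have : t ≠ s := by rintro rfl; exact h2 hsx
          exact ⟨⟨this, h1⟩, fun h4 => h2 h4.2⟩
      rw [this]; ring
    · intro t ht
      rw [Finset.mem_erase] at ht
      have htr := (mem_edg.1 ht.2).1
      exact num_eval C hm hq hz0 htr (hden t htr ht.1)
  have key0 : ∀ x ∈ ivl cs w, s ∉ edg cs w x →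
      ((∏ t ∈ edg cs w x, C.num m q x t) * ∏ t ∈ R \ edg cs w x, C.den m q t).eval z = 0 := by
    intro x hx hsx
    rw [eval_mul, eval_prod (R \ _), Finset.prod_eq_zero (Finset.mem_sdiff.2 ⟨hs, hsx⟩) hdens,
      mul_zero]
  have ss : ∀ x, s * (s * x) = x := fun x => by rw [← mul_assoc, hsr.mul_self, one_mul]
  refine Finset.sum_involution (fun x _ => if s ∈ edg cs w x then s * x else x) ?_ ?_ ?_ ?_
  · intro x hx
    have hx' := mem_ivl.1 hx
    by_cases hsx : s ∈ edg cs w x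
    · rw [if_pos hsx]
      have h1 : s * x ∈ ivl cs w := mem_ivl.2 (mem_edg.1 hsx).2
      have h2 : s ∈ edg cs w (s * x) := mem_edg.2 ⟨hsr, by rwa [ss]⟩
      rw [key x hx hsx, key _ h1 h2, C.num_eval_root hsr hz,
        C.connection h hw hwJ hx' hsx (quo n q z) hquo]
      ring
    · rw [if_neg hsx, key0 x hx hsx, add_zero]
  · intro x hx hx0
    by_cases hsx : s ∈ edg cs w x
    · rw [if_pos hsx]
      intro hc
      exact hsr.length_mul_right_ne x (by rw [hc])
    · exact absurd (key0 x hx hsx) hx0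
  · intro x hx
    by_cases hsx : s ∈ edg cs w x
    · rw [if_pos hsx]; exact mem_ivl.2 (mem_edg.1 hsx).2
    · rwa [if_neg hsx]
  · intro x hx
    have hx' := mem_ivl.1 hx
    by_cases hsx : s ∈ edg cs w x
    · have h2 : s ∈ edg cs w (s * x) := mem_edg.2 ⟨hsr, by rwa [ss]⟩
      simp only [if_pos hsx, if_pos h2, ss]
    · simp only [if_neg hsx]

end Cartan

open Polynomial in
theorem eval_poin_of_ratSmooth [Finite W] [Fintype B] [DecidableEq B] (C : Cartan cs) {w : W}
    (h : RatSmooth cs w) (q : ℤ) :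
    ∑ x ∈ ivl cs w, q ^ (cs.length w - cs.length x) = (poin cs w).eval q := by
  classical
  have h1 : (poin cs w).eval q = ∑ k ∈ Finset.range (cs.length w + 1), (poin cs w).coeff k * q ^ k :=
    eval_eq_sum_range' (by rw [Cartan.natDegree_poin]; omega) q
  rw [h1, ← Finset.sum_range_reflect]
  rw [← Finset.sum_fiberwise_of_maps_to (s := ivl cs w) (t := Finset.range (cs.length w + 1))
    (g := fun x => cs.length x) (fun x hx => Finset.mem_range.2 (by
      have := bruhat_length (mem_ivl.1 hx); omega))]
  refine Finset.sum_congr rfl fun k hk => ?_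
  have hk : k ≤ cs.length w := by have := Finset.mem_range.1 hk; omega
  rw [show cs.length w + 1 - 1 - k = cs.length w - k by omega, ← h k hk, coeff_poin,
    Finset.sum_congr (g := fun _ => q ^ (cs.length w - k)) rfl]
  · simp
  · intro x hx; rw [(Finset.mem_filter.1 hx).2]

namespace Cartan
variable [Fintype B] [DecidableEq B] (C : Cartan cs) [Finite W] {J : Set B} {t : W}

open Polynomial

theorem natDegree_num_le (m : W → ℕ) (q : ℕ) (x t : W) : (C.num m q x t).natDegree ≤ m t := by
  unfold num
  split_ifs <;> compute_degree

theorem natDegree_loc_le {R : Finset W} {w : W} (m : W → ℕ) (q : ℕ)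
    (hR : ∀ x ∈ ivl cs w, edg cs w x ⊆ R) : (C.loc R w m q).natDegree ≤ ∑ t ∈ R, m t := by
  classical
  apply natDegree_sum_le_of_forall_le
  intro x hx
  refine natDegree_mul_le.trans ?_
  rw [← Finset.sum_sdiff (hR x hx), add_comm]
  refine add_le_add ((natDegree_prod_le _ _).trans (Finset.sum_le_sum fun t _ => ?_))
    ((natDegree_prod_le _ _).trans (Finset.sum_le_sum fun t _ => C.natDegree_num_le m q x t))
  unfold den; compute_degree

theorem eval_poin_mul_prod {w : W} (h : C.SL J ∨ ∀ y ∈ WJc cs J, bruhatLE cs y w)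
    (hs : RatSmooth cs w) (hwJ : w ∈ WJc cs J)
    {q : ℕ} (hq : 2 ≤ q) :
    (((poin cs w).eval (q : ℤ) : ℤ) : ℂ) * ∏ t ∈ edg cs w 1, (1 - (q : ℂ) ^ C.ht t) =
      ∏ t ∈ edg cs w 1, (1 - (q : ℂ) ^ (C.ht t + 1)) := by
  classical
  have hq0 : (q : ℂ) ≠ 0 := by exact_mod_cast (by omega : q ≠ 0)
  have hw := C.regular_of_ratSmooth hs
  obtain ⟨n, m, hm, hm0, hne⟩ := C.exists_generic_weight
  set R : Finset W := (refls cs).filter fun t => t ∈ WJc cs J with hRdef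
  have hR : ∀ t, t ∈ R ↔ cs.IsReflection t ∧ t ∈ WJc cs J := fun t => by
    rw [hRdef, Finset.mem_filter, mem_refls]
  have hER : ∀ x ∈ ivl cs w, edg cs w x ⊆ R := by
    intro x hx t ht
    rw [mem_ivl] at hx
    refine (hR t).2 ⟨(mem_edg.1 ht).1, ?_⟩
    have := Subgroup.mul_mem _ (C.bruhat_mem_WJ (mem_edg.1 ht).2 hwJ)
      (Subgroup.inv_mem _ (C.bruhat_mem_WJ hx hwJ))
    rwa [mul_inv_cancel_right] at this
  have hmon : ∀ t ∈ R, (C.den m q t).Monic := fun t ht =>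
    monic_X_pow_sub_C _ (hm0 t ((hR t).1 ht).1).ne'
  have hdvd : ∏ t ∈ R, C.den m q t ∣ C.loc R w m q :=
    prod_dvd_of_eval_eq_zero hq (fun t ht => hm0 t ((hR t).1 ht).1)
      (fun t ht s hs hts => hne t ((hR t).1 ht).1 s ((hR s).1 hs).1 hts)
      (fun t ht z hz => C.loc_eval_root h hw hwJ hR hm hm0 hne hq ht hz)
  have hDm : (∏ t ∈ R, C.den m q t).Monic := monic_prod_of_monic _ _ hmon
  have hDd : (∏ t ∈ R, C.den m q t).natDegree = ∑ t ∈ R, m t := by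
    rw [natDegree_prod_of_monic _ _ hmon]
    exact Finset.sum_congr rfl fun t ht => natDegree_X_pow_sub_C
  obtain ⟨K, hK⟩ := hdvd
  have hK0 : K.natDegree = 0 := by
    by_cases hK1 : K = 0
    · simp [hK1]
    · have h1 := C.natDegree_loc_le m q hER
      rw [hK, hDm.natDegree_mul' hK1, hDd] at h1
      omega
  obtain ⟨c, rfl⟩ := natDegree_eq_zero.1 hK0
  have hone : (1 : W) ∈ ivl cs w := mem_ivl.2 (one_bruhat w)
  -- evaluation at zero
  have hc : c = (((poin cs w).eval (q : ℤ) : ℤ) : ℂ) := by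
    have h0 := congrArg (fun f => f.eval 0) hK
    simp only [loc, eval_finsetSum, eval_mul, eval_prod, eval_C] at h0
    have hd0 : ∀ t ∈ R, (C.den m q t).eval 0 = -(q : ℂ) ^ C.ht t := fun t ht => by
      simp [den, (hm0 t ((hR t).1 ht).1).ne']
    have hterm : ∀ x ∈ ivl cs w, (∏ t ∈ edg cs w x, (C.num m q x t).eval 0) *
        ∏ t ∈ R \ edg cs w x, (C.den m q t).eval 0 =
        (∏ t ∈ R, (C.den m q t).eval 0) * (q : ℂ) ^ (cs.length w - cs.length x) := by
      intro x hx
      rw [← Finset.prod_sdiff (hER x hx), ← C.card_up_edg hw (mem_ivl.1 hx), ← Finset.prod_const,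
        Finset.prod_filter, mul_assoc, ← Finset.prod_mul_distrib, mul_comm]
      congr 1
      refine Finset.prod_congr rfl fun t ht => ?_
      rw [hd0 t (hER x hx ht), num]
      have := (hm0 t (mem_edg.1 ht).1).ne'
      by_cases hl : cs.length (t * x) < cs.length x
      · simp [hl, this]
      · simp [hl, this, pow_succ]
    rw [Finset.sum_congr rfl hterm, ← Finset.mul_sum] at h0
    have hD0 : ∏ t ∈ R, (C.den m q t).eval 0 ≠ 0 := by
      rw [Finset.prod_ne_zero_iff]
      intro t ht; rw [hd0 t ht]; exact neg_ne_zero.2 (pow_ne_zero _ hq0)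
    rw [← mul_left_cancel₀ hD0 h0, ← eval_poin_of_ratSmooth C hs]
    push_cast; rfl
  -- evaluation at one
  have h1 := congrArg (fun f => f.eval 1) hK
  simp only [loc, eval_finsetSum, eval_mul, eval_prod, eval_C] at h1
  rw [Finset.sum_eq_single_of_mem 1 hone, hc, ← Finset.prod_sdiff (hER 1 hone)] at h1
  · have hd1 : ∀ t, (C.den m q t).eval 1 = 1 - (q : ℂ) ^ C.ht t := fun t => by simp [den]
    have hn1 : ∀ t ∈ edg cs w 1, (C.num m q 1 t).eval 1 = 1 - (q : ℂ) ^ (C.ht t + 1) := by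
      intro t ht; simp [num]
    have hne0 : ∏ t ∈ R \ edg cs w 1, (C.den m q t).eval 1 ≠ 0 := by
      rw [Finset.prod_ne_zero_iff]
      intro t ht
      rw [hd1, sub_ne_zero]
      have h2 : 1 < q ^ C.ht t := Nat.one_lt_pow
        (C.ht_pos ((hR t).1 (Finset.mem_sdiff.1 ht).1).1).ne' hq
      exact_mod_cast h2.ne
    rw [Finset.prod_congr rfl hn1, Finset.prod_congr (s₁ := edg cs w 1) rfl fun t _ => hd1 t] at h1
    apply mul_left_cancel₀ hne0
    linear_combination -h1
  · intro x hx hx1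
    obtain ⟨i, hi⟩ := cs.exists_leftDescent_of_ne_one hx1
    have hsi : cs.simple i ∈ edg cs w x := mem_edg.2 ⟨cs.isReflection_simple i,
      bruhat_trans (bruhat_of_refl' (cs.isReflection_simple i) hi) (mem_ivl.1 hx)⟩
    rw [Finset.prod_eq_zero hsi, zero_mul]
    have hi' : cs.length (cs.simple i * x) < cs.length x := hi
    rw [num, if_pos hi', ht_simple]
    simp

theorem poin_mul_prod {w : W} (h : C.SL J ∨ ∀ y ∈ WJc cs J, bruhatLE cs y w)
    (hs : RatSmooth cs w) (hwJ : w ∈ WJc cs J) :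
    poin cs w * ∏ t ∈ edg cs w 1, qint (C.ht t) = ∏ t ∈ edg cs w 1, qint (C.ht t + 1) := by
  apply Polynomial.eq_of_infinite_eval_eq
  refine (Set.infinite_range_of_injective (f := fun N : ℕ => ((N + 2 : ℕ) : ℤ)) ?_).mono ?_
  · intro a b h; simpa using h
  · rintro _ ⟨N, rfl⟩
    have h1 := C.eval_poin_mul_prod h hs hwJ (q := N + 2) (by omega)
    have hq : ∀ k, (((N + 2 : ℕ) : ℂ) - 1) * (((qint k).eval ((N + 2 : ℕ) : ℤ) : ℤ) : ℂ) =
        -(1 - ((N + 2 : ℕ) : ℂ) ^ k) := by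
      intro k
      rw [neg_sub, ← geom_sum_mul, qint, eval_finsetSum, mul_comm]
      simp
    have hne : (((N + 2 : ℕ) : ℂ) - 1) ≠ 0 := by
      push_cast
      have : ((N + 1 : ℕ) : ℂ) ≠ 0 := by exact_mod_cast Nat.succ_ne_zero N
      intro hc; apply this; push_cast; linear_combination hc
    have hpq : ∀ f : W → ℕ, (((N + 2 : ℕ) : ℂ) - 1) ^ (edg cs w 1).card *
        ∏ t ∈ edg cs w 1, (((qint (f t)).eval ((N + 2 : ℕ) : ℤ) : ℤ) : ℂ) =
        (-1) ^ (edg cs w 1).card * ∏ t ∈ edg cs w 1, (1 - ((N + 2 : ℕ) : ℂ) ^ f t) := by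
      intro f
      rw [← Finset.prod_const, ← Finset.prod_const, ← Finset.prod_mul_distrib,
        ← Finset.prod_mul_distrib]
      exact Finset.prod_congr rfl fun t _ => by rw [hq]; ring
    have h2 := hpq C.ht
    have h3 := hpq fun t => C.ht t + 1
    simp only [Set.mem_ofPred_eq, eval_mul, eval_prod]
    have h4 : ((((poin cs w).eval ((N + 2 : ℕ) : ℤ) : ℤ) : ℂ)) *
        ∏ t ∈ edg cs w 1, (((qint (C.ht t)).eval ((N + 2 : ℕ) : ℤ) : ℤ) : ℂ) =
        ∏ t ∈ edg cs w 1, (((qint (C.ht t + 1)).eval ((N + 2 : ℕ) : ℤ) : ℤ) : ℂ) := by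
      apply mul_left_cancel₀ (pow_ne_zero (edg cs w 1).card hne)
      rw [h3, ← h1]
      linear_combination (((poin cs w).eval ((N + 2 : ℕ) : ℤ) : ℤ) : ℂ) * h2
    exact_mod_cast h4

end Cartan

namespace Cartan
variable [Fintype B] [DecidableEq B] (C : Cartan cs) [Finite W] {J : Set B} {t s : W}

/-- The conjugate of `s` by the simple reflection `i`. -/
def cj (cs : CoxeterSystem M W) (i : B) (s : W) : W := cs.simple i * s * cs.simple i

theorem isReflection_cj (hs : cs.IsReflection s) (i : B) : cs.IsReflection (cj cs i s) :=
  isReflection_conj_refl (cs.isReflection_simple i) hs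

theorem cj_mem_WJ {i : B} (hi : i ∈ J) (hs : s ∈ WJc cs J) : cj cs i s ∈ WJc cs J :=
  Subgroup.mul_mem _ (Subgroup.mul_mem _ (simple_mem_WJ hi) hs) (simple_mem_WJ hi)

theorem cj_cj (i : B) (s : W) : cj cs i (cj cs i s) = s := by
  simp [cj, mul_assoc]

theorem rt_cj (hs : cs.IsReflection s) {i : B} (hi : s ≠ cs.simple i) :
    C.rt (cj cs i s) = C.rt s - C.pair i (C.rt s) • al i := by
  have h1 := C.rt_conj_refl (cs.isReflection_simple i) hs
  have h2 : 0 ≤ C.act (cs.simple i) (C.rt s) := by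
    rw [C.act_simple_sign (C.isRoot_rt hs)]
    · exact C.rt_nonneg hs
    · intro h; exact hi (C.refl_ext hs (cs.isReflection_simple i) (by rw [rt_simple]; exact Or.inl h))
    · intro h; exact hi (C.refl_ext hs (cs.isReflection_simple i) (by rw [rt_simple]; exact Or.inr h))
  rw [← act_simple]
  rcases h1 with h1 | h1
  · exact h1
  · exfalso
    have h3 := C.rt_nonneg (isReflection_cj hs i)
    rw [cj, h1] at h3
    have h4 := ((C.isRoot_rt hs).act (cs.simple i)).ne_zero
    exact h4 (le_antisymm (neg_nonneg.1 h3) h2)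

theorem ht_cj (hs : cs.IsReflection s) {i : B} (hi : s ≠ cs.simple i) :
    (C.ht (cj cs i s) : ℤ) = C.ht s - C.pair i (C.rt s) := by
  rw [C.ht_cast (isReflection_cj hs i), C.ht_cast hs, rt_cj C hs hi, hgt_sub, hgt_smul, hgt_al,
    mul_one]

theorem pair_rt (h : C.SL J) (hs : cs.IsReflection s) (hsJ : s ∈ WJc cs J) {i : B} (hi : i ∈ J)
    (hne : s ≠ cs.simple i) :
    C.pair i (C.rt s) = 0 ∨ C.pair i (C.rt s) = 1 ∨ C.pair i (C.rt s) = -1 := by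
  have := C.bil_rt_rt h (cs.isReflection_simple i) (simple_mem_WJ hi) hs hsJ hne
  rwa [rt_simple, bil_al] at this

theorem SL.A_eq (h : C.SL J) {i j : B} (hi : i ∈ J) (hj : j ∈ J) (hij : i ≠ j) :
    C.A i j = 0 ∨ C.A i j = -1 := by
  have h1 := C.off i j hij
  have h2 := h i hi j hj
  omega

theorem exists_two_rho (h : C.SL J) : ∃ c : B → ℤ, InJ J c ∧ ∀ v, InJ J v →
    ∑ i, c i * C.pair i v = 2 * hgt v := by
  classical
  set R : Finset W := (refls cs).filter fun t => t ∈ WJc cs J with hRdef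
  have hR : ∀ t, t ∈ R ↔ cs.IsReflection t ∧ t ∈ WJc cs J := fun t => by
    rw [hRdef, Finset.mem_filter, mem_refls]
  have hin : InJ J (∑ t ∈ R, C.rt t) := by
    intro k hk
    rw [Finset.sum_apply]
    exact Finset.sum_eq_zero fun t ht => C.inJ_rt ((hR t).1 ht).1 ((hR t).1 ht).2 k hk
  have hp : ∀ i ∈ J, C.pair i (∑ t ∈ R, C.rt t) = 2 := by
    intro i hi
    have hiR : cs.simple i ∈ R := (hR _).2 ⟨cs.isReflection_simple i, simple_mem_WJ hi⟩
    rw [← Finset.add_sum_erase _ _ hiR, map_add, rt_simple, pair_al, C.diag]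
    have h1 : C.act (cs.simple i) (∑ t ∈ R.erase (cs.simple i), C.rt t) =
        ∑ t ∈ R.erase (cs.simple i), C.rt t := by
      rw [act_sum]
      refine Finset.sum_bij' (fun t _ => cj cs i t) (fun t _ => cj cs i t) ?_ ?_ ?_ ?_ ?_
      · intro t ht
        rw [Finset.mem_erase, hR] at ht ⊢
        refine ⟨fun hc => ht.1 ?_, isReflection_cj ht.2.1 i, cj_mem_WJ hi ht.2.2⟩
        rw [← cj_cj (cs := cs) i t, hc]; simp [cj]
      · intro t ht
        rw [Finset.mem_erase, hR] at ht ⊢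
        refine ⟨fun hc => ht.1 ?_, isReflection_cj ht.2.1 i, cj_mem_WJ hi ht.2.2⟩
        rw [← cj_cj (cs := cs) i t, hc]; simp [cj]
      · intro t _; exact cj_cj i t
      · intro t _; exact cj_cj i t
      · intro t ht
        rw [Finset.mem_erase, hR] at ht
        rw [rt_cj C ht.2.1 ht.1, act_simple]
    rw [act_simple] at h1
    have h2 : C.pair i (∑ t ∈ R.erase (cs.simple i), C.rt t) • (al i : B → ℤ) = 0 := by
      rwa [sub_eq_self] at h1
    rw [smul_eq_zero] at h2
    rw [h2.resolve_right (al_ne_zero i), add_zero]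
  refine ⟨∑ t ∈ R, C.rt t, hin, fun v hv => ?_⟩
  change C.bil _ _ = _
  rw [C.bil_comm h hin hv, bil, hgt, Finset.mul_sum]
  refine Finset.sum_congr rfl fun i _ => ?_
  by_cases hi : i ∈ J
  · rw [hp i hi]; ring
  · rw [hv i hi]; ring

open Classical in
/-- The lowering operator, in coordinates. -/
def lower (J : Set B) (c : B → ℤ) (a : W → ℚ) (s : W) : ℚ :=
  ∑ i, if i ∈ J ∧ C.pair i (C.rt s) = -1 then (c i : ℚ) * a (cj cs i s) else 0

open Classical in
/-- The raising operator, in coordinates. -/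
def raise (J : Set B) (a : W → ℚ) (s : W) : ℚ :=
  ∑ i, if i ∈ J ∧ C.pair i (C.rt s) = 1 then a (cj cs i s) else 0

theorem raise_lower (h : C.SL J) {c : B → ℤ} (hcJ : InJ J c) (hc : ∀ v, InJ J v →
    ∑ i, c i * C.pair i v = 2 * hgt v) (a : W → ℚ) (hs : cs.IsReflection s) (hsJ : s ∈ WJc cs J)
    (h2 : 2 ≤ C.ht s) :
    C.raise J (C.lower J c a) s = C.lower J c (C.raise J a) s + 2 * C.ht s * a s := by
  classical
  have hns : ∀ i, s ≠ cs.simple i := by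
    rintro i rfl; rw [ht_simple] at h2; omega
  have hp := fun i (hi : i ∈ J) => C.pair_rt h hs hsJ hi (hns i)
  have e1 : C.raise J (C.lower J c a) s = ∑ i, ∑ j,
      if (j ∈ J ∧ C.pair j (C.rt s) = 1) ∧ (i ∈ J ∧ C.pair i (C.rt (cj cs j s)) = -1) then
        (c i : ℚ) * a (cj cs i (cj cs j s)) else 0 := by
    rw [Finset.sum_comm, raise]
    refine Finset.sum_congr rfl fun j _ => ?_
    by_cases hj : j ∈ J ∧ C.pair j (C.rt s) = 1
    · simp only [hj, lower, and_self, true_and, if_true]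
    · simp only [hj, false_and, if_false, Finset.sum_const_zero]
  have e2 : C.lower J c (C.raise J a) s = ∑ i, ∑ j,
      if (i ∈ J ∧ C.pair i (C.rt s) = -1) ∧ (j ∈ J ∧ C.pair j (C.rt (cj cs i s)) = 1) then
        (c i : ℚ) * a (cj cs j (cj cs i s)) else 0 := by
    rw [lower]
    refine Finset.sum_congr rfl fun i _ => ?_
    by_cases hi : i ∈ J ∧ C.pair i (C.rt s) = -1
    · simp only [hi, raise, and_self, true_and, if_true, Finset.mul_sum, mul_ite, mul_zero]
    · simp only [hi, false_and, if_false, Finset.sum_const_zero]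
  have e3 : (2 * C.ht s * a s : ℚ) = ∑ i, ∑ j, if i = j ∧ i ∈ J then
      (c i : ℚ) * C.pair i (C.rt s) * a s else 0 := by
    have h3 : (2 * C.ht s : ℚ) = ∑ i, (c i : ℚ) * C.pair i (C.rt s) := by
      have h4 := hc _ (C.inJ_rt hs hsJ)
      rw [← C.ht_cast hs] at h4
      exact_mod_cast h4.symm
    have hJc : ∀ i, i ∉ J → (c i : ℚ) * C.pair i (C.rt s) = 0 := by
      intro i hi; rw [hcJ i hi]; simp
    rw [h3, Finset.sum_mul]
    refine Finset.sum_congr rfl fun i _ => ?_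
    rw [Finset.sum_eq_single i]
    · by_cases hi : i ∈ J
      · simp [hi]
      · simp [hi, hJc i hi]
    · intro j _ hj; rw [if_neg]; exact fun hc => hj hc.1.symm
    · simp
  rw [e1, e2, e3, ← Finset.sum_add_distrib]
  refine Finset.sum_congr rfl fun i _ => ?_
  rw [← Finset.sum_add_distrib]
  refine Finset.sum_congr rfl fun j _ => ?_
  by_cases hi : i ∈ J
  swap
  · simp [hi]
  by_cases hj : j ∈ J
  swap
  · have : i ≠ j := fun h => hj (h ▸ hi)
    simp [hj, this]
  simp only [hi, hj, true_and, and_true]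
  rw [rt_cj C hs (hns i), rt_cj C hs (hns j), map_sub, map_sub, map_smul, map_smul, pair_al,
    pair_al, smul_eq_mul, smul_eq_mul]
  by_cases hij : i = j
  · subst hij
    rw [C.diag, cj_cj]
    rcases hp i hi with h3 | h3 | h3 <;> rw [h3] <;> norm_num
  · have hA := h.A_eq C hi hj hij
    have hA' := h i hi j hj
    rw [if_neg hij, add_zero, ← hA']
    have hcomm : C.A i j = 0 → C.pair j (C.rt s) = 1 → C.pair i (C.rt s) = -1 →
        cj cs i (cj cs j s) = cj cs j (cj cs i s) := by
      intro hA0 hpj hpi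
      have n1 : cj cs j s ≠ cs.simple i := by
        intro hc1
        have := C.rt_cj hs (hns j)
        have h4 := congrArg (C.pair i) this
        rw [hc1, rt_simple, pair_al, C.diag, map_sub, map_smul, pair_al, hA0, hpi] at h4
        simp at h4
      have n2 : cj cs i s ≠ cs.simple j := by
        intro hc1
        have := C.rt_cj hs (hns i)
        have h4 := congrArg (C.pair j) this
        rw [hc1, rt_simple, pair_al, C.diag, map_sub, map_smul, pair_al, ← hA', hA0, hpj] at h4
        simp at h4
      apply C.refl_ext (isReflection_cj (isReflection_cj hs j) i)
        (isReflection_cj (isReflection_cj hs i) j)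
      left
      rw [rt_cj C (isReflection_cj hs j) n1, rt_cj C (isReflection_cj hs i) n2,
        rt_cj C hs (hns i), rt_cj C hs (hns j), map_sub, map_sub, map_smul, map_smul, pair_al,
        pair_al, ← hA', hA0, hpj, hpi]
      module
    rcases hp i hi with h3 | h3 | h3 <;> rcases hp j hj with h4 | h4 | h4 <;>
      rcases hA with h5 | h5 <;> simp only [h3, h4, h5] <;> norm_num
    left; rw [hcomm h5 h4 h3]

theorem eq_zero_of_lower_eq_zero (h : C.SL J) {c : B → ℤ} (hcJ : InJ J c)
    (hc : ∀ v, InJ J v → ∑ i, c i * C.pair i v = 2 * hgt v) {a : W → ℚ} {k : ℕ} (hk : 1 ≤ k)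
    (ha : ∀ s, cs.IsReflection s → s ∈ WJc cs J → C.ht s = k → C.lower J c a s = 0)
    (hs : cs.IsReflection s) (hsJ : s ∈ WJc cs J) (hsk : C.ht s = k + 1) : a s = 0 := by
  classical
  have hns : ∀ s, 2 ≤ C.ht s → ∀ i, s ≠ cs.simple i := by
    rintro s h2 i rfl; rw [ht_simple] at h2; omega
  set X : ℕ → W → ℚ := fun m => (C.raise J)^[m] a with hX
  have hXs : ∀ m, X (m + 1) = C.raise J (X m) := fun m => Function.iterate_succ_apply' _ _ _
  have main : ∀ m, ∃ N : ℚ, 0 < N ∧ ∀ s, cs.IsReflection s → s ∈ WJc cs J → C.ht s = k + 1 + m →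
      C.lower J c (X (m + 1)) s = -N * X m s := by
    intro m
    induction m with
    | zero =>
      refine ⟨2 * (k + 1), by positivity, fun s hs hsJ hsk => ?_⟩
      have h1 := C.raise_lower h hcJ hc (X 0) hs hsJ (by omega)
      have h2 : C.raise J (C.lower J c (X 0)) s = 0 := by
        rw [raise]
        refine Finset.sum_eq_zero fun i _ => ?_
        split_ifs with hi
        · refine ha _ (isReflection_cj hs i) (cj_mem_WJ hi.1 hsJ) ?_
          have := C.ht_cj hs (hns s (by omega) i)
          rw [hi.2] at this; omega
        · rfl
      rw [hXs, ← sub_eq_zero]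
      rw [h2, hsk] at h1
      push_cast at h1
      linear_combination -h1
    | succ m ih =>
      obtain ⟨N, hN, ih⟩ := ih
      refine ⟨N + 2 * (k + 1 + (m + 1)), by positivity, fun s hs hsJ hsk => ?_⟩
      have h1 := C.raise_lower h hcJ hc (X (m + 1)) hs hsJ (by omega)
      have h2 : C.raise J (C.lower J c (X (m + 1))) s = -N * X (m + 1) s := by
        rw [hXs m, raise, raise, Finset.mul_sum]
        refine Finset.sum_congr rfl fun i _ => ?_
        split_ifs with hi
        · rw [← hXs m]
          refine ih _ (isReflection_cj hs i) (cj_mem_WJ hi.1 hsJ) ?_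
          have := C.ht_cj hs (hns s (by omega) i)
          rw [hi.2] at this; omega
        · simp
      rw [hXs (m + 1)]
      rw [h2, hsk] at h1
      push_cast at h1
      linear_combination -h1
  obtain ⟨K, hK⟩ : ∃ K, ∀ s, cs.IsReflection s → C.ht s < K := by
    refine ⟨(refls cs).sup C.ht + 1, fun s hs => Nat.lt_succ_of_le ?_⟩
    exact Finset.le_sup (f := C.ht) (mem_refls.2 hs)
  have fin : ∀ d m, K ≤ m + d → ∀ s, cs.IsReflection s → s ∈ WJc cs J → C.ht s = k + 1 + m →
      X m s = 0 := by
    intro d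
    induction d with
    | zero => intro m hm s hs _ hsk; have := hK s hs; omega
    | succ d ih =>
      intro m hm s hs hsJ hsk
      obtain ⟨N, hN, hm2⟩ := main m
      have h1 := hm2 s hs hsJ hsk
      have h2 : C.lower J c (X (m + 1)) s = 0 := by
        rw [lower]
        refine Finset.sum_eq_zero fun i _ => ?_
        split_ifs with hi
        · rw [ih (m + 1) (by omega) _ (isReflection_cj hs i) (cj_mem_WJ hi.1 hsJ), mul_zero]
          have := C.ht_cj hs (hns s (by omega) i)
          rw [hi.2] at this; omega
        · rfl
      rw [h2, zero_eq_mul] at h1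
      exact h1.resolve_left (neg_ne_zero.2 hN.ne')
  exact fin K 0 (by omega) s hs hsJ hsk

theorem bruhat_cj (h : C.SL J) (hs : cs.IsReflection s) (hsJ : s ∈ WJc cs J) {i : B} (hi : i ∈ J)
    (hp : C.pair i (C.rt s) = -1) : bruhatLE cs s (cj cs i s) := by
  have hne : s ≠ cs.simple i := by
    rintro rfl; rw [rt_simple, pair_al, C.diag] at hp; omega
  have hact : C.act s (al i) = al i + C.rt s := by
    rw [act_refl C hs, cor_eq_bil h hs hsJ (inJ_al hi), bil_comm h (C.inJ_rt hs hsJ) (inJ_al hi),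
      bil_al, hp]
    module
  have h1 : bruhatLE cs s (s * cs.simple i) := by
    apply bruhat_mul_simple
    rw [← C.act_al_nonneg_iff, hact]
    exact add_nonneg (al_nonneg i) (C.rt_nonneg hs)
  refine bruhat_trans h1 ?_
  have := bruhat_of_refl (cs := cs) (t := cs.simple i) (x := s * cs.simple i)
    (cs.isReflection_simple i) (by
      rw [C.up_iff (cs.isReflection_simple i), rt_simple, mul_inv_rev, act_mul, hs.inv, cs.inv_simple,
        hact, act_add, act_simple_al_self, act_simple, hp]
      have : -(al i : B → ℤ) + (C.rt s - (-1 : ℤ) • al i) = C.rt s := by module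
      rw [this]; exact C.rt_nonneg hs)
  rwa [← mul_assoc] at this

open Classical in
/-- Heights of reflections below `w` form a partition. -/
theorem card_height_le (h : C.SL J) {w : W} (hwJ : w ∈ WJc cs J) {k : ℕ} (hk : 1 ≤ k) :
    ((edg cs w 1).filter fun t => C.ht t = k + 1).card ≤
      ((edg cs w 1).filter fun t => C.ht t = k).card := by
  obtain ⟨c, hcJ, hc⟩ := C.exists_two_rho h
  set I := (edg cs w 1).filter fun t => C.ht t = k with hI
  set I' := (edg cs w 1).filter fun t => C.ht t = k + 1 with hI'
  have hmem : ∀ t, t ∈ edg cs w 1 ↔ cs.IsReflection t ∧ bruhatLE cs t w := fun t => by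
    rw [mem_edg, mul_one]
  let ext : (I' → ℚ) → W → ℚ := fun a s => if hs : s ∈ I' then a ⟨s, hs⟩ else 0
  have hext : ∀ a b, ext (a + b) = ext a + ext b := by
    intro a b; funext s; simp only [ext, Pi.add_apply]; split_ifs <;> simp
  have hext' : ∀ (r : ℚ) a, ext (r • a) = r • ext a := by
    intro a b; funext s; simp only [ext, Pi.smul_apply]; split_ifs <;> simp
  let f : (I' → ℚ) →ₗ[ℚ] (I → ℚ) :=
    { toFun := fun a s => C.lower J c (ext a) s
      map_add' := by
        intro a b; funext s
        simp only [hext, lower, Pi.add_apply, ← Finset.sum_add_distrib]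
        refine Finset.sum_congr rfl fun i _ => ?_
        split_ifs <;> ring
      map_smul' := by
        intro a b; funext s
        simp only [hext', lower, Pi.smul_apply, smul_eq_mul, Finset.mul_sum, RingHom.id_apply]
        refine Finset.sum_congr rfl fun i _ => ?_
        split_ifs <;> ring }
  have hf : Function.Injective f := by
    rw [← LinearMap.ker_eq_bot, LinearMap.ker_eq_bot']
    intro a ha
    funext s
    have hs := Finset.mem_filter.1 s.2
    have hsr := (hmem _).1 hs.1
    have := C.eq_zero_of_lower_eq_zero h hcJ hc (a := ext a) hk ?_ hsr.1
      (C.bruhat_mem_WJ hsr.2 hwJ) hs.2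
    · simpa [ext] using this
    · intro t ht htJ htk
      by_cases hti : t ∈ I
      · exact congrFun ha ⟨t, hti⟩
      · rw [lower]
        refine Finset.sum_eq_zero fun i _ => ?_
        split_ifs with hi
        · have : cj cs i t ∉ I' := by
            intro hc
            apply hti
            have h1 := (hmem _).1 (Finset.mem_filter.1 hc).1
            exact Finset.mem_filter.2 ⟨(hmem t).2 ⟨ht, bruhat_trans (C.bruhat_cj h ht htJ hi.1 hi.2) h1.2⟩, htk⟩
          simp [ext, this]
        · rfl
  have := LinearMap.finrank_le_finrank_of_injective hf
  simpa using this

end Cartan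

open Classical in
/-- A product of ratios of consecutive `q`-integers along a partition is a product of `q`-integers,
indexed by the conjugate partition. -/
theorem exists_exponents {ι κ : Type*} {S : Finset ι} {I : Finset κ} {f : κ → ℕ}
    (hf : ∀ t ∈ I, 1 ≤ f t)
    (hmono : ∀ k, 1 ≤ k → (I.filter fun t => f t = k + 1).card ≤ (I.filter fun t => f t = k).card)
    (hS : (I.filter fun t => f t = 1).card ≤ S.card) {P : Polynomial ℤ}
    (hP : P * ∏ t ∈ I, qint (f t) = ∏ t ∈ I, qint (f t + 1)) :
    ∃ m : ι → ℕ, (∀ i, i ∉ S → m i = 0) ∧ P = ∏ i ∈ S, qint (m i + 1) := by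
  set h : ℕ → ℕ := fun k => (I.filter fun t => f t = k + 1).card with hh
  have hanti : Antitone h := antitone_nat_of_succ_le fun k => hmono (k + 1) (by omega)
  obtain ⟨N, hN⟩ : ∃ N, ∀ t ∈ I, f t ≤ N := ⟨I.sup f, fun t ht => Finset.le_sup (f := f) ht⟩
  let e : ι → ℕ := fun i => if hi : i ∈ S then (S.equivFin ⟨i, hi⟩ : ℕ) else 0
  let m : ι → ℕ := fun i => if i ∈ S then ((Finset.range N).filter fun k => e i < h k).card else 0
  have hm : ∀ i ∈ S, (Finset.range N).filter (fun k => e i < h k) = Finset.range (m i) := by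
    intro i hi
    have h1 : m i = ((Finset.range N).filter fun k => e i < h k).card := if_pos hi
    rw [h1]
    set A := (Finset.range N).filter fun k => e i < h k with hA
    have hdown : ∀ k ∈ A, ∀ j, j ≤ k → j ∈ A := by
      intro k hk j hj
      rw [hA, Finset.mem_filter, Finset.mem_range] at hk ⊢
      exact ⟨lt_of_le_of_lt hj hk.1, lt_of_lt_of_le hk.2 (hanti hj)⟩
    apply Finset.eq_of_subset_of_card_le
    · intro k hk
      rw [Finset.mem_range]
      have : Finset.range (k + 1) ⊆ A := fun j hj =>
        hdown k hk j (by have := Finset.mem_range.1 hj; omega)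
      have := Finset.card_le_card this
      rw [Finset.card_range] at this; omega
    · rw [Finset.card_range]
  have hcount : ∀ k, (S.filter fun i => e i < h k).card = h k := by
    intro k
    have hk : h k ≤ S.card := (hanti (Nat.zero_le k)).trans hS
    have h1 : (S.filter fun i => e i < h k).card = (Finset.range (h k)).card := by
      refine Finset.card_bij (fun i _ => e i) ?_ ?_ ?_
      · intro i hi; rw [Finset.mem_range]; exact (Finset.mem_filter.1 hi).2
      · intro i hi j hj hij
        have hi := (Finset.mem_filter.1 hi).1
        have hj := (Finset.mem_filter.1 hj).1
        simp only [e, dif_pos hi, dif_pos hj] at hij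
        have := S.equivFin.injective (Fin.ext hij)
        exact congrArg Subtype.val this
      · intro b hb
        rw [Finset.mem_range] at hb
        refine ⟨(S.equivFin.symm ⟨b, by omega⟩ : S), ?_, ?_⟩
        · simp [e, hb]
        · simp [e]
    rw [h1, Finset.card_range]
  have hprod : ∀ F : ℕ → Polynomial ℤ, ∏ i ∈ S, ∏ k ∈ Finset.range (m i), F k =
      ∏ t ∈ I, F (f t - 1) := by
    intro F
    rw [Finset.prod_congr rfl fun i hi => by rw [← hm i hi, Finset.prod_filter], Finset.prod_comm,
      ← Finset.prod_fiberwise_of_maps_to (s := I) (t := Finset.range N) (g := fun t => f t - 1)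
        (fun t ht => Finset.mem_range.2 (by have := hN t ht; have := hf t ht; omega))]
    refine Finset.prod_congr rfl fun k _ => ?_
    rw [← Finset.prod_filter, Finset.prod_const, hcount,
      Finset.prod_congr (g := fun _ => F k) rfl fun t ht => by rw [(Finset.mem_filter.1 ht).2],
      Finset.prod_const]
    congr 1
    refine congrArg Finset.card (Finset.filter_congr fun t ht => ?_)
    have := hf t ht; omega
  have htel : ∀ n : ℕ, qint (n + 1) * ∏ k ∈ Finset.range n, qint (k + 1) =
      ∏ k ∈ Finset.range n, qint (k + 2) := by
    intro n
    induction n with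
    | zero => simp [qint]
    | succ n ih => rw [Finset.prod_range_succ, Finset.prod_range_succ, ← ih]; ring
  refine ⟨m, fun i hi => if_neg hi, ?_⟩
  have h1 := hprod fun k => qint (k + 1)
  have h2 := hprod fun k => qint (k + 2)
  have h3 : (∏ i ∈ S, qint (m i + 1)) * ∏ t ∈ I, qint (f t) = ∏ t ∈ I, qint (f t + 1) := by
    rw [Finset.prod_congr (g := fun t => qint (f t - 1 + 1)) rfl fun t ht => by
        rw [Nat.sub_add_cancel (hf t ht)], ← h1,
      Finset.prod_congr (s₁ := I) (g := fun t => qint (f t - 1 + 2)) rfl fun t ht => by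
        have := hf t ht; congr 1; omega, ← h2, ← Finset.prod_mul_distrib]
    exact Finset.prod_congr rfl fun i _ => htel _
  rw [← h3] at hP
  refine mul_right_cancel₀ ?_ hP
  have : (∏ t ∈ I, qint (f t - 1 + 1)).Monic := Polynomial.monic_prod_of_monic _ _ fun t _ =>
    qint_monic _
  rw [Finset.prod_congr (g := fun t => qint (f t - 1 + 1)) rfl fun t ht => by
        rw [Nat.sub_add_cancel (hf t ht)]]
  exact this.ne_zero

/-- The Poincare polynomial of `w` is a product of `q`-integers indexed by `J`. -/
def Factors (cs : CoxeterSystem M W) [Fintype B] (J : Set B) (w : W) : Prop :=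
  ∃ m : B → ℕ, (∀ i, i ∉ J → m i = 0) ∧ poin cs w = ∏ i, qint (m i + 1)

namespace Cartan
variable [Fintype B] [DecidableEq B] (C : Cartan cs) [Finite W] {J : Set B} {t s : W}

theorem exists_simple_of_ht_eq_one (ht : cs.IsReflection t) (h : C.ht t = 1) :
    ∃ i, t = cs.simple i := by
  have h1 := C.ht_cast ht
  rw [h, hgt] at h1
  obtain ⟨k, hk⟩ := Function.ne_iff.1 (C.rt_ne_zero ht)
  have hk' : 0 < C.rt t k := lt_of_le_of_ne (C.rt_nonneg ht k) (Ne.symm hk)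
  have h2 := Finset.add_sum_erase Finset.univ (C.rt t) (Finset.mem_univ k)
  have h3 : 0 ≤ ∑ i ∈ Finset.univ.erase k, C.rt t i :=
    Finset.sum_nonneg fun i _ => C.rt_nonneg ht i
  have h4 : ∑ i ∈ Finset.univ.erase k, C.rt t i = 0 := by
    push_cast at h1; omega
  refine ⟨k, C.refl_ext ht (cs.isReflection_simple k) (Or.inl ?_)⟩
  rw [rt_simple]
  funext i
  by_cases hik : i = k
  · subst hik; simp [al]; push_cast at h1; omega
  · simp [al, hik]
    exact (Finset.sum_eq_zero_iff_of_nonneg fun i _ => C.rt_nonneg ht i).1 h4 i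
      (Finset.mem_erase.2 ⟨hik, Finset.mem_univ i⟩)

theorem factors_of_SL (h : C.SL J) {w : W} (hs : RatSmooth cs w) (hwJ : w ∈ WJc cs J) :
    Factors cs J w := by
  classical
  set S : Finset B := Finset.univ.filter fun i => i ∈ J with hS
  obtain ⟨m, hm, hp⟩ := exists_exponents (S := S) (I := edg cs w 1) (f := C.ht)
    (fun t ht => C.ht_pos (mem_edg.1 ht).1) (fun k hk => C.card_height_le h hwJ hk) (by
      have : (edg cs w 1).filter (fun t => C.ht t = 1) ⊆ S.image cs.simple := by
        intro t ht
        rw [Finset.mem_filter, mem_edg, mul_one] at ht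
        obtain ⟨i, rfl⟩ := C.exists_simple_of_ht_eq_one ht.1.1 ht.2
        refine Finset.mem_image.2 ⟨i, ?_, rfl⟩
        have h1 := C.inJ_rt ht.1.1 (C.bruhat_mem_WJ ht.1.2 hwJ)
        rw [rt_simple] at h1
        by_contra hi
        have := h1 i (fun hc => hi (by simp [hS, hc]))
        simp [al] at this
      exact (Finset.card_le_card this).trans Finset.card_image_le)
    (C.poin_mul_prod (Or.inl h) hs hwJ)
  refine ⟨m, fun i hi => hm i (by simp [hS, hi]), ?_⟩
  rw [hp]
  refine Finset.prod_subset (Finset.subset_univ _) fun i _ hi => ?_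
  rw [hm i hi]; simp [qint]

end Cartan

namespace Cartan
variable [Fintype B] [DecidableEq B] (C : Cartan cs) [Finite W] {J : Set B} {v u w x y : W}

theorem eq_sum_al (v : B → ℤ) : v = ∑ i, v i • al i := by
  funext k
  simp [al, Finset.sum_apply, Pi.single_apply]

theorem act_nonneg_of_minLeft (hv : MinLeft cs J v) {a : B → ℤ} (ha : 0 ≤ a) (haJ : InJ J a) :
    0 ≤ C.act v a := by
  rw [eq_sum_al a, act_sum]
  refine Finset.sum_nonneg fun i _ => ?_
  rw [act_smul]
  by_cases hi : i ∈ J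
  · exact smul_nonneg (ha i) (C.act_al_nonneg v i (hv i hi))
  · rw [haJ i hi, zero_smul]

theorem minLeft_one : MinLeft cs J (1 : W) := fun i _ => by simp

theorem mem_of_simple_mem_WJ (C : Cartan cs) {i : B} (h : cs.simple i ∈ WJc cs J) : i ∈ J := by
  by_contra hi
  have := C.inJ_rt (cs.isReflection_simple i) h i hi
  rw [rt_simple] at this
  simp [al] at this

theorem simple_bruhat_of_descent (C : Cartan cs) {i : B}
    (h : cs.length (u * cs.simple i) < cs.length u) : bruhatLE cs (cs.simple i) u := by
  have := C.bruhat_mul_simple_le (i := i) (one_bruhat (cs := cs) u) h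
  rwa [one_mul] at this

theorem descent_mem (C : Cartan cs) (hu : u ∈ WJc cs J) {i : B}
    (h : cs.length (u * cs.simple i) < cs.length u) : i ∈ J :=
  C.mem_of_simple_mem_WJ (C.bruhat_mem_WJ (C.simple_bruhat_of_descent h) hu)

/-- Induction on the length of an element of a parabolic subgroup. -/
theorem WJ_induction (C : Cartan cs) {P : W → Prop} (h1 : P 1)
    (h2 : ∀ u i, u ∈ WJc cs J → i ∈ J → cs.length u < cs.length (u * cs.simple i) → P u →
      P (u * cs.simple i)) (hu : u ∈ WJc cs J) : P u := by
  induction hn : cs.length u using Nat.strong_induction_on generalizing u with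
  | _ n ih =>
    by_cases h : u = 1
    · exact h ▸ h1
    obtain ⟨i, hi⟩ := cs.exists_rightDescent_of_ne_one h
    have hi : cs.length (u * cs.simple i) < cs.length u := hi
    have hiJ := C.descent_mem hu hi
    have := h2 (u * cs.simple i) i (Subgroup.mul_mem _ hu (simple_mem_WJ hiJ)) hiJ (by simpa using hi)
      (ih _ (hn ▸ hi) (Subgroup.mul_mem _ hu (simple_mem_WJ hiJ)) rfl)
    simpa using this

theorem length_mul_lt (C : Cartan cs) (hv : MinLeft cs J v) (hu : u ∈ WJc cs J) {i : B} (hi : i ∈ J)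
    (h : cs.length u < cs.length (u * cs.simple i)) :
    cs.length (v * u) < cs.length (v * u * cs.simple i) := by
  rw [← C.act_al_nonneg_iff, act_mul]
  exact C.act_nonneg_of_minLeft hv (C.act_al_nonneg u i h) (C.inJ_act hu (inJ_al hi))

theorem length_add_one {i : B} (h : cs.length x < cs.length (x * cs.simple i)) :
    cs.length (x * cs.simple i) = cs.length x + 1 := by
  have := cs.length_mul_simple x i
  omega

theorem length_mul_of_minLeft (C : Cartan cs) (hv : MinLeft cs J v) (hu : u ∈ WJc cs J) :
    cs.length (v * u) = cs.length v + cs.length u := by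
  refine C.WJ_induction (P := fun u => cs.length (v * u) = cs.length v + cs.length u)
    (by simp) ?_ hu
  intro u i hu hi hl ih
  have h1 := C.length_mul_lt hv hu hi hl
  rw [← mul_assoc, length_add_one h1, length_add_one hl, ih, add_assoc]

theorem exists_minLeft (J : Set B) (w : W) :
    ∃ v u, MinLeft cs J v ∧ u ∈ WJc cs J ∧ w = v * u := by
  induction hn : cs.length w using Nat.strong_induction_on generalizing w with
  | _ n ih =>
    by_cases h : MinLeft cs J w
    · exact ⟨w, 1, h, Subgroup.one_mem _, by simp⟩
    · simp only [MinLeft, not_forall, not_lt] at h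
      obtain ⟨i, hi, hl⟩ := h
      have hl := lt_of_le_of_ne hl (cs.length_mul_simple_ne w i)
      obtain ⟨v, u, hv, hu, h⟩ := ih _ (hn ▸ hl) _ rfl
      exact ⟨v, u * cs.simple i, hv, Subgroup.mul_mem _ hu (simple_mem_WJ hi), by
        rw [← mul_assoc, ← h, simple_mul_simple_cancel_right]⟩

theorem minLeft_unique (C : Cartan cs) {v' u' : W} (hv : MinLeft cs J v) (hv' : MinLeft cs J v')
    (hu : u ∈ WJc cs J) (hu' : u' ∈ WJc cs J) (h : v * u = v' * u') : v = v' ∧ u = u' := by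
  have h1 : v' = v * (u * u'⁻¹) := by rw [← mul_assoc, h]; simp
  have hz := Subgroup.mul_mem _ hu (Subgroup.inv_mem _ hu')
  have h2 := C.length_mul_of_minLeft hv hz
  have h3 := C.length_mul_of_minLeft hv' (Subgroup.inv_mem _ hz)
  rw [← h1] at h2
  have h4 : v' * (u * u'⁻¹)⁻¹ = v := by rw [h1]; simp [mul_assoc]
  rw [h4, cs.length_inv] at h3
  have h5 : cs.length (u * u'⁻¹) = 0 := by omega
  rw [cs.length_eq_zero_iff] at h5
  rw [h5, mul_one] at h1
  exact ⟨h1.symm, by rw [← mul_inv_eq_one, h5]⟩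

theorem bruhat_mul_le_mul (C : Cartan cs) (hv : MinLeft cs J v) (hu : u ∈ WJc cs J)
    (hx : bruhatLE cs x v) (hy : bruhatLE cs y u) : bruhatLE cs (x * y) (v * u) := by
  revert y
  refine C.WJ_induction (P := fun u => ∀ {y}, bruhatLE cs y u → bruhatLE cs (x * y) (v * u))
    ?_ ?_ hu
  · intro y hy; rw [bruhat_one_iff.1 hy]; simpa only [mul_one] using hx
  · intro u i hu hi hl ih y hy
    have h1 := C.length_mul_lt hv hu hi hl
    rw [← mul_assoc]
    rcases C.bruhat_lift_min hy i with h | h <;> rw [simple_mul_simple_cancel_right] at h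
    · have := C.bruhat_mul_both (ih h) h1
      rwa [← mul_assoc, simple_mul_simple_cancel_right] at this
    · exact bruhat_trans (ih h) (bruhat_mul_simple h1)

theorem bruhat_of_minLeft (C : Cartan cs) (hx : MinLeft cs J x) (hu : u ∈ WJc cs J)
    (hv : MinLeft cs J v) (h : bruhatLE cs x (v * u)) : bruhatLE cs x v := by
  revert h
  refine C.WJ_induction (P := fun u => bruhatLE cs x (v * u) → bruhatLE cs x v) ?_ ?_ hu
  · intro h; rwa [mul_one] at h
  · intro u i hu hi hl ih h
    apply ih
    have := C.bruhat_le_mul_simple h (hx i hi)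
    rwa [← mul_assoc, simple_mul_simple_cancel_right] at this

theorem bruhat_mul_iff (C : Cartan cs) {v' u' : W} (hv : MinLeft cs J v) (hv' : MinLeft cs J v')
    (hu : u ∈ WJc cs J) (hu' : u' ∈ WJc cs J)
    (h : ∀ y ∈ WJc cs J, bruhatLE cs y (v * u) → bruhatLE cs y u) :
    bruhatLE cs (v' * u') (v * u) ↔ bruhatLE cs v' v ∧ bruhatLE cs u' u := by
  refine ⟨fun h1 => ⟨?_, ?_⟩, fun h1 => C.bruhat_mul_le_mul hv hu h1.1 h1.2⟩
  · refine C.bruhat_of_minLeft hv' hu hv (bruhat_trans ?_ h1)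
    have := C.bruhat_mul_le_mul hv' hu' (bruhat_refl v') (one_bruhat u')
    rwa [mul_one] at this
  · refine h u' hu' (bruhat_trans ?_ h1)
    have := C.bruhat_mul_le_mul hv' hu' (one_bruhat v') (bruhat_refl u')
    rwa [one_mul] at this

open Classical in
/-- The multiplicativity of Poincaré polynomials in a Billey–Postnikov decomposition. -/
theorem poin_mul_of_max (C : Cartan cs) (hv : MinLeft cs J v) (hu : u ∈ WJc cs J)
    (h : ∀ y ∈ WJc cs J, bruhatLE cs y (v * u) → bruhatLE cs y u) :
    poin cs (v * u) = (∑ x ∈ (ivl cs v).filter (MinLeft cs J), Polynomial.X ^ cs.length x) *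
      poin cs u := by
  rw [poin_eq, poin_eq, Finset.sum_mul_sum, ← Finset.sum_product']
  have hm : ∀ u', bruhatLE cs u' u → u' ∈ WJc cs J := fun u' h => C.bruhat_mem_WJ h hu
  symm
  refine Finset.sum_bij (fun p _ => p.1 * p.2) ?_ ?_ ?_ ?_
  · rintro ⟨v', u'⟩ hp
    simp only [Finset.mem_product, Finset.mem_filter, mem_ivl] at hp ⊢
    exact C.bruhat_mul_le_mul hv hu hp.1.1 hp.2
  · rintro ⟨v', u'⟩ hp ⟨v'', u''⟩ hp' he
    simp only [Finset.mem_product, Finset.mem_filter, mem_ivl] at hp hp' he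
    obtain ⟨rfl, rfl⟩ := C.minLeft_unique hp.1.2 hp'.1.2 (hm _ hp.2) (hm _ hp'.2) he
    rfl
  · intro x hx
    obtain ⟨v', u', hv', hu', rfl⟩ := exists_minLeft (cs := cs) J x
    rw [mem_ivl] at hx
    have := (C.bruhat_mul_iff hv hv' hu hu' h).1 hx
    exact ⟨(v', u'), by simp [mem_ivl, this, hv'], rfl⟩
  · rintro ⟨v', u'⟩ hp
    simp only [Finset.mem_product, Finset.mem_filter, mem_ivl] at hp
    rw [← pow_add, C.length_mul_of_minLeft hp.1.2 (hm _ hp.2)]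

theorem length_lt_of_notMem (C : Cartan cs) (hu : u ∈ WJc cs J) {i : B} (hi : i ∉ J) :
    cs.length u < cs.length (u * cs.simple i) := by
  rcases lt_or_gt_of_ne (cs.length_mul_simple_ne u i) with h | h
  · exact absurd (C.descent_mem hu h) hi
  · exact h

theorem exists_max (C : Cartan cs) (J : Set B) (w : W) :
    ∃ u, u ∈ WJc cs J ∧ bruhatLE cs u w ∧ ∀ y ∈ WJc cs J, bruhatLE cs y w → bruhatLE cs y u := by
  have hw : w ∈ WJc cs (Set.univ : Set B) := by
    rw [WJc, Set.image_univ, cs.subgroup_closure_range_simple]; trivial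
  refine C.WJ_induction (P := fun w => ∃ u, u ∈ WJc cs J ∧ bruhatLE cs u w ∧
    ∀ y ∈ WJc cs J, bruhatLE cs y w → bruhatLE cs y u) ?_ ?_ hw
  · exact ⟨1, Subgroup.one_mem _, bruhat_refl _, fun y _ h => h⟩
  · rintro w i - - hl ⟨u, hu, huw, hmax⟩
    by_cases hi : i ∈ J
    · have key : ∀ y ∈ WJc cs J, bruhatLE cs y (w * cs.simple i) →
          bruhatLE cs y u ∨ bruhatLE cs (y * cs.simple i) u := by
        intro y hy h
        rcases C.bruhat_lift_min h i with h | h <;> rw [simple_mul_simple_cancel_right] at h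
        · exact Or.inr (hmax _ (Subgroup.mul_mem _ hy (simple_mem_WJ hi)) h)
        · exact Or.inl (hmax _ hy h)
      rcases lt_or_gt_of_ne (cs.length_mul_simple_ne u i) with h | h
      · refine ⟨u, hu, bruhat_trans huw (bruhat_mul_simple hl), fun y hy hyw => ?_⟩
        exact (key y hy hyw).elim id fun h1 => (C.bruhat_mul_simple_le_iff h).1 h1
      · refine ⟨u * cs.simple i, Subgroup.mul_mem _ hu (simple_mem_WJ hi),
          C.bruhat_mul_both huw hl, fun y hy hyw => ?_⟩
        rcases key y hy hyw with h1 | h1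
        · exact bruhat_trans h1 (bruhat_mul_simple h)
        · have := C.bruhat_mul_both h1 h
          rwa [simple_mul_simple_cancel_right] at this
    · refine ⟨u, hu, bruhat_trans huw (bruhat_mul_simple hl), fun y hy hyw => hmax y hy ?_⟩
      have := C.bruhat_le_mul_simple hyw (C.length_lt_of_notMem hy hi)
      rwa [simple_mul_simple_cancel_right] at this

open Classical in
/-- A criterion for a parabolic decomposition to be a Billey–Postnikov decomposition. -/
theorem max_of_card (C : Cartan cs) (hv : MinLeft cs J v) (hu : u ∈ WJc cs J)
    (hr : (edg cs (v * u) 1).card = cs.length (v * u))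
    (hc : cs.length v ≤ ((edg cs (v * u) 1).filter fun t => t ∉ WJc cs J).card) :
    ∀ y ∈ WJc cs J, bruhatLE cs y (v * u) → bruhatLE cs y u := by
  obtain ⟨u', hu', hle, hmax⟩ := C.exists_max J (v * u)
  have h1 : bruhatLE cs u u' := hmax u hu (by
    have := C.bruhat_mul_le_mul hv hu (one_bruhat v) (bruhat_refl u)
    rwa [one_mul] at this)
  have h2 := C.deodhar (one_bruhat (cs := cs) u')
  have h3 : edg cs u' 1 ⊆ (edg cs (v * u) 1).filter fun t => t ∈ WJc cs J := by
    intro t ht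
    rw [mem_edg, mul_one] at ht
    rw [Finset.mem_filter, mem_edg, mul_one]
    exact ⟨⟨ht.1, bruhat_trans ht.2 hle⟩, C.bruhat_mem_WJ ht.2 hu'⟩
  have h4 := Finset.card_le_card h3
  have h5 := Finset.card_filter_add_card_filter_not (s := edg cs (v * u) 1) (fun t => t ∈ WJc cs J)
  rw [C.length_mul_of_minLeft hv hu] at hr
  have h6 : u = u' := by
    by_contra hne
    have := bruhat_length_lt h1 hne
    omega
  rwa [← h6] at hmax
end Cartan

theorem ratSmooth_iff_reverse [Fintype B] [DecidableEq B] [Finite W] (w : W) :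
    RatSmooth cs w ↔ (poin cs w).reverse = poin cs w := by
  rw [Polynomial.ext_iff]
  simp only [Polynomial.coeff_reverse, Cartan.natDegree_poin]
  constructor
  · intro h n
    by_cases hn : n ≤ cs.length w
    · rw [Polynomial.revAt_le hn, ← h n hn]
    · rw [Polynomial.revAt_eq_self_of_lt (not_le.1 hn)]
  · intro h n hn
    rw [← h n, Polynomial.revAt_le hn]

theorem qint_reverse (m : ℕ) : (qint (m + 1)).reverse = qint (m + 1) := by
  rw [Polynomial.reverse, qint_natDegree, qint_reflect]

theorem poin_ne_zero [Fintype B] [DecidableEq B] [Finite W] (w : W) : poin cs w ≠ 0 := fun h => by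
  have h1 := coeff_poin (cs := cs) w 0
  rw [h, Polynomial.coeff_zero, eq_comm, Nat.cast_eq_zero, Finset.card_eq_zero] at h1
  exact Finset.eq_empty_iff_forall_notMem.1 h1 1
    (Finset.mem_filter.2 ⟨mem_ivl.2 (one_bruhat w), cs.length_one⟩)

theorem ratSmooth_of_mul [Fintype B] [DecidableEq B] [Finite W] {u w : W} {Q : Polynomial ℤ}
    (hQ : Q.reverse = Q) (h : poin cs w = Q * poin cs u) (hw : RatSmooth cs w) :
    RatSmooth cs u := by
  rw [ratSmooth_iff_reverse] at hw ⊢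
  have hQ0 : Q ≠ 0 := by rintro rfl; exact poin_ne_zero w (by rw [h, zero_mul])
  rw [h, Polynomial.reverse_mul_of_domain, hQ] at hw
  exact mul_left_cancel₀ hQ0 hw

theorem poin_inv [Finite W] (w : W) : poin cs w⁻¹ = poin cs w := by
  rw [poin_eq, poin_eq]
  refine Finset.sum_bij (fun x _ => x⁻¹) ?_ (fun _ _ _ _ h => inv_injective h) ?_ ?_
  · intro x hx
    rw [mem_ivl] at hx ⊢
    rw [← bruhat_inv_iff, inv_inv]; exact hx
  · intro x hx
    rw [mem_ivl] at hx
    exact ⟨x⁻¹, mem_ivl.2 (bruhat_inv hx), inv_inv x⟩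
  · intro x _
    rw [cs.length_inv]

theorem ratSmooth_inv [Finite W] {w : W} (h : RatSmooth cs w) : RatSmooth cs w⁻¹ := by
  intro i hi
  rw [poin_inv, cs.length_inv]
  exact h i (by rwa [cs.length_inv] at hi)

/-- The element `s_{c (k-1)} ⋯ s_{c 0}`. -/
def chn (cs : CoxeterSystem M W) (c : ℕ → B) : ℕ → W
  | 0 => 1
  | k + 1 => cs.simple (c k) * chn cs c k

namespace Cartan
variable [Fintype B] [DecidableEq B] (C : Cartan cs) [Finite W] {J : Set B} {v u w x y : W}

/-- The elements `chn cs c k`, `k ≤ m`, are exactly the minimal coset representatives below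
`chn cs c m`. -/
structure IsChain (J : Set B) (c : ℕ → B) (m : ℕ) : Prop where
  nonneg : ∀ k < m, 0 ≤ C.act (chn cs c k)⁻¹ (al (c k))
  notInJ : ∀ k < m, ¬ InJ J (C.act (chn cs c k)⁻¹ (al (c k)))
  other : ∀ i k, i < k → k < m → c k = c i ∨ C.act (chn cs c i)⁻¹ (al (c k)) ≤ 0 ∨
    InJ J (C.act (chn cs c i)⁻¹ (al (c k)))

variable {C} {c : ℕ → B} {m : ℕ}

theorem IsChain.length (h : C.IsChain J c m) {k : ℕ} (hk : k ≤ m) :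
    cs.length (chn cs c k) = k := by
  induction k with
  | zero => simp [chn]
  | succ k ih =>
    have h1 := (C.up_iff (cs.isReflection_simple (c k)) (chn cs c k)).2 (by
      rw [rt_simple]; exact h.nonneg k hk)
    have h2 := cs.length_simple_mul (chn cs c k) (c k)
    rw [chn]
    have := ih (by omega)
    omega

theorem IsChain.minLeft (h : C.IsChain J c m) {k : ℕ} (hk : k ≤ m) :
    MinLeft cs J (chn cs c k) := by
  induction k with
  | zero => exact minLeft_one
  | succ k ih =>
    intro j hj
    have h1 := C.act_al_nonneg _ _ (ih (by omega) j hj)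
    rw [← C.act_al_nonneg_iff, chn, act_mul]
    apply ((isRoot_al j).act _).act_simple_nonneg h1
    intro h2
    apply h.notInJ k hk
    rw [← h2, act_inv_act]
    exact inJ_al hj

theorem minLeft_of_simple_mul {i : B} (hx : MinLeft cs J x)
    (h : cs.length (cs.simple i * x) < cs.length x) : MinLeft cs J (cs.simple i * x) := by
  intro j hj
  have h1 := hx j hj
  have h2 := cs.length_simple_mul (x * cs.simple j) i
  rw [← mul_assoc] at h2
  omega

theorem IsChain.exists_eq (h : C.IsChain J c m) {k : ℕ} (hk : k ≤ m) (hx : MinLeft cs J x)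
    (hxk : bruhatLE cs x (chn cs c k)) : ∃ i ≤ k, x = chn cs c i := by
  induction k generalizing x with
  | zero => exact ⟨0, le_rfl, bruhat_one_iff.1 hxk⟩
  | succ k ih =>
    have ih := fun {x} => @ih x (by omega)
    by_cases hlt : cs.length (cs.simple (c k) * x) < cs.length x
    · have h1 := bruhat_inv hxk
      rw [chn, mul_inv_rev, cs.inv_simple] at h1
      have h2 : bruhatLE cs (cs.simple (c k) * x) (chn cs c k) := by
        rcases C.bruhat_lift_min h1 (c k) with h1 | h1 <;>
          rw [simple_mul_simple_cancel_right, ← bruhat_inv_iff] at h1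
        · simpa only [mul_inv_rev, inv_inv, cs.inv_simple] using h1
        · rw [inv_inv, inv_inv] at h1
          exact bruhat_trans (bruhat_of_refl' (cs.isReflection_simple _) hlt) h1
      obtain ⟨i, hi, h3⟩ := ih (minLeft_of_simple_mul hx hlt) h2
      have h4 : x = cs.simple (c k) * chn cs c i := by rw [← h3, simple_mul_simple_cancel_left]
      rcases hi.lt_or_eq with hi | rfl
      · rcases h.other i k hi hk with h5 | h5 | h5
        · exact ⟨i + 1, by omega, by rw [h4, h5]; rfl⟩
        · exfalso
          rw [← rt_simple C, ← C.down_iff (cs.isReflection_simple _), ← h4, ← h3] at h5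
          omega
        · exfalso
          have hr : cs.IsReflection ((chn cs c i)⁻¹ * cs.simple (c k) * (chn cs c i)⁻¹⁻¹) :=
            (cs.isReflection_simple _).conj _
          have h6 : (chn cs c i)⁻¹ * cs.simple (c k) * (chn cs c i)⁻¹⁻¹ ∈ WJc cs J := by
            apply C.mem_WJ_of_inJ hr
            rcases C.rt_conj (cs.isReflection_simple (c k)) (chn cs c i)⁻¹ with h7 | h7
            · rw [h7, rt_simple]; exact h5
            · rw [h7, rt_simple]; exact h5.neg
          have h8 := (C.minLeft_unique hx (h.minLeft (k := i) (by omega)) (Subgroup.one_mem _) h6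
            (by rw [h4]; simp [mul_assoc])).2
          have h9 := hr.odd_length
          rw [← h8] at h9
          simp at h9
      · exact ⟨i + 1, le_rfl, h4⟩
    · have h1 := bruhat_inv hxk
      rw [chn, mul_inv_rev, cs.inv_simple] at h1
      have h2 := C.bruhat_le_mul_simple h1 (i := c k) (by
        rw [show x⁻¹ * cs.simple (c k) = (cs.simple (c k) * x)⁻¹ by simp, cs.length_inv,
          cs.length_inv]
        have := cs.length_simple_mul x (c k)
        omega)
      rw [simple_mul_simple_cancel_right, bruhat_inv_iff] at h2
      obtain ⟨i, hi, h3⟩ := ih hx h2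
      exact ⟨i, by omega, h3⟩

theorem IsChain.bruhat (h : C.IsChain J c m) {i k : ℕ} (hik : i ≤ k) (hk : k ≤ m) :
    bruhatLE cs (chn cs c i) (chn cs c k) := by
  induction k, hik using Nat.le_induction with
  | base => exact bruhat_refl _
  | succ k _ ih =>
    refine bruhat_trans (ih (by omega)) (bruhat_of_refl (cs.isReflection_simple (c k)) ?_)
    have h1 := h.length hk
    rw [chn] at h1
    rw [h1, h.length (by omega : k ≤ m)]
    omega

open Classical in
theorem IsChain.sum_eq (h : C.IsChain J c m) :
    ∑ x ∈ (ivl cs (chn cs c m)).filter (MinLeft cs J), Polynomial.X ^ cs.length x =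
      qint (m + 1) := by
  rw [qint]
  symm
  refine Finset.sum_bij (fun k _ => chn cs c k) ?_ ?_ ?_ ?_
  · intro k hk
    rw [Finset.mem_range] at hk
    rw [Finset.mem_filter, mem_ivl]
    exact ⟨h.bruhat (by omega) le_rfl, h.minLeft (by omega)⟩
  · intro k hk l hl he
    rw [Finset.mem_range] at hk hl
    rw [← h.length (k := k) (by omega), he, h.length (by omega)]
  · intro x hx
    rw [Finset.mem_filter, mem_ivl] at hx
    obtain ⟨i, hi, rfl⟩ := h.exists_eq le_rfl hx.2 hx.1
    exact ⟨i, by rw [Finset.mem_range]; omega, rfl⟩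
  · intro k hk
    rw [Finset.mem_range] at hk
    rw [h.length (by omega)]

open Classical in
/-- Stripping a chain off a rationally smooth element. -/
theorem IsChain.strip (h : C.IsChain J c m) (hu : u ∈ WJc cs J)
    (hs : RatSmooth cs (chn cs c m * u))
    (hc : m ≤ ((edg cs (chn cs c m * u) 1).filter fun t => t ∉ WJc cs J).card) :
    poin cs (chn cs c m * u) = qint (m + 1) * poin cs u ∧ RatSmooth cs u := by
  have h1 := C.poin_mul_of_max (h.minLeft le_rfl) hu (C.max_of_card (h.minLeft le_rfl) hu
    (C.regular_of_ratSmooth hs 1 (one_bruhat _)) (by rwa [h.length le_rfl]))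
  rw [h.sum_eq] at h1
  exact ⟨h1, ratSmooth_of_mul (qint_reverse m) h1 hs⟩
end Cartan

namespace Cartan
variable [Fintype B] [DecidableEq B] (C : Cartan cs) [Finite W] {J J' K : Set B} {v u w x y : W}

/-- The elements `chn cs c k`, `k ≤ m`, are all the minimal coset representatives of `W_J / W_{J'}`. -/
structure IsFullChain (J J' : Set B) (c : ℕ → B) (m : ℕ) : Prop where
  mem : ∀ k < m, c k ∈ J
  nonneg : ∀ k < m, 0 ≤ C.act (chn cs c k)⁻¹ (al (c k))
  notInJ : ∀ k < m, ¬ InJ J' (C.act (chn cs c k)⁻¹ (al (c k)))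
  cover : ∀ k ≤ m, ∀ j ∈ J, (k < m ∧ j = c k) ∨ C.act (chn cs c k)⁻¹ (al j) ≤ 0 ∨
    InJ J' (C.act (chn cs c k)⁻¹ (al j))

variable {C} {c : ℕ → B} {m n : ℕ}

theorem IsFullChain.isChain (h : C.IsFullChain J J' c n) (hm : m ≤ n) : C.IsChain J' c m where
  nonneg k hk := h.nonneg k (by omega)
  notInJ k hk := h.notInJ k (by omega)
  other i k hi hk := by
    rcases h.cover i (by omega) (c k) (h.mem k (by omega)) with h1 | h1 | h1
    · exact Or.inl h1.2
    · exact Or.inr (Or.inl h1)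
    · exact Or.inr (Or.inr h1)

/-- Left multiplication by a simple reflection with root in `gΦ_J` leaves the coset `g W_J`. -/
theorem not_minLeft_of_inJ (C : Cartan cs) {i : B} (hx : MinLeft cs J x)
    (h5 : InJ J (C.act x⁻¹ (al i))) : ¬ MinLeft cs J (cs.simple i * x) := by
  intro h'
  have hr : cs.IsReflection (x⁻¹ * cs.simple i * x⁻¹⁻¹) := (cs.isReflection_simple _).conj _
  have h6 : x⁻¹ * cs.simple i * x⁻¹⁻¹ ∈ WJc cs J := by
    apply C.mem_WJ_of_inJ hr
    rcases C.rt_conj (cs.isReflection_simple i) x⁻¹ with h7 | h7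
    · rw [h7, rt_simple]; exact h5
    · rw [h7, rt_simple]; exact h5.neg
  have h8 := (C.minLeft_unique h' hx (Subgroup.one_mem _) h6 (by simp [mul_assoc])).2
  have h9 := hr.odd_length
  rw [← h8] at h9
  simp at h9

theorem exists_left_descent (C : Cartan cs) (hx : x ∈ WJc cs J) (h1 : x ≠ 1) :
    ∃ i ∈ J, cs.length (cs.simple i * x) < cs.length x := by
  have hx' := Subgroup.inv_mem _ hx
  obtain ⟨i, hi⟩ := cs.exists_rightDescent_of_ne_one (inv_ne_one.2 h1)
  have hi : cs.length (x⁻¹ * cs.simple i) < cs.length x⁻¹ := hi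
  refine ⟨i, C.descent_mem hx' hi, ?_⟩
  rwa [cs.length_inv, show x⁻¹ * cs.simple i = (cs.simple i * x)⁻¹ by simp, cs.length_inv] at hi

theorem IsFullChain.exists_eq (h : C.IsFullChain J J' c n) (hx : MinLeft cs J' x)
    (hxJ : x ∈ WJc cs J) : ∃ k ≤ n, x = chn cs c k := by
  induction hl : cs.length x using Nat.strong_induction_on generalizing x with
  | _ l ih =>
    by_cases h1 : x = 1
    · exact ⟨0, by omega, h1⟩
    obtain ⟨i, hi, hlt⟩ := C.exists_left_descent hxJ h1
    obtain ⟨k, hk, h2⟩ := ih _ (hl ▸ hlt) (minLeft_of_simple_mul hx hlt)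
      (Subgroup.mul_mem _ (simple_mem_WJ hi) hxJ) rfl
    have h4 : x = cs.simple i * chn cs c k := by rw [← h2, simple_mul_simple_cancel_left]
    rcases h.cover k hk i hi with h5 | h5 | h5
    · exact ⟨k + 1, by omega, by rw [h4, h5.2]; rfl⟩
    · exfalso
      rw [← rt_simple C, ← C.down_iff (cs.isReflection_simple _), ← h4, ← h2] at h5
      omega
    · rw [h4] at hx
      exact absurd hx (C.not_minLeft_of_inJ ((h.isChain le_rfl).minLeft hk) h5)

theorem WJ_mono (h : J' ⊆ J) : WJc cs J' ≤ WJc cs J := Subgroup.closure_mono (Set.image_mono h)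

theorem IsFullChain.exists_mul (h : C.IsFullChain J J' c n) (hJ : J' ⊆ J) (hw : w ∈ WJc cs J) :
    ∃ k ≤ n, ∃ u ∈ WJc cs J', w = chn cs c k * u := by
  obtain ⟨v, u, hv, hu, rfl⟩ := exists_minLeft (cs := cs) J' w
  have hvJ : v ∈ WJc cs J := by
    have := Subgroup.mul_mem _ hw (Subgroup.inv_mem _ (WJ_mono hJ hu))
    rwa [mul_inv_cancel_right] at this
  obtain ⟨k, hk, rfl⟩ := h.exists_eq hv hvJ
  exact ⟨k, hk, u, hu, rfl⟩

open Classical in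
/-- `w` has a chain which can be stripped off on the left with the remaining factor in `W_{J'}`. -/
def Strip (C : Cartan cs) (J' : Set B) (w : W) : Prop :=
  ∃ c m u, C.IsChain J' c m ∧ u ∈ WJc cs J' ∧ w = chn cs c m * u ∧
    m ≤ ((edg cs w 1).filter fun t => t ∉ WJc cs J').card

theorem factors_of_strip {i : B} (hi : i ∈ J) (hw : RatSmooth cs w)
    (h : C.Strip (J \ {i}) w ∨ C.Strip (J \ {i}) w⁻¹)
    (ih : ∀ u ∈ WJc cs (J \ {i}), RatSmooth cs u → Factors cs (J \ {i}) u) :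
    Factors cs J w := by
  obtain ⟨m, u, hp, hu, hs⟩ : ∃ m u, poin cs w = qint (m + 1) * poin cs u ∧
      u ∈ WJc cs (J \ {i}) ∧ RatSmooth cs u := by
    rcases h with h | h
    · obtain ⟨c, m, u, hc, hu, rfl, hm⟩ := h
      obtain ⟨h1, h2⟩ := hc.strip hu hw hm
      exact ⟨m, u, h1, hu, h2⟩
    · obtain ⟨c, m, u, hc, hu, he, hm⟩ := h
      have hw' := ratSmooth_inv hw
      rw [he] at hm hw'
      obtain ⟨h1, h2⟩ := hc.strip hu hw' hm
      rw [← he, poin_inv] at h1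
      exact ⟨m, u, h1, hu, h2⟩
  obtain ⟨f, hf, hpu⟩ := ih u hu hs
  refine ⟨Function.update f i m, fun j hj => ?_, ?_⟩
  · have hne : j ≠ i := by rintro rfl; exact hj hi
    rw [Function.update_of_ne hne]
    exact hf j fun h => hj h.1
  · rw [hp, hpu, ← Finset.mul_prod_erase _ _ (Finset.mem_univ i),
      ← Finset.mul_prod_erase _ _ (Finset.mem_univ i), Function.update_self,
      hf i (fun h => h.2 rfl)]
    simp only [zero_add, qint, Finset.range_one, Finset.sum_singleton, pow_zero, one_mul]
    congr 1
    refine Finset.prod_congr rfl fun j hj => ?_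
    rw [Function.update_of_ne (Finset.ne_of_mem_erase hj)]

open Classical in
/-- The reflections below `a ≤ w` that are not in `W_{J'}`. -/
theorem card_outside_mono (C : Cartan cs) (h : bruhatLE cs x w) :
    ((edg cs x 1).filter fun t => t ∉ WJc cs J').card ≤
      ((edg cs w 1).filter fun t => t ∉ WJc cs J').card := by
  apply Finset.card_le_card
  intro t ht
  rw [Finset.mem_filter, mem_edg, mul_one] at ht ⊢
  exact ⟨⟨ht.1.1, bruhat_trans ht.1.2 h⟩, ht.2⟩

theorem pair_al_eq_zero (C : Cartan cs) {i j : B} (hij : i ≠ j) (h : M i j = 2) : C.A i j = 0 := by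
  rcases C.off i j hij with h | h | h | h | h | h <;> omega

theorem IsFullChain.isolated (C : Cartan cs) {j : B} (hj : j ∈ J)
    (h : ∀ k ∈ J, k ≠ j → M j k = 2) : C.IsFullChain J (J \ {j}) (fun _ => j) 1 where
  mem k hk := hj
  nonneg k hk := by
    obtain rfl : k = 0 := by omega
    simpa [chn] using al_nonneg j
  notInJ k hk h := by
    obtain rfl : k = 0 := by omega
    have := h j (by simp)
    simp [chn, al] at this
  cover k hk l hl := by
    interval_cases k
    · by_cases hlj : l = j
      · exact Or.inl ⟨by omega, hlj⟩
      · right; right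
        rw [chn, inv_one, act_one]
        exact inJ_al ⟨hl, hlj⟩
    · right
      simp only [chn, mul_one, cs.inv_simple]
      by_cases hlj : l = j
      · left; rw [hlj, act_simple_al_self, neg_nonpos]; exact al_nonneg j
      · right
        rw [act_simple, pair_al, C.pair_al_eq_zero (Ne.symm hlj) (h l hl hlj), zero_smul, sub_zero]
        exact inJ_al ⟨hl, hlj⟩
end Cartan

namespace Cartan
variable [Fintype B] [DecidableEq B] (C : Cartan cs) [Finite W] {J J' K : Set B} {v u w x y : W}
  {c : ℕ → B} {m n : ℕ}

theorem act_chn_zero (c : ℕ → B) (v : B → ℤ) : C.act (chn cs c 0)⁻¹ v = v := by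
  rw [chn, inv_one, act_one]

theorem act_chn_succ (c : ℕ → B) (k : ℕ) (v : B → ℤ) : C.act (chn cs c (k + 1))⁻¹ v =
    C.act (chn cs c k)⁻¹ v - C.pair (c k) v • C.act (chn cs c k)⁻¹ (al (c k)) := by
  rw [chn, mul_inv_rev, act_mul, cs.inv_simple, act_simple, act_sub, act_smul]

theorem chn_mem (c : ℕ → B) (m : ℕ) (h : ∀ k < m, c k ∈ K) : chn cs c m ∈ WJc cs K := by
  induction m with
  | zero => exact Subgroup.one_mem _
  | succ m ih =>
    exact Subgroup.mul_mem _ (simple_mem_WJ (h m (by omega))) (ih fun k hk => h k (by omega))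

theorem chn_succ' (cs : CoxeterSystem M W) (c : ℕ → B) (m : ℕ) :
    chn cs c (m + 1) = chn cs (fun k => c (k + 1)) m * cs.simple (c 0) := by
  induction m with
  | zero => simp [chn]
  | succ m ih => rw [chn, ih, ← mul_assoc]; rfl

section G2
variable {i j : B}

theorem eq_simple_of_inJ {t : W} (ht : cs.IsReflection t) (h1 : InJ {i, j} (C.rt t))
    (h2 : InJ (J \ {i}) (C.rt t)) : t = cs.simple j := by
  apply C.refl_ext' (c := 1) (d := C.rt t j) ht (cs.isReflection_simple j) one_ne_zero
  rw [one_smul, rt_simple]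
  funext k
  by_cases hk : k = j
  · subst hk; simp [al]
  · simp only [al, Pi.smul_apply, Pi.single_eq_of_ne hk, smul_zero]
    by_cases hk' : k = i
    · exact h2 k fun h => h.2 hk'
    · exact h1 k (by simp [hk, hk'])

/-- A chain in a rank two parabolic subgroup, followed by the second generator, can be stripped
off. -/
theorem strip_of_rank_two {z : W} (hij : i ≠ j) (hj : j ∈ J) (hc : C.IsChain (J \ {i}) c m)
    (hcm : ∀ k < m, c k ∈ ({i, j} : Set B)) (hz : z ∈ WJc cs ((J \ {i}) \ {j})) :
    C.Strip (J \ {i}) (chn cs c m * (cs.simple j * z)) := by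
  classical
  have hjJ : j ∈ J \ {i} := ⟨hj, hij.symm⟩
  have hsz : cs.simple j * z ∈ WJc cs (J \ {i}) :=
    Subgroup.mul_mem _ (simple_mem_WJ hjJ) (WJ_mono Set.sdiff_subset hz)
  refine ⟨c, m, _, hc, hsz, rfl, ?_⟩
  have hsj : MinLeft cs ((J \ {i}) \ {j}) (cs.simple j) := by
    intro k hk
    have hkj : k ≠ j := fun h => hk.2 h
    rw [← C.act_al_nonneg_iff, act_simple, pair_al]
    have h1 : C.A j k ≤ 0 := by
      rcases C.off j k hkj.symm with h | h | h | h | h | h <;> omega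
    have h2 := al_nonneg k
    have h3 : 0 ≤ (-C.A j k) • al j := smul_nonneg (by omega) (al_nonneg j)
    rw [show al k - C.A j k • al j = al k + (-C.A j k) • al j by module]
    exact add_nonneg h2 h3
  have h1 : bruhatLE cs (chn cs c m * cs.simple j) (chn cs c m * (cs.simple j * z)) := by
    apply C.bruhat_mul_le_mul (hc.minLeft le_rfl) hsz (bruhat_refl _)
    simpa only [mul_one] using C.bruhat_mul_le_mul hsj hz (bruhat_refl _) (one_bruhat z)
  refine le_trans ?_ (C.card_outside_mono h1)
  have h2 := C.deodhar (one_bruhat (cs := cs) (chn cs c m * cs.simple j))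
  rw [C.length_mul_of_minLeft (hc.minLeft le_rfl) (simple_mem_WJ hjJ), hc.length le_rfl,
    cs.length_simple] at h2
  have h3 := Finset.card_filter_add_card_filter_not (s := edg cs (chn cs c m * cs.simple j) 1)
    (fun t => t ∈ WJc cs (J \ {i}))
  have h4 : ((edg cs (chn cs c m * cs.simple j) 1).filter
      fun t => t ∈ WJc cs (J \ {i})).card ≤ 1 := by
    rw [← Finset.card_singleton (cs.simple j)]
    apply Finset.card_le_card
    intro t ht
    rw [Finset.mem_filter, mem_edg, mul_one] at ht
    rw [Finset.mem_singleton]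
    apply C.eq_simple_of_inJ (J := J) (i := i) ht.1.1 _ (C.inJ_rt ht.1.1 ht.2)
    refine C.inJ_rt ht.1.1 (C.bruhat_mem_WJ ht.1.2 ?_)
    exact Subgroup.mul_mem _ (chn_mem c m hcm) (simple_mem_WJ (by simp))
  omega

/-- The letters `i, j, i, j, …`. -/
def alt (i j : B) (k : ℕ) : B := if k % 2 = 0 then i else j

theorem isFullChain_G2 (hi : i ∈ J) (hj : j ∈ J) (hij : i ≠ j) (hM : M i j = 6)
    (h : ∀ k ∈ J, k ≠ i → k ≠ j → M i k = 2 ∧ M j k = 2) :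
    C.IsFullChain J (J \ {i}) (alt i j) 5 := by
  obtain ⟨a, b, ha, hb, hab, ha0, hb0⟩ : ∃ a b, C.A i j = -a ∧ C.A j i = -b ∧ a * b = 3 ∧
      0 < a ∧ 0 < b := by
    rcases C.off i j hij with h | h | h | h | h | h
    · omega
    · omega
    · omega
    · omega
    · exact ⟨1, 3, h.2.1, h.2.2, rfl, by omega, by omega⟩
    · exact ⟨3, 1, h.2.1, h.2.2, rfl, by omega, by omega⟩
  have c0 : alt i j 0 = i := rfl
  have c1 : alt i j 1 = j := rfl
  have c2 : alt i j 2 = i := rfl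
  have c3 : alt i j 3 = j := rfl
  have c4 : alt i j 4 = i := rfl
  have c5 : alt i j 5 = j := rfl
  have q0 : C.act (chn cs (alt i j) 0)⁻¹ (al i) = al i := C.act_chn_zero _ _
  have r0 : C.act (chn cs (alt i j) 0)⁻¹ (al j) = al j := C.act_chn_zero _ _
  have step := fun k v => C.act_chn_succ (alt i j) k v
  have q1 : C.act (chn cs (alt i j) 1)⁻¹ (al i) = - al i := by
    rw [step, c0, q0, pair_al, C.diag]; module
  have r1 : C.act (chn cs (alt i j) 1)⁻¹ (al j) = a • al i + al j := by
    rw [step, c0, q0, r0, pair_al, ha]; module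
  have r2 : C.act (chn cs (alt i j) 2)⁻¹ (al j) = - (a • al i + al j) := by
    rw [step, c1, r1, pair_al, C.diag]; module
  have q2 : C.act (chn cs (alt i j) 2)⁻¹ (al i) = 2 • al i + b • al j := by
    rw [step, c1, r1, q1, pair_al, hb,
      show - al i - -b • (a • al i + al j) = (-1 + a * b) • al i + b • al j by module, hab]
    module
  have q3 : C.act (chn cs (alt i j) 3)⁻¹ (al i) = - (2 • al i + b • al j) := by
    rw [step, c2, q2, pair_al, C.diag]; module
  have r3 : C.act (chn cs (alt i j) 3)⁻¹ (al j) = a • al i + 2 • al j := by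
    rw [step, c2, q2, r2, pair_al, ha,
      show - (a • al i + al j) - -a • (2 • al i + b • al j)
        = a • al i + (-1 + a * b) • al j by module, hab]
    module
  have r4 : C.act (chn cs (alt i j) 4)⁻¹ (al j) = - (a • al i + 2 • al j) := by
    rw [step, c3, r3, pair_al, C.diag]; module
  have q4 : C.act (chn cs (alt i j) 4)⁻¹ (al i) = al i + b • al j := by
    rw [step, c3, r3, q3, pair_al, hb,
      show - (2 • al i + b • al j) - -b • (a • al i + 2 • al j)
        = (-2 + a * b) • al i + b • al j by module, hab]
    module
  have q5 : C.act (chn cs (alt i j) 5)⁻¹ (al i) = - (al i + b • al j) := by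
    rw [step, c4, q4, pair_al, C.diag]; module
  have r5 : C.act (chn cs (alt i j) 5)⁻¹ (al j) = al j := by
    rw [step, c4, q4, r4, pair_al, ha,
      show - (a • al i + 2 • al j) - -a • (al i + b • al j)
        = (-2 + a * b) • al j by module, hab]
    module
  have hi0 := al_nonneg i
  have hj0 := al_nonneg j
  have pos : ∀ x y : ℤ, 0 ≤ x → 0 ≤ y → (0 : B → ℤ) ≤ x • al i + y • al j := fun x y hx hy =>
    add_nonneg (smul_nonneg hx hi0) (smul_nonneg hy hj0)
  have p1 : 0 ≤ a • al i + al j := by simpa using pos a 1 ha0.le zero_le_one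
  have p2 : 0 ≤ 2 • al i + b • al j := by simpa using pos 2 b (by norm_num) hb0.le
  have p3 : 0 ≤ a • al i + 2 • al j := by simpa using pos a 2 ha0.le (by norm_num)
  have p4 : 0 ≤ al i + b • al j := by simpa using pos 1 b (by norm_num) hb0.le
  have hJj : InJ (J \ {i}) (al j) := inJ_al ⟨hj, hij.symm⟩
  have hother : ∀ l ∈ J, l ≠ i → l ≠ j → ∀ k, InJ (J \ {i}) (C.act (chn cs (alt i j) k)⁻¹ (al l)) := by
    intro l hl h1 h2 k
    have h3 : C.act (chn cs (alt i j) k)⁻¹ (al l) = al l := by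
      induction k with
      | zero => exact C.act_chn_zero _ _
      | succ k ih =>
        have h4 : C.A (alt i j k) l = 0 := by
          unfold alt
          split_ifs
          · exact C.pair_al_eq_zero h1.symm (h l hl h1 h2).1
          · exact C.pair_al_eq_zero h2.symm (h l hl h1 h2).2
        rw [step, ih, pair_al, h4, zero_smul, sub_zero]
    rw [h3]
    exact inJ_al ⟨hl, h1⟩
  have hn : ∀ x y : ℤ, 0 < x → ¬ InJ (J \ {i}) (x • al i + y • al j) := by
    intro x y hx h
    have := h i (by simp)
    simp [al, hij] at this
    omega
  have hn0 : ¬ InJ (J \ {i}) (al i) := by simpa using hn 1 0 one_pos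
  have hn1 : ¬ InJ (J \ {i}) (a • al i + al j) := by simpa using hn a 1 ha0
  have hn2 : ¬ InJ (J \ {i}) (2 • al i + b • al j) := by simpa using hn 2 b two_pos
  have hn3 : ¬ InJ (J \ {i}) (a • al i + 2 • al j) := by simpa using hn a 2 ha0
  have hn4 : ¬ InJ (J \ {i}) (al i + b • al j) := by simpa using hn 1 b one_pos
  refine ⟨fun k hk => ?_, fun k hk => ?_, fun k hk => ?_, fun k hk l hl => ?_⟩
  · unfold alt; split_ifs <;> assumption
  · interval_cases k
    · rw [c0, q0]; exact hi0
    · rw [c1, r1]; exact p1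
    · rw [c2, q2]; exact p2
    · rw [c3, r3]; exact p3
    · rw [c4, q4]; exact p4
  · interval_cases k
    · rw [c0, q0]; exact hn0
    · rw [c1, r1]; exact hn1
    · rw [c2, q2]; exact hn2
    · rw [c3, r3]; exact hn3
    · rw [c4, q4]; exact hn4
  · by_cases h1 : l = i
    · subst h1
      interval_cases k
      · exact Or.inl ⟨by omega, rfl⟩
      · right; left; rw [q1, neg_nonpos]; exact hi0
      · exact Or.inl ⟨by omega, rfl⟩
      · right; left; rw [q3, neg_nonpos]; exact p2
      · exact Or.inl ⟨by omega, rfl⟩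
      · right; left; rw [q5, neg_nonpos]; exact p4
    by_cases h2 : l = j
    · subst h2
      interval_cases k
      · right; right; rw [r0]; exact hJj
      · exact Or.inl ⟨by omega, rfl⟩
      · right; left; rw [r2, neg_nonpos]; exact p1
      · exact Or.inl ⟨by omega, rfl⟩
      · right; left; rw [r4, neg_nonpos]; exact p3
      · right; right; rw [r5]; exact hJj
    · exact Or.inr (Or.inr (hother l hl h1 h2 k))

theorem alt_mem (k : ℕ) : alt i j k ∈ ({i, j} : Set B) := by unfold alt; split_ifs <;> simp

theorem factors_G2 (C : Cartan cs) (hi : i ∈ J) (hj : j ∈ J) (hij : i ≠ j) (hM : M i j = 6)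
    (h : ∀ k ∈ J, k ≠ i → k ≠ j → M i k = 2 ∧ M j k = 2) (hs : RatSmooth cs w)
    (hw : w ∈ WJc cs J) (ih : ∀ i ∈ J, ∀ u ∈ WJc cs (J \ {i}), RatSmooth cs u →
      Factors cs (J \ {i}) u) : Factors cs J w := by
  have h1 := C.isFullChain_G2 hi hj hij hM h
  have h2 := C.isFullChain_G2 hj hi hij.symm (by rw [M.symmetric]; exact hM)
    fun k hk h1 h2 => (h k hk h2 h1).symm
  have h3 : C.IsFullChain (J \ {i}) ((J \ {i}) \ {j}) (fun _ => j) 1 := by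
    apply IsFullChain.isolated C (show j ∈ J \ {i} from ⟨hj, hij.symm⟩)
    exact fun k hk h1 => (h k hk.1 hk.2 h1).2
  obtain ⟨m, hm, u, hu, rfl⟩ := h1.exists_mul Set.sdiff_subset hw
  obtain ⟨n, hn, z, hz, rfl⟩ := h3.exists_mul Set.sdiff_subset hu
  interval_cases n
  · simp only [chn, one_mul] at hu hs hw ⊢
    cases m with
    | zero =>
      refine factors_of_strip (C := C) hi hs (Or.inl ?_) (ih i hi)
      exact ⟨alt i j, 0, z, h1.isChain (by omega), hu, rfl, Nat.zero_le _⟩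
    | succ m =>
      refine factors_of_strip (C := C) hj hs (Or.inl ?_) (ih j hj)
      have e : (fun k => alt i j (k + 1)) = alt j i := by
        funext k; unfold alt; split_ifs <;> first | rfl | omega
      rw [chn_succ', e, mul_assoc]
      refine C.strip_of_rank_two hij.symm hi (h2.isChain (by omega)) (fun k _ => alt_mem k) ?_
      rwa [Set.sdiff_sdiff_comm]
  · refine factors_of_strip (C := C) hi hs (Or.inl ?_) (ih i hi)
    simp only [chn, mul_one]
    exact C.strip_of_rank_two hij hj (h1.isChain hm) (fun k _ => alt_mem k) hz
end G2
end Cartan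

/-- The coefficient vectors of the positive roots of type `B₃`, with respect to an orthogonal
basis. -/
def rootsB3 : List (ℤ × ℤ × ℤ) :=
  [(1, 0, 0), (0, 1, 0), (0, 0, 1), (1, -1, 0), (1, 1, 0), (1, 0, -1), (1, 0, 1), (0, 1, -1),
    (0, 1, 1)]

/-- The scalar product of coefficient vectors. -/
def dotB3 (u v : ℤ × ℤ × ℤ) : ℤ := u.1 * v.1 + u.2.1 * v.2.1 + u.2.2 * v.2.2

/-- The reflection in the root with coefficient vector `r`. -/
def reflB3 (r v : ℤ × ℤ × ℤ) : ℤ × ℤ × ℤ :=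
  (v.1 - 2 / dotB3 r r * dotB3 r v * r.1, v.2.1 - 2 / dotB3 r r * dotB3 r v * r.2.1,
    v.2.2 - 2 / dotB3 r r * dotB3 r v * r.2.2)

/-- The linear map with columns `m`. -/
def appB3 (m : (ℤ × ℤ × ℤ) × (ℤ × ℤ × ℤ) × (ℤ × ℤ × ℤ)) (v : ℤ × ℤ × ℤ) : ℤ × ℤ × ℤ :=
  (v.1 * m.1.1 + v.2.1 * m.2.1.1 + v.2.2 * m.2.2.1,
    v.1 * m.1.2.1 + v.2.1 * m.2.1.2.1 + v.2.2 * m.2.2.2.1,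
    v.1 * m.1.2.2 + v.2.1 * m.2.1.2.2 + v.2.2 * m.2.2.2.2)

/-- Composition of the linear map with columns `m` with the reflection in `r`. -/
def reflMapB3 (r : ℤ × ℤ × ℤ) (m : (ℤ × ℤ × ℤ) × (ℤ × ℤ × ℤ) × (ℤ × ℤ × ℤ)) :
    (ℤ × ℤ × ℤ) × (ℤ × ℤ × ℤ) × (ℤ × ℤ × ℤ) :=
  (reflB3 r m.1, reflB3 r m.2.1, reflB3 r m.2.2)

theorem appB3_reflMapB3 (r v : ℤ × ℤ × ℤ) (m) :
    appB3 (reflMapB3 r m) v = reflB3 r (appB3 m v) := by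
  simp only [appB3, reflMapB3, reflB3, dotB3, Prod.mk.injEq]
  refine ⟨?_, ?_, ?_⟩ <;> ring

/-- The determinant of three coefficient vectors. -/
def detB3 (t s r : ℤ × ℤ × ℤ) : ℤ :=
  t.1 * (s.2.1 * r.2.2 - s.2.2 * r.2.1) - t.2.1 * (s.1 * r.2.2 - s.2.2 * r.1) +
    t.2.2 * (s.1 * r.2.1 - s.2.1 * r.1)

theorem two_div_dotB3 {r : ℤ × ℤ × ℤ} (hr : r ∈ rootsB3) : 2 / dotB3 r r * dotB3 r r = 2 := by
  revert r; decide

namespace Cartan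
variable [Fintype B] [DecidableEq B] (C : Cartan cs) [Finite W] {w x y t : W} {X Y Z : B → ℤ}

/-- The linear combination of `X, Y, Z` with coefficients `v`. -/
def ev (X Y Z : B → ℤ) (v : ℤ × ℤ × ℤ) : B → ℤ := v.1 • X + v.2.1 • Y + v.2.2 • Z

/-- `X, Y, Z` is an orthogonal frame for a subsystem of type `B₃`. -/
structure Frame (X Y Z : B → ℤ) : Prop where
  XY : C.form X Y = 0
  XZ : C.form X Z = 0
  YZ : C.form Y Z = 0
  YY : C.form Y Y = C.form X X
  ZZ : C.form Z Z = C.form X X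
  root : ∀ r ∈ rootsB3, C.IsRoot (ev X Y Z r)
  nonneg : ∀ r ∈ rootsB3, 0 ≤ ev X Y Z r
  cls : ∀ t, cs.IsReflection t → ∀ (c : ℤ) v, c ≠ 0 → c • C.rt t = ev X Y Z v →
    ∃ r ∈ rootsB3, C.rt t = ev X Y Z r

/-- `x` acts on the span of `X, Y, Z` with matrix `m`, and trivially modulo this span. -/
def Mp (X Y Z : B → ℤ) (x : W) (m : (ℤ × ℤ × ℤ) × (ℤ × ℤ × ℤ) × (ℤ × ℤ × ℤ)) : Prop :=
  (∀ v, ∃ k, C.act x v - v = ev X Y Z k) ∧ ∀ v, C.act x (ev X Y Z v) = ev X Y Z (appB3 m v)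

theorem ev_add (u v : ℤ × ℤ × ℤ) : ev X Y Z u + ev X Y Z v = ev X Y Z (u + v) := by
  simp only [ev, Prod.fst_add, Prod.snd_add]; module
theorem ev_sub (u v : ℤ × ℤ × ℤ) : ev X Y Z u - ev X Y Z v = ev X Y Z (u - v) := by
  simp only [ev, Prod.fst_sub, Prod.snd_sub]; module
theorem ev_smul (c : ℤ) (v : ℤ × ℤ × ℤ) : c • ev X Y Z v = ev X Y Z (c • v) := by
  simp only [ev, Prod.smul_fst, Prod.smul_snd, smul_eq_mul]; module

theorem form_add_left (u v z : B → ℤ) : C.form (u + v) z = C.form u z + C.form v z := by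
  rw [form_comm, form_add, form_comm _ z u, form_comm _ z v]
theorem form_sub_left (u v z : B → ℤ) : C.form (u - v) z = C.form u z - C.form v z := by
  rw [form_comm, form_sub, form_comm _ z u, form_comm _ z v]
theorem form_smul_left (c : ℤ) (u z : B → ℤ) : C.form (c • u) z = c * C.form u z := by
  rw [form_comm, form_smul, form_comm]

namespace Frame
variable {C}

theorem form_ev (F : C.Frame X Y Z) (u v : ℤ × ℤ × ℤ) :
    C.form (ev X Y Z u) (ev X Y Z v) = dotB3 u v * C.form X X := by
  simp only [ev, form_add, form_add_left, form_smul, form_smul_left, F.XY, F.XZ, F.YZ, F.YY, F.ZZ,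
    C.form_comm Y X, C.form_comm Z X, C.form_comm Z Y, dotB3]
  ring

theorem form_pos (F : C.Frame X Y Z) : 0 < C.form X X := by
  apply C.form_self_pos
  have h := (F.root (1, 0, 0) (by decide)).ne_zero
  simpa [ev] using h

theorem ev_inj (F : C.Frame X Y Z) {u v : ℤ × ℤ × ℤ} (h : ev X Y Z u = ev X Y Z v) : u = v := by
  have key : ∀ k, dotB3 u k = dotB3 v k := fun k => by
    have h1 := F.form_ev u k
    rw [h, F.form_ev] at h1
    exact (mul_right_cancel₀ F.form_pos.ne' h1).symm
  have h1 := key (1, 0, 0)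
  have h2 := key (0, 1, 0)
  have h3 := key (0, 0, 1)
  simp only [dotB3, mul_one, mul_zero, add_zero, zero_add] at h1 h2 h3
  exact Prod.ext h1 (Prod.ext h2 h3)

theorem act_ev (F : C.Frame X Y Z) (ht : cs.IsReflection t) {r : ℤ × ℤ × ℤ} (hr : r ∈ rootsB3)
    (h : C.rt t = ev X Y Z r) (v : ℤ × ℤ × ℤ) :
    C.act t (ev X Y Z v) = ev X Y Z (reflB3 r v) := by
  have h1 := C.cor_form ht (ev X Y Z v)
  have h2 := two_div_dotB3 hr
  have h3 : dotB3 r r ≠ 0 := by rintro h3; rw [h3] at h2; simp at h2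
  have h4 := F.form_pos
  rw [h, F.form_ev, F.form_ev] at h1
  have h5 : C.cor t (ev X Y Z v) = 2 / dotB3 r r * dotB3 r v := by
    apply mul_right_cancel₀ (mul_ne_zero h3 h4.ne')
    rw [h1]
    linear_combination (- dotB3 r v * C.form X X) * h2
  rw [C.act_refl ht, h, h5, ev_smul, ev_sub]
  rfl

theorem Mp_refl_mul (F : C.Frame X Y Z) {m} (hx : C.Mp X Y Z x m) (ht : cs.IsReflection t)
    {r : ℤ × ℤ × ℤ} (hr : r ∈ rootsB3) (h : C.rt t = ev X Y Z r) :
    C.Mp X Y Z (t * x) (reflMapB3 r m) := by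
  refine ⟨fun v => ?_, fun v => ?_⟩
  · obtain ⟨k, hk⟩ := hx.1 v
    refine ⟨k - C.cor t (C.act x v) • r, ?_⟩
    rw [act_mul, C.act_refl ht, h, ← ev_sub, ← ev_smul, ← hk]
    module
  · rw [act_mul, hx.2, F.act_ev ht hr h, appB3_reflMapB3]

theorem Mp_one : C.Mp X Y Z 1 ((1, 0, 0), (0, 1, 0), (0, 0, 1)) := by
  refine ⟨fun v => ⟨0, ?_⟩, fun v => ?_⟩
  · simp [ev, act_one]
  · rw [act_one]; simp [appB3]

theorem Mp_unique {m} (hx : C.Mp X Y Z x m) (hy : C.Mp X Y Z y m) : x = y := by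
  have h1 : ∀ v, C.act (x⁻¹ * y) (ev X Y Z v) = ev X Y Z v := fun v => by
    rw [act_mul, hy.2, ← hx.2, act_inv_act]
  have h2 : x⁻¹ * y = 1 := by
    apply C.eq_one_of_act
    intro v
    obtain ⟨k, hk⟩ := hx.1 (C.act (x⁻¹ * y) v)
    obtain ⟨l, hl⟩ := hy.1 v
    have h3 : C.act (x⁻¹ * y) v - v = ev X Y Z (l - k) := by
      rw [← ev_sub, ← hk, ← hl, act_mul, act_act_inv]; module
    have h4 : C.form (C.act (x⁻¹ * y) v - v) (ev X Y Z (l - k)) = 0 := by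
      rw [form_sub_left, sub_eq_zero]
      conv_lhs => rw [← h1 (l - k), form_act]
    rw [h3] at h4
    by_contra h5
    rw [← ne_eq, ← sub_ne_zero, h3] at h5
    exact (C.form_self_pos h5).ne' h4
  rw [inv_mul_eq_one] at h2
  exact h2

/-- Some (hence the) element with matrix `m` is below `w`. -/
def Below (C : Cartan cs) (X Y Z : B → ℤ) (w : W)
    (m : (ℤ × ℤ × ℤ) × (ℤ × ℤ × ℤ) × (ℤ × ℤ × ℤ)) : Prop :=
  ∃ x, C.Mp X Y Z x m ∧ bruhatLE cs x w

theorem exists_refl (F : C.Frame X Y Z) {r : ℤ × ℤ × ℤ} (hr : r ∈ rootsB3) :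
    ∃ t, cs.IsReflection t ∧ C.rt t = ev X Y Z r :=
  (F.root r hr).exists_refl_of_nonneg (F.nonneg r hr)

theorem down (F : C.Frame X Y Z) {m m'} (h : Below C X Y Z w m) (r v : ℤ × ℤ × ℤ)
    (hr : r ∈ rootsB3 := by decide) (hv : -v ∈ rootsB3 := by decide)
    (hmv : appB3 m v = r := by decide) (hm' : reflMapB3 r m = m' := by decide) :
    Below C X Y Z w m' := by
  obtain ⟨x, hx, hxw⟩ := h
  obtain ⟨t, ht, htr⟩ := F.exists_refl hr
  refine ⟨t * x, hm' ▸ F.Mp_refl_mul hx ht hr htr, bruhat_trans ?_ hxw⟩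
  apply bruhat_of_refl' ht
  rw [C.down_iff ht, htr, ← hmv, ← hx.2, act_inv_act]
  have := F.nonneg _ hv
  rw [show -v = (-1 : ℤ) • v by simp, ← ev_smul] at this
  simpa using this

theorem move (F : C.Frame X Y Z) (hw : Regular cs w) {m m'} (t s r : ℤ × ℤ × ℤ)
    (hx : Below C X Y Z w m)
    (h : ∀ r ∈ rootsB3, detB3 t s r = 0 → Below C X Y Z w (reflMapB3 r m))
    (d e : ℤ) (hd : r = d • t + e • s := by decide)
    (ht : t ∈ rootsB3 := by decide) (hs : s ∈ rootsB3 := by decide) (hts : s ≠ t := by decide)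
    (hr : r ∈ rootsB3 := by decide)
    (hm' : reflMapB3 r (reflMapB3 t m) = m' := by decide) :
    Below C X Y Z w m' := by
  classical
  obtain ⟨x, hx, hxw⟩ := hx
  have key : ∀ r ∈ rootsB3, detB3 t s r = 0 → ∀ ρ, cs.IsReflection ρ → C.rt ρ = ev X Y Z r →
      bruhatLE cs (ρ * x) w := by
    intro r hr hdet ρ hρ hρr
    obtain ⟨y, hy, hyw⟩ := h r hr hdet
    rwa [Mp_unique (F.Mp_refl_mul hx hρ hr hρr) hy]
  obtain ⟨τ, hτ, hτt⟩ := F.exists_refl ht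
  obtain ⟨σ, hσ, hσs⟩ := F.exists_refl hs
  obtain ⟨ρ, hρ, hρr⟩ := F.exists_refl hr
  have hτx : bruhatLE cs (τ * x) w := key t ht (by simp only [detB3]; ring) τ hτ hτt
  have h1 := C.plane_count hw hxw hτ hτx hσ (by
    rintro rfl
    exact hts (F.ev_inj (hσs.symm.trans hτt)))
  have h2 : (edg cs w (τ * x)).filter (C.Pl τ σ) ⊆ (edg cs w x).filter (C.Pl τ σ) := by
    intro κ hκ
    rw [Finset.mem_filter, mem_edg] at hκ ⊢
    refine ⟨⟨hκ.1.1, ?_⟩, hκ.2⟩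
    obtain ⟨-, c, d, e, hc, hcde⟩ := hκ.2
    rw [hτt, hσs, ev_smul, ev_smul, ev_add] at hcde
    obtain ⟨q, hq, hκq⟩ := F.cls κ hκ.1.1 c _ hc hcde
    refine key q hq ?_ κ hκ.1.1 hκq
    rw [hκq, ev_smul] at hcde
    have h3 := F.ev_inj hcde
    have h4 : c * detB3 t s q = 0 := by
      have h5 := congrArg Prod.fst h3
      have h6 := congrArg (fun p => p.2.1) h3
      have h7 := congrArg (fun p => p.2.2) h3
      simp only [Prod.smul_fst, Prod.smul_snd, Prod.fst_add, Prod.snd_add, smul_eq_mul] at h5 h6 h7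
      simp only [detB3]
      linear_combination (t.2.1 * s.2.2 - t.2.2 * s.2.1) * h5 -
        (t.1 * s.2.2 - t.2.2 * s.1) * h6 + (t.1 * s.2.1 - t.2.1 * s.1) * h7
    exact (mul_eq_zero.1 h4).resolve_left hc
  have h3 := Finset.eq_of_subset_of_card_le h2 h1.le
  have h4 : ρ ∈ (edg cs w x).filter (C.Pl τ σ) := by
    rw [Finset.mem_filter, mem_edg]
    refine ⟨⟨hρ, key r hr ?_ ρ hρ hρr⟩, hρ, 1, d, e, one_ne_zero, ?_⟩
    · rw [hd]
      simp only [detB3, Prod.smul_fst, Prod.smul_snd, Prod.fst_add, Prod.snd_add, smul_eq_mul]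
      ring
    · rw [one_smul, hρr, hτt, hσs, ev_smul, ev_smul, ev_add, hd]
  rw [← h3, Finset.mem_filter, mem_edg] at h4
  exact ⟨_, hm' ▸ F.Mp_refl_mul (F.Mp_refl_mul hx hτ ht hτt) hρ hr hρr, h4.1.2⟩

/-- The main computation in type `B₃`. -/
theorem below (F : C.Frame X Y Z) (hw : Regular cs w)
    (h : Below C X Y Z w ((-1, 0, 0), (0, 1, 0), (0, 0, -1))) :
    Below C X Y Z w ((0, -1, 0), (-1, 0, 0), (0, 0, 1)) := by
  have hX : Below C X Y Z w ((-1, 0, 0), (0, 1, 0), (0, 0, 1)) :=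
    F.down h (0, 0, 1) (0, 0, -1)
  have h1 : Below C X Y Z w ((1, 0, 0), (0, 1, 0), (0, 0, 1)) :=
    F.down hX (1, 0, 0) (-1, 0, 0)
  have hXmY : Below C X Y Z w ((0, -1, 0), (1, 0, 0), (0, 0, -1)) :=
    F.down h (1, -1, 0) (-1, -1, 0)
  have hYpZ : Below C X Y Z w ((1, 0, 0), (0, 0, -1), (0, -1, 0)) :=
    F.down (F.down hXmY (1, 1, 0) (-1, 1, 0) (hm' := rfl)) (0, 1, -1) (0, -1, 1)
  have hz : Below C X Y Z w ((-1, 0, 0), (0, 0, -1), (0, -1, 0)) := by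
    refine F.move hw (1, 0, 0) (0, 1, 1) (0, 1, 1) h1 ?_ 0 1
    intro r hr hd
    fin_cases hr <;> first | exact absurd hd (by decide) | assumption
  have hx0 : Below C X Y Z w ((0, 0, 1), (1, 0, 0), (0, 1, 0)) :=
    F.down (F.down hz (0, 1, 0) (0, 0, -1) (hm' := rfl)) (1, 0, 1) (-1, -1, 0)
  have hXpZx0 : Below C X Y Z w ((-1, 0, 0), (0, 0, -1), (0, 1, 0)) :=
    F.down hz (0, 1, 0) (0, 0, -1)
  have hXpYx0 : Below C X Y Z w ((0, 0, 1), (0, -1, 0), (-1, 0, 0)) :=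
    F.down (F.down (F.down hz (0, 0, 1) (0, -1, 0) (hm' := rfl)) (1, -1, 0) (-1, 0, 1)
      (hm' := rfl)) (0, 1, 1) (-1, 1, 0)
  have hYR : Below C X Y Z w ((0, -1, 0), (1, 0, 0), (0, 0, 1)) :=
    F.down hXmY (0, 0, 1) (0, 0, -1)
  have hR : Below C X Y Z w ((0, 1, 0), (1, 0, 0), (0, 0, 1)) :=
    F.down hYR (0, 1, 0) (-1, 0, 0)
  have hXR : Below C X Y Z w ((0, 1, 0), (-1, 0, 0), (0, 0, 1)) :=
    F.down hX (1, 1, 0) (-1, 1, 0)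
  have hXpYR : Below C X Y Z w ((-1, 0, 0), (0, -1, 0), (0, 0, 1)) := by
    refine F.move hw (0, 1, -1) (1, 1, 0) (1, 1, 0) hx0 ?_ 0 1
    intro r hr hd
    fin_cases hr <;> first | exact absurd hd (by decide) | assumption
  refine F.move hw (1, -1, 0) (1, 0, 0) (1, 1, 0) hR ?_ (-1) 2
  intro r hr hd
  fin_cases hr <;> first | exact absurd hd (by decide) | assumption
end Frame
end Cartan

namespace Cartan
variable [Fintype B] [DecidableEq B] (C : Cartan cs) [Finite W] {J : Set B} {w x y t : W}
  {p : ℕ → B} {N : ℕ}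

/-- The nodes `p 0, …, p N` form a connected component of type `B` of the diagram of `J`; the
node `p 0` is short. -/
structure PathB (J : Set B) (p : ℕ → B) (N : ℕ) : Prop where
  pos : 1 ≤ N
  inj : ∀ a b, a ≤ N → b ≤ N → p a = p b → a = b
  mem : ∀ a ≤ N, p a ∈ J
  A_zero_one : C.A (p 0) (p 1) = -2
  A_one_zero : C.A (p 1) (p 0) = -1
  A_succ : ∀ a, 1 ≤ a → a + 1 ≤ N → C.A (p a) (p (a + 1)) = -1 ∧ C.A (p (a + 1)) (p a) = -1
  A_far : ∀ a b, a + 2 ≤ b → b ≤ N → C.A (p a) (p b) = 0 ∧ C.A (p b) (p a) = 0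
  A_out : ∀ j ∈ J, (∀ a ≤ N, p a ≠ j) → ∀ a ≤ N, C.A (p a) j = 0

/-- The root `α_{p 0} + ⋯ + α_{p m}`. -/
def fB (p : ℕ → B) (m : ℕ) : B → ℤ := ∑ i ∈ Finset.range (m + 1), al (p i)

theorem fB_zero (p : ℕ → B) : fB p 0 = al (p 0) := by simp [fB]
theorem fB_succ (p : ℕ → B) (m : ℕ) : fB p (m + 1) = fB p m + al (p (m + 1)) := by
  rw [fB, Finset.sum_range_succ]; rfl
theorem al_succ (p : ℕ → B) (m : ℕ) : al (p (m + 1)) = fB p (m + 1) - fB p m := by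
  rw [fB_succ]; module

theorem fB_nonneg (p : ℕ → B) (m : ℕ) : 0 ≤ fB p m := Finset.sum_nonneg fun i _ => al_nonneg (p i)

namespace PathB
variable {C}

theorem pair_zero (P : C.PathB J p N) {m : ℕ} (hm : m ≤ N) :
    C.pair (p 0) (fB p m) = if m = 0 then 2 else 0 := by
  induction m with
  | zero => simp [fB_zero, C.diag]
  | succ m ih =>
    rw [fB_succ, map_add, ih (by omega), pair_al]
    rcases m with _ | m
    · simp [P.A_zero_one]
    · simp [(P.A_far 0 (m + 1 + 1) (by omega) hm).1]

theorem pair_succ (P : C.PathB J p N) {k m : ℕ} (hk : k + 1 ≤ N) (hm : m ≤ N) :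
    C.pair (p (k + 1)) (fB p m) = (if m = k + 1 then 1 else 0) - if m = k then 1 else 0 := by
  induction m with
  | zero =>
    rw [fB_zero, pair_al]
    rcases k with _ | k
    · simp [P.A_one_zero]
    · simp [(P.A_far 0 (k + 1 + 1) (by omega) hk).2]
  | succ m ih =>
    rw [fB_succ, map_add, ih (by omega), pair_al]
    rcases lt_trichotomy m k with h | rfl | h
    · rcases eq_or_ne (m + 1) k with rfl | h1
      · rw [(P.A_succ (m + 1) (by omega) hk).2]
        split_ifs <;> omega
      · rw [(P.A_far (m + 1) (k + 1) (by omega) hk).2]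
        split_ifs <;> omega
    · rw [C.diag]; split_ifs <;> omega
    · rcases eq_or_ne m (k + 1) with rfl | h1
      · rw [(P.A_succ (k + 1) (by omega) hm).1]
        split_ifs <;> omega
      · rw [(P.A_far (k + 1) (m + 1) (by omega) hm).1]
        split_ifs <;> omega

theorem act_zero_self (P : C.PathB J p N) : C.act (cs.simple (p 0)) (fB p 0) = - fB p 0 := by
  rw [act_simple, P.pair_zero (Nat.zero_le _), if_pos rfl, fB_zero]; module

theorem act_zero_of_pos (P : C.PathB J p N) {m : ℕ} (hm : m ≤ N) (h : 1 ≤ m) :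
    C.act (cs.simple (p 0)) (fB p m) = fB p m := by
  rw [act_simple, P.pair_zero hm, if_neg (by omega), zero_smul, sub_zero]

theorem act_succ_self (P : C.PathB J p N) {k : ℕ} (hk : k + 1 ≤ N) :
    C.act (cs.simple (p (k + 1))) (fB p (k + 1)) = fB p k := by
  rw [act_simple, P.pair_succ hk hk, if_pos rfl, if_neg (by omega), al_succ]; module

theorem act_succ_pred (P : C.PathB J p N) {k : ℕ} (hk : k + 1 ≤ N) :
    C.act (cs.simple (p (k + 1))) (fB p k) = fB p (k + 1) := by
  rw [act_simple, P.pair_succ hk (by omega), if_neg (by omega), if_pos rfl, al_succ]; module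

theorem act_succ_of_ne (P : C.PathB J p N) {k m : ℕ} (hk : k + 1 ≤ N) (hm : m ≤ N) (h1 : m ≠ k)
    (h2 : m ≠ k + 1) : C.act (cs.simple (p (k + 1))) (fB p m) = fB p m := by
  rw [act_simple, P.pair_succ hk hm, if_neg h2, if_neg h1, sub_zero, zero_smul, sub_zero]

theorem act_out (P : C.PathB J p N) {j : B} (hj : j ∈ J) (h : ∀ a ≤ N, p a ≠ j) {a : ℕ}
    (ha : a ≤ N) : C.act (cs.simple (p a)) (al j) = al j := by
  rw [act_simple, pair_al, P.A_out j hj h a ha, zero_smul, sub_zero]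

/-- The coordinate of `f_m` in a vector. -/
theorem fB_apply (P : C.PathB J p N) {m k : ℕ} (hm : m ≤ N) (hk : k ≤ N) :
    fB p m (p k) = if k ≤ m then 1 else 0 := by
  rw [fB, Finset.sum_apply]
  have : ∀ i ∈ Finset.range (m + 1), al (p i) (p k) = if k = i then 1 else 0 := by
    intro i hi
    rw [Finset.mem_range] at hi
    rw [al, Pi.single_apply]
    by_cases h : k = i
    · simp [h]
    · rw [if_neg h, if_neg fun h' => h (P.inj _ _ hk (by omega) h')]
  rw [Finset.sum_congr rfl this, Finset.sum_ite_eq, ]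
  simp [Nat.lt_succ_iff]

theorem fB_inJ {m : ℕ} {K : Set B} (h : ∀ i ≤ m, p i ∈ K) :
    InJ K (fB p m) := by
  intro k hk
  rw [fB, Finset.sum_apply]
  apply Finset.sum_eq_zero
  intro i hi
  rw [Finset.mem_range] at hi
  rw [al, Pi.single_apply, if_neg]
  rintro rfl
  exact hk (h i (by omega))

/-- The letters of the longest chain. -/
def ltr (p : ℕ → B) (N k : ℕ) : B := p ((N - k) + (k - N))

/-- `x` maps `f_d` to `±f_N`, preserving the order of the other vectors. -/
def Spin (p : ℕ → B) (N : ℕ) (C : Cartan cs) (x : W) (d : ℕ) (e : ℤ) : Prop :=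
  ∀ i ≤ N, C.act x (fB p i) =
    if i = d then e • fB p N else if i < d then fB p i else fB p (i - 1)

theorem spin_one : Spin p N C 1 N 1 := by
  intro i hi
  rw [act_one]
  split_ifs with h1 h2
  · rw [h1, one_smul]
  · rfl
  · omega

theorem Spin.zero (P : C.PathB J p N) (h : Spin p N C x 0 1) :
    Spin p N C (x * cs.simple (p 0)) 0 (-1) := by
  intro i hi
  rw [act_mul]
  rcases Nat.eq_zero_or_pos i with rfl | h1
  · rw [P.act_zero_self, act_neg, h 0 hi, if_pos rfl, if_pos rfl]; module
  · rw [P.act_zero_of_pos hi h1, h i hi, if_neg (by omega), if_neg (by omega),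
      if_neg (by omega)]

theorem Spin.step_down (P : C.PathB J p N) {d : ℕ} (hd : d + 1 ≤ N) {e : ℤ}
    (h : Spin p N C x (d + 1) e) : Spin p N C (x * cs.simple (p (d + 1))) d e := by
  intro i hi
  rw [act_mul]
  by_cases h1 : i = d
  · subst h1
    rw [P.act_succ_pred hd, h _ hd, if_pos rfl, if_pos rfl]
  by_cases h2 : i = d + 1
  · subst h2
    rw [P.act_succ_self hd, h _ (by omega), if_neg (by omega), if_pos (by omega),
      if_neg (by omega), if_neg (by omega)]
    rfl
  · rw [P.act_succ_of_ne hd hi h1 h2, h _ hi, if_neg h2, if_neg h1]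
    split_ifs <;> first | rfl | omega

theorem Spin.step_up (P : C.PathB J p N) {d : ℕ} (hd : d + 1 ≤ N) {e : ℤ}
    (h : Spin p N C x d e) : Spin p N C (x * cs.simple (p (d + 1))) (d + 1) e := by
  intro i hi
  rw [act_mul]
  by_cases h1 : i = d
  · subst h1
    rw [P.act_succ_pred hd, h _ hd, if_neg (by omega), if_neg (by omega), if_neg (by omega),
      if_pos (by omega)]
    rfl
  by_cases h2 : i = d + 1
  · subst h2
    rw [P.act_succ_self hd, h _ (by omega), if_pos rfl, if_pos rfl]
  · rw [P.act_succ_of_ne hd hi h1 h2, h _ hi, if_neg h2, if_neg h1]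
    split_ifs <;> first | rfl | omega

theorem spin_down (P : C.PathB J p N) {k : ℕ} (hk : k ≤ N) :
    Spin p N C (chn cs (ltr p N) k)⁻¹ (N - k) 1 := by
  induction k with
  | zero => rw [chn, inv_one]; exact spin_one
  | succ k ih =>
    obtain ⟨d, hd⟩ : ∃ d, N - k = d + 1 := ⟨N - k - 1, by omega⟩
    have h1 : ltr p N k = p (d + 1) := by rw [ltr]; congr 1; omega
    have h2 : N - (k + 1) = d := by omega
    rw [chn, mul_inv_rev, cs.inv_simple, h1, h2]
    exact Spin.step_down P (by omega) (hd ▸ ih (by omega))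

theorem spin_up (P : C.PathB J p N) {k : ℕ} (hk : k ≤ N) :
    Spin p N C (chn cs (ltr p N) (N + 1 + k))⁻¹ k (-1) := by
  induction k with
  | zero =>
    have h1 : ltr p N N = p 0 := by rw [ltr]; congr 1; omega
    rw [add_zero, chn, mul_inv_rev, cs.inv_simple, h1]
    have := P.spin_down le_rfl
    rw [Nat.sub_self] at this
    exact Spin.zero P this
  | succ k ih =>
    have h1 : ltr p N (N + 1 + k) = p (k + 1) := by rw [ltr]; congr 1; omega
    rw [← add_assoc, chn, mul_inv_rev, cs.inv_simple, h1]
    exact Spin.step_up P (by omega) (ih (by omega))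
end PathB
end Cartan

namespace Cartan
variable [Fintype B] [DecidableEq B] {C : Cartan cs} [Finite W] {J : Set B} {w x y t u : W}
  {p : ℕ → B} {N : ℕ}
namespace PathB

theorem fB_coord (P : C.PathB J p N) {m : ℕ} (hm : m < N) : fB p m (p N) = 0 := by
  rw [P.fB_apply hm.le le_rfl, if_neg (by omega)]

theorem fB_coord_self (P : C.PathB J p N) : fB p N (p N) = 1 := by
  rw [P.fB_apply le_rfl le_rfl, if_pos le_rfl]

theorem inJ_fB (P : C.PathB J p N) {m : ℕ} (hm : m < N) : InJ (J \ {p N}) (fB p m) :=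
  fB_inJ fun i hi => ⟨P.mem i (by omega), fun h => by
    have := P.inj _ _ (by omega) le_rfl h
    omega⟩

theorem inJ_al_path (P : C.PathB J p N) {m : ℕ} (hm : m < N) : InJ (J \ {p N}) (al (p m)) :=
  inJ_al ⟨P.mem m (by omega), fun h => by
    have := P.inj _ _ (by omega) le_rfl h
    omega⟩

theorem ltr_mem (P : C.PathB J p N) {k : ℕ} (hk : k < 2 * N + 1) : ltr p N k ∈ J :=
  P.mem _ (by omega)

theorem act_chn_out (P : C.PathB J p N) {j : B} (hj : j ∈ J) (h : ∀ a ≤ N, p a ≠ j) {k : ℕ}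
    (hk : k ≤ 2 * N + 1) : C.act (chn cs (ltr p N) k)⁻¹ (al j) = al j := by
  induction k with
  | zero => rw [chn, inv_one, act_one]
  | succ k ih =>
    rw [chn, mul_inv_rev, act_mul, cs.inv_simple, ltr, P.act_out hj h (by omega), ih (by omega)]

theorem chn_ce_down (P : C.PathB J p N) {d : ℕ} (hd : d ≤ N) :
    C.act (chn cs (ltr p N) (N - d))⁻¹ (al (p d)) = if d = 0 then fB p N else fB p N - fB p (d - 1) := by
  have h := P.spin_down (k := N - d) (by omega)
  rw [show N - (N - d) = d by omega] at h
  rcases d with _ | d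
  · rw [← fB_zero, h 0 hd, if_pos rfl, if_pos rfl, one_smul]
  · rw [al_succ, act_sub, h _ hd, h _ (by omega), if_pos rfl, if_neg (by omega), if_pos (by omega),
      if_neg (by omega), one_smul]
    rfl

theorem chn_ce_up (P : C.PathB J p N) {d : ℕ} (hd : d + 1 ≤ N) :
    C.act (chn cs (ltr p N) (N + 1 + d))⁻¹ (al (p (d + 1))) = fB p N + fB p d := by
  have h := P.spin_up (k := d) (by omega)
  rw [al_succ, act_sub, h _ hd, h _ (by omega), if_neg (by omega), if_neg (by omega), if_pos rfl]
  simp only [Nat.add_sub_cancel]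
  module

theorem notInJ_of_coord {v : B → ℤ} (h : v (p N) = 1) : ¬ InJ (J \ {p N}) v := fun h' => by
  have := h' (p N) (by simp)
  omega

theorem isFullChain (P : C.PathB J p N) :
    C.IsFullChain J (J \ {p N}) (ltr p N) (2 * N + 1) where
  mem k hk := P.ltr_mem hk
  nonneg k hk := by
    rcases le_or_gt k N with h | h
    · have h1 : ltr p N k = p (N - k) := by rw [ltr]; congr 1; omega
      have := P.chn_ce_down (d := N - k) (by omega)
      rw [show N - (N - k) = k by omega] at this
      rw [h1, this]
      split_ifs with h2
      · exact fB_nonneg p N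
      · rw [fB, fB, sub_nonneg]
        exact Finset.sum_le_sum_of_subset_of_nonneg
          (Finset.range_subset_range.2 (by omega)) fun i _ _ => al_nonneg _
    · obtain ⟨d, rfl⟩ : ∃ d, k = N + 1 + d := ⟨k - (N + 1), by omega⟩
      have h1 : ltr p N (N + 1 + d) = p (d + 1) := by rw [ltr]; congr 1; omega
      rw [h1, P.chn_ce_up (by omega)]
      exact add_nonneg (fB_nonneg p N) (fB_nonneg p d)
  notInJ k hk := by
    rcases le_or_gt k N with h | h
    · have h1 : ltr p N k = p (N - k) := by rw [ltr]; congr 1; omega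
      have := P.chn_ce_down (d := N - k) (by omega)
      rw [show N - (N - k) = k by omega] at this
      rw [h1, this]
      apply notInJ_of_coord
      split_ifs with h2
      · exact P.fB_coord_self
      · rw [Pi.sub_apply, P.fB_coord_self, P.fB_coord (by omega), sub_zero]
    · obtain ⟨d, rfl⟩ : ∃ d, k = N + 1 + d := ⟨k - (N + 1), by omega⟩
      have h1 : ltr p N (N + 1 + d) = p (d + 1) := by rw [ltr]; congr 1; omega
      rw [h1, P.chn_ce_up (by omega)]
      apply notInJ_of_coord
      rw [Pi.add_apply, P.fB_coord_self, P.fB_coord (by omega), add_zero]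
  cover k hk j hj := by
    by_cases hp : ∀ a ≤ N, p a ≠ j
    · right; right
      rw [P.act_chn_out hj hp hk]
      exact inJ_al ⟨hj, fun h => hp N le_rfl h.symm⟩
    push Not at hp
    obtain ⟨i, hi, rfl⟩ := hp
    rcases le_or_gt k N with h | h
    · obtain ⟨d, rfl⟩ : ∃ d, k = N - d := ⟨N - k, by omega⟩
      obtain ⟨d, hd, he⟩ : ∃ e, e ≤ N ∧ N - d = N - e := ⟨N - (N - d), by omega, by omega⟩
      rw [he]
      have h1 : ltr p N (N - d) = p d := by rw [ltr]; congr 1; omega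
      have hs := P.spin_down (k := N - d) (by omega)
      rw [show N - (N - d) = d by omega] at hs
      rcases lt_trichotomy i d with hid | rfl | hid
      · right; right
        rcases i with _ | i
        · rw [← fB_zero, hs _ hi, if_neg (by omega), if_pos (by omega)]
          exact P.inJ_fB (by omega)
        · rw [al_succ, act_sub, hs _ hi, hs _ (by omega), if_neg (by omega), if_pos (by omega),
            if_neg (by omega), if_pos (by omega), ← al_succ]
          exact P.inJ_al_path (by omega)
      · exact Or.inl ⟨by omega, h1.symm⟩
      · right
        obtain ⟨i, rfl⟩ : ∃ e, i = e + 1 := ⟨i - 1, by omega⟩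
        rcases eq_or_ne i d with rfl | hne
        · left
          rw [al_succ, act_sub, hs _ hi, hs _ (by omega), if_neg (by omega), if_neg (by omega),
            if_pos rfl, one_smul, Nat.add_sub_cancel, sub_nonpos, fB, fB]
          exact Finset.sum_le_sum_of_subset_of_nonneg
            (Finset.range_subset_range.2 (by omega)) fun i _ _ => al_nonneg _
        · right
          obtain ⟨i, rfl⟩ : ∃ e, i = e + 1 := ⟨i - 1, by omega⟩
          rw [al_succ, act_sub, hs _ hi, hs _ (by omega), if_neg (by omega), if_neg (by omega),
            if_neg (by omega), if_neg (by omega), Nat.add_sub_cancel, Nat.add_sub_cancel, ← al_succ]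
          exact P.inJ_al_path (by omega)
    · obtain ⟨d, rfl⟩ : ∃ d, k = N + 1 + d := ⟨k - (N + 1), by omega⟩
      have hs := P.spin_up (k := d) (by omega)
      rcases lt_trichotomy i d with hid | rfl | hid
      · right; right
        rcases i with _ | i
        · rw [← fB_zero, hs _ hi, if_neg (by omega), if_pos (by omega)]
          exact P.inJ_fB (by omega)
        · rw [al_succ, act_sub, hs _ hi, hs _ (by omega), if_neg (by omega), if_pos (by omega),
            if_neg (by omega), if_pos (by omega), ← al_succ]
          exact P.inJ_al_path (by omega)
      · right; left
        rcases i with _ | i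
        · rw [← fB_zero, hs _ hi, if_pos rfl, neg_one_smul, Left.neg_nonpos_iff]
          exact fB_nonneg p N
        · rw [al_succ, act_sub, hs _ hi, hs _ (by omega), if_pos rfl, if_neg (by omega),
            if_pos (by omega), neg_one_smul, sub_nonpos]
          exact (Left.neg_nonpos_iff.2 (fB_nonneg p N)).trans (fB_nonneg p i)
      · obtain ⟨i, rfl⟩ : ∃ e, i = e + 1 := ⟨i - 1, by omega⟩
        rcases eq_or_ne i d with rfl | hne
        · left
          refine ⟨by omega, ?_⟩
          rw [ltr]; congr 1; omega
        · right; right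
          obtain ⟨i, rfl⟩ : ∃ e, i = e + 1 := ⟨i - 1, by omega⟩
          rw [al_succ, act_sub, hs _ hi, hs _ (by omega), if_neg (by omega), if_neg (by omega),
            if_neg (by omega), if_neg (by omega), Nat.add_sub_cancel, Nat.add_sub_cancel, ← al_succ]
          exact P.inJ_al_path (by omega)
end PathB
end Cartan

namespace Cartan
variable [Fintype B] [DecidableEq B] {C : Cartan cs} [Finite W] {J J' : Set B} {w x y t u : W}
  {c : ℕ → B} {m k : ℕ}

theorem strip_of_refls (hc : C.IsChain J' c m) (hu : u ∈ WJc cs J') (hw : w = chn cs c m * u)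
    (r : ℕ → W) (hr : ∀ k < m, cs.IsReflection (r k) ∧ bruhatLE cs (r k) w ∧ r k ∉ WJc cs J')
    (hinj : ∀ i < m, ∀ k < m, r i = r k → i = k) : C.Strip J' w := by
  classical
  refine ⟨c, m, u, hc, hu, hw, ?_⟩
  have h1 : ((Finset.range m).image r).card = m := by
    rw [Finset.card_image_of_injOn, Finset.card_range]
    intro i hi k hk h
    exact hinj i (by simpa using hi) k (by simpa using hk) h
  refine h1.symm.le.trans (Finset.card_le_card fun t ht => ?_)
  obtain ⟨k, hk, rfl⟩ := Finset.mem_image.1 ht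
  rw [Finset.mem_filter, mem_edg, mul_one]
  obtain ⟨h2, h3, h4⟩ := hr k (by simpa using hk)
  exact ⟨⟨h2, h3⟩, h4⟩

theorem IsChain.eq_of_coset (hc : C.IsChain J' c m) {i k : ℕ} (hi : i ≤ m) (hk : k ≤ m)
    (hx : x ∈ WJc cs J') (hy : y ∈ WJc cs J') (h : chn cs c i * x = chn cs c k * y) : i = k := by
  have := (C.minLeft_unique (hc.minLeft hi) (hc.minLeft hk) hx hy h).1
  rw [← hc.length hi, this, hc.length hk]

theorem IsChain.notMem (hc : C.IsChain J' c m) (hk : k + 1 ≤ m) (hx : x ∈ WJc cs J') :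
    chn cs c (k + 1) * x ∉ WJc cs J' := by
  intro h
  have := hc.eq_of_coset hk (Nat.zero_le _) hx h (by rw [chn, one_mul])
  omega

/-- Conjugates of the first letter of a chain. -/
def crefl (cs : CoxeterSystem M W) (c : ℕ → B) (k : ℕ) : W :=
  chn cs (fun j => c (j + 1)) k * cs.simple (c 0) * (chn cs (fun j => c (j + 1)) k)⁻¹

theorem crefl_eq (c : ℕ → B) (k : ℕ) :
    crefl cs c k = chn cs c (k + 1) * (chn cs (fun j => c (j + 1)) k)⁻¹ := by
  rw [crefl, chn_succ']

theorem isReflection_crefl (c : ℕ → B) (k : ℕ) : cs.IsReflection (crefl cs c k) :=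
  (cs.isReflection_simple _).conj _

theorem strip_of_double {k' : ℕ} {u' : W} (hc : C.IsChain J' c k') (hi : c 0 ∉ J')
    (hcJ : ∀ j, j + 1 < k' → c (j + 1) ∈ J') (hk : k ≤ k') (hu : u ∈ WJc cs J')
    (hu' : u' ∈ WJc cs J') (hw : w = chn cs c k * u) (hw' : w⁻¹ = chn cs c k' * u') :
    C.Strip J' w := by
  have hck : C.IsChain J' c k :=
    ⟨fun j hj => hc.nonneg j (by omega), fun j hj => hc.notInJ j (by omega),
      fun i j hij hj => hc.other i j hij (by omega)⟩
  have hy : ∀ j, j + 1 ≤ k' → chn cs (fun j => c (j + 1)) j ∈ WJc cs J' := fun j hj =>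
    chn_mem _ _ fun i hi => hcJ i (by omega)
  refine strip_of_refls hck hu hw (crefl cs c) (fun j hj => ⟨isReflection_crefl c j, ?_, ?_⟩) ?_
  · obtain ⟨l, rfl⟩ : ∃ l, k = l + 1 := ⟨k - 1, by omega⟩
    have h1 : u⁻¹ * cs.simple (c 0) = chn cs c k' * (u' * chn cs (fun j => c (j + 1)) l) := by
      rw [← mul_assoc, ← hw', hw, chn_succ']
      simp [mul_assoc]
    have h2 : bruhatLE cs (chn cs c (j + 1)) (u⁻¹ * cs.simple (c 0)) := by
      rw [h1]
      have := C.bruhat_mul_le_mul (hc.minLeft le_rfl) (Subgroup.mul_mem _ hu' (hy l hk))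
        (hc.bruhat (show j + 1 ≤ k' by omega) le_rfl) (one_bruhat _)
      rwa [mul_one] at this
    have h3 : cs.length (chn cs c (j + 1) * cs.simple (c 0)) < cs.length (chn cs c (j + 1)) := by
      rw [chn_succ']
      have := C.length_lt_of_notMem (hy j (by omega)) hi
      simpa using this
    have h4 := C.bruhat_mul_simple_mul_simple h2 h3
    rw [chn_succ'] at h4
    simp only [mul_assoc, simple_mul_simple_self, mul_one] at h4
    rw [crefl_eq, hw]
    apply C.bruhat_mul_le_mul (hck.minLeft le_rfl) hu (hck.bruhat hj le_rfl)
    have := bruhat_inv h4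
    rwa [inv_inv] at this
  · rw [crefl_eq]
    exact hck.notMem hj (Subgroup.inv_mem _ (hy j (by omega)))
  · intro i hi j hj h
    rw [crefl_eq, crefl_eq] at h
    have := hck.eq_of_coset (by omega) (by omega) (Subgroup.inv_mem _ (hy i (by omega)))
      (Subgroup.inv_mem _ (hy j (by omega))) h
    omega

end Cartan

namespace Cartan
variable [Fintype B] [DecidableEq B] {C : Cartan cs} [Finite W] {J J' : Set B} {w x y t u : W}
  {p : ℕ → B} {N k : ℕ}

theorem bruhat_conj_simple (C : Cartan cs) {i : B} (h : bruhatLE cs x y)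
    (hl : cs.length (cs.simple i * y * cs.simple i) = cs.length y + 2) :
    bruhatLE cs (cs.simple i * x * cs.simple i) (cs.simple i * y * cs.simple i) := by
  have h1 : cs.length (cs.simple i * y * cs.simple i) ≤ cs.length (cs.simple i * y) + 1 :=
    (cs.length_mul_le _ _).trans (by rw [cs.length_simple])
  have h2 : cs.length (cs.simple i * y) ≤ 1 + cs.length y :=
    (cs.length_mul_le _ _).trans (by rw [cs.length_simple])
  apply C.bruhat_mul_both _ (by omega)
  have h3 : cs.length y⁻¹ < cs.length (y⁻¹ * cs.simple i) := by
    rw [show y⁻¹ * cs.simple i = (cs.simple i * y)⁻¹ by simp, cs.length_inv, cs.length_inv]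
    omega
  have h4 := bruhat_inv (C.bruhat_mul_both (bruhat_inv h) h3)
  simpa only [mul_inv_rev, inv_inv, cs.inv_simple] using h4

/-- The reflection in `f_k`. -/
def rho (cs : CoxeterSystem M W) (p : ℕ → B) : ℕ → W
  | 0 => cs.simple (p 0)
  | k + 1 => cs.simple (p (k + 1)) * rho cs p k * cs.simple (p (k + 1))

/-- The reflection in `f_{d+m} - f_{d-1}`. -/
def sgm (cs : CoxeterSystem M W) (p : ℕ → B) (d : ℕ) : ℕ → W
  | 0 => cs.simple (p d)
  | m + 1 => cs.simple (p (d + m + 1)) * sgm cs p d m * cs.simple (p (d + m + 1))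

theorem isReflection_conj_simple (h : cs.IsReflection t) (i : B) :
    cs.IsReflection (cs.simple i * t * cs.simple i) := by
  have := h.conj (cs.simple i)
  rwa [cs.inv_simple] at this

theorem rt_conj_simple (C : Cartan cs) (h : cs.IsReflection t) {i : B}
    (h0 : 0 ≤ C.act (cs.simple i) (C.rt t)) :
    C.rt (cs.simple i * t * cs.simple i) = C.act (cs.simple i) (C.rt t) := by
  have h1 := C.rt_conj h (cs.simple i)
  have h2 := isReflection_conj_simple h i
  rw [cs.inv_simple] at h1
  rcases h1 with h1 | h1
  · exact h1
  · have h3 := C.rt_nonneg h2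
    rw [h1] at h3
    exact absurd (le_antisymm h0 (by simpa using h3)).symm ((C.isRoot_rt h).act _).ne_zero

theorem isReflection_rho (k : ℕ) : cs.IsReflection (rho cs p k) := by
  induction k with
  | zero => exact cs.isReflection_simple _
  | succ k ih => exact isReflection_conj_simple ih _

theorem isReflection_sgm (d m : ℕ) : cs.IsReflection (sgm cs p d m) := by
  induction m with
  | zero => exact cs.isReflection_simple _
  | succ k ih => exact isReflection_conj_simple ih _

theorem rho_eq_chn (p : ℕ → B) (N : ℕ) : rho cs p N = chn cs (PathB.ltr p N) (2 * N + 1) := by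
  induction N with
  | zero => simp [rho, chn, PathB.ltr]
  | succ N ih =>
    have h1 : (fun k => PathB.ltr p (N + 1) (k + 1)) = PathB.ltr p N := by
      funext k
      rw [PathB.ltr, PathB.ltr]; congr 1; omega
    rw [show 2 * (N + 1) + 1 = (2 * N + 1 + 1) + 1 by ring, chn, chn_succ', h1, rho, ih,
      ← mul_assoc]
    have h2 : PathB.ltr p (N + 1) (2 * N + 1 + 1) = p (N + 1) := by rw [PathB.ltr]; congr 1; omega
    have h3 : PathB.ltr p (N + 1) 0 = p (N + 1) := by rw [PathB.ltr]; congr 1; omega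
    rw [h2, h3]

theorem fB_mono (p : ℕ → B) {a b : ℕ} (h : a ≤ b) : fB p a ≤ fB p b :=
  Finset.sum_le_sum_of_subset_of_nonneg (Finset.range_subset_range.2 (by omega))
    fun _ _ _ => al_nonneg _

theorem hgt_fB (p : ℕ → B) (m : ℕ) : hgt (fB p m) = m + 1 := by
  induction m with
  | zero => rw [fB_zero, hgt_al]; simp
  | succ m ih => rw [fB_succ, hgt_add, ih, hgt_al]; push_cast; ring

namespace PathB

theorem restrict (P : C.PathB J p N) (hk : 1 ≤ k) (hkN : k ≤ N) :
    C.PathB {j | ∃ a ≤ k, p a = j} p k where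
  pos := hk
  inj a b ha hb h := P.inj a b (by omega) (by omega) h
  mem a ha := ⟨a, ha, rfl⟩
  A_zero_one := P.A_zero_one
  A_one_zero := P.A_one_zero
  A_succ a ha h := P.A_succ a ha (by omega)
  A_far a b h hb := P.A_far a b h (by omega)
  A_out := by rintro j ⟨a, ha, rfl⟩ h; exact absurd rfl (h a ha)

theorem length_rho (P : C.PathB J p N) (hk : k ≤ N) : cs.length (rho cs p k) = 2 * k + 1 := by
  rcases Nat.eq_zero_or_pos k with rfl | h
  · exact cs.length_simple _
  · rw [rho_eq_chn]
    exact ((P.restrict h hk).isFullChain.isChain le_rfl).length le_rfl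

theorem rho_step (P : C.PathB J p N) (hk : k + 1 ≤ N) :
    bruhatLE cs (rho cs p k) (rho cs p (k + 1)) := by
  have h0 := P.length_rho (k := k) (by omega)
  have h1 := P.length_rho hk
  have h2 : cs.length (rho cs p (k + 1)) ≤ 1 + cs.length (rho cs p k * cs.simple (p (k + 1))) := by
    rw [rho, mul_assoc]
    exact (cs.length_mul_le _ _).trans (by rw [cs.length_simple])
  have h3 : cs.length (rho cs p k * cs.simple (p (k + 1))) ≤ cs.length (rho cs p k) + 1 :=
    (cs.length_mul_le _ _).trans (by rw [cs.length_simple])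
  refine bruhat_trans (bruhat_mul_simple (i := p (k + 1)) (by omega)) ?_
  rw [rho, mul_assoc]
  refine bruhat_of_refl (cs.isReflection_simple _) ?_
  rw [← mul_assoc]
  change _ < cs.length (rho cs p (k + 1))
  omega

theorem rho_le (P : C.PathB J p N) {a b : ℕ} (hab : a ≤ b) (hb : b ≤ N) :
    bruhatLE cs (rho cs p a) (rho cs p b) := by
  induction b, hab using Nat.le_induction with
  | base => exact bruhat_refl _
  | succ b _ ih => exact bruhat_trans (ih (by omega)) (P.rho_step hb)

theorem sgm_le (P : C.PathB J p N) {d m : ℕ} (hd : d + m ≤ N) :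
    bruhatLE cs (sgm cs p d m) (rho cs p (d + m)) := by
  induction m with
  | zero =>
    rcases d with _ | d
    · exact bruhat_refl _
    · apply C.simple_bruhat_of_descent
      have h1 := P.length_rho hd
      have h2 := P.length_rho (k := d) (by simp at hd; omega)
      simp only [add_zero] at h1 ⊢
      rw [h1, rho, simple_mul_simple_cancel_right]
      have := cs.length_mul_le (cs.simple (p (d + 1))) (rho cs p d)
      rw [cs.length_simple] at this
      omega
  | succ m ih =>
    rw [sgm, ← add_assoc, rho]
    apply C.bruhat_conj_simple (ih (by omega))
    change cs.length (rho cs p (d + m + 1)) = _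
    rw [P.length_rho (show d + m + 1 ≤ N from hd), P.length_rho (by omega)]
    ring

theorem rt_rho (P : C.PathB J p N) (hk : k ≤ N) : C.rt (rho cs p k) = fB p k := by
  induction k with
  | zero => rw [rho, rt_simple, fB_zero]
  | succ k ih =>
    have h : C.act (cs.simple (p (k + 1))) (C.rt (rho cs p k)) = fB p (k + 1) := by
      rw [ih (by omega), P.act_succ_pred hk]
    rw [rho, C.rt_conj_simple (isReflection_rho k) (by rw [h]; exact fB_nonneg _ _), h]

theorem rt_sgm (P : C.PathB J p N) {d m : ℕ} (hd : d + 1 + m ≤ N) :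
    C.rt (sgm cs p (d + 1) m) = fB p (d + 1 + m) - fB p d := by
  induction m with
  | zero => rw [sgm, rt_simple, al_succ, add_zero]
  | succ m ih =>
    have h : C.act (cs.simple (p (d + 1 + m + 1))) (C.rt (sgm cs p (d + 1) m)) =
        fB p (d + 1 + (m + 1)) - fB p d := by
      rw [ih (by omega), act_sub, P.act_succ_pred (show d + 1 + m + 1 ≤ N from hd),
        P.act_succ_of_ne (show d + 1 + m + 1 ≤ N from hd) (by omega) (by omega) (by omega)]
      rfl
    rw [sgm, C.rt_conj_simple (isReflection_sgm _ m)
      (by rw [h, sub_nonneg]; exact fB_mono p (by omega)), h]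

theorem isRoot_fB (P : C.PathB J p N) (hk : k ≤ N) : C.IsRoot (fB p k) :=
  P.rt_rho hk ▸ C.isRoot_rt (isReflection_rho k)

theorem act_rho_self (P : C.PathB J p N) (hk : k ≤ N) :
    C.act (rho cs p k) (fB p k) = - fB p k := by
  have := C.act_rt (isReflection_rho (cs := cs) (p := p) k)
  rwa [P.rt_rho hk] at this

theorem act_rho_of_ne (P : C.PathB J p N) {i : ℕ} (hk : k ≤ N) (hi : i ≤ N) (h : i ≠ k) :
    C.act (rho cs p k) (fB p i) = fB p i := by
  induction k generalizing i with
  | zero => exact P.act_zero_of_pos hi (by omega)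
  | succ k ih =>
    rw [rho, act_mul, act_mul]
    by_cases h1 : i = k
    · subst h1
      rw [P.act_succ_pred hk, ih (by omega) hk (by omega), P.act_succ_self hk]
    · rw [P.act_succ_of_ne hk hi h1 h, ih (by omega) hi h1, P.act_succ_of_ne hk hi h1 h]

theorem isRoot_sub (P : C.PathB J p N) {a b : ℕ} (hab : a < b) (hb : b ≤ N) :
    C.IsRoot (fB p b - fB p a) := by
  obtain ⟨m, rfl⟩ : ∃ m, b = a + 1 + m := ⟨b - (a + 1), by omega⟩
  exact P.rt_sgm hb ▸ C.isRoot_rt (isReflection_sgm _ m)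

theorem isRoot_add (P : C.PathB J p N) {a b : ℕ} (hab : a < b) (hb : b ≤ N) :
    C.IsRoot (fB p b + fB p a) := by
  have h := (P.isRoot_sub hab hb).act (rho cs p a)
  rwa [act_sub, P.act_rho_self (by omega), P.act_rho_of_ne (by omega) hb (by omega),
    sub_neg_eq_add] at h

theorem form_fB_ne (P : C.PathB J p N) {a b : ℕ} (ha : a ≤ N) (hb : b ≤ N) (h : a ≠ b) :
    C.form (fB p a) (fB p b) = 0 := by
  have h1 := C.form_act (rho cs p b) (fB p a) (fB p b)
  rw [P.act_rho_self hb, P.act_rho_of_ne hb ha h, form_neg] at h1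
  omega

theorem form_fB_self (P : C.PathB J p N) (hk : k ≤ N) :
    C.form (fB p k) (fB p k) = C.form (fB p 0) (fB p 0) := by
  induction k with
  | zero => rfl
  | succ k ih =>
    rw [← ih (by omega), ← P.act_succ_pred hk, form_act]

end PathB
end Cartan

namespace Cartan
variable [Fintype B] [DecidableEq B] {C : Cartan cs} [Finite W] {J J' : Set B} {w x y t u : W}
  {p : ℕ → B} {N k : ℕ}
namespace PathB

theorem act_fB (P : C.PathB J p N) (hx : x ∈ WJc cs {j | ∃ a ≤ N, p a = j}) :
    ∀ k ≤ N, ∃ l ≤ N, C.act x (fB p k) = fB p l ∨ C.act x (fB p k) = -fB p l := by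
  refine C.WJ_induction (P := fun x => ∀ k ≤ N, ∃ l ≤ N, C.act x (fB p k) = fB p l ∨
    C.act x (fB p k) = -fB p l) (fun k hk => ⟨k, hk, Or.inl (C.act_one _)⟩) ?_ hx
  rintro x i - ⟨a, ha, rfl⟩ - ih k hk
  rw [act_mul]
  rcases a with _ | a
  · rcases Nat.eq_zero_or_pos k with rfl | h
    · obtain ⟨l, hl, h1⟩ := ih 0 hk
      rw [P.act_zero_self, act_neg]
      exact ⟨l, hl, h1.elim (fun h => Or.inr (by rw [h])) fun h => Or.inl (by rw [h, neg_neg])⟩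
    · rw [P.act_zero_of_pos hk h]; exact ih k hk
  · by_cases h1 : k = a
    · rw [h1, P.act_succ_pred ha]; exact ih _ ha
    by_cases h2 : k = a + 1
    · rw [h2, P.act_succ_self ha]; exact ih _ (by omega)
    · rw [P.act_succ_of_ne ha hk h1 h2]; exact ih _ hk

theorem sign_of_nonneg (P : C.PathB J p N) {v : B → ℤ} (h0 : 0 ≤ v) {a b : ℕ} (ha : a ≤ N)
    (hb : b ≤ N) (hab : a ≠ b) (h : v = fB p a + fB p b ∨ v = fB p a - fB p b ∨
      v = -fB p a + fB p b ∨ v = -fB p a - fB p b) :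
    ∃ l k, l < k ∧ k ≤ N ∧ (v = fB p k - fB p l ∨ v = fB p k + fB p l) := by
  have hva := h0 (p a)
  have hvb := h0 (p b)
  have h1 := P.fB_apply ha ha
  have h2 := P.fB_apply ha hb
  have h3 := P.fB_apply hb ha
  have h4 := P.fB_apply hb hb
  rw [if_pos le_rfl] at h1 h4
  rcases lt_or_gt_of_ne hab with hl | hl
  · refine ⟨a, b, hl, hb, ?_⟩
    rw [if_neg (by omega)] at h2
    rcases h with rfl | rfl | rfl | rfl
    · right; abel
    · exfalso; simp [h2, h4] at hvb
    · left; abel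
    · exfalso; simp [h2, h4] at hvb
  · refine ⟨b, a, hl, ha, ?_⟩
    rw [if_neg (by omega)] at h3
    rcases h with rfl | rfl | rfl | rfl
    · right; abel
    · left; abel
    · exfalso; simp [h1, h3] at hva
    · exfalso; simp [h1, h3] at hva

theorem isRoot_cases (P : C.PathB J p N) {v : B → ℤ} (hv : C.IsRoot v) (h0 : 0 ≤ v)
    (hJ : InJ {j | ∃ a ≤ N, p a = j} v) :
    (∃ k ≤ N, v = fB p k) ∨
      ∃ l k, l < k ∧ k ≤ N ∧ (v = fB p k - fB p l ∨ v = fB p k + fB p l) := by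
  obtain ⟨x, hx, i, ⟨j, hj, rfl⟩, h⟩ := C.exists_WJ_of_isRoot hv h0 hJ
  rcases j with _ | j
  · obtain ⟨k, hk, h1⟩ := P.act_fB hx 0 hj
    rw [← fB_zero] at h
    refine Or.inl ⟨k, hk, h1.elim (fun h1 => h.trans h1) fun h1 => ?_⟩
    rw [← h] at h1
    have h2 : 0 ≤ -fB p k := h1 ▸ h0
    exact absurd (le_antisymm (Left.nonneg_neg_iff.1 h2) (fB_nonneg p k)) (P.isRoot_fB hk).ne_zero
  · right
    obtain ⟨a, ha, h1⟩ := P.act_fB hx (j + 1) hj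
    obtain ⟨b, hb, h2⟩ := P.act_fB hx j (by omega)
    rw [al_succ, act_sub] at h
    have hab : a ≠ b := by
      rintro rfl
      have key : ∃ c : ℤ, v = c • fB p a ∧ (c = 0 ∨ c = 2 ∨ c = -2) := by
        rcases h1 with h1 | h1 <;> rcases h2 with h2 | h2 <;> rw [h1, h2] at h
        · exact ⟨0, by rw [h]; module, by simp⟩
        · exact ⟨2, by rw [h]; module, by simp⟩
        · exact ⟨-2, by rw [h]; module, by simp⟩
        · exact ⟨0, by rw [h]; module, by simp⟩
      obtain ⟨c, h3, h4⟩ := key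
      rcases hv.primitive h3 with h5 | h5 <;> omega
    apply P.sign_of_nonneg h0 ha hb hab
    rcases h1 with h1 | h1 <;> rcases h2 with h2 | h2 <;> rw [h1, h2] at h
    · exact Or.inr (Or.inl h)
    · left; rw [h]; abel
    · exact Or.inr (Or.inr (Or.inr h))
    · right; right; left; rw [h]; abel

theorem form_fB (P : C.PathB J p N) {a b : ℕ} (ha : a ≤ N) (hb : b ≤ N) :
    C.form (fB p a) (fB p b) = if a = b then C.form (fB p 0) (fB p 0) else 0 := by
  split_ifs with h
  · rw [h, P.form_fB_self hb]
  · exact P.form_fB_ne ha hb h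

theorem form_fB_pos (P : C.PathB J p N) : 0 < C.form (fB p 0) (fB p 0) :=
  C.form_self_pos (P.isRoot_fB (Nat.zero_le _)).ne_zero

theorem inJ_path (hk : k ≤ N) : InJ {j | ∃ a ≤ N, p a = j} (fB p k) :=
  fB_inJ fun i hi => ⟨i, by omega, rfl⟩

theorem inJ_of_smul {v : B → ℤ} {c : ℤ} (hc : c ≠ 0) (h : InJ J (c • v)) : InJ J v := by
  intro k hk
  have := h k hk
  rw [Pi.smul_apply, smul_eq_mul] at this
  exact (mul_eq_zero.1 this).resolve_left hc

theorem frame (P : C.PathB J p N) {i : ℕ} (h0 : 0 < i) (hi : i < N) :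
    C.Frame (fB p N) (fB p i) (fB p 0) where
  XY := P.form_fB_ne le_rfl hi.le (by omega)
  XZ := P.form_fB_ne le_rfl (by omega) (by omega)
  YZ := P.form_fB_ne hi.le (by omega) (by omega)
  YY := by rw [P.form_fB_self hi.le, P.form_fB_self le_rfl]
  ZZ := by rw [P.form_fB_self le_rfl]
  root := by
    simp only [rootsB3, List.forall_mem_cons, ev, zero_smul, one_smul, neg_smul, add_zero, zero_add]
    simp only [← sub_eq_add_neg]
    exact ⟨P.isRoot_fB le_rfl, P.isRoot_fB hi.le, P.isRoot_fB (by omega),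
      P.isRoot_sub hi le_rfl, P.isRoot_add hi le_rfl, P.isRoot_sub (by omega) le_rfl,
      P.isRoot_add (by omega) le_rfl, P.isRoot_sub h0 hi.le, P.isRoot_add h0 hi.le, by simp⟩
  nonneg := by
    simp only [rootsB3, List.forall_mem_cons, ev, zero_smul, one_smul, neg_smul, add_zero, zero_add]
    simp only [← sub_eq_add_neg, sub_nonneg]
    have h (k) := fB_nonneg p k
    exact ⟨h _, h _, h _, fB_mono p hi.le, add_nonneg (h _) (h _), fB_mono p (by omega),
      add_nonneg (h _) (h _), fB_mono p h0.le, add_nonneg (h _) (h _), by simp⟩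
  cls t ht c v hc h := by
    have hJ : InJ {j | ∃ a ≤ N, p a = j} (C.rt t) := by
      apply inJ_of_smul hc
      rw [h, ev]
      exact (((inJ_path le_rfl).smul _).add ((inJ_path hi.le).smul _)).add
        ((inJ_path (by omega)).smul _)
    have key : ∀ k ≤ N, C.form (C.rt t) (fB p k) ≠ 0 → k = N ∨ k = i ∨ k = 0 := by
      intro k hk hne
      by_contra hcon
      push Not at hcon
      have h1 : C.form (c • C.rt t) (fB p k) = 0 := by
        rw [h, ev, form_add_left, form_add_left, form_smul_left, form_smul_left, form_smul_left,
          P.form_fB_ne le_rfl hk hcon.1.symm, P.form_fB_ne hi.le hk hcon.2.1.symm,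
          P.form_fB_ne (by omega) hk hcon.2.2.symm]
        ring
      rw [form_smul_left] at h1
      exact hne ((mul_eq_zero.1 h1).resolve_left hc)
    have hpos := P.form_fB_pos
    rcases P.isRoot_cases (C.isRoot_rt ht) (C.rt_nonneg ht) hJ with ⟨k, hk, hv⟩ |
      ⟨l, k, hlk, hk, hv⟩
    · have h1 := key k hk (by rw [hv, P.form_fB hk hk, if_pos rfl]; omega)
      rw [hv]
      rcases h1 with rfl | rfl | rfl
      · exact ⟨(1, 0, 0), by decide, by simp [ev]⟩
      · exact ⟨(0, 1, 0), by decide, by simp [ev]⟩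
      · exact ⟨(0, 0, 1), by decide, by simp [ev]⟩
    · have h1 := key k hk (by
        rcases hv with hv | hv
        · rw [hv, form_sub_left, P.form_fB hk hk, P.form_fB (by omega) hk, if_pos rfl,
            if_neg (by omega)]; omega
        · rw [hv, form_add_left, P.form_fB hk hk, P.form_fB (by omega) hk, if_pos rfl,
            if_neg (by omega)]; omega)
      have h2 := key l (by omega) (by
        rcases hv with hv | hv
        · rw [hv, form_sub_left, P.form_fB_ne hk (by omega) (by omega),
            P.form_fB_self (by omega)]; omega
        · rw [hv, form_add_left, P.form_fB_ne hk (by omega) (by omega),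
            P.form_fB_self (by omega)]; omega)
      rcases hv with hv | hv
      · rw [hv]
        rcases h1 with rfl | rfl | rfl <;> rcases h2 with rfl | rfl | rfl <;> try omega
        · exact ⟨(1, -1, 0), by decide, by simp [ev, sub_eq_add_neg]⟩
        · exact ⟨(1, 0, -1), by decide, by simp [ev, sub_eq_add_neg]⟩
        · exact ⟨(0, 1, -1), by decide, by simp [ev, sub_eq_add_neg]⟩
      · rw [hv]
        rcases h1 with rfl | rfl | rfl <;> rcases h2 with rfl | rfl | rfl <;> try omega
        · exact ⟨(1, 1, 0), by decide, by simp [ev]⟩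
        · exact ⟨(1, 0, 1), by decide, by simp [ev]⟩
        · exact ⟨(0, 1, 1), by decide, by simp [ev]⟩

end PathB
end Cartan

theorem chn_add (cs : CoxeterSystem M W) (c : ℕ → B) (a b : ℕ) :
    chn cs c (a + b) = chn cs (fun k => c (k + a)) b * chn cs c a := by
  induction b with
  | zero => simp [chn]
  | succ b ih =>
    rw [← add_assoc, chn, chn, ih, mul_assoc, add_comm a b]

namespace Cartan
variable [Fintype B] [DecidableEq B] {C : Cartan cs} [Finite W] {J J' : Set B} {w x y t s r u : W}
  {p : ℕ → B} {N k : ℕ}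

theorem conj_eq_of_act (C : Cartan cs) (ht : cs.IsReflection t) (hs : cs.IsReflection s)
    (hr : cs.IsReflection r) (h : C.act t (C.rt s) = -C.rt r) : t * s * t = r := by
  have h1 := hs.conj t
  rw [ht.inv] at h1
  apply C.refl_ext h1 hr
  rcases C.rt_conj_refl ht hs with h2 | h2
  · right; rw [h2, h]
  · left; rw [h2, h, neg_neg]

theorem simple_bruhat_or_mem (C : Cartan cs) (i : B) (hu : u ∈ WJc cs J) :
    bruhatLE cs (cs.simple i) u ∨ u ∈ WJc cs (J \ {i}) := by
  refine C.WJ_induction (P := fun u => bruhatLE cs (cs.simple i) u ∨ u ∈ WJc cs (J \ {i}))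
    (Or.inr (Subgroup.one_mem _)) ?_ hu
  rintro u j - hj hl h
  rcases h with h | h
  · exact Or.inl (bruhat_trans h (bruhat_mul_simple hl))
  · by_cases hji : j = i
    · subst hji
      left
      apply C.simple_bruhat_of_descent
      rwa [simple_mul_simple_cancel_right]
    · exact Or.inr (Subgroup.mul_mem _ h (simple_mem_WJ ⟨hj, hji⟩))

namespace PathB

/-- The action of the inverse of `s_{p (k-1)} ⋯ s_{p 0}`. -/
theorem act_chn_path (P : C.PathB J p N) (hk : k ≤ N) {i : ℕ} (hi : i ≤ N) :
    C.act (chn cs p (k + 1))⁻¹ (fB p i) =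
      if i = k then -fB p 0 else if i < k then fB p (i + 1) else fB p i := by
  induction k generalizing i with
  | zero =>
    rw [chn, chn, mul_one, cs.inv_simple]
    rcases Nat.eq_zero_or_pos i with rfl | h
    · rw [if_pos rfl, P.act_zero_self]
    · rw [P.act_zero_of_pos hi h, if_neg (by omega), if_neg (by omega)]
  | succ k ih =>
    rw [chn, mul_inv_rev, cs.inv_simple, act_mul]
    by_cases h1 : i = k
    · rw [h1, P.act_succ_pred hk, ih (by omega) hk, if_neg (by omega), if_neg (by omega),
        if_neg (by omega), if_pos (by omega)]
    by_cases h2 : i = k + 1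
    · rw [h2, P.act_succ_self hk, ih (by omega) (by omega), if_pos rfl, if_pos rfl]
    · rw [P.act_succ_of_ne hk hi h1 h2, ih (by omega) hi, if_neg h1, if_neg h2]
      split_ifs <;> first | rfl | omega

theorem isChain_path (P : C.PathB J p N) : C.IsChain (J \ {p 0}) p (N + 1) := by
  have ce : ∀ k ≤ N, C.act (chn cs p k)⁻¹ (al (p k)) =
      if k = 0 then fB p 0 else fB p k + fB p 0 := by
    intro k hk
    rcases k with _ | k
    · rw [chn, inv_one, act_one, if_pos rfl, fB_zero]
    · rw [al_succ, act_sub, P.act_chn_path (by omega) hk, P.act_chn_path (by omega) (by omega),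
        if_neg (by omega), if_neg (by omega), if_pos rfl, if_neg (by omega), sub_neg_eq_add]
  refine ⟨fun k hk => ?_, fun k hk h => ?_, fun i k hik hk => Or.inr (Or.inr ?_)⟩
  · rw [ce k (by omega)]
    split_ifs
    · exact fB_nonneg p 0
    · exact add_nonneg (fB_nonneg p k) (fB_nonneg p 0)
  · have h1 := h (p 0) (by simp)
    rw [ce k (by omega)] at h1
    split_ifs at h1
    · rw [P.fB_apply (by omega) (by omega), if_pos le_rfl] at h1
      omega
    · rw [Pi.add_apply, P.fB_apply (by omega) (by omega), P.fB_apply (by omega) (by omega),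
        if_pos (by omega), if_pos le_rfl] at h1
      omega
  · have h0 : InJ (J \ {p 0}) (al (p k)) := inJ_al ⟨P.mem k (by omega), fun h => by
      have := P.inj _ _ (by omega) (by omega) h
      omega⟩
    rcases i with _ | i
    · rwa [chn, inv_one, act_one]
    · obtain ⟨k, rfl⟩ : ∃ e, k = e + 1 := ⟨k - 1, by omega⟩
      rw [al_succ, act_sub, P.act_chn_path (by omega) (by omega),
        P.act_chn_path (by omega) (by omega), if_neg (by omega), if_neg (by omega),
        if_neg (by omega), if_neg (by omega), ← al_succ]
      exact h0

theorem strip_path (P : C.PathB J p N) (hu : u ∈ WJc cs (J \ {p 0}))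
    (hu' : u ∈ WJc cs (J \ {p N})) :
    C.Strip (J \ {p 0}) (rho cs p N * u) := by
  have h1 : rho cs p N = chn cs p (N + 1) * chn cs (ltr p N) N := by
    rw [rho_eq_chn, show 2 * N + 1 = N + (N + 1) by ring, chn_add]
    congr 2
    funext k
    rw [ltr]; congr 1; omega
  have h2 : chn cs (ltr p N) N ∈ WJc cs (J \ {p 0}) := chn_mem _ _ fun k hk =>
    ⟨P.mem _ (by omega), fun h => by
      have := P.inj _ _ (by omega) (by omega) h
      omega⟩
  have h3 : bruhatLE cs (rho cs p N) (rho cs p N * u) := by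
    have h4 := (P.isFullChain.isChain le_rfl).minLeft le_rfl
    rw [← rho_eq_chn] at h4
    simpa only [mul_one] using C.bruhat_mul_le_mul h4 hu' (bruhat_refl _) (one_bruhat u)
  refine strip_of_refls P.isChain_path (Subgroup.mul_mem _ h2 hu)
    (by rw [← mul_assoc, ← h1]) (rho cs p) (fun k hk => ⟨isReflection_rho k,
      bruhat_trans (P.rho_le (by omega) le_rfl) h3, fun h => ?_⟩) fun i hi k hk h => ?_
  · have h4 := C.inJ_rt (isReflection_rho k) h (p 0) (by simp)
    rw [P.rt_rho (by omega), P.fB_apply (by omega) (by omega), if_pos (by omega)] at h4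
    omega
  · have h4 := P.rt_rho (k := i) (by omega)
    rw [h, P.rt_rho (by omega)] at h4
    have h5 := congrArg hgt h4
    rw [hgt_fB, hgt_fB] at h5
    omega

end PathB
end Cartan

namespace Cartan
variable [Fintype B] [DecidableEq B] {C : Cartan cs} [Finite W] {J J' : Set B} {w x y t s r u : W}
  {p : ℕ → B} {N k : ℕ}

namespace PathB

theorem minLeft_rho (P : C.PathB J p N) : MinLeft cs (J \ {p N}) (rho cs p N) := by
  rw [rho_eq_chn]
  exact (P.isFullChain.isChain le_rfl).minLeft le_rfl

theorem exists_refl_add_zero (P : C.PathB J p N) (hu : u ∈ WJc cs (J \ {p N}))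
    (h : bruhatLE cs (cs.simple (p 0)) u) :
    ∃ r, cs.IsReflection r ∧ C.rt r = fB p N + fB p 0 ∧ bruhatLE cs r (rho cs p N * u) := by
  have hN := P.pos
  obtain ⟨t, ht, hrt⟩ := (P.isRoot_sub (show 0 < N by omega) le_rfl).exists_refl_of_nonneg
    (sub_nonneg.2 (fB_mono p (Nat.zero_le _)))
  obtain ⟨r, hr, hrr⟩ := (P.isRoot_add (show 0 < N by omega) le_rfl).exists_refl_of_nonneg
    (add_nonneg (fB_nonneg p N) (fB_nonneg p 0))
  have hδ := isReflection_rho (cs := cs) (p := p) N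
  have h1 : C.act (rho cs p N) (C.rt t) = -C.rt r := by
    rw [hrt, hrr, act_sub, P.act_rho_self le_rfl, P.act_rho_of_ne le_rfl (by omega) (by omega)]
    module
  have e1 : rho cs p N * t * rho cs p N = r := C.conj_eq_of_act hδ ht hr h1
  have h2 : C.act r (C.rt (rho cs p 0)) = -C.rt (rho cs p N) := by
    have h3 := C.cor_form hr (fB p 0)
    have hne := P.form_fB_ne (a := N) (b := 0) le_rfl (by omega) (by omega)
    have hne' := P.form_fB_ne (a := 0) (b := N) (by omega) le_rfl (by omega)
    have hself := P.form_fB_self (k := N) le_rfl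
    rw [hrr, form_add_left, form_add_left, form_add, form_add, hne, hne', hself] at h3
    have h4 := P.form_fB_pos
    have h5 : C.cor r (fB p 0) = 1 := by
      apply mul_right_cancel₀ h4.ne'
      linarith
    rw [P.rt_rho (by omega), P.rt_rho le_rfl, C.act_refl hr, h5, hrr]
    module
  have e2 : r * rho cs p 0 * r = rho cs p N :=
    C.conj_eq_of_act hr (isReflection_rho 0) hδ h2
  have e3 : r = t * rho cs p N * cs.simple (p 0) := by
    change r = t * rho cs p N * rho cs p 0
    have h6 : t * rho cs p N = rho cs p N * r := by
      rw [← e1, ← mul_assoc, ← mul_assoc, hδ.mul_self, one_mul]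
    rw [h6, ← e2]
    simp only [mul_assoc, hr.mul_self, mul_one]
    rw [(isReflection_rho (cs := cs) (p := p) 0).mul_self, mul_one]
  refine ⟨r, hr, hrr, ?_⟩
  rw [e3]
  refine C.bruhat_mul_le_mul P.minLeft_rho hu (bruhat_of_refl' ht ?_) h
  rw [C.down_iff ht, hδ.inv, h1, Left.neg_nonpos_iff]
  exact C.rt_nonneg hr

theorem exists_refl_add (P : C.PathB J p N) (hu : u ∈ WJc cs (J \ {p N}))
    (h : bruhatLE cs (cs.simple (p 0)) u) (hw : Regular cs (rho cs p N * u)) {d : ℕ} (hd : d < N) :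
    ∃ r, cs.IsReflection r ∧ C.rt r = fB p N + fB p d ∧ bruhatLE cs r (rho cs p N * u) := by
  rcases Nat.eq_zero_or_pos d with rfl | h0
  · exact P.exists_refl_add_zero hu h
  have F := P.frame h0 hd
  have h1 : C.Mp (fB p N) (fB p d) (fB p 0) (rho cs p N * (rho cs p 0 * 1))
      ((-1, 0, 0), (0, 1, 0), (0, 0, -1)) := by
    have h2 := F.Mp_refl_mul (F.Mp_refl_mul Frame.Mp_one (isReflection_rho 0) (r := (0, 0, 1))
      (by decide) (by rw [P.rt_rho (by omega)]; simp [ev])) (isReflection_rho N) (r := (1, 0, 0))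
      (by decide) (by rw [P.rt_rho le_rfl]; simp [ev])
    have h3 : reflMapB3 (1, 0, 0) (reflMapB3 (0, 0, 1) ((1, 0, 0), (0, 1, 0), (0, 0, 1))) =
      ((-1, 0, 0), (0, 1, 0), (0, 0, -1)) := by decide
    rwa [h3] at h2
  rw [mul_one] at h1
  obtain ⟨x, hx, hxw⟩ := F.below hw ⟨_, h1, C.bruhat_mul_le_mul P.minLeft_rho hu (bruhat_refl _) h⟩
  obtain ⟨r, hr, hrr⟩ := F.exists_refl (r := (1, 1, 0)) (by decide)
  have h2 := F.Mp_refl_mul Frame.Mp_one hr (by decide) hrr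
  have h3 : reflMapB3 (1, 1, 0) ((1, 0, 0), (0, 1, 0), (0, 0, 1)) =
    ((0, -1, 0), (-1, 0, 0), (0, 0, 1)) := by decide
  rw [h3, mul_one] at h2
  refine ⟨r, hr, by rw [hrr]; simp [ev], ?_⟩
  rwa [Frame.Mp_unique hx h2] at hxw

theorem strip_full (P : C.PathB J p N) (hu : u ∈ WJc cs (J \ {p N}))
    (h : bruhatLE cs (cs.simple (p 0)) u) (hw : Regular cs (rho cs p N * u)) :
    C.Strip (J \ {p N}) (rho cs p N * u) := by
  have hδ : bruhatLE cs (rho cs p N) (rho cs p N * u) := by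
    simpa only [mul_one] using C.bruhat_mul_le_mul P.minLeft_rho hu (bruhat_refl _) (one_bruhat u)
  have key : ∀ k, ∃ r, k < 2 * N + 1 → cs.IsReflection r ∧ bruhatLE cs r (rho cs p N * u) ∧
      C.rt r (p N) = 1 ∧ hgt (C.rt r) = k + 1 := by
    intro k
    by_cases hk : k < 2 * N + 1
    swap
    · exact ⟨1, fun h => absurd h hk⟩
    rcases lt_trichotomy k N with h1 | rfl | h1
    · obtain ⟨d, rfl⟩ : ∃ d, N = d + 1 + k := ⟨N - (k + 1), by omega⟩
      refine ⟨sgm cs p (d + 1) k, fun _ => ⟨isReflection_sgm _ _,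
        bruhat_trans (P.sgm_le le_rfl) hδ, ?_, ?_⟩⟩
      · rw [P.rt_sgm le_rfl, Pi.sub_apply, P.fB_coord_self, P.fB_coord (by omega), sub_zero]
      · rw [P.rt_sgm le_rfl, hgt_sub, hgt_fB, hgt_fB]; push_cast; ring
    · refine ⟨_, fun _ => ⟨isReflection_rho _, hδ, ?_, ?_⟩⟩
      · rw [P.rt_rho le_rfl, P.fB_coord_self]
      · rw [P.rt_rho le_rfl, hgt_fB]
    · obtain ⟨d, rfl⟩ : ∃ d, k = N + 1 + d := ⟨k - (N + 1), by omega⟩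
      obtain ⟨r, hr, hrr, hrw⟩ := P.exists_refl_add hu h hw (d := d) (by omega)
      refine ⟨r, fun _ => ⟨hr, hrw, ?_, ?_⟩⟩
      · rw [hrr, Pi.add_apply, P.fB_coord_self, P.fB_coord (by omega), add_zero]
      · rw [hrr, hgt_add, hgt_fB, hgt_fB]; push_cast; ring
  choose r hr using key
  refine strip_of_refls (P.isFullChain.isChain le_rfl) hu (by rw [rho_eq_chn]) r
    (fun k hk => ⟨(hr k hk).1, (hr k hk).2.1, fun hm => ?_⟩) fun i hi k hk h => ?_
  · have h1 := C.inJ_rt (hr k hk).1 hm (p N) (by simp)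
    rw [(hr k hk).2.2.1] at h1
    omega
  · have h1 := (hr i hi).2.2.2
    rw [h, (hr k hk).2.2.2] at h1
    omega

theorem factors_full (P : C.PathB J p N) (hu : u ∈ WJc cs (J \ {p N}))
    (hs : RatSmooth cs (rho cs p N * u))
    (ih : ∀ i ∈ J, ∀ u ∈ WJc cs (J \ {i}), RatSmooth cs u → Factors cs (J \ {i}) u) :
    Factors cs J (rho cs p N * u) := by
  rcases C.simple_bruhat_or_mem (p 0) hu with h | h
  · exact factors_of_strip (C := C) (P.mem N le_rfl) hs
      (Or.inl (P.strip_full hu h (C.regular_of_ratSmooth hs))) (ih _ (P.mem N le_rfl))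
  · have h0 := P.mem 0 (Nat.zero_le _)
    exact factors_of_strip (C := C) h0 hs (Or.inl (P.strip_path
      (WJ_mono (Set.sdiff_subset_sdiff_left Set.sdiff_subset) h) hu)) (ih _ h0)

theorem factors (P : C.PathB J p N) (hs : RatSmooth cs w) (hw : w ∈ WJc cs J)
    (ih : ∀ i ∈ J, ∀ u ∈ WJc cs (J \ {i}), RatSmooth cs u → Factors cs (J \ {i}) u) :
    Factors cs J w := by
  obtain ⟨k, hk, u, hu, h1⟩ := P.isFullChain.exists_mul Set.sdiff_subset hw
  obtain ⟨k', hk', u', hu', h2⟩ :=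
    P.isFullChain.exists_mul Set.sdiff_subset (Subgroup.inv_mem _ hw)
  by_cases hkN : k = 2 * N + 1
  · rw [hkN, ← rho_eq_chn] at h1
    rw [h1] at hs ⊢
    exact P.factors_full hu hs ih
  by_cases hkN' : k' = 2 * N + 1
  · rw [hkN', ← rho_eq_chn] at h2
    have hs' := ratSmooth_inv hs
    rw [h2] at hs'
    obtain ⟨m, hm, hp⟩ := P.factors_full hu' hs' ih
    rw [← h2, poin_inv] at hp
    exact ⟨m, hm, hp⟩
  have h0 : ltr p N 0 ∉ J \ {p N} := by simp [ltr]
  have hcJ : ∀ j, j + 1 < 2 * N → ltr p N (j + 1) ∈ J \ {p N} := fun j hj =>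
    ⟨P.ltr_mem (by omega), fun h => by
      have := P.inj _ _ (by omega) le_rfl h
      omega⟩
  refine factors_of_strip (C := C) (P.mem N le_rfl) hs ?_ (ih _ (P.mem N le_rfl))
  rcases le_total k k' with hkk | hkk
  · exact Or.inl (strip_of_double (P.isFullChain.isChain hk') h0 (fun j hj => hcJ j (by omega))
      hkk hu hu' h1 h2)
  · exact Or.inr (strip_of_double (P.isFullChain.isChain hk) h0 (fun j hj => hcJ j (by omega))
      hkk hu' hu h2 (by rw [inv_inv]; exact h1))

end PathB
end Cartan

/-- Integer vectors indexed by the nodes of the diagram of type `F₄`. -/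
@[ext] structure Vec4 where
  a : ℤ
  b : ℤ
  c : ℤ
  d : ℤ

namespace Vec4

/-- Evaluate a natural number before passing it on. -/
def forceNat {α : Type} (n : ℕ) (k : ℕ → α) : α :=
  Nat.rec (motive := fun _ => α) (k 0) (fun m _ => k (m + 1)) n

/-- Evaluate an integer before passing it on. -/
def forceInt {α : Type} (z : ℤ) (k : ℤ → α) : α :=
  match z with
  | .ofNat n => forceNat n fun n => k (.ofNat n)
  | .negSucc n => forceNat n fun n => k (.negSucc n)

/-- Evaluate a vector before passing it on. -/
def force {α : Type} (v : Vec4) (k : Vec4 → α) : α :=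
  forceInt v.a fun a => forceInt v.b fun b => forceInt v.c fun c => forceInt v.d fun d =>
    k ⟨a, b, c, d⟩

theorem forceNat_eq {α : Type} (n : ℕ) (k : ℕ → α) : forceNat n k = k n := by
  cases n <;> rfl

theorem forceInt_eq {α : Type} (z : ℤ) (k : ℤ → α) : forceInt z k = k z := by
  cases z <;> simp only [forceInt, forceNat_eq]

theorem force_eq {α : Type} (v : Vec4) (k : Vec4 → α) : force v k = k v := by
  simp only [force, forceInt_eq]

/-- The coordinates of a vector. -/
def coord : Fin 4 → Vec4 → ℤ
  | 0, v => v.a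
  | 1, v => v.b
  | 2, v => v.c
  | 3, v => v.d

/-- The effect of a simple reflection on the heights of the images of the simple roots. -/
def step : Fin 4 → Vec4 → Vec4
  | 0, v => ⟨-v.a, v.b + v.a, v.c, v.d⟩
  | 1, v => ⟨v.a + v.b, -v.b, v.c + v.b, v.d⟩
  | 2, v => ⟨v.a, v.b + 2 * v.c, -v.c, v.d + v.c⟩
  | 3, v => ⟨v.a, v.b, v.c + v.d, -v.d⟩

/-- The effect of a simple reflection on the coordinates with respect to the simple roots. -/
def rstep : Fin 4 → Vec4 → Vec4
  | 0, v => ⟨v.b - v.a, v.b, v.c, v.d⟩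
  | 1, v => ⟨v.a, v.a - v.b + v.c, v.c, v.d⟩
  | 2, v => ⟨v.a, v.b, 2 * v.b - v.c + v.d, v.d⟩
  | 3, v => ⟨v.a, v.b, v.c, v.c - v.d⟩

/-- The Cartan matrix of type `F₄`. -/
def cartan : Fin 4 → Fin 4 → ℤ :=
  ![![2, -1, 0, 0], ![-1, 2, -1, 0], ![0, -2, 2, -1], ![0, 0, -1, 2]]

/-- The unit vectors. -/
def unit : Fin 4 → Vec4
  | 0 => ⟨1, 0, 0, 0⟩
  | 1 => ⟨0, 1, 0, 0⟩
  | 2 => ⟨0, 0, 1, 0⟩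
  | 3 => ⟨0, 0, 0, 1⟩

/-- Negativity of an integer. -/
def isNeg : ℤ → Bool
  | .ofNat _ => false
  | .negSucc _ => true

theorem isNeg_eq_true {z : ℤ} : isNeg z = true ↔ z < 0 := by
  cases z <;> simp [isNeg, Int.negSucc_lt_zero]

/-- The vector of heights of the simple roots. -/
def one : Vec4 := ⟨1, 1, 1, 1⟩

/-- Test for the vector of heights of the simple roots. -/
def isOne (v : Vec4) : Bool :=
  decide (v.a = 1) && (decide (v.b = 1) && (decide (v.c = 1) && decide (v.d = 1)))

theorem isOne_iff {v : Vec4} : isOne v = true ↔ v = one := by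
  simp [isOne, one, Vec4.ext_iff]

/-- One step of the greedy subword algorithm. -/
def red (j : Fin 4) (v : Vec4) : Vec4 := bif isNeg (coord j v) then step j v else v

/-- Coordinates of the image of `α_i` under a word. -/
def root (p : List (Fin 4) × Fin 4) : Vec4 := p.1.foldr rstep (unit p.2)

/-- A word for the reflection in the image of `α_i` under a word. -/
def rword (p : List (Fin 4) × Fin 4) : List (Fin 4) := p.1 ++ p.2 :: p.1.reverse

/-- The heights of the images of the simple roots under a word. -/
def heights (l : List (Fin 4)) : Vec4 := l.foldl (fun v j => step j v) one

/-- The positive roots. -/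
def table : List (List (Fin 4) × Fin 4) :=
  [([], 0), ([], 1), ([], 2), ([], 3), ([1], 0), ([2], 1), ([1], 2), ([3], 2), ([2, 1], 0),
    ([3, 2], 1), ([0, 1], 2), ([3, 1], 2), ([1, 2, 1], 0), ([3, 2, 1], 0), ([3, 0, 1], 2),
    ([2, 3, 1], 2), ([3, 1, 2, 1], 0), ([2, 3, 0, 1], 2), ([2, 3, 1, 2, 1], 0),
    ([1, 2, 3, 0, 1], 2), ([1, 2, 3, 1, 2, 1], 0), ([2, 1, 2, 3, 0, 1], 2),
    ([0, 1, 2, 3, 1, 2, 1], 0), ([3, 2, 1, 2, 3, 0, 1], 2)]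

/-- The roots together with the states of the greedy subword algorithm. -/
def start : List (Vec4 × Vec4) := table.map fun p => (root p, heights (rword p))

/-- Apply the greedy algorithm to a list of states, moving the finished ones to `D`. -/
def redList {α : Type} (co : Vec4 → ℤ) (st : Vec4 → Vec4) :
    List (Vec4 × Vec4) → List Vec4 → (List (Vec4 × Vec4) → List Vec4 → α) → α
  | [], D, k => k [] D
  | (e, v) :: l, D, k => match co v with
    | .ofNat _ => redList co st l D fun l D => k ((e, v) :: l) D
    | .negSucc _ => force (st v) fun v => bif isOne v then redList co st l (e :: D) k
        else redList co st l D fun l D => k ((e, v) :: l) D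

/-- Greedy reduction to the identity using the given letters. -/
def descend (f : Vec4 → Option Vec4) : ℕ → Vec4 → Bool
  | 0, _ => false
  | n + 1, v => force v fun v => match f v with
    | none => isOne v
    | some v => descend f n v

/-- A descent step in the letters `1, 2, 3`. -/
def desc0 (v : Vec4) : Option Vec4 :=
  bif isNeg v.b then some (step 1 v) else bif isNeg v.c then some (step 2 v) else
    bif isNeg v.d then some (step 3 v) else none

/-- A descent step in the letters `0, 1, 2`. -/
def desc3 (v : Vec4) : Option Vec4 :=
  bif isNeg v.a then some (step 0 v) else bif isNeg v.b then some (step 1 v) else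
    bif isNeg v.c then some (step 2 v) else none

/-- Remove the letters of a word, outermost first. -/
def peel (l : List (Fin 4)) (v : Vec4) : Vec4 := l.foldl (fun v j => step j v) v

/-- Chains of minimal coset representatives for the leaf `0`. -/
def chains0 : List (List (Fin 4)) :=
  [[], [0], [1, 0], [2, 1, 0], [1, 2, 1, 0], [0, 1, 2, 1, 0], [3, 2, 1, 0]]

/-- Chains of minimal coset representatives for the leaf `3`. -/
def chains3 : List (List (Fin 4)) :=
  [[], [3], [2, 3], [1, 2, 3], [2, 1, 2, 3], [3, 2, 1, 2, 3], [0, 1, 2, 3]]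

/-- Test for a chain decomposition. -/
def hasStrip (h : Vec4) (D : List Vec4) : Bool :=
  (chains0.any fun l => Nat.ble l.length (D.filter fun e => decide (e.a ≠ 0)).length &&
    descend desc0 10 (peel l h)) ||
  (chains3.any fun l => Nat.ble l.length (D.filter fun e => decide (e.d ≠ 0)).length &&
    descend desc3 10 (peel l h))

/-- The greedy subword test for the words `x` and `ω`. -/
def below (x ω : List (Fin 4)) : Bool := isOne (ω.foldr red (heights x))

/-- Too many edges at the vertex `x`. -/
def excess (x ω : List (Fin 4)) : Bool :=
  below x ω && Nat.blt ω.length (table.filter fun p => below (rword p ++ x) ω).length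

/-- The test applied to each element of the group. -/
def good (ω : List (Fin 4)) (h : Vec4) (D : List Vec4) : Bool :=
  Nat.blt ω.length D.length || (hasStrip h D || (hasStrip (heights ω) D ||
    (excess [0] ω || (excess [3] ω ||
      (isNeg h.a && (isNeg h.b && (isNeg h.c && isNeg h.d)))))))

/-- Run through all elements of the group, applying the test to each. -/
def search : ℕ → List (Fin 4) → Vec4 → List (Vec4 × Vec4) → List Vec4 → Bool
  | 0, _, _, _, _ => false
  | n + 1, ω, h, R, D =>
    good ω h D &&
    ((isNeg h.a || force (step 0 h) fun h' =>
      redList a (step 0) R D fun R D => search n (0 :: ω) h' R D) &&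
    ((isNeg h.b || force (step 1 h) fun h' => isNeg h'.a ||
      redList b (step 1) R D fun R D => search n (1 :: ω) h' R D) &&
    ((isNeg h.c || force (step 2 h) fun h' => isNeg h'.a || (isNeg h'.b ||
      redList c (step 2) R D fun R D => search n (2 :: ω) h' R D)) &&
    (isNeg h.d || force (step 3 h) fun h' => isNeg h'.a || (isNeg h'.b || (isNeg h'.c ||
      redList d (step 3) R D fun R D => search n (3 :: ω) h' R D))))))

/-- Evaluate the vectors in a list before passing it on. -/
def forceList {α : Type} : List (Vec4 × Vec4) → (List (Vec4 × Vec4) → α) → α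
  | [], k => k []
  | (e, v) :: l, k => force e fun e => force v fun v => forceList l fun l => k ((e, v) :: l)

theorem forceList_eq {α : Type} (l : List (Vec4 × Vec4)) (k : List (Vec4 × Vec4) → α) :
    forceList l k = k l := by
  induction l generalizing k with
  | nil => rfl
  | cons p l ih => simp only [forceList, force_eq, ih]

theorem search_start : search 25 [] one start [] = true := by
  rw [← forceList_eq start fun R => search 25 [] one R []]
  decide +kernel

end Vec4

namespace Cartan
variable [Fintype B] [DecidableEq B] {C : Cartan cs} [Finite W] {J J' : Set B} {w x y z t s r u : W}
  {n : Fin 4 → B} {v e h : Vec4} {ω : List (Fin 4)}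

/-- The nodes `n 0, n 1, n 2, n 3` form a connected component of type `F₄` of `J`. -/
structure NodesF4 (C : Cartan cs) (J : Set B) (n : Fin 4 → B) : Prop where
  inj : Function.Injective n
  mem : ∀ i, n i ∈ J
  A_eq : ∀ i j, C.A (n i) (n j) = Vec4.cartan i j
  A_out : ∀ j ∈ J, (∀ i, n i ≠ j) → ∀ i, C.A (n i) j = 0

/-- The vector with given coordinates on the nodes. -/
def vec4 (n : Fin 4 → B) (v : Vec4) : B → ℤ :=
  v.a • al (n 0) + v.b • al (n 1) + v.c • al (n 2) + v.d • al (n 3)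

/-- The heights of the images of the simple roots. -/
def HasHeights (C : Cartan cs) (n : Fin 4 → B) (x : W) (v : Vec4) : Prop :=
  ∀ i, hgt (C.act x (al (n i))) = v.coord i

theorem hasHeights_one : C.HasHeights n 1 Vec4.one := by
  intro i
  rw [act_one, hgt_al]
  fin_cases i <;> rfl

theorem HasHeights.neg_iff (hv : C.HasHeights n x v) (i : Fin 4) :
    v.coord i < 0 ↔ cs.length (x * cs.simple (n i)) < cs.length x := by
  rw [← C.act_al_nonpos_iff, ← hv i]
  have hr : C.IsRoot (C.act x (al (n i))) := ⟨x, n i, rfl⟩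
  constructor
  · intro h1
    rcases hr.nonneg_or_nonpos with h2 | h2
    · exact absurd (hgt_nonneg h2) (by omega)
    · exact h2
  · intro h1
    have h2 := hgt_pos (neg_nonneg.2 h1) (neg_ne_zero.2 hr.ne_zero)
    rw [show hgt (-C.act x (al (n i))) = -hgt (C.act x (al (n i))) by simp [hgt]] at h2
    omega

theorem HasHeights.pos_iff (hv : C.HasHeights n x v) (i : Fin 4) :
    0 ≤ v.coord i ↔ cs.length x < cs.length (x * cs.simple (n i)) := by
  rw [← not_lt, hv.neg_iff, not_lt]
  have := cs.length_mul_simple_ne x (n i)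
  omega

theorem HasHeights.eq_one (hv : C.HasHeights n x Vec4.one) (hx : x ∈ WJc cs (Set.range n)) :
    x = 1 := by
  by_contra h1
  obtain ⟨i, ⟨j, rfl⟩, hi⟩ := C.exists_left_descent (Subgroup.inv_mem _ hx) (inv_ne_one.2 h1)
  have h2 : cs.length (x * cs.simple (n j)) < cs.length x := by
    rw [← cs.length_inv, ← cs.length_inv x]
    simpa using hi
  have h3 := (hv.neg_iff j).2 h2
  fin_cases j <;> simp [Vec4.one, Vec4.coord] at h3

namespace NodesF4

theorem heights_step (P : C.NodesF4 J n) (hv : C.HasHeights n x v) (j : Fin 4) :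
    C.HasHeights n (x * cs.simple (n j)) (Vec4.step j v) := by
  intro i
  rw [act_mul, act_simple, act_sub, act_smul, hgt_sub, hgt_smul, hv i, hv j, pair_al, P.A_eq]
  fin_cases j <;> fin_cases i <;> simp [Vec4.step, Vec4.coord, Vec4.cartan] <;> ring

theorem act_simple_vec4 (P : C.NodesF4 J n) (j : Fin 4) (v : Vec4) :
    C.act (cs.simple (n j)) (vec4 n v) = vec4 n (Vec4.rstep j v) := by
  rw [act_simple, vec4, map_add, map_add, map_add, map_smul, map_smul, map_smul, map_smul,
    pair_al, pair_al, pair_al, pair_al, P.A_eq, P.A_eq, P.A_eq, P.A_eq]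
  fin_cases j <;> simp only [vec4, Vec4.rstep, Vec4.cartan, Fin.zero_eta, Fin.mk_one,
    Fin.reduceFinMk, Matrix.cons_val, smul_eq_mul] <;> module

theorem coord_vec4 (P : C.NodesF4 J n) (v : Vec4) (i : Fin 4) :
    vec4 n v (n i) = v.coord i := by
  have hne : ∀ i j, i ≠ j → n i ≠ n j := fun i j h h' => h (P.inj h')
  simp only [vec4, Pi.add_apply, Pi.smul_apply, al, Pi.single_apply, P.inj.eq_iff, smul_eq_mul]
  fin_cases i <;> simp [Vec4.coord]

theorem inJ_vec4 (v : Vec4) : InJ (Set.range n) (vec4 n v) :=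
  have h : ∀ (c : ℤ) (i : Fin 4), InJ (Set.range n) (c • al (n i)) := fun c i =>
    (inJ_al (Set.mem_range_self i)).smul c
  (((h _ 0).add (h _ 1)).add (h _ 2)).add (h _ 3)

theorem vec4_injective (P : C.NodesF4 J n) : Function.Injective (vec4 n) := by
  intro v v' h
  have h1 := fun i => by
    have := P.coord_vec4 v i
    rw [h, P.coord_vec4] at this
    exact this
  exact Vec4.ext (h1 0).symm (h1 1).symm (h1 2).symm (h1 3).symm

/-- The product of a word in the nodes. -/
def _root_.Paper.Cartan.wd (cs : CoxeterSystem M W) (n : Fin 4 → B) (l : List (Fin 4)) : W :=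
  (l.map fun i => cs.simple (n i)).prod

theorem wd_cons (i : Fin 4) (l : List (Fin 4)) :
    wd cs n (i :: l) = cs.simple (n i) * wd cs n l := by simp [wd]

theorem wd_append (l l' : List (Fin 4)) : wd cs n (l ++ l') = wd cs n l * wd cs n l' := by
  simp [wd]

theorem wd_reverse (l : List (Fin 4)) : wd cs n l.reverse = (wd cs n l)⁻¹ := by
  induction l with
  | nil => simp [wd]
  | cons i l ih =>
    rw [List.reverse_cons, wd_append, ih, wd_cons i l, mul_inv_rev, cs.inv_simple]
    simp [wd]

theorem wd_mem (l : List (Fin 4)) : wd cs n l ∈ WJc cs (Set.range n) := by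
  induction l with
  | nil => exact Subgroup.one_mem _
  | cons i l ih => rw [wd_cons]; exact Subgroup.mul_mem _ (simple_mem_WJ ⟨i, rfl⟩) ih

theorem heights_foldl (P : C.NodesF4 J n) (hv : C.HasHeights n x v) (l : List (Fin 4)) :
    C.HasHeights n (x * wd cs n l) (l.foldl (fun v j => Vec4.step j v) v) := by
  induction l generalizing x v with
  | nil => simpa [wd] using hv
  | cons i l ih =>
    rw [wd_cons, ← mul_assoc]
    exact ih (P.heights_step hv i)

theorem heights_wd (P : C.NodesF4 J n) (l : List (Fin 4)) :
    C.HasHeights n (wd cs n l) (Vec4.heights l) := by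
  have := P.heights_foldl (hasHeights_one (C := C) (n := n)) l
  rwa [one_mul] at this

theorem act_wd (P : C.NodesF4 J n) (p : List (Fin 4) × Fin 4) :
    C.act (wd cs n p.1) (al (n p.2)) = vec4 n (Vec4.root p) := by
  obtain ⟨l, i⟩ := p
  induction l with
  | nil => fin_cases i <;> simp [wd, Vec4.root, Vec4.unit, vec4]
  | cons j l ih =>
    simp only at ih ⊢
    rw [wd_cons, act_mul, ih, P.act_simple_vec4]
    rfl

theorem wd_rword (p : List (Fin 4) × Fin 4) :
    wd cs n (Vec4.rword p) = wd cs n p.1 * cs.simple (n p.2) * (wd cs n p.1)⁻¹ := by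
  rw [Vec4.rword, wd_append, wd_cons, wd_reverse, mul_assoc]

theorem isReflection_wd (p : List (Fin 4) × Fin 4) : cs.IsReflection (wd cs n (Vec4.rword p)) :=
  ⟨_, _, wd_rword p⟩

theorem rt_wd (P : C.NodesF4 J n) {p : List (Fin 4) × Fin 4} (hp : p ∈ Vec4.table) :
    C.rt (wd cs n (Vec4.rword p)) = vec4 n (Vec4.root p) := by
  have h0 : ∀ p ∈ Vec4.table, ∃ i, 0 < (Vec4.root p).coord i := by decide
  obtain ⟨i, hi⟩ := h0 p hp
  rcases C.rt_eq _ _ (wd_rword (cs := cs) (n := n) p) with h | h <;> rw [P.act_wd] at h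
  · exact h
  · have h1 : 0 ≤ C.rt (wd cs n (Vec4.rword p)) (n i) :=
      C.rt_nonneg (isReflection_wd (cs := cs) (n := n) p) (n i)
    rw [h, Pi.neg_apply, P.coord_vec4] at h1
    omega

/-- A state of the greedy subword algorithm. -/
def _root_.Paper.Cartan.Res (C : Cartan cs) (n : Fin 4 → B) (w z : W) (v : Vec4) : Prop :=
  ∃ x ∈ WJc cs (Set.range n), ∃ y, bruhatLE cs y w ∧ z = x * y ∧ C.HasHeights n x v

theorem res_start (hz : z ∈ WJc cs (Set.range n)) (hv : C.HasHeights n z v) : C.Res n 1 z v :=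
  ⟨z, hz, 1, bruhat_refl _, (mul_one z).symm, hv⟩

theorem _root_.Paper.Cartan.Res.up (h : C.Res n w z v) {j : B}
    (hw : cs.length w < cs.length (cs.simple j * w)) : C.Res n (cs.simple j * w) z v := by
  obtain ⟨x, hx, y, hy, h1, h2⟩ := h
  exact ⟨x, hx, y, bruhat_trans hy (bruhat_of_refl (cs.isReflection_simple j) hw), h1, h2⟩

theorem res_step (P : C.NodesF4 J n) (h : C.Res n w z v) {j : Fin 4}
    (hw : cs.length w < cs.length (cs.simple (n j) * w)) :
    C.Res n (cs.simple (n j) * w) z (Vec4.step j v) := by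
  obtain ⟨x, hx, y, hy, h1, h2⟩ := h
  refine ⟨x * cs.simple (n j), Subgroup.mul_mem _ hx (simple_mem_WJ ⟨j, rfl⟩), cs.simple (n j) * y,
    ?_, ?_, P.heights_step h2 j⟩
  · have h3 := C.bruhat_mul_both (i := n j) (bruhat_inv hy) (by
      rw [← cs.length_inv, ← cs.length_inv (w⁻¹ * _)]; simpa using hw)
    have h4 := bruhat_inv h3
    simpa only [mul_inv_rev, inv_inv, cs.inv_simple] using h4
  · rw [h1, mul_assoc, ← mul_assoc _ _ y, cs.simple_mul_simple_self, one_mul]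

theorem res_red (P : C.NodesF4 J n) (h : C.Res n w z v) {j : Fin 4}
    (hw : cs.length w < cs.length (cs.simple (n j) * w)) :
    C.Res n (cs.simple (n j) * w) z (Vec4.red j v) := by
  unfold Vec4.red
  cases Vec4.isNeg (Vec4.coord j v)
  · exact h.up hw
  · exact P.res_step h hw

theorem _root_.Paper.Cartan.Res.bruhat (h : C.Res n w z Vec4.one) : bruhatLE cs z w := by
  obtain ⟨x, hx, y, hy, h1, h2⟩ := h
  rwa [h1, h2.eq_one hx, one_mul]

/-- Reduced words in the nodes. -/
inductive _root_.Paper.Cartan.Red (cs : CoxeterSystem M W) (n : Fin 4 → B) :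
    List (Fin 4) → W → Prop
  | nil : Red cs n [] 1
  | cons {ω : List (Fin 4)} {w : W} (j : Fin 4) (h : Red cs n ω w)
      (hw : cs.length w < cs.length (cs.simple (n j) * w)) :
      Red cs n (j :: ω) (cs.simple (n j) * w)

theorem _root_.Paper.Cartan.Red.eq (h : Red cs n ω w) : w = wd cs n ω := by
  induction h with
  | nil => simp [wd]
  | cons j h hw ih => rw [wd_cons, ← ih]

theorem _root_.Paper.Cartan.Red.length (h : Red cs n ω w) : cs.length w = ω.length := by
  induction h with
  | nil => simp
  | @cons ω w j h hw ih =>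
    rw [List.length_cons, ← ih]
    rcases cs.length_simple_mul w (n j) with h1 | h1 <;> omega

theorem res_foldr (P : C.NodesF4 J n) (h : Red cs n ω w) (hz : C.Res n 1 z v) :
    C.Res n w z (ω.foldr Vec4.red v) := by
  induction h with
  | nil => exact hz
  | cons j h hw ih => exact P.res_red ih hw

theorem bruhat_of_below (P : C.NodesF4 J n) (h : Red cs n ω w) {l : List (Fin 4)}
    (hl : Vec4.below l ω = true) : bruhatLE cs (wd cs n l) w := by
  have h1 := P.res_foldr h (res_start (wd_mem l) (P.heights_wd l))
  rw [Vec4.below, Vec4.isOne_iff] at hl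
  unfold Vec4.heights at hl h1
  rw [hl] at h1
  exact h1.bruhat

theorem not_regular_of_excess (P : C.NodesF4 J n) (h : Red cs n ω w) {l : List (Fin 4)}
    (hl : Vec4.excess l ω = true) : ¬ Regular cs w := by
  classical
  intro hr
  simp only [Vec4.excess, Bool.and_eq_true, Nat.blt_eq] at hl
  have h1 := hr _ (P.bruhat_of_below h hl.1)
  rw [h.length] at h1
  have h2 : (Vec4.table.filter fun p => Vec4.below (Vec4.rword p ++ l) ω).length ≤
      (edg cs w (wd cs n l)).card := by
    rw [← List.length_map (fun p => wd cs n (Vec4.rword p)), ← List.toFinset_card_of_nodup]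
    · refine Finset.card_le_card fun t ht => ?_
      rw [List.mem_toFinset, List.mem_map] at ht
      obtain ⟨p, hp, rfl⟩ := ht
      rw [List.mem_filter] at hp
      refine mem_edg.2 ⟨isReflection_wd p, ?_⟩
      rw [← wd_append]
      exact P.bruhat_of_below h hp.2
    · refine List.Nodup.map_on ?_ (List.Nodup.filter _ (by decide))
      intro p hp q hq hpq
      have h3 := P.rt_wd (List.mem_filter.1 hp).1
      rw [hpq, P.rt_wd (List.mem_filter.1 hq).1] at h3
      have h4 : ∀ p ∈ Vec4.table, ∀ q ∈ Vec4.table, (Vec4.root q).coord 0 = (Vec4.root p).coord 0 →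
          (Vec4.root q).coord 1 = (Vec4.root p).coord 1 →
          (Vec4.root q).coord 2 = (Vec4.root p).coord 2 →
          (Vec4.root q).coord 3 = (Vec4.root p).coord 3 → p = q := by decide
      have h5 := P.vec4_injective h3
      exact h4 p (List.mem_filter.1 hp).1 q (List.mem_filter.1 hq).1 (by rw [h5]) (by rw [h5])
        (by rw [h5]) (by rw [h5])
  omega

end NodesF4
end Cartan

theorem Vec4.redList_spec {α : Type} {co : Vec4 → ℤ} {j : Fin 4} (hco : ∀ v, co v = v.coord j)
    (l : List (Vec4 × Vec4)) (D : List Vec4) (k : List (Vec4 × Vec4) → List Vec4 → α) :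
    ∃ l' D', redList co (step j) l D k = k l' D' ∧
      (D' ++ l'.map Prod.fst).Perm (D ++ l.map Prod.fst) ∧
      (∀ e ∈ D', e ∈ D ∨ ∃ v, (e, v) ∈ l ∧ red j v = one) ∧
      ∀ p ∈ l', ∃ v, (p.1, v) ∈ l ∧ p.2 = red j v := by
  induction l generalizing D k with
  | nil => exact ⟨[], D, rfl, List.Perm.refl _, fun e he => Or.inl he, by simp⟩
  | cons p l ih =>
    obtain ⟨e, v⟩ := p
    rw [redList]
    have keep : ∀ v', v' = red j v →
        ∃ l' D', redList co (step j) l D (fun l D => k ((e, v') :: l) D) = k l' D' ∧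
        (D' ++ l'.map Prod.fst).Perm (D ++ ((e, v) :: l).map Prod.fst) ∧
        (∀ e' ∈ D', e' ∈ D ∨ ∃ v', (e', v') ∈ (e, v) :: l ∧ red j v' = one) ∧
        ∀ p ∈ l', ∃ v', (p.1, v') ∈ (e, v) :: l ∧ p.2 = red j v' := by
      intro v' hv'
      obtain ⟨l', D', h1, h2, h3, h4⟩ := ih D fun l D => k ((e, v') :: l) D
      refine ⟨(e, v') :: l', D', h1, ?_, fun e' he => ?_, fun p hp => ?_⟩
      · simp only [List.map_cons]
        exact List.perm_middle.trans ((h2.cons e).trans List.perm_middle.symm)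
      · rcases h3 e' he with h | ⟨w, hw, hw'⟩
        · exact Or.inl h
        · exact Or.inr ⟨w, List.mem_cons_of_mem _ hw, hw'⟩
      · rcases List.mem_cons.1 hp with rfl | hp
        · exact ⟨v, List.mem_cons_self, hv'⟩
        · obtain ⟨w, hw, hw'⟩ := h4 p hp
          exact ⟨w, List.mem_cons_of_mem _ hw, hw'⟩
    have hr : red j v = bif isNeg (co v) then step j v else v := by rw [hco]; rfl
    cases hc : co v with
    | ofNat m =>
      rw [hc] at hr
      exact keep v hr.symm
    | negSucc m =>
      rw [hc] at hr
      have hr : red j v = step j v := hr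
      simp only [force_eq]
      cases h1 : isOne (step j v) with
      | false => exact keep _ hr.symm
      | true =>
        rw [isOne_iff] at h1
        obtain ⟨l', D', h2, h3, h4, h5⟩ := ih (e :: D) k
        refine ⟨l', D', h2, ?_, fun e' he => ?_, fun p hp => ?_⟩
        · refine h3.trans ?_
          simp only [List.map_cons, List.cons_append]
          exact List.perm_middle.symm
        · rcases h4 e' he with h | ⟨w, hw, hw'⟩
          · rcases List.mem_cons.1 h with rfl | h
            · exact Or.inr ⟨v, List.mem_cons_self, by rw [hr, h1]⟩
            · exact Or.inl h
          · exact Or.inr ⟨w, List.mem_cons_of_mem _ hw, hw'⟩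
        · obtain ⟨w, hw, hw'⟩ := h5 p hp
          exact ⟨w, List.mem_cons_of_mem _ hw, hw'⟩

namespace Cartan
variable [Fintype B] [DecidableEq B] {C : Cartan cs} [Finite W] {J J' : Set B} {w x y z t s r u : W}
  {n : Fin 4 → B} {v e h : Vec4} {ω : List (Fin 4)} {R : List (Vec4 × Vec4)} {D : List Vec4}

/-- The invariant of the search through the group of type `F₄`. -/
structure StateF4 (C : Cartan cs) (n : Fin 4 → B) (w : W) (ω : List (Fin 4)) (h : Vec4)
    (R : List (Vec4 × Vec4)) (D : List Vec4) : Prop where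
  red : Red cs n ω w
  heights : C.HasHeights n w⁻¹ h
  nodup : (D ++ R.map Prod.fst).Nodup
  done : ∀ e ∈ D, ∃ t, cs.IsReflection t ∧ C.rt t = vec4 n e ∧ bruhatLE cs t w
  todo : ∀ p ∈ R, ∃ t, cs.IsReflection t ∧ C.rt t = vec4 n p.1 ∧ C.Res n w t p.2

/-- The element `w` passes the test. -/
def PassF4 (C : Cartan cs) (n : Fin 4 → B) (w : W) : Prop :=
  ∃ k ω h R D, C.StateF4 n w ω h R D ∧ Vec4.search k ω h R D = true

namespace NodesF4

theorem step_state (P : C.NodesF4 J n) (hS : C.StateF4 n w ω h R D) {j : Fin 4}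
    (hw : cs.length w < cs.length (cs.simple (n j) * w)) {co : Vec4 → ℤ}
    (hco : ∀ v, co v = v.coord j) {k : ℕ}
    (hk : Vec4.redList co (Vec4.step j) R D
      (fun R D => Vec4.search k (j :: ω) (Vec4.step j h) R D) = true) :
    C.PassF4 n (cs.simple (n j) * w) := by
  obtain ⟨R', D', h1, h2, h3, h4⟩ := Vec4.redList_spec hco R D
    (fun R D => Vec4.search k (j :: ω) (Vec4.step j h) R D)
  rw [h1] at hk
  refine ⟨k, _, _, R', D', ⟨hS.red.cons j hw, ?_, h2.nodup_iff.2 hS.nodup, fun e he => ?_,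
    fun p hp => ?_⟩, hk⟩
  · rw [mul_inv_rev, cs.inv_simple]
    exact P.heights_step hS.heights j
  · rcases h3 e he with h5 | ⟨v, hv, hv'⟩
    · obtain ⟨t, ht, h6, h7⟩ := hS.done e h5
      exact ⟨t, ht, h6, bruhat_trans h7 (bruhat_of_refl (cs.isReflection_simple _) hw)⟩
    · obtain ⟨t, ht, h6, h7⟩ := hS.todo _ hv
      have h8 := P.res_red h7 hw
      simp only [hv'] at h8
      exact ⟨t, ht, h6, h8.bruhat⟩
  · obtain ⟨v, hv, hv'⟩ := h4 p hp
    obtain ⟨t, ht, h6, h7⟩ := hS.todo _ hv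
    exact ⟨t, ht, h6, by rw [hv']; exact P.res_red h7 hw⟩

theorem pass_one (P : C.NodesF4 J n) : C.PassF4 n (1 : W) := by
  refine ⟨25, [], Vec4.one, Vec4.start, [], ⟨Red.nil, ?_, ?_, ?_, fun p hp => ?_⟩,
    Vec4.search_start⟩
  · rw [inv_one]; exact hasHeights_one
  · rw [List.nil_append, Vec4.start, List.map_map]
    refine List.Nodup.map_on ?_ (by decide)
    intro p hp q hq hpq
    have h4 : ∀ p ∈ Vec4.table, ∀ q ∈ Vec4.table, (Vec4.root q).coord 0 = (Vec4.root p).coord 0 →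
        (Vec4.root q).coord 1 = (Vec4.root p).coord 1 →
        (Vec4.root q).coord 2 = (Vec4.root p).coord 2 →
        (Vec4.root q).coord 3 = (Vec4.root p).coord 3 → p = q := by decide
    have h5 : Vec4.root p = Vec4.root q := hpq
    exact h4 p hp q hq (by rw [h5]) (by rw [h5]) (by rw [h5]) (by rw [h5])
  · simp
  · obtain ⟨q, hq, rfl⟩ := List.mem_map.1 hp
    exact ⟨_, isReflection_wd q, P.rt_wd hq, res_start (wd_mem _) (P.heights_wd _)⟩

theorem pass_step (P : C.NodesF4 J n) (hp : C.PassF4 n w) {j : Fin 4}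
    (hw : cs.length w < cs.length (cs.simple (n j) * w))
    (hk : ∀ k < j, cs.length (cs.simple (n j) * w) <
      cs.length (cs.simple (n k) * (cs.simple (n j) * w))) :
    C.PassF4 n (cs.simple (n j) * w) := by
  obtain ⟨k, ω, h, R, D, hS, hs⟩ := hp
  have hh := P.heights_step hS.heights j
  have h0 : 0 ≤ h.coord j := by
    rw [hS.heights.pos_iff, ← cs.length_inv, ← cs.length_inv (w⁻¹ * _)]
    simpa using hw
  have h1 : ∀ k < j, 0 ≤ (Vec4.step j h).coord k := by
    intro k hkj
    rw [hh.pos_iff, ← cs.length_inv, ← cs.length_inv (w⁻¹ * _ * _)]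
    simpa using hk k hkj
  cases k with
  | zero => simp [Vec4.search] at hs
  | succ k =>
  rw [Vec4.search] at hs
  simp only [Bool.and_eq_true, Bool.or_eq_true, Vec4.force_eq, Vec4.isNeg_eq_true] at hs
  obtain ⟨-, ha, hb, hc, hd⟩ := hs
  fin_cases j
  · exact P.step_state hS hw (fun v => rfl) (ha.resolve_left (not_lt.2 h0))
  · exact P.step_state hS hw (fun v => rfl) ((hb.resolve_left (not_lt.2 h0)).resolve_left
      (not_lt.2 (h1 0 (by decide))))
  · exact P.step_state hS hw (fun v => rfl) (((hc.resolve_left (not_lt.2 h0)).resolve_left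
      (not_lt.2 (h1 0 (by decide)))).resolve_left (not_lt.2 (h1 1 (by decide))))
  · exact P.step_state hS hw (fun v => rfl) ((((hd.resolve_left (not_lt.2 h0)).resolve_left
      (not_lt.2 (h1 0 (by decide)))).resolve_left (not_lt.2 (h1 1 (by decide)))).resolve_left
      (not_lt.2 (h1 2 (by decide))))

theorem pass (P : C.NodesF4 J n) (hw : w ∈ WJc cs (Set.range n)) : C.PassF4 n w := by
  induction hl : cs.length w using Nat.strong_induction_on generalizing w with
  | _ l ih =>
  by_cases h1 : w = 1
  · rw [h1]; exact P.pass_one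
  obtain ⟨_, ⟨i, rfl⟩, hi⟩ := C.exists_left_descent hw h1
  obtain ⟨j, hj, hmin⟩ : ∃ j, cs.length (cs.simple (n j) * w) < cs.length w ∧
      ∀ k < j, ¬ cs.length (cs.simple (n k) * w) < cs.length w := by
    obtain ⟨j, hj, hmin⟩ := WellFounded.has_min (wellFounded_lt (α := Fin 4))
      {j : Fin 4 | cs.length (cs.simple (n j) * w) < cs.length w} ⟨i, hi⟩
    exact ⟨j, hj, fun k hk h => hmin k h hk⟩
  have h2 := ih _ (by rw [← hl]; exact hj)
    (Subgroup.mul_mem _ (simple_mem_WJ (Set.mem_range_self j)) hw) rfl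
  have h3 := P.pass_step h2 (j := j) (by rwa [cs.simple_mul_simple_cancel_left]) (fun k hk => by
    rw [cs.simple_mul_simple_cancel_left]
    have := hmin k hk
    have := cs.length_simple_mul_ne w (n k)
    omega)
  rwa [cs.simple_mul_simple_cancel_left] at h3

end NodesF4
end Cartan

namespace Cartan
variable [Fintype B] [DecidableEq B] {C : Cartan cs} [Finite W] {J J' K : Set B} {a b w x y z t s : W}

section Product
theorem commute_WJ (hK : ∀ i ∈ K, ∀ j ∈ J', M i j = 2) (ha : a ∈ WJc cs K) (hb : b ∈ WJc cs J') :
    a * b = b * a := by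
  have h0 : ∀ i ∈ K, ∀ j ∈ J', cs.simple i * cs.simple j = cs.simple j * cs.simple i := by
    intro i hi j hj
    have h1 := cs.simple_mul_simple_pow i j
    rw [hK i hi j hj, pow_two] at h1
    have h2 := eq_inv_of_mul_eq_one_left h1
    rwa [mul_inv_rev, cs.inv_simple, cs.inv_simple] at h2
  have h1 : ∀ i ∈ K, ∀ b ∈ WJc cs J', cs.simple i * b = b * cs.simple i := by
    intro i hi b hb
    have : WJc cs J' ≤ Subgroup.centralizer {cs.simple i} := by
      refine (Subgroup.closure_le _).2 ?_
      rintro _ ⟨j, hj, rfl⟩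
      refine Subgroup.mem_centralizer_iff.2 ?_
      rintro _ rfl
      exact h0 i hi j hj
    exact Subgroup.mem_centralizer_iff.1 (this hb) _ rfl
  have : WJc cs K ≤ Subgroup.centralizer {b} := by
    refine (Subgroup.closure_le _).2 ?_
    rintro _ ⟨i, hi, rfl⟩
    refine Subgroup.mem_centralizer_iff.2 ?_
    rintro _ rfl
    exact (h1 i hi _ hb).symm
  exact (Subgroup.mem_centralizer_iff.1 (this ha) _ rfl).symm

theorem exists_mul_of_commute (C : Cartan cs) (hK : ∀ i ∈ K, ∀ j ∈ J \ K, M i j = 2) (hw : w ∈ WJc cs J) :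
    ∃ a ∈ WJc cs K, ∃ b ∈ WJc cs (J \ K), w = a * b := by
  have : ∀ w, w ∈ WJc cs J → ∃ a ∈ WJc cs K, ∃ b ∈ WJc cs (J \ K), w = a * b := by
    intro w hw
    refine C.WJ_induction (P := fun w => ∃ a ∈ WJc cs K, ∃ b ∈ WJc cs (J \ K), w = a * b)
      ⟨1, Subgroup.one_mem _, 1, Subgroup.one_mem _, by simp⟩ ?_ hw
    rintro u i - hi - ⟨a, ha, b, hb, rfl⟩
    by_cases hiK : i ∈ K
    · refine ⟨a * cs.simple i, Subgroup.mul_mem _ ha (simple_mem_WJ hiK), b, hb, ?_⟩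
      rw [mul_assoc, mul_assoc, commute_WJ hK (simple_mem_WJ hiK) hb]
    · exact ⟨a, ha, b * cs.simple i, Subgroup.mul_mem _ hb (simple_mem_WJ ⟨hi, hiK⟩),
        by rw [mul_assoc]⟩
  exact this w hw

theorem minLeft_of_disjoint (C : Cartan cs) (ha : a ∈ WJc cs K) (hd : ∀ j ∈ J', j ∉ K) : MinLeft cs J' a :=
  fun j hj => C.length_lt_of_notMem ha (hd j hj)

theorem bruhat_right_of_mul (C : Cartan cs) (hK : ∀ i ∈ K, ∀ j ∈ J', M i j = 2)
    (hd : ∀ j ∈ J', j ∉ K)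
    (ha : a ∈ WJc cs K) (hb : b ∈ WJc cs J') (hy : y ∈ WJc cs J')
    (h : bruhatLE cs y (a * b)) : bruhatLE cs y b := by
  rw [commute_WJ hK ha hb] at h
  exact C.bruhat_of_minLeft (C.minLeft_of_disjoint hy fun i hi hi' => hd i hi' hi) ha
    (C.minLeft_of_disjoint hb fun i hi hi' => hd i hi' hi) h

theorem regular_left (C : Cartan cs) (hK : ∀ i ∈ K, ∀ j ∈ J', M i j = 2) (hd : ∀ j ∈ J', j ∉ K)
    (ha : a ∈ WJc cs K) (hb : b ∈ WJc cs J') (h : Regular cs (a * b)) : Regular cs a := by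
  classical
  intro x hx
  have hxK := C.bruhat_mem_WJ hx ha
  have hmin := C.minLeft_of_disjoint ha hd
  have h1 := C.bruhat_mul_le_mul hmin hb hx (one_bruhat b)
  rw [mul_one] at h1
  have h2 := h x h1
  have h3 : edg cs a x ∪ edg cs b 1 ⊆ edg cs (a * b) x := by
    intro t ht
    rcases Finset.mem_union.1 ht with ht | ht
    · rw [mem_edg] at ht ⊢
      refine ⟨ht.1, ?_⟩
      have := C.bruhat_mul_le_mul hmin hb ht.2 (one_bruhat b)
      rwa [mul_one] at this
    · rw [mem_edg, mul_one] at ht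
      rw [mem_edg, ← commute_WJ hK hxK (C.bruhat_mem_WJ ht.2 hb)]
      exact ⟨ht.1, C.bruhat_mul_le_mul hmin hb hx ht.2⟩
  have h4 : Disjoint (edg cs a x) (edg cs b 1) := by
    rw [Finset.disjoint_left]
    intro t ht ht'
    rw [mem_edg] at ht
    rw [mem_edg, mul_one] at ht'
    have h5 : t ∈ WJc cs K := by
      simpa using Subgroup.mul_mem _ (C.bruhat_mem_WJ ht.2 ha) (Subgroup.inv_mem _ hxK)
    have h6 := C.inJ_rt ht.1 h5
    have h7 := C.inJ_rt ht.1 (C.bruhat_mem_WJ ht'.2 hb)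
    refine C.rt_ne_zero ht.1 (funext fun k => ?_)
    by_cases hk : k ∈ K
    · exact h7 k fun hk' => hd k hk' hk
    · exact h6 k hk
  have h5 := Finset.card_le_card h3
  rw [Finset.card_union_of_disjoint h4, h2, C.length_mul_of_minLeft hmin hb] at h5
  have h6 := C.deodhar hx
  have h7 := C.deodhar (one_bruhat b)
  omega

theorem poin_mul_of_commute (C : Cartan cs) (hK : ∀ i ∈ K, ∀ j ∈ J', M i j = 2)
    (hd : ∀ j ∈ J', j ∉ K) (ha : a ∈ WJc cs K) (hb : b ∈ WJc cs J') :
    poin cs (a * b) = poin cs a * poin cs b := by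
  classical
  rw [C.poin_mul_of_max (C.minLeft_of_disjoint ha hd) hb fun y hy h =>
    bruhat_right_of_mul C hK hd ha hb hy h, Finset.filter_true_of_mem, ← poin_eq]
  intro x hx
  exact C.minLeft_of_disjoint (C.bruhat_mem_WJ (mem_ivl.1 hx) ha) hd

end Product

section Longest

theorem act_nonpos_of_desc (ha : ∀ i ∈ K, C.act a⁻¹ (al i) ≤ 0) {v : B → ℤ} (h0 : 0 ≤ v)
    (hv : InJ K v) : C.act a⁻¹ v ≤ 0 := by
  rw [eq_sum_al v, act_sum]
  refine Finset.sum_nonpos fun i _ => ?_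
  rw [act_smul]
  by_cases hi : i ∈ K
  · exact smul_nonpos_of_nonneg_of_nonpos (h0 i) (ha i hi)
  · rw [hv i hi, zero_smul]

theorem length_of_desc (ha : ∀ i ∈ K, C.act a⁻¹ (al i) ≤ 0) (hy : y ∈ WJc cs K) :
    cs.length (y * a) + cs.length y = cs.length a := by
  rw [← cs.length_inv (y * a), ← cs.length_inv y, mul_inv_rev]
  have hy' := Subgroup.inv_mem _ hy
  generalize y⁻¹ = y' at hy'
  rw [← cs.length_inv a]
  refine C.WJ_induction (P := fun y => cs.length (a⁻¹ * y) + cs.length y = cs.length a⁻¹)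
    (by simp) ?_ hy'
  intro u i hu hi hl ih
  have h1 := C.act_nonpos_of_desc ha (C.act_al_nonneg u i hl) (C.inJ_act hu (inJ_al hi))
  rw [← act_mul, C.act_al_nonpos_iff, mul_assoc] at h1
  have h2 := cs.length_mul_simple (a⁻¹ * u) i
  rw [mul_assoc] at h2
  have h3 := length_add_one hl
  omega

theorem bruhat_of_desc (ha : ∀ i ∈ K, C.act a⁻¹ (al i) ≤ 0) (haK : a ∈ WJc cs K)
    (hy : y ∈ WJc cs K) : bruhatLE cs y a := by
  have hle : ∀ z ∈ WJc cs K, cs.length z ≤ cs.length a := fun z hz => by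
    have := length_of_desc ha hz
    omega
  induction hn : cs.length a - cs.length y using Nat.strong_induction_on generalizing y with
  | _ m ih =>
  by_cases h : ∀ i ∈ K, C.act y⁻¹ (al i) ≤ 0
  · have h1 := length_of_desc h (Subgroup.mul_mem _ haK (Subgroup.inv_mem _ hy))
    have h2 := hle y hy
    rw [inv_mul_cancel_right] at h1
    have h3 : a * y⁻¹ = 1 := cs.length_eq_zero_iff.1 (by omega)
    rw [mul_inv_eq_one.1 h3]
    exact bruhat_refl _
  · push Not at h
    obtain ⟨i, hi, h⟩ := h
    rw [C.act_al_nonpos_iff, ← cs.length_inv (y⁻¹ * _), mul_inv_rev, cs.inv_simple, inv_inv,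
      cs.length_inv] at h
    have h0 := cs.length_simple_mul_ne y i
    have h1 : cs.length y < cs.length (cs.simple i * y) := by omega
    have h2 := Subgroup.mul_mem _ (simple_mem_WJ hi) hy
    have h3 := hle _ h2
    exact bruhat_trans (bruhat_of_refl (cs.isReflection_simple i) h1) (ih _ (by omega) h2 rfl)

theorem ratSmooth_of_desc (ha : ∀ i ∈ K, C.act a⁻¹ (al i) ≤ 0) (haK : a ∈ WJc cs K) :
    RatSmooth cs a := by
  intro i hi
  have hmem : ∀ y, bruhatLE cs y a ↔ y ∈ WJc cs K := fun y =>
    ⟨fun h => C.bruhat_mem_WJ h haK, fun h => bruhat_of_desc ha haK h⟩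
  rw [coeff_poin, coeff_poin]
  have h1 : ∀ y ∈ WJc cs K, ∀ j ≤ cs.length a, cs.length y = j →
      cs.length (y * a) = cs.length a - j := fun y hy j hj hl => by
    have := length_of_desc ha hy
    omega
  have h2 : ∀ y ∈ WJc cs K, cs.length y = cs.length a - i → cs.length (y * a⁻¹) = i :=
      fun y hy hl => by
    have := length_of_desc ha (Subgroup.mul_mem _ hy (Subgroup.inv_mem _ haK))
    rw [inv_mul_cancel_right] at this
    omega
  refine congrArg _ (Finset.card_nbij' (fun y => y * a) (fun y => y * a⁻¹) ?_ ?_ ?_ ?_)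
  · intro y hy
    simp only [Finset.coe_filter, Set.mem_ofPred_eq, mem_ivl, hmem] at hy ⊢
    exact ⟨Subgroup.mul_mem _ hy.1 haK, h1 y hy.1 i hi hy.2⟩
  · intro y hy
    simp only [Finset.coe_filter, Set.mem_ofPred_eq, mem_ivl, hmem] at hy ⊢
    exact ⟨Subgroup.mul_mem _ hy.1 (Subgroup.inv_mem _ haK), h2 y hy.1 hy.2⟩
  · intro y _; simp
  · intro y _; simp

end Longest
end Cartan

namespace Cartan
variable [Fintype B] [DecidableEq B] {C : Cartan cs} [Finite W] {J J' K : Set B} {a b w x y z t s : W}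
  {n : Fin 4 → B} {v e h : Vec4} {ω : List (Fin 4)} {R : List (Vec4 × Vec4)} {D : List Vec4}
namespace NodesF4

theorem root_mem_table (P : C.NodesF4 J n) (hx : x ∈ WJc cs (Set.range n)) (i : Fin 4) :
    ∃ p ∈ Vec4.table, C.act x (al (n i)) = vec4 n (Vec4.root p) ∨
      C.act x (al (n i)) = -vec4 n (Vec4.root p) := by
  have h0 : ∀ p ∈ Vec4.table, ∀ j, ∃ q ∈ Vec4.table,
      (∀ i, (Vec4.rstep j (Vec4.root p)).coord i = (Vec4.root q).coord i) ∨
      (∀ i, (Vec4.rstep j (Vec4.root p)).coord i = -(Vec4.root q).coord i) := by decide +kernel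
  have h1 : ∀ i, ∃ p ∈ Vec4.table, ∀ k, (Vec4.unit i).coord k = (Vec4.root p).coord k := by
    decide +kernel
  have hext : ∀ u v : Vec4, (∀ i, u.coord i = v.coord i) → vec4 n u = vec4 n v := by
    intro u v huv
    have : u = v := Vec4.ext (huv 0) (huv 1) (huv 2) (huv 3)
    rw [this]
  have hneg : ∀ u v : Vec4, (∀ i, u.coord i = -v.coord i) → vec4 n u = -vec4 n v := by
    intro u v huv
    have h0 : u.a = -v.a := huv 0
    have h1 : u.b = -v.b := huv 1
    have h2 : u.c = -v.c := huv 2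
    have h3 : u.d = -v.d := huv 3
    rw [vec4, vec4, h0, h1, h2, h3]
    module
  have hx' := Subgroup.inv_mem _ hx
  rw [← inv_inv x]
  generalize x⁻¹ = y at hx'
  refine C.WJ_induction (P := fun y => ∃ p ∈ Vec4.table,
    C.act y⁻¹ (al (n i)) = vec4 n (Vec4.root p) ∨
      C.act y⁻¹ (al (n i)) = -vec4 n (Vec4.root p)) ?_ ?_ hx'
  · obtain ⟨p, hp, h2⟩ := h1 i
    refine ⟨p, hp, Or.inl ?_⟩
    rw [inv_one, act_one, ← hext _ _ h2]
    fin_cases i <;> simp [Vec4.unit, vec4]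
  · rintro u _ - ⟨j, rfl⟩ - ⟨p, hp, h2⟩
    obtain ⟨q, hq, h3⟩ := h0 p hp j
    refine ⟨q, hq, ?_⟩
    rw [mul_inv_rev, cs.inv_simple, act_mul]
    rcases h2 with h2 | h2 <;> rw [h2]
    · rw [P.act_simple_vec4]
      exact h3.imp (hext _ _) (hneg _ _)
    · rw [act_neg, P.act_simple_vec4, neg_inj, neg_eq_iff_eq_neg]
      exact h3.symm.imp (hneg _ _) (hext _ _)

theorem table_inj : ∀ p ∈ Vec4.table, ∀ q ∈ Vec4.table, Vec4.root p = Vec4.root q → p = q := by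
  have h4 : ∀ p ∈ Vec4.table, ∀ q ∈ Vec4.table, (∀ i, (Vec4.root p).coord i =
      (Vec4.root q).coord i) → p = q := by decide +kernel
  intro p hp q hq h
  exact h4 p hp q hq fun i => by rw [h]

theorem wd_rword_inj (P : C.NodesF4 J n) {p q : List (Fin 4) × Fin 4} (hp : p ∈ Vec4.table)
    (hq : q ∈ Vec4.table) (h : wd cs n (Vec4.rword p) = wd cs n (Vec4.rword q)) : p = q := by
  have h3 := P.rt_wd hp
  rw [h, P.rt_wd hq] at h3
  exact table_inj p hp q hq (P.vec4_injective h3).symm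

open Classical in
theorem edg_eq (P : C.NodesF4 J n) (hmax : ∀ y ∈ WJc cs (Set.range n), bruhatLE cs y a)
    (ha : a ∈ WJc cs (Set.range n)) :
    edg cs a 1 = (Vec4.table.map fun p => wd cs n (Vec4.rword p)).toFinset := by
  ext t
  rw [mem_edg, mul_one, List.mem_toFinset, List.mem_map]
  constructor
  · rintro ⟨ht, hta⟩
    obtain ⟨x, hx, _, ⟨i, rfl⟩, h1, h2⟩ := C.exists_WJ_of_refl ht
      (C.inJ_rt ht (C.bruhat_mem_WJ hta ha))
    obtain ⟨p, hp, h3⟩ := P.root_mem_table hx i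
    refine ⟨p, hp, C.refl_ext (isReflection_wd p) ht ?_⟩
    rw [P.rt_wd hp, h1]
    rcases h3 with h3 | h3 <;> rw [h3]
    · exact Or.inl rfl
    · exact Or.inr (neg_neg _).symm
  · rintro ⟨p, -, rfl⟩
    exact ⟨isReflection_wd p, hmax _ (wd_mem _)⟩

theorem hgt_vec4 (v : Vec4) : hgt (vec4 n v) = v.a + v.b + v.c + v.d := by
  simp only [vec4, hgt_add, hgt_smul, hgt_al, mul_one]

theorem poin_of_max (P : C.NodesF4 J n) (ha : a ∈ WJc cs (Set.range n))
    (hd : ∀ i, C.act a⁻¹ (al (n i)) ≤ 0) :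
    poin cs a = qint 2 * qint 6 * qint 8 * qint 12 := by
  classical
  have hd' : ∀ i ∈ Set.range n, C.act a⁻¹ (al i) ≤ 0 := by
    rintro _ ⟨i, rfl⟩; exact hd i
  have hmax : ∀ y ∈ WJc cs (Set.range n), bruhatLE cs y a := fun y hy => bruhat_of_desc hd' ha hy
  have h1 := C.poin_mul_prod (Or.inr hmax) (ratSmooth_of_desc hd' ha) ha
  have hnd : (Vec4.table.map fun p => wd cs n (Vec4.rword p)).Nodup :=
    List.Nodup.map_on (fun p hp q hq => P.wd_rword_inj hp hq) (by decide)
  have hh : (Vec4.table.map fun p => ((Vec4.root p).a + (Vec4.root p).b + (Vec4.root p).c +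
      (Vec4.root p).d).toNat) = [1, 1, 1, 1, 2, 3, 2, 2, 4, 5, 3, 3, 5, 6,
      4, 4, 7, 5, 9, 6, 10, 7, 11, 8] := by
    decide +kernel
  have key : ∀ f : ℕ → Polynomial ℤ, ∏ t ∈ edg cs a 1, f (C.ht t) =
      (List.map f [1, 1, 1, 1, 2, 3, 2, 2, 4, 5, 3, 3, 5, 6,
      4, 4, 7, 5, 9, 6, 10, 7, 11, 8]).prod := by
    intro f
    rw [P.edg_eq hmax ha, List.prod_toFinset (fun t => f (C.ht t)) hnd, List.map_map, ← hh,
      List.map_map]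
    congr 1
    refine List.map_congr_left fun p hp => ?_
    simp only [Function.comp_apply, ht]
    rw [P.rt_wd hp, hgt_vec4]
  have hne : ∏ t ∈ edg cs a 1, qint (C.ht t) ≠ 0 := by
    refine Finset.prod_ne_zero_iff.2 fun t ht => ?_
    obtain ⟨m, hm⟩ := Nat.exists_eq_succ_of_ne_zero (C.ht_pos (mem_edg.1 ht).1).ne'
    rw [hm]
    exact (qint_monic _).ne_zero
  apply mul_right_cancel₀ hne
  rw [h1, key qint, key fun m => qint (m + 1)]
  have h3 : qint 1 = 1 := by simp [qint]
  simp only [List.map_cons, List.map_nil, List.prod_cons, List.prod_nil, Nat.reduceAdd, h3]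
  ring

end NodesF4
end Cartan

namespace Cartan
variable [Fintype B] [DecidableEq B] {C : Cartan cs} [Finite W] {J J' K : Set B} {a b w x y z t s : W}
  {n : Fin 4 → B} {v e h : Vec4} {ω : List (Fin 4)} {R : List (Vec4 × Vec4)} {D : List Vec4}
namespace NodesF4

theorem vec4_nonneg (h : ∀ i, 0 ≤ v.coord i) : 0 ≤ vec4 n v := by
  rw [vec4]
  have := fun i => al_nonneg (n i)
  exact add_nonneg (add_nonneg (add_nonneg (smul_nonneg (h 0) (this 0))
    (smul_nonneg (h 1) (this 1))) (smul_nonneg (h 2) (this 2))) (smul_nonneg (h 3) (this 3))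

theorem vec4_nonpos (h : ∀ i, v.coord i ≤ 0) : vec4 n v ≤ 0 := by
  rw [vec4]
  have := fun i => al_nonneg (n i)
  exact add_nonpos (add_nonpos (add_nonpos (smul_nonpos_of_nonpos_of_nonneg (h 0) (this 0))
    (smul_nonpos_of_nonpos_of_nonneg (h 1) (this 1)))
    (smul_nonpos_of_nonpos_of_nonneg (h 2) (this 2)))
    (smul_nonpos_of_nonpos_of_nonneg (h 3) (this 3))

theorem inJ_vec4_iff (P : C.NodesF4 J n) (i : Fin 4) :
    InJ (J \ {n i}) (vec4 n v) ↔ v.coord i = 0 := by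
  refine ⟨fun h => ?_, fun h k hk => ?_⟩
  · have := h (n i) (by simp)
    rwa [P.coord_vec4] at this
  · by_cases hki : k = n i
    · rw [hki, P.coord_vec4, h]
    · refine inJ_vec4 v k ?_
      rintro ⟨j, rfl⟩
      exact hk ⟨P.mem j, hki⟩

theorem mem_of_descend (P : C.NodesF4 J n) {f : Vec4 → Option Vec4} {i : Fin 4}
    (hf : ∀ v v', f v = some v' → ∃ j, j ≠ i ∧ v' = Vec4.step j v) {k : ℕ}
    (hd : Vec4.descend f k v = true) (hx : x ∈ WJc cs (Set.range n)) (hv : C.HasHeights n x v) :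
    x ∈ WJc cs (Set.range n \ {n i}) := by
  induction k generalizing x v with
  | zero => simp [Vec4.descend] at hd
  | succ k ih =>
    rw [Vec4.descend, Vec4.force_eq] at hd
    cases hfv : f v with
    | none =>
      simp only [hfv, Vec4.isOne_iff] at hd
      rw [hd] at hv
      rw [hv.eq_one hx]
      exact Subgroup.one_mem _
    | some v' =>
      simp only [hfv] at hd
      obtain ⟨j, hj, rfl⟩ := hf v v' hfv
      have h1 := ih hd (Subgroup.mul_mem _ hx (simple_mem_WJ (Set.mem_range_self j)))
        (P.heights_step hv j)
      have h2 : n j ∈ Set.range n \ {n i} := ⟨Set.mem_range_self j, fun h => hj (P.inj h)⟩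
      have h3 := Subgroup.mul_mem _ h1 (simple_mem_WJ h2)
      rwa [cs.simple_mul_simple_cancel_right] at h3

theorem desc0_spec (v v' : Vec4) (h : Vec4.desc0 v = some v') : ∃ j, j ≠ 0 ∧ v' = Vec4.step j v := by
  unfold Vec4.desc0 at h
  cases h1 : Vec4.isNeg v.b with
  | true => exact ⟨1, by decide, by simpa [h1, eq_comm] using h⟩
  | false =>
  cases h2 : Vec4.isNeg v.c with
  | true => exact ⟨2, by decide, by simpa [h1, h2, eq_comm] using h⟩
  | false =>
  cases h3 : Vec4.isNeg v.d with
  | true => exact ⟨3, by decide, by simpa [h1, h2, h3, eq_comm] using h⟩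
  | false => simp [h1, h2, h3] at h

theorem desc3_spec (v v' : Vec4) (h : Vec4.desc3 v = some v') : ∃ j, j ≠ 3 ∧ v' = Vec4.step j v := by
  unfold Vec4.desc3 at h
  cases h1 : Vec4.isNeg v.a with
  | true => exact ⟨0, by decide, by simpa [h1, eq_comm] using h⟩
  | false =>
  cases h2 : Vec4.isNeg v.b with
  | true => exact ⟨1, by decide, by simpa [h1, h2, eq_comm] using h⟩
  | false =>
  cases h3 : Vec4.isNeg v.c with
  | true => exact ⟨2, by decide, by simpa [h1, h2, h3, eq_comm] using h⟩
  | false => simp [h1, h2, h3] at h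

/-- The conditions for the reverse of `r` to be a chain for the leaf `i`. -/
def ChainWord (i : Fin 4) (r : List (Fin 4)) : Prop :=
  (∀ k < r.length, (∀ j, 0 ≤ (Vec4.root (r.take k, r.getD k 0)).coord j) ∧
    (Vec4.root (r.take k, r.getD k 0)).coord i ≠ 0) ∧
  ∀ k < r.length, ∀ l < k, r.getD k 0 = r.getD l 0 ∨
    (∀ j, (Vec4.root (r.take l, r.getD k 0)).coord j ≤ 0) ∨
    (Vec4.root (r.take l, r.getD k 0)).coord i = 0

instance (i : Fin 4) (r : List (Fin 4)) : Decidable (ChainWord i r) := by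
  unfold ChainWord; infer_instance

theorem chn_list (r : List (Fin 4)) {k : ℕ} (hk : k ≤ r.length) :
    chn cs (fun k => n (r.getD k 0)) k = (wd cs n (r.take k))⁻¹ := by
  induction k with
  | zero => simp [chn, wd]
  | succ k ih =>
    rw [chn, ih (by omega), List.take_add_one, wd_append, mul_inv_rev]
    congr 1
    have h1 : r[k]? = some (r.getD k 0) := by
      rw [List.getD_eq_getElem _ _ (by omega), List.getElem?_eq_getElem]
    rw [h1]
    simp [wd]

theorem isChain_of_word (P : C.NodesF4 J n) {i : Fin 4} {r : List (Fin 4)} (h : ChainWord i r) :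
    C.IsChain (J \ {n i}) (fun k => n (r.getD k 0)) r.length := by
  have key : ∀ k ≤ r.length, ∀ j, C.act (chn cs (fun k => n (r.getD k 0)) k)⁻¹ (al (n j)) =
      vec4 n (Vec4.root (r.take k, j)) := by
    intro k hk j
    rw [chn_list r hk, inv_inv]
    exact P.act_wd (r.take k, j)
  refine ⟨fun k hk => ?_, fun k hk => ?_, fun l k hl hk => ?_⟩
  · rw [key k hk.le]
    exact vec4_nonneg (h.1 k hk).1
  · rw [key k hk.le, P.inJ_vec4_iff]
    exact (h.1 k hk).2
  · rw [key l (by omega), P.inJ_vec4_iff]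
    exact (h.2 k hk l hl).imp (congrArg n) (Or.imp_left vec4_nonpos)

theorem strip_of_word (P : C.NodesF4 J n) {i : Fin 4} {l : List (Fin 4)}
    (hl : ChainWord i l.reverse) {f : Vec4 → Option Vec4}
    (hf : ∀ v v', f v = some v' → ∃ j, j ≠ i ∧ v' = Vec4.step j v) {k : ℕ}
    (hd : Vec4.descend f k (Vec4.peel l h) = true) (ha : a ∈ WJc cs (Set.range n))
    (hh : C.HasHeights n a⁻¹ h) (hb : b ∈ WJc cs (J \ Set.range n))
    (hab : bruhatLE cs a (a * b)) (hD : D.Nodup)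
    (hDa : ∀ e ∈ D, ∃ t, cs.IsReflection t ∧ C.rt t = vec4 n e ∧ bruhatLE cs t a)
    (hc : l.length ≤ (D.filter fun e => decide (e.coord i ≠ 0)).length) :
    C.Strip (J \ {n i}) (a * b) := by
  classical
  have h1 := P.mem_of_descend hf hd (Subgroup.mul_mem _ (Subgroup.inv_mem _ ha) (wd_mem l))
    (P.heights_foldl hh l)
  have hJ : Set.range n \ {n i} ⊆ J \ {n i} := by
    rintro _ ⟨⟨j, rfl⟩, hj⟩
    exact ⟨P.mem j, hj⟩
  have hJ' : J \ Set.range n ⊆ J \ {n i} := fun j hj =>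
    ⟨hj.1, fun h => hj.2 ⟨i, h.symm⟩⟩
  refine ⟨_, _, (a⁻¹ * wd cs n l)⁻¹ * b, P.isChain_of_word hl, Subgroup.mul_mem _
    (Subgroup.inv_mem _ (WJ_mono hJ h1)) (WJ_mono hJ' hb), ?_, ?_⟩
  · rw [chn_list _ le_rfl, List.take_length, ← wd_reverse, List.reverse_reverse]
    group
  · rw [List.length_reverse]
    refine hc.trans ?_
    choose! t ht using hDa
    rw [← List.length_map t, ← List.toFinset_card_of_nodup]
    · refine Finset.card_le_card fun s hs => ?_
      rw [List.mem_toFinset, List.mem_map] at hs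
      obtain ⟨e, he, rfl⟩ := hs
      rw [List.mem_filter, decide_eq_true_iff] at he
      obtain ⟨h2, h3, h4⟩ := ht e he.1
      rw [Finset.mem_filter, mem_edg, mul_one, C.refl_mem_WJ_iff h2, h3, P.inJ_vec4_iff]
      exact ⟨⟨h2, bruhat_trans h4 hab⟩, he.2⟩
    · refine List.Nodup.map_on (fun e he e' he' hee => ?_) (hD.filter _)
      have h2 := (ht e (List.mem_filter.1 he).1).2.1
      rw [hee, (ht e' (List.mem_filter.1 he').1).2.1] at h2
      exact (P.vec4_injective h2).symm

theorem strip_of_hasStrip (P : C.NodesF4 J n) (hs : Vec4.hasStrip h D = true)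
    (ha : a ∈ WJc cs (Set.range n))
    (hh : C.HasHeights n a⁻¹ h) (hb : b ∈ WJc cs (J \ Set.range n))
    (hab : bruhatLE cs a (a * b)) (hD : D.Nodup)
    (hDa : ∀ e ∈ D, ∃ t, cs.IsReflection t ∧ C.rt t = vec4 n e ∧ bruhatLE cs t a) :
    ∃ i, C.Strip (J \ {n i}) (a * b) := by
  have c0 : ∀ l ∈ Vec4.chains0, ChainWord 0 l.reverse := by decide +kernel
  have c3 : ∀ l ∈ Vec4.chains3, ChainWord 3 l.reverse := by decide +kernel
  simp only [Vec4.hasStrip, Bool.or_eq_true, List.any_eq_true, Bool.and_eq_true,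
    Nat.ble_eq] at hs
  rcases hs with ⟨l, hl, h1, h2⟩ | ⟨l, hl, h1, h2⟩
  · exact ⟨0, P.strip_of_word (c0 l hl) desc0_spec h2 ha hh hb hab hD hDa h1⟩
  · exact ⟨3, P.strip_of_word (c3 l hl) desc3_spec h2 ha hh hb hab hD hDa h1⟩

end NodesF4
end Cartan

namespace Cartan
variable [Fintype B] [DecidableEq B] {C : Cartan cs} [Finite W] {J J' K : Set B} {a b w x y z t s : W}
  {n : Fin 4 → B} {v e h : Vec4} {ω : List (Fin 4)} {R : List (Vec4 × Vec4)} {D : List Vec4}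

theorem M_eq_two_of_A (C : Cartan cs) {i j : B} (hij : i ≠ j) (h : C.A i j = 0) : M i j = 2 := by
  have := C.off i j hij
  omega

theorem length_of_nodup (hD : D.Nodup) (hDa : ∀ e ∈ D, ∃ t, cs.IsReflection t ∧
    C.rt t = vec4 n e ∧ bruhatLE cs t a) (P : C.NodesF4 J n) : D.length ≤ (edg cs a 1).card := by
  classical
  rw [← List.toFinset_card_of_nodup hD, ← Finset.card_image_of_injective _ P.vec4_injective]
  refine le_trans (Finset.card_le_card (t := (edg cs a 1).image C.rt) fun v hv => ?_)
    Finset.card_image_le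
  obtain ⟨e, he, rfl⟩ := Finset.mem_image.1 hv
  obtain ⟨t, ht, hr, hta⟩ := hDa e (List.mem_toFinset.1 he)
  exact Finset.mem_image.2 ⟨t, mem_edg.2 ⟨ht, by rwa [mul_one]⟩, hr⟩

namespace NodesF4

theorem M_eq_two (P : C.NodesF4 J n) : ∀ i ∈ Set.range n, ∀ j ∈ J \ Set.range n, M i j = 2 := by
  rintro _ ⟨i, rfl⟩ j ⟨hj, hj'⟩
  exact C.M_eq_two_of_A (fun h => hj' ⟨i, h⟩) (P.A_out j hj (fun i h => hj' ⟨i, h⟩) i)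

theorem factors_of_longest (P : C.NodesF4 J n) (ha : a ∈ WJc cs (Set.range n))
    (hb : b ∈ WJc cs (J \ Set.range n)) (hd : ∀ i, C.act a⁻¹ (al (n i)) ≤ 0)
    (hs : RatSmooth cs (a * b))
    (ih : RatSmooth cs b → Factors cs (J \ Set.range n) b) : Factors cs J (a * b) := by
  have hp := C.poin_mul_of_commute P.M_eq_two (fun j hj => hj.2) ha hb
  have hd' : ∀ i ∈ Set.range n, C.act a⁻¹ (al i) ≤ 0 := by
    rintro _ ⟨i, rfl⟩; exact hd i
  obtain ⟨m, hm, hbm⟩ := ih (ratSmooth_of_mul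
    ((ratSmooth_iff_reverse _).1 (ratSmooth_of_desc hd' ha)) hp hs)
  refine ⟨fun i => m i + ∑ k : Fin 4, if i = n k then ![1, 5, 7, 11] k else 0, fun i hi => ?_, ?_⟩
  · simp only [hm i fun h => hi h.1, zero_add]
    refine Finset.sum_eq_zero fun k _ => if_neg ?_
    rintro rfl
    exact hi (P.mem k)
  · have h1 : ∀ i, qint (m i + (∑ k : Fin 4, if i = n k then ![1, 5, 7, 11] k else 0) + 1) =
        qint (m i + 1) * ∏ k : Fin 4, if i = n k then qint (![1, 5, 7, 11] k + 1) else 1 := by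
      intro i
      by_cases hi : ∃ k, i = n k
      · obtain ⟨k, rfl⟩ := hi
        have : ∀ l, n k = n l ↔ k = l := fun l => P.inj.eq_iff
        simp only [this, Finset.sum_ite_eq, Finset.prod_ite_eq, Finset.mem_univ, if_true]
        rw [hm _ fun h => h.2 (Set.mem_range_self k), zero_add]
        simp [qint]
      · push Not at hi
        simp [hi]
    rw [hp, P.poin_of_max ha hd, hbm]
    simp only [h1]
    rw [Finset.prod_mul_distrib, Finset.prod_comm]
    simp only [Finset.prod_ite_eq', Finset.mem_univ, if_true]
    rw [Fin.prod_univ_four, mul_comm]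
    rfl

theorem factors (P : C.NodesF4 J n) (hs : RatSmooth cs w) (hw : w ∈ WJc cs J)
    (ih : ∀ i ∈ J, ∀ K ⊆ J \ {i}, ∀ u ∈ WJc cs K, RatSmooth cs u → Factors cs K u) :
    Factors cs J w := by
  obtain ⟨a, ha, b, hb, rfl⟩ := C.exists_mul_of_commute P.M_eq_two hw
  have hd : ∀ j ∈ J \ Set.range n, j ∉ Set.range n := fun j hj => hj.2
  have hreg : Regular cs a := C.regular_left P.M_eq_two hd ha hb (C.regular_of_ratSmooth hs)
  have hmin : ∀ {a}, a ∈ WJc cs (Set.range n) → MinLeft cs (J \ Set.range n) a :=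
    fun ha => C.minLeft_of_disjoint ha hd
  have hle : ∀ {a b}, a ∈ WJc cs (Set.range n) → b ∈ WJc cs (J \ Set.range n) →
      bruhatLE cs a (a * b) := fun {a b} ha hb => by
    have := C.bruhat_mul_le_mul (hmin ha) hb (bruhat_refl a) (one_bruhat b)
    rwa [mul_one] at this
  obtain ⟨k, ω, h, R, D, hS, hk⟩ := P.pass ha
  have hD : D.Nodup := (List.nodup_append.1 hS.nodup).1
  have hg : Vec4.good ω h D = true := by
    cases k with
    | zero => simp [Vec4.search] at hk
    | succ k =>
      rw [Vec4.search, Bool.and_eq_true] at hk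
      exact hk.1
  simp only [Vec4.good, Bool.or_eq_true, Bool.and_eq_true, Nat.blt_eq, Vec4.isNeg_eq_true] at hg
  rcases hg with hg | hg | hg | hg | hg | hg
  · exfalso
    have h1 := hreg 1 (one_bruhat a)
    have h2 := length_of_nodup hD hS.done P
    rw [hS.red.length] at h1
    omega
  · obtain ⟨i, hi⟩ := P.strip_of_hasStrip hg ha hS.heights hb (hle ha hb) hD hS.done
    exact factors_of_strip (C := C) (P.mem i) hs (Or.inl hi) (ih _ (P.mem i) _ subset_rfl)
  · have ha' := Subgroup.inv_mem _ ha
    have hb' := Subgroup.inv_mem _ hb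
    have hD' : ∀ e ∈ D, ∃ t, cs.IsReflection t ∧ C.rt t = vec4 n e ∧ bruhatLE cs t a⁻¹ := by
      intro e he
      obtain ⟨t, ht, hr, hta⟩ := hS.done e he
      refine ⟨t, ht, hr, ?_⟩
      rw [← ht.inv]
      exact bruhat_inv hta
    have hh : C.HasHeights n a⁻¹⁻¹ (Vec4.heights ω) := by
      rw [inv_inv, hS.red.eq]
      exact P.heights_wd ω
    obtain ⟨i, hi⟩ := P.strip_of_hasStrip hg ha' hh hb' (hle ha' hb') hD hD'
    rw [← mul_inv_rev, ← commute_WJ P.M_eq_two ha hb] at hi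
    exact factors_of_strip (C := C) (P.mem i) hs (Or.inr hi) (ih _ (P.mem i) _ subset_rfl)
  · exact absurd hreg (P.not_regular_of_excess hS.red hg)
  · exact absurd hreg (P.not_regular_of_excess hS.red hg)
  · refine P.factors_of_longest ha hb (fun i => ?_) hs fun hb' => ?_
    · rw [act_al_nonpos_iff, ← hS.heights.neg_iff]
      fin_cases i
      exacts [hg.1, hg.2.1, hg.2.2.1, hg.2.2.2]
    · refine ih _ (P.mem 0) _ (fun j hj => ?_) _ hb hb'
      exact ⟨hj.1, fun h => hj.2 ⟨0, h.symm⟩⟩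
end NodesF4
end Cartan

namespace Cartan
variable [Fintype B] [DecidableEq B] (C : Cartan cs) [Finite W] {J : Set B} {i j k l : B}

theorem A_nonpos (h : i ≠ j) : C.A i j ≤ 0 := by
  rcases C.off i j h with h | h | h | h | h | h <;> omega

theorem A_le_neg_one (h : i ≠ j) (hM : M i j ≠ 2) : C.A i j ≤ -1 := by
  rcases C.off i j h with h | h | h | h | h | h <;> omega

theorem A_of_M_eq_three (h : i ≠ j) (hM : M i j = 3) : C.A i j = -1 ∧ C.A j i = -1 := by
  rcases C.off i j h with h | h | h | h | h | h <;> omega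

theorem A_of_M_eq_two (h : i ≠ j) (hM : M i j = 2) : C.A i j = 0 ∧ C.A j i = 0 := by
  rcases C.off i j h with h | h | h | h | h | h <;> omega

theorem A_of_M_multiple (h : i ≠ j) (h2 : M i j ≠ 2) (h3 : M i j ≠ 3) :
    C.A i j ≤ -2 ∧ C.A j i ≤ -1 ∨ C.A i j ≤ -1 ∧ C.A j i ≤ -2 := by
  rcases C.off i j h with h | h | h | h | h | h <;> omega

/-- No positive combination of simple roots pairs nonpositively with all coroots in its support. -/
theorem false_of_subdominant {ι : Type*} [DecidableEq ι] (S : Finset ι) {q : ι → B}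
    (hq : Set.InjOn q S) {c : ι → ℤ} (hS : S.Nonempty) (hc : ∀ a ∈ S, 0 < c a)
    (h : ∀ a ∈ S, ∃ T ⊆ S, a ∈ T ∧ ∑ b ∈ T, c b * C.A (q a) (q b) ≤ 0) : False := by
  set v : B → ℤ := ∑ a ∈ S, c a • al (q a) with hv
  have h1 : ∀ x, v x = ∑ a ∈ S, if x = q a then c a else 0 := by
    intro x
    simp [hv, Finset.sum_apply, al, Pi.single_apply]
  have h2 : 0 ≤ v := Finset.sum_nonneg fun a ha => smul_nonneg (hc a ha).le (al_nonneg _)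
  have h3 : ∀ a ∈ S, v (q a) = c a := by
    intro a ha
    rw [h1, Finset.sum_eq_single_of_mem a ha fun b hb hba => if_neg fun e => hba (hq ha hb e).symm,
      if_pos rfl]
  have h4 : v ≠ 0 := by
    obtain ⟨a, ha⟩ := hS
    intro h
    have := h3 a ha
    rw [h, Pi.zero_apply] at this
    exact absurd (hc a ha) (by omega)
  obtain ⟨i, hi, hp⟩ := C.exists_pair_pos h2 h4
  obtain ⟨a, ha, rfl⟩ : ∃ a ∈ S, q a = i := by
    by_contra! hcon
    rw [h1, Finset.sum_eq_zero fun a ha => if_neg (hcon a ha).symm] at hi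
    exact lt_irrefl _ hi
  obtain ⟨T, hT, haT, hle⟩ := h a ha
  rw [hv, map_sum] at hp
  simp only [map_smul, pair_al, smul_eq_mul] at hp
  refine absurd hp (not_lt.2 (le_trans ?_ hle))
  rw [← Finset.sum_sdiff hT]
  have : ∑ b ∈ S \ T, c b * C.A (q a) (q b) ≤ 0 := Finset.sum_nonpos fun b hb => by
    obtain ⟨hbS, hbT⟩ := Finset.mem_sdiff.1 hb
    refine mul_nonpos_of_nonneg_of_nonpos (hc b hbS).le (C.A_nonpos fun e => hbT ?_)
    rwa [← hq ha hbS e]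
  linarith

theorem false_of_chain (n : ℕ) {q : ℕ → B} (hq : ∀ b ≤ n + 1, ∀ a < b, q a ≠ q b) {c : ℕ → ℤ}
    (hc : ∀ a ≤ n + 1, 0 < c a) (h0 : 2 * c 0 + c 1 * C.A (q 0) (q 1) ≤ 0)
    (hm : ∀ a < n, c a * C.A (q (a + 1)) (q a) + 2 * c (a + 1) +
      c (a + 2) * C.A (q (a + 1)) (q (a + 2)) ≤ 0)
    (hn : c n * C.A (q (n + 1)) (q n) + 2 * c (n + 1) ≤ 0) : False := by
  refine C.false_of_subdominant (Finset.range (n + 2)) (q := q) (c := c) ?_ ⟨0, by simp⟩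
    (fun a ha => hc a (by have := Finset.mem_range.1 ha; omega)) ?_
  · intro a ha b hb hab
    have ha := Finset.mem_range.1 (Finset.mem_coe.1 ha)
    have hb := Finset.mem_range.1 (Finset.mem_coe.1 hb)
    rcases lt_trichotomy a b with h | h | h
    · exact absurd hab (hq b (by omega) a h)
    · exact h
    · exact absurd hab.symm (hq a (by omega) b h)
  · intro a ha
    have ha := Finset.mem_range.1 ha
    obtain rfl | ⟨a, rfl⟩ : a = 0 ∨ ∃ b, a = b + 1 := by cases a <;> simp
    · refine ⟨{0, 1}, fun b hb => ?_, by simp, ?_⟩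
      · simp only [Finset.mem_insert, Finset.mem_singleton] at hb
        simp only [Finset.mem_range]; omega
      · rw [Finset.sum_pair (by simp), C.diag]; linarith
    · by_cases han : a < n
      · refine ⟨{a, a + 1, a + 2}, fun b hb => ?_, by simp, ?_⟩
        · simp only [Finset.mem_insert, Finset.mem_singleton] at hb
          simp only [Finset.mem_range]; omega
        · rw [Finset.sum_insert (by simp), Finset.sum_pair (by simp), C.diag]
          linarith [hm a han]
      · obtain rfl : a = n := by omega
        refine ⟨{a, a + 1}, fun b hb => ?_, by simp, ?_⟩
        · simp only [Finset.mem_insert, Finset.mem_singleton] at hb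
          simp only [Finset.mem_range]; omega
        · rw [Finset.sum_pair (by simp), C.diag]; linarith

theorem false_of_chain_three (hij : i ≠ j) (hik : i ≠ k) (hjk : j ≠ k) {c d e : ℤ} (hc : 0 < c)
    (hd : 0 < d) (he : 0 < e) (h1 : 2 * c + d * C.A i j ≤ 0)
    (h2 : c * C.A j i + 2 * d + e * C.A j k ≤ 0) (h3 : d * C.A k j + 2 * e ≤ 0) : False := by
  refine C.false_of_chain 1 (q := fun a => match a with | 0 => i | 1 => j | _ => k)
    (c := fun a => match a with | 0 => c | 1 => d | _ => e) ?_ ?_ h1 ?_ h3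
  · intro b hb a ha
    interval_cases b <;> interval_cases a <;> assumption
  · intro a ha
    interval_cases a <;> assumption
  · intro a ha
    interval_cases a
    exact h2

theorem false_of_chain_four (hij : i ≠ j) (hik : i ≠ k) (hil : i ≠ l) (hjk : j ≠ k) (hjl : j ≠ l)
    (hkl : k ≠ l) {c d e f : ℤ} (hc : 0 < c)
    (hd : 0 < d) (he : 0 < e) (hf : 0 < f) (h1 : 2 * c + d * C.A i j ≤ 0)
    (h2 : c * C.A j i + 2 * d + e * C.A j k ≤ 0) (h3 : d * C.A k j + 2 * e + f * C.A k l ≤ 0)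
    (h4 : e * C.A l k + 2 * f ≤ 0) : False := by
  refine C.false_of_chain 2 (q := fun a => match a with | 0 => i | 1 => j | 2 => k | _ => l)
    (c := fun a => match a with | 0 => c | 1 => d | 2 => e | _ => f) ?_ ?_ h1 ?_ h4
  · intro b hb a ha
    interval_cases b <;> interval_cases a <;> assumption
  · intro a ha
    interval_cases a <;> assumption
  · intro a ha
    interval_cases a
    exacts [h2, h3]

theorem false_of_star (hij : i ≠ j) (hik : i ≠ k) (hil : i ≠ l) (hjk : j ≠ k) (hjl : j ≠ l)
    (hkl : k ≠ l) (hj : C.A i j ≤ -2) (hj' : C.A j i ≤ -1) (hk : C.A i k ≤ -1)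
    (hk' : C.A k i ≤ -1) (hl : C.A i l ≤ -1) (hl' : C.A l i ≤ -1) : False := by
  refine C.false_of_subdominant (ι := Fin 4) Finset.univ (q := ![i, j, k, l]) (c := ![2, 1, 1, 1])
    ?_ Finset.univ_nonempty ?_ ?_
  · intro a _ b _ h
    fin_cases a <;> fin_cases b <;> simp_all [eq_comm]
  · intro a _
    fin_cases a <;> simp
  · intro a _
    by_cases ha : a = 0
    · subst ha
      refine ⟨Finset.univ, subset_rfl, by simp, ?_⟩
      simp only [Fin.sum_univ_four, Matrix.cons_val]
      rw [C.diag]; linarith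
    · refine ⟨{0, a}, Finset.subset_univ _, by simp, ?_⟩
      rw [Finset.sum_pair (Ne.symm ha), C.diag]
      fin_cases a
      · simp at ha
      · simp only [Matrix.cons_val, Fin.reduceFinMk, Fin.mk_one, Matrix.cons_val_one, Matrix.cons_val_zero]; linarith
      · simp only [Matrix.cons_val, Fin.reduceFinMk]; linarith
      · simp only [Matrix.cons_val, Fin.reduceFinMk]; linarith

/-- An edge of order six is a connected component. -/
theorem isolated_of_M_eq_six (C : Cartan cs) (hij : i ≠ j) (hM : M i j = 6) (hik : k ≠ i)
    (hjk : k ≠ j) : M i k = 2 ∧ M j k = 2 := by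
  have key : ∀ {i j k : B}, i ≠ j → M i j = 6 → k ≠ i → k ≠ j → M j k = 2 := by
    intro i j k hij hM hki hkj
    by_contra h
    have h1 := C.A_le_neg_one hkj.symm h
    have h2 := C.A_le_neg_one hkj (by rwa [M.symmetric])
    have h3 : C.A i j = -1 ∧ C.A j i = -3 ∨ C.A i j = -3 ∧ C.A j i = -1 := by
      have := C.off i j hij
      omega
    rcases h3 with ⟨h3, h4⟩ | ⟨h3, h4⟩
    · exact C.false_of_chain_three hij hki.symm hkj.symm (c := 1) (d := 2) (e := 1) (by norm_num)
        (by norm_num) (by norm_num) (by linarith) (by linarith) (by linarith)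
    · exact C.false_of_chain_three hij hki.symm hkj.symm (c := 3) (d := 2) (e := 1) (by norm_num)
        (by norm_num) (by norm_num) (by linarith) (by linarith) (by linarith)
  exact ⟨key hij.symm (by rw [M.symmetric]; exact hM) hjk hik, key hij hM hik hjk⟩

end Cartan

/-- A path in the Coxeter graph whose first edge is the only one of order four, the others being
of order three. -/
structure EdgePath (M : CoxeterMatrix B) (J : Set B) (p : ℕ → B) (N : ℕ) : Prop where
  pos : 1 ≤ N
  ne : ∀ b ≤ N, ∀ a < b, p a ≠ p b
  mem : ∀ a ≤ N, p a ∈ J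
  four : M (p 0) (p 1) = 4
  three : ∀ a, 1 ≤ a → a < N → M (p a) (p (a + 1)) = 3

/-- The path `p` of length `N`, extended by `j`. -/
def snoc (p : ℕ → B) (N : ℕ) (j : B) (a : ℕ) : B := if a ≤ N then p a else j

theorem snoc_of_le {p : ℕ → B} {N a : ℕ} {j : B} (h : a ≤ N) : snoc p N j a = p a := if_pos h
theorem snoc_succ {p : ℕ → B} {N : ℕ} {j : B} : snoc p N j (N + 1) = j := if_neg (by omega)

theorem snoc_ne {p : ℕ → B} {N n : ℕ} {j : B} (hn : n ≤ N) (hp : ∀ b ≤ N, ∀ a < b, p a ≠ p b)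
    (hj : ∀ a ≤ N, p a ≠ j) : ∀ b ≤ n + 1, ∀ a < b, snoc p n j a ≠ snoc p n j b := by
  intro b hb a hab
  rw [snoc_of_le (show a ≤ n by omega)]
  by_cases h : b ≤ n
  · rw [snoc_of_le h]; exact hp b (by omega) a hab
  · obtain rfl : b = n + 1 := by omega
    rw [snoc_succ]; exact hj a (by omega)

namespace EdgePath
variable {J : Set B} {p : ℕ → B} {N : ℕ} {i j : B}

theorem snoc (P : EdgePath M J p N) (hj : j ∈ J) (hp : ∀ a ≤ N, p a ≠ j) (hM : M (p N) j = 3) :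
    EdgePath M J (snoc p N j) (N + 1) where
  pos := by omega
  ne := snoc_ne le_rfl P.ne hp
  mem a ha := by
    by_cases h : a ≤ N
    · rw [snoc_of_le h]; exact P.mem a h
    · obtain rfl : a = N + 1 := by omega
      rwa [snoc_succ]
  four := by
    rw [snoc_of_le (by omega), snoc_of_le P.pos]; exact P.four
  three a h1 h2 := by
    rw [snoc_of_le (show a ≤ N by omega)]
    by_cases h : a < N
    · rw [snoc_of_le h]; exact P.three a h1 h
    · obtain rfl : a = N := by omega
      rwa [snoc_succ]

theorem of_edge (hi : i ∈ J) (hj : j ∈ J) (hij : i ≠ j) (hM : M i j = 4) :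
    EdgePath M J (fun a => if a = 0 then i else j) 1 where
  pos := le_rfl
  ne b hb a hab := by
    obtain rfl : b = 1 := by omega
    obtain rfl : a = 0 := by omega
    simpa
  mem a ha := by split_ifs <;> assumption
  four := by simpa
  three a h1 h2 := by omega

theorem reverse_snoc (P : EdgePath M J p N) (hj : j ∈ J) (hp : ∀ a ≤ N, p a ≠ j)
    (hM : M (p 0) j = 3) :
    EdgePath M J (Paper.snoc (fun a => if a = 0 then p 1 else p 0) 1 j) 2 := by
  have := P.pos
  refine (of_edge (P.mem 1 P.pos) (P.mem 0 (by omega)) (P.ne 1 P.pos 0 (by omega)).symm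
    (by rw [M.symmetric]; exact P.four)).snoc hj (fun a _ => ?_) (by simpa)
  split_ifs
  exacts [hp 1 P.pos, hp 0 (by omega)]

theorem lt_card [Fintype B] (P : EdgePath M J p N) : N < Fintype.card B := by
  have h := Fintype.card_le_of_injective (fun a : Fin (N + 1) => p a) fun a b hab => by
    rcases lt_trichotomy (a : ℕ) b with h | h | h
    · exact absurd hab (P.ne b (by omega) a h)
    · exact Fin.ext h
    · exact absurd hab.symm (P.ne a (by omega) b h)
  rw [Fintype.card_fin] at h
  omega

theorem exists_maximal [Fintype B] (hi : i ∈ J) (hj : j ∈ J) (hij : i ≠ j) (hM : M i j = 4) :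
    ∃ p N, EdgePath M J p N ∧ ∀ p', ¬ EdgePath M J p' (N + 1) := by
  by_contra! h
  have : ∀ N, ∃ p, EdgePath M J p (N + 1) := by
    intro N
    induction N with
    | zero => exact ⟨_, of_edge hi hj hij hM⟩
    | succ N ih =>
      obtain ⟨p, hp⟩ := ih
      exact h p _ hp
  obtain ⟨p, hp⟩ := this (Fintype.card B)
  have := hp.lt_card
  omega

end EdgePath

/-- Every crystallographic Coxeter matrix comes from a Cartan matrix, and the root lengths on one
edge can be prescribed. -/
theorem exists_cartan [Fintype B] (cs : CoxeterSystem M W) (hM : IsWeylMatrix M) {a b : B}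
    (hab : a ≠ b) : ∃ C : Cartan cs, M a b = 4 → C.A a b = -2 := by
  classical
  set e := Fintype.equivFin B
  let r : B → B → Prop := fun i j => e i < e j ↔ e a < e b
  have hr : ∀ i j, i ≠ j → (r i j ↔ ¬ r j i) := by
    intro i j hij
    have : e i ≠ e j := e.injective.ne hij
    simp only [r]
    rcases lt_or_gt_of_ne this with h | h
    · simp [h, h.not_gt]
    · simp [h, h.not_gt]
  refine ⟨⟨fun i j => if i = j then 2 else if M i j = 2 then 0 else if M i j = 3 then -1 else
    if r i j then (if M i j = 4 then -2 else -3) else -1, fun i => by simp, fun i j hij => ?_⟩,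
    fun h => ?_⟩
  · have h1 := hM i j hij
    have h2 := hr i j hij
    simp only [Set.mem_insert_iff, Set.mem_singleton_iff] at h1
    rw [M.symmetric j i]
    simp only [if_neg hij, if_neg hij.symm]
    by_cases hrij : r i j
    · have := h2.1 hrij
      rcases h1 with h1 | h1 | h1 | h1 <;> simp [h1, hrij, this]
    · have : r j i := by tauto
      rcases h1 with h1 | h1 | h1 | h1 <;> simp [h1, hrij, this]
  · simp [hab, h, r]

namespace EdgePath
variable [Fintype B] [DecidableEq B] {C : Cartan cs} [Finite W] {J : Set B} {p : ℕ → B} {N m : ℕ}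
  {i j k l : B}

theorem A_one_zero (P : EdgePath M J p N) (h : C.A (p 0) (p 1) = -2) : C.A (p 1) (p 0) = -1 := by
  have := C.off _ _ (P.ne 1 P.pos 0 (by omega))
  omega

theorem A_up (P : EdgePath M J p N) {a : ℕ} (h1 : 1 ≤ a) (h2 : a < N) :
    C.A (p a) (p (a + 1)) = -1 :=
  (C.A_of_M_eq_three (P.ne _ (by omega) _ (by omega)) (P.three a h1 h2)).1

theorem A_down (P : EdgePath M J p N) (h : C.A (p 0) (p 1) = -2) {a : ℕ} (h2 : a < N) :
    C.A (p (a + 1)) (p a) = -1 := by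
  by_cases h1 : 1 ≤ a
  · exact (C.A_of_M_eq_three (P.ne _ (by omega) _ (by omega)) (P.three a h1 h2)).2
  · obtain rfl : a = 0 := by omega
    exact P.A_one_zero h

theorem A_up_le (P : EdgePath M J p N) (h : C.A (p 0) (p 1) = -2) {a : ℕ} (h2 : a < N) :
    C.A (p a) (p (a + 1)) ≤ -1 := by
  by_cases h1 : 1 ≤ a
  · exact (P.A_up h1 h2).le
  · obtain rfl : a = 0 := by omega
    rw [zero_add, h]; norm_num

theorem no_chord (P : EdgePath M J p N) (h : C.A (p 0) (p 1) = -2) {a b : ℕ} (hab : a + 2 ≤ b)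
    (hb : b ≤ N) : M (p a) (p b) = 2 := by
  by_contra hM
  have hne := P.ne b hb a (by omega)
  have h1 := C.A_le_neg_one hne hM
  have h2 := C.A_le_neg_one hne.symm (by rwa [M.symmetric])
  refine C.false_of_subdominant (Finset.Icc a b) (q := p) (c := fun _ => 1) ?_
    ⟨a, Finset.mem_Icc.2 ⟨le_rfl, by omega⟩⟩ (fun _ _ => one_pos) fun x hx => ?_
  · intro x hx y hy hxy
    have hx := Finset.mem_Icc.1 (Finset.mem_coe.1 hx)
    have hy := Finset.mem_Icc.1 (Finset.mem_coe.1 hy)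
    rcases lt_trichotomy x y with h | h | h
    · exact absurd hxy (P.ne y (by omega) x h)
    · exact h
    · exact absurd hxy.symm (P.ne x (by omega) y h)
  · have hx := Finset.mem_Icc.1 hx
    rcases Nat.eq_or_lt_of_le hx.1 with rfl | hxa
    · have h3 := P.A_up_le h (show a < N by omega)
      refine ⟨{a, a + 1, b}, fun y hy => ?_, by simp, ?_⟩
      · simp only [Finset.mem_insert, Finset.mem_singleton] at hy
        simp only [Finset.mem_Icc]; omega
      · rw [Finset.sum_insert (by simp; omega), Finset.sum_pair (by omega), C.diag]
        linarith
    · obtain ⟨x, rfl⟩ : ∃ y, x = y + 1 := ⟨x - 1, by omega⟩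
      have h3 := P.A_down h (show x < N by omega)
      rcases Nat.eq_or_lt_of_le hx.2 with rfl | hxb
      · refine ⟨{a, x, x + 1}, fun y hy => ?_, by simp, ?_⟩
        · simp only [Finset.mem_insert, Finset.mem_singleton] at hy
          simp only [Finset.mem_Icc]; omega
        · rw [Finset.sum_insert (by simp; omega), Finset.sum_pair (by omega), C.diag]
          linarith
      · have h4 := P.A_up_le h (show x + 1 < N by omega)
        refine ⟨{x, x + 1, x + 1 + 1}, fun y hy => ?_, by simp, ?_⟩
        · simp only [Finset.mem_insert, Finset.mem_singleton] at hy
          simp only [Finset.mem_Icc]; omega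
        · rw [Finset.sum_insert (by simp; omega), Finset.sum_pair (by omega), C.diag]
          linarith

theorem no_branch (P : EdgePath M J p N) (h : C.A (p 0) (p 1) = -2) (hj : ∀ a ≤ N, p a ≠ j)
    (h1 : 1 ≤ m) (h2 : m < N) : M (p m) j = 2 := by
  by_contra hM
  have hne := hj m h2.le
  have e1 := C.A_le_neg_one hne hM
  have e2 := C.A_le_neg_one hne.symm (by rwa [M.symmetric])
  have hq := snoc_ne (n := m + 1) (by omega) P.ne hj
  have hs : ∀ a ≤ m + 1, Paper.snoc p (m + 1) j a = p a := fun a ha => snoc_of_le ha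
  have hs' : Paper.snoc p (m + 1) j (m + 2) = j := snoc_succ
  refine C.false_of_subdominant (Finset.range (m + 3)) (q := Paper.snoc p (m + 1) j)
    (c := fun a => if a ≤ m then 2 else 1) ?_ ⟨0, by simp⟩ (fun a _ => by
      split_ifs <;> norm_num) fun x hx => ?_
  · intro x hx y hy hxy
    have hx := Finset.mem_range.1 (Finset.mem_coe.1 hx)
    have hy := Finset.mem_range.1 (Finset.mem_coe.1 hy)
    rcases lt_trichotomy x y with h | h | h
    · exact absurd hxy (hq y (by omega) x h)
    · exact h
    · exact absurd hxy.symm (hq x (by omega) y h)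
  · have hx := Finset.mem_range.1 hx
    have hsub : ∀ T : Finset ℕ, (∀ y ∈ T, y < m + 3) → T ⊆ Finset.range (m + 3) :=
      fun T hT y hy => Finset.mem_range.2 (hT y hy)
    obtain rfl | rfl | rfl | ⟨x, rfl, hxm⟩ : x = m + 2 ∨ x = m + 1 ∨ x = 0 ∨
        ∃ y, x = y + 1 ∧ y + 1 ≤ m := by
      by_cases h0 : x = 0
      · exact Or.inr (Or.inr (Or.inl h0))
      · by_cases hxm : x ≤ m
        · exact Or.inr (Or.inr (Or.inr ⟨x - 1, by omega, by omega⟩))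
        · omega
    · refine ⟨{m, m + 2}, hsub _ fun y hy => ?_, by simp, ?_⟩
      · simp only [Finset.mem_insert, Finset.mem_singleton] at hy; omega
      · rw [Finset.sum_pair (by omega), hs', hs m (by omega), C.diag, if_pos le_rfl,
          if_neg (by omega)]
        linarith
    · refine ⟨{m, m + 1}, hsub _ fun y hy => ?_, by simp, ?_⟩
      · simp only [Finset.mem_insert, Finset.mem_singleton] at hy; omega
      · rw [Finset.sum_pair (by omega), hs _ le_rfl, hs m (by omega), C.diag, if_pos le_rfl,
          if_neg (by omega), P.A_down h h2]
        norm_num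
    · refine ⟨{0, 1}, hsub _ fun y hy => ?_, by simp, ?_⟩
      · simp only [Finset.mem_insert, Finset.mem_singleton] at hy; omega
      · rw [Finset.sum_pair (by omega), hs 0 (by omega), hs 1 (by omega), C.diag, if_pos (by omega),
          if_pos (by omega), h]
        norm_num
    · rcases Nat.eq_or_lt_of_le hxm with rfl | hxm
      · refine ⟨{x, x + 1, x + 2, x + 3}, hsub _ fun y hy => ?_, by simp, ?_⟩
        · simp only [Finset.mem_insert, Finset.mem_singleton] at hy; omega
        · rw [Finset.sum_insert (by simp), Finset.sum_insert (by simp), Finset.sum_pair (by omega),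
            show x + 3 = x + 1 + 2 from rfl, hs', hs x (by omega), hs (x + 1) (by omega),
            hs (x + 2) (by omega), C.diag, if_pos (by omega), if_pos (by omega), if_neg (by omega),
            if_neg (by omega), P.A_down h (by omega)]
          have := P.A_up (C := C) h1 h2
          rw [show x + 2 = x + 1 + 1 from rfl, this]
          linarith
      · refine ⟨{x, x + 1, x + 2}, hsub _ fun y hy => ?_, by simp, ?_⟩
        · simp only [Finset.mem_insert, Finset.mem_singleton] at hy; omega
        · rw [Finset.sum_insert (by simp), Finset.sum_pair (by omega),
            hs x (by omega), hs (x + 1) (by omega),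
            hs (x + 2) (by omega), C.diag, if_pos (by omega), if_pos (by omega), if_pos (by omega),
            P.A_down h (by omega)]
          have := P.A_up (C := C) (a := x + 1) (by omega) (by omega)
          rw [show x + 2 = x + 1 + 1 from rfl, this]
          norm_num

theorem end_le_three (P : EdgePath M J p N) (h : C.A (p 0) (p 1) = -2) (hj : ∀ a ≤ N, p a ≠ j)
    (hM : M (p N) j ≠ 2) : M (p N) j = 3 := by
  by_contra hM3
  have hq := snoc_ne le_rfl P.ne hj
  have hs : ∀ a ≤ N, Paper.snoc p N j a = p a := fun a ha => snoc_of_le ha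
  have hs' : Paper.snoc p N j (N + 1) = j := snoc_succ
  have hN := P.pos
  rcases C.A_of_M_multiple (hj N le_rfl) hM hM3 with ⟨h1, h2⟩ | ⟨h1, h2⟩
  · refine C.false_of_chain N hq (c := fun a => if a ≤ N then 2 else 1)
      (fun a _ => by split_ifs <;> norm_num) ?_ (fun a ha => ?_) ?_
    · rw [hs 0 (by omega), hs 1 hN, h, if_pos (by omega), if_pos hN]; norm_num
    · rw [hs a (by omega), hs (a + 1) (by omega), if_pos (by omega), if_pos (by omega),
        P.A_down h ha]
      by_cases ha' : a + 1 < N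
      · rw [if_pos (by omega), hs (a + 2) (by omega), show a + 2 = a + 1 + 1 from rfl,
          P.A_up (by omega) ha']
        norm_num
      · obtain rfl : N = a + 1 := by omega
        rw [if_neg (by omega), show a + 2 = a + 1 + 1 from rfl, hs']
        linarith
    · rw [hs', hs N le_rfl, if_pos le_rfl, if_neg (by omega)]; linarith
  · refine C.false_of_chain N hq (c := fun _ => 1) (fun _ _ => one_pos) ?_ (fun a ha => ?_) ?_
    · rw [hs 0 (by omega), hs 1 hN, h]; norm_num
    · rw [hs a (by omega), hs (a + 1) (by omega), P.A_down h ha]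
      by_cases ha' : a + 1 < N
      · rw [hs (a + 2) (by omega), show a + 2 = a + 1 + 1 from rfl, P.A_up (by omega) ha']
        norm_num
      · obtain rfl : N = a + 1 := by omega
        rw [show a + 2 = a + 1 + 1 from rfl, hs']
        linarith
    · rw [hs', hs N le_rfl]; linarith

theorem start_le_three (P : EdgePath M J p N) (h : C.A (p 0) (p 1) = -2) (hj : ∀ a ≤ N, p a ≠ j)
    (hM : M (p 0) j ≠ 2) : M (p 0) j = 3 := by
  by_contra hM3
  have h0 := hj 0 (by omega)
  have h1 := hj 1 P.pos
  have h01 := P.ne 1 P.pos 0 (by omega)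
  have h10 := P.A_one_zero h
  rcases C.A_of_M_multiple h0 hM hM3 with ⟨h1', h2⟩ | ⟨h1', h2⟩
  · exact C.false_of_chain_three h01.symm h1 h0 (c := 1) (d := 2) (e := 1) one_pos two_pos one_pos
      (by linarith) (by linarith) (by linarith)
  · exact C.false_of_chain_three h01.symm h1 h0 (c := 1) (d := 2) (e := 2) one_pos two_pos two_pos
      (by linarith) (by linarith) (by linarith)

theorem start_of_three_le (P : EdgePath M J p N) (h : C.A (p 0) (p 1) = -2)
    (hj : ∀ a ≤ N, p a ≠ j) (hN : 3 ≤ N) : M (p 0) j = 2 := by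
  by_contra hM
  have h0 := hj 0 (by omega)
  have e1 := C.A_le_neg_one h0 hM
  have e2 := C.A_le_neg_one h0.symm (by rwa [M.symmetric])
  have e3 := P.A_one_zero h
  have e4 := P.A_up (C := C) le_rfl (show 1 < N by omega)
  have e5 := P.A_up (C := C) (a := 2) (by omega) (show 2 < N by omega)
  have e6 := P.A_down (C := C) h (show 1 < N by omega)
  have e7 := P.A_down (C := C) h (show 2 < N by omega)
  simp only [Nat.reduceAdd] at e4 e5 e6 e7
  refine C.false_of_chain 3 (q := fun a => match a with
    | 0 => p 3 | 1 => p 2 | 2 => p 1 | 3 => p 0 | _ => j)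
    (c := fun a => match a with | 0 => 1 | 1 => 2 | 2 => 3 | 3 => 4 | _ => 2) ?_ ?_ ?_ ?_ ?_
  · intro b hb a ha
    interval_cases b <;> interval_cases a <;>
      first | exact hj _ (by omega) | exact (P.ne _ (by omega) _ (by omega)).symm
  · intro a ha
    interval_cases a <;> norm_num
  · show 2 * 1 + 2 * C.A (p 3) (p 2) ≤ 0
    linarith
  · intro a ha
    interval_cases a
    · show 1 * C.A (p 2) (p 3) + 2 * 2 + 3 * C.A (p 2) (p 1) ≤ 0
      linarith
    · show 2 * C.A (p 1) (p 2) + 2 * 3 + 4 * C.A (p 1) (p 0) ≤ 0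
      linarith
    · show 3 * C.A (p 0) (p 1) + 2 * 4 + 2 * C.A (p 0) j ≤ 0
      linarith
  · show 4 * C.A j (p 0) + 2 * 2 ≤ 0
    linarith

end EdgePath

namespace EdgePath
variable [Fintype B] [DecidableEq B] {C : Cartan cs} [Finite W] {J : Set B} {p : ℕ → B} {N m : ℕ}
  {i j k l : B}

theorem M_end (P : EdgePath M J p N) (h : C.A (p 0) (p 1) = -2)
    (hmax : ∀ p', ¬ EdgePath M J p' (N + 1)) (hjJ : j ∈ J) (hj : ∀ a ≤ N, p a ≠ j) :
    M (p N) j = 2 := by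
  by_contra hM
  exact hmax _ (P.snoc hjJ hj (P.end_le_three h hj hM))

theorem nodesF4 (P : EdgePath M J p 2) (h : C.A (p 0) (p 1) = -2)
    (hmax : ∀ p', ¬ EdgePath M J p' (2 + 1)) (hjJ : j ∈ J) (hj : ∀ a ≤ 2, p a ≠ j)
    (hM : M (p 0) j = 3) : C.NodesF4 J ![p 2, p 1, p 0, j] := by
  have h0 := hj 0 (by omega)
  have h1 := hj 1 (by omega)
  have h2 := hj 2 (by omega)
  have h01 := P.ne 1 (by omega) 0 (by omega)
  have h02 := P.ne 2 (by omega) 0 (by omega)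
  have h12 := P.ne 2 (by omega) 1 (by omega)
  have A10 := P.A_one_zero h
  have A12 := P.A_up (C := C) le_rfl (show 1 < 2 by omega)
  have A21 := P.A_down (C := C) h (show 1 < 2 by omega)
  simp only [Nat.reduceAdd] at A12 A21
  obtain ⟨A02, A20⟩ := C.A_of_M_eq_two h02 (P.no_chord h (a := 0) (b := 2) le_rfl le_rfl)
  obtain ⟨A1j, Aj1⟩ := C.A_of_M_eq_two h1 (P.no_branch h hj le_rfl (by omega))
  obtain ⟨A2j, Aj2⟩ := C.A_of_M_eq_two h2 (P.M_end h hmax hjJ hj)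
  obtain ⟨A0j, Aj0⟩ := C.A_of_M_eq_three h0 hM
  refine ⟨?_, ?_, ?_, ?_⟩
  · intro a b hab
    fin_cases a <;> fin_cases b <;> first
      | rfl
      | exact absurd hab h0 | exact absurd hab h1 | exact absurd hab h2
      | exact absurd hab h01 | exact absurd hab h02 | exact absurd hab h12
      | exact absurd hab.symm h0 | exact absurd hab.symm h1 | exact absurd hab.symm h2
      | exact absurd hab.symm h01 | exact absurd hab.symm h02 | exact absurd hab.symm h12
  · intro i
    fin_cases i
    exacts [P.mem 2 le_rfl, P.mem 1 (by omega), P.mem 0 (by omega), hjJ]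
  · intro a b
    fin_cases a <;> fin_cases b
    exacts [C.diag _, A21, A20, A2j, A12, C.diag _, A10, A1j, A02, h, C.diag _, A0j, Aj2, Aj1, Aj0,
      C.diag _]
  · intro l hlJ hl
    have hlj : j ≠ l := hl 3
    have hlp : ∀ a ≤ 2, p a ≠ l := by
      intro a ha
      interval_cases a
      exacts [hl 2, hl 1, hl 0]
    have M2 := P.M_end h hmax hlJ hlp
    have M1 := P.no_branch h hlp le_rfl (show 1 < 2 by omega)
    have M0 : M (p 0) l = 2 := by
      by_contra h'
      exact C.false_of_star h01 h0 (hlp 0 (by omega)) h1 (hlp 1 (by omega)) hlj h.le A10.le A0j.le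
        Aj0.le (C.A_le_neg_one (hlp 0 (by omega)) h')
        (C.A_le_neg_one (hlp 0 (by omega)).symm (by rwa [M.symmetric]))
    have Mj : M j l = 2 := by
      by_contra h'
      by_cases h3 : M j l = 3
      · have Q := P.reverse_snoc hjJ hj hM
        refine hmax _ (Q.snoc hlJ (fun a ha => ?_) (by rwa [snoc_succ]))
        interval_cases a
        exacts [hlp 1 (by omega), hlp 0 (by omega), hlj]
      · rcases C.A_of_M_multiple hlj h' h3 with ⟨e1, e2⟩ | ⟨e1, e2⟩
        · exact C.false_of_chain_four h01.symm h1 (hlp 1 (by omega)) h0 (hlp 0 (by omega)) hlj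
            (c := 1) (d := 2) (e := 2) (f := 1) one_pos two_pos two_pos one_pos
            (by linarith) (by linarith) (by linarith) (by linarith)
        · exact C.false_of_chain_four h01.symm h1 (hlp 1 (by omega)) h0 (hlp 0 (by omega)) hlj
            (c := 1) (d := 2) (e := 2) (f := 2) one_pos two_pos two_pos two_pos
            (by linarith) (by linarith) (by linarith) (by linarith)
    intro a
    fin_cases a
    exacts [(C.A_of_M_eq_two (hlp 2 le_rfl) M2).1, (C.A_of_M_eq_two (hlp 1 (by omega)) M1).1,
      (C.A_of_M_eq_two (hlp 0 (by omega)) M0).1, (C.A_of_M_eq_two hlj Mj).1]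

/-- A maximal path belongs to a component of type `B` or `F₄`. -/
theorem pathB_or_nodesF4 (P : EdgePath M J p N) (h : C.A (p 0) (p 1) = -2)
    (hmax : ∀ p', ¬ EdgePath M J p' (N + 1)) : C.PathB J p N ∨ ∃ n, C.NodesF4 J n := by
  by_cases hout : ∀ j ∈ J, (∀ a ≤ N, p a ≠ j) → M (p 0) j = 2
  · refine Or.inl ⟨P.pos, fun a b ha hb hab => ?_, P.mem, h, P.A_one_zero h,
      fun a h1 h2 => ⟨P.A_up h1 (by omega), P.A_down h (by omega)⟩,
      fun a b hab hb => C.A_of_M_eq_two (P.ne b hb a (by omega)) (P.no_chord h hab hb),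
      fun j hjJ hj a ha => (C.A_of_M_eq_two (hj a ha) ?_).1⟩
    · rcases lt_trichotomy a b with h | h | h
      · exact absurd hab (P.ne b hb a h)
      · exact h
      · exact absurd hab.symm (P.ne a ha b h)
    · obtain rfl | rfl | ⟨h1, h2⟩ : a = 0 ∨ a = N ∨ 1 ≤ a ∧ a < N := by omega
      · exact hout j hjJ hj
      · exact P.M_end h hmax hjJ hj
      · exact P.no_branch h hj h1 h2
  · push Not at hout
    obtain ⟨j, hjJ, hj, hM⟩ := hout
    have hM3 := P.start_le_three h hj hM
    have := P.pos
    obtain rfl | rfl | hN : N = 1 ∨ N = 2 ∨ 3 ≤ N := by omega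
    · exact absurd (P.reverse_snoc hjJ hj hM3) (hmax _)
    · exact Or.inr ⟨_, P.nodesF4 h hmax hjJ hj hM3⟩
    · exact absurd (P.start_of_three_le h hj hN) hM

end EdgePath

theorem factors_of_ratSmooth [Fintype B] [Finite W] (hM : IsWeylMatrix M) (J : Set B) :
    ∀ w ∈ WJc cs J, RatSmooth cs w → Factors cs J w := by
  classical
  induction hn : J.ncard using Nat.strong_induction_on generalizing J with
  | _ m ih =>
  intro w hw hs
  have ih' : ∀ i ∈ J, ∀ K ⊆ J \ {i}, ∀ u ∈ WJc cs K, RatSmooth cs u → Factors cs K u := by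
    intro i hi K hK
    refine ih _ ?_ K rfl
    rw [← hn]
    exact Set.ncard_lt_ncard ((Set.ssubset_iff_of_subset fun x hx => (hK hx).1).2
      ⟨i, hi, fun h => (hK h).2 rfl⟩) (Set.toFinite _)
  have ih1 : ∀ i ∈ J, ∀ u ∈ WJc cs (J \ {i}), RatSmooth cs u → Factors cs (J \ {i}) u :=
    fun i hi => ih' i hi _ subset_rfl
  by_cases h6 : ∃ i ∈ J, ∃ j ∈ J, i ≠ j ∧ M i j = 6
  · obtain ⟨i, hi, j, hj, hij, h6⟩ := h6
    obtain ⟨C, -⟩ := exists_cartan cs hM hij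
    exact Cartan.factors_G2 C hi hj hij h6
      (fun k _ hki hkj => Cartan.isolated_of_M_eq_six C hij h6 hki hkj) hs hw ih1
  by_cases h4 : ∃ i ∈ J, ∃ j ∈ J, i ≠ j ∧ M i j = 4
  · obtain ⟨i, hi, j, hj, hij, h4⟩ := h4
    obtain ⟨p, N, P, hmax⟩ := EdgePath.exists_maximal hi hj hij h4
    obtain ⟨C, hC⟩ := exists_cartan cs hM (P.ne 1 P.pos 0 (by omega))
    rcases P.pathB_or_nodesF4 (hC P.four) hmax with h | ⟨n, h⟩
    · exact h.factors hs hw ih1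
    · exact h.factors hs hw ih'
  push Not at h4 h6
  have hSL : ∀ C : Cartan cs, C.SL J := by
    intro C i hi j hj
    by_cases hij : i = j
    · rw [hij]
    · have h1 := C.off i j hij
      have h2 := h4 i hi j hj hij
      have h3 := h6 i hi j hj hij
      omega
  by_cases hB : ∃ a b : B, a ≠ b
  · obtain ⟨a, b, hab⟩ := hB
    obtain ⟨C, -⟩ := exists_cartan cs hM hab
    exact Cartan.factors_of_SL C (hSL C) hs hw
  · push Not at hB
    let C : Cartan cs := ⟨fun _ _ => 2, fun _ => rfl, fun i j h => absurd (hB i j) h⟩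
    exact Cartan.factors_of_SL C (hSL C) hs hw

end Paper
end

noncomputable section
namespace Paper
open Polynomial

variable {B W : Type*} [Group W] {M : CoxeterMatrix B} (cs : CoxeterSystem M W)

theorem statement_0 {B W : Type*} [Group W] [Finite W] [Fintype B]
    {M : CoxeterMatrix B} (cs : CoxeterSystem M W) (hM : IsWeylMatrix M) (w : W) :
    RatSmooth cs w ↔ ∃ m : B → ℕ, poin cs w = ∏ i : B, qint (m i + 1) := by
  classical
  constructor
  · intro h
    have hw : w ∈ WJc cs Set.univ := by
      rw [WJc, Set.image_univ, cs.subgroup_closure_range_simple]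
      exact Subgroup.mem_top w
    obtain ⟨m, -, hm⟩ := factors_of_ratSmooth hM Set.univ w hw h
    exact ⟨m, hm⟩
  · rintro ⟨m, hm⟩
    exact Cartan.ratSmooth_of_prod hm

end Paper
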